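/- Let (s₀,φ) ∈ W. For λ > 0 let (s_λ,u_λ) be the solution of problem (P) with initial data (s₀,λφ), and let T_λ denote its maximal existence time. Then there exist λ_*, λ^* ∈ (0,∞) with λ_* ≤ λ^* such that: (1) if 0 < λ < λ_*, then T_λ = ∞, lim_{t→∞} s_λ(t) < ∞, and ‖u_λ(t)‖_{L^∞} = O(e^{−αt}) as t → ∞ for some α ∈ (0,∞); (2) if λ_* ≤ λ ≤ λ^*, then T_λ = ∞, lim_{t→∞} s_λ(t) = ∞, lim_{t→∞} ‖u_λ(t)‖_{L^∞} = 0, liminf_{t→∞} s_λ(t)^{1/(p−1)} ‖u_λ(t)‖_{L^∞} > 0, s_λ(t) = (1+o(1)) ∫₀^t u_λ(τ,0)^p dτ = o(t^{1/2}) as t → ∞, and liminf_{t→∞} t^{1/(2(p−1))} ‖u_λ(t)‖_{L^∞} = ∞; (3) if λ > λ^*, then T_λ < ∞. -/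

import Mathlib

open Set MeasureTheory Filter Topology Real
open scoped ENNReal

noncomputable section

/-- `(s₀, φ)` belongs to the class `W`: `s₀ ∈ (0,∞)`, `φ` is Lipschitz on `[0,s₀]`,
not identically zero, nonnegative there, and vanishes at `s₀`. -/
def memW (s₀ : ℝ) (φ : ℝ → ℝ) : Prop :=
  0 < s₀ ∧ (∃ K : NNReal, LipschitzOnWith K φ (Icc 0 s₀)) ∧
    (∃ x ∈ Icc 0 s₀, φ x ≠ 0) ∧ (∀ x ∈ Icc 0 s₀, 0 ≤ φ x) ∧ φ s₀ = 0

/-- `(s,u)` is a solution of the one-phase Stefan problem (P) on `(0,T]` (finite `T`)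
with exponent `p` and initial data `(s₀,φ)`. -/
structure IsSolOn (p s₀ : ℝ) (φ : ℝ → ℝ) (T : ℝ) (s : ℝ → ℝ) (u : ℝ → ℝ → ℝ) : Prop where
  T_pos : 0 < T
  s_cont : ContinuousOn s (Icc 0 T)
  s_diff : ∀ t ∈ Ioc 0 T, DifferentiableAt ℝ s t
  s_deriv_cont : ContinuousOn (deriv s) (Ioc 0 T)
  s_pos : ∀ t ∈ Icc 0 T, 0 < s t
  ut_diff : ∀ t ∈ Ioc 0 T, ∀ x ∈ Ioo 0 (s t), DifferentiableAt ℝ (fun τ => u τ x) t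
  ux_diff : ∀ t ∈ Ioc 0 T, ∀ x ∈ Ioo 0 (s t), DifferentiableAt ℝ (u t) x
  uxx_diff : ∀ t ∈ Ioc 0 T, ∀ x ∈ Ioo 0 (s t), DifferentiableAt ℝ (deriv (u t)) x
  ut_cont : ContinuousOn (fun q : ℝ × ℝ => deriv (fun τ => u τ q.2) q.1)
      {q : ℝ × ℝ | q.1 ∈ Ioc 0 T ∧ q.2 ∈ Ioo 0 (s q.1)}
  uxx_cont : ContinuousOn (fun q : ℝ × ℝ => deriv (deriv (u q.1)) q.2)
      {q : ℝ × ℝ | q.1 ∈ Ioc 0 T ∧ q.2 ∈ Ioo 0 (s q.1)}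
  ux_cont : ContinuousOn (fun q : ℝ × ℝ => deriv (u q.1) q.2)
      {q : ℝ × ℝ | q.1 ∈ Ioc 0 T ∧ q.2 ∈ Icc 0 (s q.1)}
  u_cont : ContinuousOn (fun q : ℝ × ℝ => u q.1 q.2)
      {q : ℝ × ℝ | q.1 ∈ Icc 0 T ∧ q.2 ∈ Icc 0 (s q.1)}
  u_nonneg : ∀ t ∈ Icc 0 T, ∀ x ∈ Icc 0 (s t), 0 ≤ u t x
  heat : ∀ t ∈ Ioc 0 T, ∀ x ∈ Ioo 0 (s t),
      deriv (fun τ => u τ x) t = deriv (deriv (u t)) x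
  bc_zero : ∀ t ∈ Ioc 0 T, -deriv (u t) 0 = u t 0 ^ p
  bc_free : ∀ t ∈ Ioc 0 T, u t (s t) = 0
  stefan : ∀ t ∈ Ioc 0 T, deriv s t = -deriv (u t) (s t)
  init : ∀ x ∈ Icc 0 s₀, u 0 x = φ x
  init_s : s 0 = s₀

/-- `(s,u)` is a global-in-time solution of problem (P). -/
def IsGlobalSol (p s₀ : ℝ) (φ : ℝ → ℝ) (s : ℝ → ℝ) (u : ℝ → ℝ → ℝ) : Prop :=
  ∀ T : ℝ, 0 < T → IsSolOn p s₀ φ T s u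

/-- `Tm ∈ (0,∞]` is the maximal existence time of the solution `(s,u)` of (P) with
initial data `(s₀,φ)`: the solution exists on `(0,T]` for every `T < Tm`, and for
`T > Tm` problem (P) admits no solution on `(0,T]`. -/
def IsMaxSol (p s₀ : ℝ) (φ : ℝ → ℝ) (Tm : ℝ≥0∞) (s : ℝ → ℝ) (u : ℝ → ℝ → ℝ) : Prop :=
  0 < Tm ∧
    (∀ T : ℝ, 0 < T → ENNReal.ofReal T < Tm → IsSolOn p s₀ φ T s u) ∧
    (∀ T : ℝ, Tm < ENNReal.ofReal T → ¬∃ σ v, IsSolOn p s₀ φ T σ v)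

/-- The sup norm `‖u(t)‖_{L^∞(0,s(t))}`. -/
def supNorm (s : ℝ → ℝ) (u : ℝ → ℝ → ℝ) (t : ℝ) : ℝ :=
  sSup (u t '' Ioo 0 (s t))

/-- The `L¹` norm `‖u(t)‖_{L¹(0,s(t))}` of the nonnegative function `u(t,·)`. -/
def L1Norm (s : ℝ → ℝ) (u : ℝ → ℝ → ℝ) (t : ℝ) : ℝ :=
  ∫ x in (0:ℝ)..(s t), u t x

/-- The energy `E(s(t),u(t))`. -/
def energy (p : ℝ) (s : ℝ → ℝ) (u : ℝ → ℝ → ℝ) (t : ℝ) : ℝ :=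
  1 / 2 * (∫ x in (0:ℝ)..(s t), (deriv (u t) x) ^ 2) - u t 0 ^ (p + 1) / (p + 1)

local notation "♮" => (by linarith)
local notation "♭" => (by positivity)
local notation "♯" => (by fun_prop)
local notation "♩" => (by norm_num)
local notation "⓪" => (0:ℝ)
local notation "⊟" => (-(1/2):ℝ)
local notation "⊠" => (-(3/2):ℝ)
local notation "◈" => (fun _ => 0)
local notation "◉" => (abs_nonneg _)
local notation "◨" => (min_le_right _ _)
local notation "◧" => (min_le_left _ _)
local notation "◇" => (Exists.intro _ rfl)
local notation "ℝ²" => ℝ × ℝ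

/-! Heat kernel pieces -/
def E (a t x : ℝ) : ℝ := if 0 < t then t ^ (-a) * exp (-x ^ 2 / (4 * t)) else 0

lemma E_nonneg (a t x : ℝ) : 0 ≤ E a t x := by
  unfold E; split_ifs with h <;> positivity

lemma exp_bd (b : ℝ) (hb : 0 ≤ b) : ∃ C, 0 < C ∧ ∀ y : ℝ, 0 < y → exp (-y) ≤ C * y ^ (-b) := by
  obtain ⟨n, hn⟩ := exists_nat_ge b
  refine ⟨1 + n.factorial, ♭, fun y hy => ?_⟩
  have h1 : y ^ b ≤ 1 + y ^ n := by
    rcases le_total y 1 with h | h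
    · have := rpow_le_one hy.le h hb
      have : 0 ≤ y ^ n := ♭
      linarith
    · have := rpow_le_rpow_of_exponent_le h hn
      rw [rpow_natCast] at this; linarith
  have h2 : y ^ n ≤ n.factorial * exp y := by
    have := Real.pow_div_factorial_le_exp y hy.le n
    rw [div_le_iff₀ ♭] at this; linarith
  have h3 : 1 ≤ exp y := one_le_exp hy.le
  rw [rpow_neg hy.le, exp_neg, ← div_eq_mul_inv, le_div_iff₀ ♭, inv_mul_le_iff₀ ♭]
  linarith

lemma E_bd (a b : ℝ) (hb : 0 ≤ b) : ∃ C, 0 < C ∧ ∀ t x : ℝ, 0 < t → x ≠ 0 →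
    E a t x ≤ C * t ^ (b - a) * (x ^ 2) ^ (-b) := by
  obtain ⟨C, hC, h⟩ := exp_bd b hb
  refine ⟨C * 4 ^ b, ♭, fun t x ht hx => ?_⟩
  have hx2 : 0 < x ^ 2 := ♭
  have := h (x ^ 2 / (4 * t)) ♭
  rw [E, if_pos ht]
  calc _ ≤ t ^ (-a) * (C * (x ^ 2 / (4 * t)) ^ (-b)) := by
        rw [neg_div]; gcongr
    _ = _ := by
        rw [Real.div_rpow hx2.le ♭, Real.mul_rpow ♩ ht.le, sub_eq_add_neg,
          add_comm b, rpow_add ht, rpow_neg (by norm_num : ⓪ ≤ 4), rpow_neg ht.le b]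
        field_simp

lemma E_le (a t x : ℝ) : E a t x ≤ t ^ (-a) ∨ t ≤ 0 := by
  rcases le_or_gt t 0 with h | h
  · exact Or.inr h
  · left; rw [E, if_pos h]
    have : exp (-x ^ 2 / (4 * t)) ≤ 1 := exp_le_one_iff.2 (by rw [neg_div]; simp; positivity)
    exact mul_le_of_le_one_right ♭ this

lemma E_cont (a t x : ℝ) (h : t ≠ 0 ∨ x ≠ 0) :
    ContinuousAt (fun q : ℝ² => E a q.1 q.2) (t, x) := by
  rcases lt_trichotomy t 0 with ht | ht | ht
  · have : (fun q : ℝ² => E a q.1 q.2) =ᶠ[𝓝 (t, x)] fun _ => 0 := by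
      filter_upwards [(isOpen_Iio.preimage continuous_fst).mem_nhds (show t ∈ Iio 0 from ht)] with q hq
      simp only [mem_preimage, mem_Iio] at hq
      rw [E, if_neg ♮]
    exact continuousAt_const.congr this.symm
  · subst ht
    have hx : x ≠ 0 := by simpa using h
    obtain ⟨C, hC, hb⟩ := E_bd a (|a| + 1) ♭
    have h0 : E a 0 x = 0 := by simp [E]
    unfold ContinuousAt; simp only [h0]
    have hlim : Tendsto (fun q : ℝ² => C * (|q.1|) ^ (|a| + 1 - a) * (q.2 ^ 2) ^ (-(|a| + 1))) (𝓝 (0, x)) (𝓝 0) := by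
      have hp : 0 < |a| + 1 - a := by linarith [le_abs_self a]
      have : ContinuousAt (fun q : ℝ² => C * (|q.1|) ^ (|a| + 1 - a) * (q.2 ^ 2) ^ (-(|a| + 1))) (0, x) := by
        refine ContinuousAt.mul (ContinuousAt.mul continuousAt_const ?_) ?_
        · exact ContinuousAt.rpow_const ♯ (Or.inr hp.le)
        · exact ContinuousAt.rpow_const ♯ (Or.inl (by simpa using hx))
      have h2 := this.tendsto
      simpa [zero_rpow hp.ne'] using h2
    refine squeeze_zero' (Eventually.of_forall fun q => E_nonneg _ _ _) ?_ hlim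
    filter_upwards [(isOpen_ne.preimage continuous_snd).mem_nhds (show x ∈ {y : ℝ | y ≠ 0} from hx)] with q hq
    rcases le_or_gt q.1 0 with h1 | h1
    · rw [E, if_neg ♮]; positivity
    · rw [abs_of_pos h1]; exact hb _ _ h1 hq
  · have : (fun q : ℝ² => E a q.1 q.2) =ᶠ[𝓝 (t, x)] fun q => q.1 ^ (-a) * exp (-q.2 ^ 2 / (4 * q.1)) := by
      filter_upwards [(isOpen_Ioi.preimage continuous_fst).mem_nhds (show t ∈ Ioi 0 from ht)] with q hq
      simp only [mem_preimage, mem_Ioi] at hq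
      rw [E, if_pos hq]
    refine ContinuousAt.congr ?_ this.symm
    refine ContinuousAt.mul (ContinuousAt.rpow_const ♯ (Or.inl ht.ne')) ?_
    refine ContinuousAt.rexp (ContinuousAt.div ♯ ♯ (by simp [ht.ne']))

lemma E_hx (a t x : ℝ) : HasDerivAt (E a t) (-(x / 2) * E (a + 1) t x) x := by
  unfold E
  split_ifs with h
  · have h1 : HasDerivAt (fun x : ℝ => -x ^ 2 / (4 * t)) (-(2 * x) / (4 * t)) x := by
      simpa using ((hasDerivAt_pow 2 x).neg.div_const (4 * t))
    have h2 := h1.exp.const_mul (t ^ (-a))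
    refine h2.congr_deriv ?_
    rw [neg_add, rpow_add h, rpow_neg_one]; field_simp; ring
  · simpa using hasDerivAt_const x ⓪

lemma E_ht (a t x : ℝ) (h : t ≠ 0 ∨ x ≠ 0) :
    HasDerivAt (fun t => E a t x) (-a * E (a + 1) t x + x ^ 2 / 4 * E (a + 2) t x) t := by
  have main : ∀ t : ℝ, t ≠ 0 → HasDerivAt (fun t => E a t x) (-a * E (a + 1) t x + x ^ 2 / 4 * E (a + 2) t x) t := by
    intro t ht0
    rcases lt_or_gt_of_ne ht0 with ht | ht
    · have : (fun t => E a t x) =ᶠ[𝓝 t] fun _ => 0 := by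
        filter_upwards [Iio_mem_nhds ht] with q hq
        rw [E, if_neg (by simp at hq; linarith)]
      rw [this.hasDerivAt_iff]
      simpa [E, ht.not_gt] using hasDerivAt_const t ⓪
    · have : (fun t => E a t x) =ᶠ[𝓝 t] fun t => t ^ (-a) * exp (-x ^ 2 / (4 * t)) := by
        filter_upwards [Ioi_mem_nhds ht] with q hq
        rw [E, if_pos (mem_Ioi.1 hq)]
      rw [this.hasDerivAt_iff]
      have h1 : HasDerivAt (fun t : ℝ => -x ^ 2 / (4 * t)) (x ^ 2 / (4 * t ^ 2)) t := by
        have := (hasDerivAt_const t (-x ^ 2)).div ((hasDerivAt_id t).const_mul 4) (by simp [ht0])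
        refine this.congr_deriv ?_; simp; field_simp
      have h2 := (Real.hasDerivAt_rpow_const (p := -a) (Or.inl ht0)).mul h1.exp
      refine h2.congr_deriv ?_
      simp only [E, if_pos ht]
      have e1 : t ^ (-(a + 1)) = t ^ (-a) * t⁻¹ := by rw [neg_add, rpow_add ht, rpow_neg_one]
      have e2 : t ^ (-(a + 2)) = t ^ (-a) * (t ^ 2)⁻¹ := by
        rw [neg_add, rpow_add ht]; congr 1; rw [rpow_neg ht.le]; norm_cast
      have e3 : t ^ (-a - 1) = t ^ (-a) * t⁻¹ := by rw [← e1]; congr 1; ring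
      rw [e1, e2, e3]; field_simp
  rcases eq_or_ne t 0 with rfl | ht
  · have hx : x ≠ 0 := by simpa using h
    have cE : ∀ b, ContinuousAt (fun t => E b t x) 0 := fun b =>
      ContinuousAt.comp (f := fun t : ℝ => (t, x)) (g := fun q : ℝ² => E b q.1 q.2) (E_cont b 0 x (Or.inr hx)) ♯
    exact hasDerivAt_of_hasDerivAt_of_ne (x := 0) (f := fun t => E a t x)
      (g := fun t => -a * E (a + 1) t x + x ^ 2 / 4 * E (a + 2) t x) (fun y hy => main y hy) (cE a)
      ((continuousAt_const.mul (cE _)).add (continuousAt_const.mul (cE _)))  |> fun h => by simpa using h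
  · exact main t ht

lemma sdt {f f' : ℝ → ℝ} {x c : ℝ} (hm : IsLocalMax f x) (h1 : ∀ᶠ y in 𝓝 x, HasDerivAt f (f' y) y)
    (h2 : HasDerivAt f' c x) : f' x = 0 ∧ c ≤ 0 := by
  have h0 : f' x = 0 := hm.hasDerivAt_eq_zero h1.self_of_nhds
  refine ⟨h0, ?_⟩
  by_contra hc
  push Not at hc
  have hpos : ∀ᶠ y in 𝓝[>] x, 0 < f' y := by
    have := (hasDerivAt_iff_tendsto_slope.1 h2).mono_left (nhdsWithin_mono x (fun y (hy : y ∈ Ioi x) => ne_of_gt hy))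
    filter_upwards [this.eventually (lt_mem_nhds hc), self_mem_nhdsWithin] with y hy hxy
    rw [slope_def_field, h0, sub_zero] at hy
    exact (div_pos_iff_of_pos_right (sub_pos.2 hxy)).1 hy
  have hall := hpos.and ((h1.filter_mono nhdsWithin_le_nhds).and (hm.filter_mono nhdsWithin_le_nhds))
  obtain ⟨z, hz, hzz⟩ := mem_nhdsGT_iff_exists_Ioc_subset.1 hall
  have hz' : x < z := hz
  have hmono : StrictMonoOn f (Icc x z) := by
    refine strictMonoOn_of_deriv_pos (convex_Icc _ _) ?_ ?_
    · intro y hy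
      rcases eq_or_lt_of_le hy.1 with rfl | h
      · exact h1.self_of_nhds.continuousAt.continuousWithinAt
      · exact (hzz ⟨h, hy.2⟩).2.1.continuousAt.continuousWithinAt
    · intro y hy
      rw [interior_Icc] at hy
      have := hzz ⟨hy.1, hy.2.le⟩
      rw [this.2.1.deriv]; exact this.1
  have := hmono (left_mem_Icc.2 hz'.le) (right_mem_Icc.2 hz'.le) hz'
  have h3 : f z ≤ f x := (hzz ⟨hz', le_rfl⟩).2.2
  linarith

/-- left max: derivative nonneg -/
lemma ldt {f : ℝ → ℝ} {t a : ℝ} (h : HasDerivAt f a t) (hm : ∀ᶠ τ in 𝓝[<] t, f τ ≤ f t) : 0 ≤ a := by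
  have := (hasDerivAt_iff_tendsto_slope.1 h).mono_left (nhdsWithin_mono t (fun y (hy : y ∈ Iio t) => ne_of_lt hy))
  refine ge_of_tendsto this ?_
  filter_upwards [hm, self_mem_nhdsWithin] with y hy hlt
  rw [slope_def_field]
  exact div_nonneg_of_nonpos ♮ (by simp at hlt; linarith)

lemma rdt {f : ℝ → ℝ} {t a : ℝ} (h : HasDerivWithinAt f a (Ici t) t) (hm : ∀ᶠ τ in 𝓝[>] t, f τ ≤ f t) : a ≤ 0 := by
  have := hasDerivWithinAt_iff_tendsto_slope.1 h
  have e : Ici t \ {t} = Ioi t := by ext y; simp [lt_iff_le_and_ne]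
  rw [e] at this
  refine le_of_tendsto this ?_
  filter_upwards [hm, self_mem_nhdsWithin] with y hy hlt
  rw [slope_def_field]
  exact div_nonpos_of_nonpos_of_nonneg ♮ (by simp at hlt; linarith)

def Reg (t0 t1 : ℝ) (l r : ℝ → ℝ) : Set (ℝ²) := {q | q.1 ∈ Icc t0 t1 ∧ q.2 ∈ Icc (l q.1) (r q.1)}

lemma Reg_compact {t0 t1 : ℝ} {l r : ℝ → ℝ} (lc : ContinuousOn l (Icc t0 t1)) (rc : ContinuousOn r (Icc t0 t1)) :
    IsCompact (Reg t0 t1 l r) := by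
  obtain ⟨A, hA⟩ := isCompact_Icc.bddBelow_image lc
  obtain ⟨B, hB⟩ := isCompact_Icc.bddAbove_image rc
  refine IsCompact.of_isClosed_subset ((isCompact_Icc (a := t0) (b := t1)).prod (isCompact_Icc (a := A) (b := B))) ?_ ?_
  · have c1 : ContinuousOn (fun q : ℝ² => (l q.1 - q.2, q.2 - r q.1)) (Icc t0 t1 ×ˢ univ) := by
      refine ContinuousOn.prodMk (ContinuousOn.sub (lc.comp continuousOn_fst fun q hq => hq.1) continuousOn_snd)
        (ContinuousOn.sub continuousOn_snd (rc.comp continuousOn_fst fun q hq => hq.1))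
    have := c1.preimage_isClosed_of_isClosed (isClosed_Icc.prod isClosed_univ) (isClosed_Iic.prod isClosed_Iic : IsClosed (Iic ⓪ ×ˢ Iic ⓪))
    convert this using 1
    ext q; simp [Reg, and_assoc]
  · rintro q ⟨h1, h2⟩
    exact ⟨h1, (hA (mem_image_of_mem _ h1)).trans h2.1, h2.2.trans (hB (mem_image_of_mem _ h1))⟩

lemma MPL {t0 t1 C : ℝ} {l r : ℝ → ℝ} {w : ℝ → ℝ → ℝ}
    (lc : ContinuousOn l (Icc t0 t1)) (rc : ContinuousOn r (Icc t0 t1))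
    (wc : ContinuousOn (fun q : ℝ² => w q.1 q.2) (Reg t0 t1 l r))
    (hi : ∀ x ∈ Icc (l t0) (r t0), w t0 x ≤ 0)
    (hint : ∀ t ∈ Ioc t0 t1, ∀ x ∈ Ioo (l t) (r t), 0 < w t x → ∃ a b, ∃ f' : ℝ → ℝ,
      HasDerivAt (fun τ => w τ x) a t ∧ (∀ᶠ y in 𝓝 x, HasDerivAt (w t) (f' y) y) ∧ HasDerivAt f' b x ∧
      a ≤ b + C * w t x)
    (hl : ∀ t ∈ Ioc t0 t1, l t < r t → 0 < w t (l t) → ∃ d, HasDerivWithinAt (w t) d (Ici (l t)) (l t) ∧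
      -C * w t (l t) ≤ d)
    (hr : ∀ t ∈ Ioc t0 t1, l t ≤ r t → w t (r t) ≤ 0) :
    ∀ t ∈ Icc t0 t1, ∀ x ∈ Icc (l t) (r t), w t x ≤ 0 := by
  intro t ht x hx
  by_contra hpos
  push Not at hpos
  set μ := C + 1
  set κ := μ ^ 2 + C + 1
  have gc : ContinuousOn (fun q : ℝ² => w q.1 q.2 * exp (μ * q.2 - κ * q.1)) (Reg t0 t1 l r) :=
    wc.mul ♯
  obtain ⟨⟨ts, xs⟩, ⟨hts, hxs⟩, hmax⟩ := (Reg_compact lc rc).exists_isMaxOn ⟨(t, x), ht, hx⟩ gc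
  simp only at hts hxs
  have hM : ∀ τ y, τ ∈ Icc t0 t1 → y ∈ Icc (l τ) (r τ) →
      w τ y * exp (μ * y - κ * τ) ≤ w ts xs * exp (μ * xs - κ * ts) := fun τ y h1 h2 =>
    hmax (show (τ, y) ∈ Reg t0 t1 l r from ⟨h1, h2⟩)
  have hw : 0 < w ts xs := by
    have := hM t x ht hx
    have h3 : 0 < w ts xs * exp (μ * xs - κ * ts) := lt_of_lt_of_le ♭ this
    exact (pos_iff_pos_of_mul_pos h3).2 (exp_pos _)
  have htt : t0 < ts := by
    rcases eq_or_lt_of_le hts.1 with rfl | h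
    · linarith [hi xs hxs]
    · exact h
  have hxr : xs < r ts := by
    rcases eq_or_lt_of_le hxs.2 with h | h
    · have := hr ts ⟨htt, hts.2⟩ (hxs.1.trans hxs.2); rw [← h] at this; linarith
    · exact h
  have he : ∀ y, HasDerivAt (fun y => exp (μ * y - κ * ts)) (μ * exp (μ * y - κ * ts)) y := fun y => by
    have := ((hasDerivAt_id y).const_mul μ |>.sub_const (κ * ts)).exp
    refine this.congr_deriv ?_; simp; ring
  rcases eq_or_lt_of_le hxs.1 with hxl | hxl
  · subst hxl
    obtain ⟨d, hd, hd2⟩ := hl ts ⟨htt, hts.2⟩ hxr hw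
    have h1 := rdt (hd.mul (he (l ts)).hasDerivWithinAt) (by
      filter_upwards [Ioo_mem_nhdsGT hxr] with y hy
      exact hM ts y hts ⟨hy.1.le, hy.2.le⟩)
    have h2 := exp_pos (μ * l ts - κ * ts)
    have h3 : d + μ * w ts (l ts) ≤ 0 := by
      by_contra h; push Not at h
      have := mul_pos h h2; nlinarith
    simp only [μ] at h3; nlinarith
  · obtain ⟨a, b, f', ha, hf, hb, hab⟩ := hint ts ⟨htt, hts.2⟩ xs ⟨hxl, hxr⟩ hw
    have h2 := exp_pos (μ * xs - κ * ts)
    have hA : 0 ≤ a - κ * w ts xs := by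
      have e2 : HasDerivAt (fun τ => exp (μ * xs - κ * τ)) (-κ * exp (μ * xs - κ * ts)) ts := by
        have := (((hasDerivAt_id ts).const_mul κ).const_sub (μ * xs)).exp
        refine this.congr_deriv ?_; simp; ring
      have h1 := ldt (ha.mul e2) (by
        have hsub : 𝓝[<] ts ≤ 𝓝[Icc t0 t1] ts := by
          rw [← nhdsWithin_Ioo_eq_nhdsLT htt]
          exact nhdsWithin_mono _ fun y hy => ⟨hy.1.le, hy.2.le.trans hts.2⟩
        filter_upwards [((lc ts hts).mono_left hsub).eventually (gt_mem_nhds hxl),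
          ((rc ts hts).mono_left hsub).eventually (lt_mem_nhds hxr), Ioo_mem_nhdsLT htt] with τ h1 h2 h3
        exact hM τ xs ⟨h3.1.le, h3.2.le.trans hts.2⟩ ⟨h1.le, h2.le⟩)
      by_contra h; push Not at h
      have := mul_pos (neg_pos.2 h) h2; nlinarith
    have hS := sdt (f := fun y => w ts y * exp (μ * y - κ * ts))
      (f' := fun y => f' y * exp (μ * y - κ * ts) + w ts y * (μ * exp (μ * y - κ * ts))) (x := xs) (by
        filter_upwards [Ioo_mem_nhds hxl hxr] with y hy
        exact hM ts y hts ⟨hy.1.le, hy.2.le⟩) (by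
        filter_upwards [hf] with y hy
        exact hy.mul (he y)) ((hb.mul (he xs)).add (hf.self_of_nhds.mul ((he xs).const_mul μ)))
    obtain ⟨hS1, hS2⟩ := hS
    have g1 : f' xs = -μ * w ts xs := by
      have : (f' xs + μ * w ts xs) * exp (μ * xs - κ * ts) = 0 := ♮
      rcases mul_eq_zero.1 this with h | h
      · linarith
      · exact absurd h h2.ne'
    have g2 : b - μ ^ 2 * w ts xs ≤ 0 := by
      by_contra h; push Not at h
      have := mul_pos h h2
      rw [g1] at hS2; nlinarith
    simp only [κ] at hA; nlinarith

lemma E_far (a δ : ℝ) (k : ℕ) (hk : (k:ℝ) ≤ 2 * a) (hd : 0 < δ) :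
    ∃ C, 0 ≤ C ∧ ∀ t x : ℝ, δ ≤ t ∨ δ ≤ |x| → |x| ^ k * E a t x ≤ C := by
  have ha : 0 ≤ a := by have : ⓪ ≤ k := ♭
                        linarith
  obtain ⟨C, hC, hb⟩ := E_bd a a ha
  refine ⟨C * δ ^ ((k:ℝ) - 2 * a) + δ ^ k * δ ^ (-a), ♭, fun t x h => ?_⟩
  have p1 : 0 ≤ C * δ ^ ((k:ℝ) - 2 * a) := ♭
  have p2 : 0 ≤ δ ^ k * δ ^ (-a) := ♭
  rcases le_or_gt t 0 with ht | ht
  · rw [E, if_neg ♮]; simp; linarith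
  by_cases hx : δ ≤ |x|
  · have hx0 : 0 < |x| := ♮
    have := hb t x ht (abs_pos.1 hx0)
    rw [sub_self, rpow_zero, mul_one, ← sq_abs, ← rpow_natCast |x| 2, ← rpow_mul hx0.le] at this
    calc |x| ^ k * E a t x ≤ |x| ^ k * (C * |x| ^ (((2:ℕ):ℝ) * -a)) := by gcongr
      _ = C * |x| ^ ((k:ℝ) - 2 * a) := by
          rw [sub_eq_add_neg, rpow_add hx0, rpow_natCast]; push_cast; rw [mul_neg]; ring
      _ ≤ C * δ ^ ((k:ℝ) - 2 * a) := by
          gcongr C * ?_; exact rpow_le_rpow_of_nonpos hd hx ♮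
      _ ≤ _ := ♮
  · have h1 : δ ≤ t := by tauto
    push Not at hx
    have h2 : E a t x ≤ δ ^ (-a) := by
      rcases E_le a t x with h | h
      · exact h.trans (rpow_le_rpow_of_nonpos hd h1 ♮)
      · linarith
    calc _ ≤ δ ^ k * δ ^ (-a) := by gcongr; exact E_nonneg _ _ _
      _ ≤ _ := ♮

/-- near bound -/
lemma E_near (a : ℝ) (k : ℕ) : ∃ C, 0 < C ∧ ∀ t x : ℝ, 0 < t →
    |x| ^ k * E a t x ≤ C * t ^ ((k:ℝ) / 2 - a) := by
  obtain ⟨C, hC, hb⟩ := E_bd a (k / 2) ♭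
  refine ⟨C + 1, ♭, fun t x ht => ?_⟩
  rcases eq_or_ne x 0 with rfl | hx
  · rcases Nat.eq_zero_or_pos k with rfl | hk
    · have := (E_le a t 0).resolve_right ♮
      simp; have : 0 ≤ C * t ^ (-a) := ♭
      nlinarith
    · simp [hk.ne']; positivity
  · have hx0 : 0 < |x| := ♭
    have := hb t x ht hx
    rw [← sq_abs, ← rpow_natCast |x| 2, ← rpow_mul hx0.le] at this
    calc |x| ^ k * E a t x ≤ |x| ^ k * (C * t ^ ((k:ℝ) / 2 - a) * |x| ^ (((2:ℕ):ℝ) * -((k:ℝ) / 2))) := by gcongr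
      _ = C * t ^ ((k:ℝ) / 2 - a) := by
          rw [show ((2:ℕ):ℝ) * -((k:ℝ) / 2) = -(k:ℝ) by push_cast; ring, rpow_neg hx0.le, rpow_natCast]; field_simp
      _ ≤ _ := by have : 0 ≤ t ^ ((k:ℝ) / 2 - a) := ♭
                  nlinarith

def k0 : ℝ := (√(4 * π))⁻¹
lemma k0_pos : 0 < k0 := by unfold k0; positivity
def Γ0 (t x : ℝ) : ℝ := k0 * E (1/2) t x
def Γ1 (t x : ℝ) : ℝ := k0 * (-(x / 2) * E (3/2) t x)
def Γ2 (t x : ℝ) : ℝ := k0 * (-(1/2) * E (3/2) t x + x ^ 2 / 4 * E (5/2) t x)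

lemma Γ0_hx (t x : ℝ) : HasDerivAt (Γ0 t) (Γ1 t x) x := by
  have := (E_hx (1/2) t x).const_mul k0
  refine this.congr_deriv ?_; unfold Γ1; norm_num
lemma Γ1_hx (t x : ℝ) : HasDerivAt (Γ1 t) (Γ2 t x) x := by
  have := (((hasDerivAt_id x).div_const 2).neg.mul (E_hx (3/2) t x)).const_mul k0
  refine this.congr_deriv ?_
  unfold Γ2; simp; left; norm_num; ring
lemma Γ0_ht (t x : ℝ) (h : t ≠ 0 ∨ x ≠ 0) : HasDerivAt (fun t => Γ0 t x) (Γ2 t x) t := by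
  have := (E_ht (1/2) t x h).const_mul k0
  refine this.congr_deriv ?_
  unfold Γ2; norm_num
lemma Γ_zero (t x : ℝ) (h : t ≤ 0) : Γ0 t x = 0 ∧ Γ1 t x = 0 ∧ Γ2 t x = 0 := by
  simp [Γ0, Γ1, Γ2, E, not_lt.2 h]
lemma Γ_cont (t x : ℝ) (h : t ≠ 0 ∨ x ≠ 0) : ContinuousAt (fun q : ℝ² => Γ0 q.1 q.2) (t, x) ∧
    ContinuousAt (fun q : ℝ² => Γ1 q.1 q.2) (t, x) ∧ ContinuousAt (fun q : ℝ² => Γ2 q.1 q.2) (t, x) := by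
  have e := fun a => E_cont a t x h
  refine ⟨continuousAt_const.mul (e _), continuousAt_const.mul (ContinuousAt.mul ♯ (e _)),
    continuousAt_const.mul ((continuousAt_const.mul (e _)).add (ContinuousAt.mul ♯ (e _)))⟩
lemma Γ_far (δ : ℝ) (hd : 0 < δ) : ∃ C, 0 ≤ C ∧ ∀ t x : ℝ, δ ≤ t ∨ δ ≤ |x| →
    |Γ0 t x| ≤ C ∧ |Γ1 t x| ≤ C ∧ |Γ2 t x| ≤ C := by
  obtain ⟨C0, p0, h0⟩ := E_far (1/2) δ 0 ♩ hd
  obtain ⟨C1, p1, h1⟩ := E_far (3/2) δ 1 ♩ hd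
  obtain ⟨C2, p2, h2⟩ := E_far (3/2) δ 0 ♩ hd
  obtain ⟨C3, p3, h3⟩ := E_far (5/2) δ 2 ♩ hd
  have hk := k0_pos
  refine ⟨k0 * (C0 + C1 + C2 + C3), ♭, fun t x h => ?_⟩
  have a0 := h0 t x h; have a1 := h1 t x h; have a2 := h2 t x h; have a3 := h3 t x h
  simp only [pow_zero, one_mul, pow_one, sq_abs] at a0 a1 a2 a3
  have e0 := E_nonneg (1/2) t x; have e1 := E_nonneg (3/2) t x; have e2 := E_nonneg (5/2) t x
  refine ⟨?_, ?_, ?_⟩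
  · rw [Γ0, abs_mul, abs_of_pos hk, abs_of_nonneg e0]; gcongr; linarith
  · rw [Γ1, abs_mul, abs_of_pos hk, abs_mul, abs_neg, abs_div, abs_of_nonneg e1, abs_two]; gcongr
    have := abs_nonneg x; nlinarith
  · rw [Γ2, abs_mul, abs_of_pos hk]; gcongr
    have := sq_nonneg x
    rw [abs_le]; constructor <;> nlinarith [mul_nonneg this e2]
lemma Γ_near : ∃ C, 0 < C ∧ ∀ t x : ℝ, 0 < t → |Γ0 t x| ≤ C * t ^ ⊟ ∧
    |Γ1 t x| ≤ C * t ^ (-1:ℝ) ∧ |Γ2 t x| ≤ C * t ^ ⊠ := by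
  obtain ⟨C0, p0, h0⟩ := E_near (1/2) 0
  obtain ⟨C1, p1, h1⟩ := E_near (3/2) 1
  obtain ⟨C2, p2, h2⟩ := E_near (3/2) 0
  obtain ⟨C3, p3, h3⟩ := E_near (5/2) 2
  have hk := k0_pos
  refine ⟨k0 * (C0 + C1 + C2 + C3), ♭, fun t x h => ?_⟩
  have a0 := h0 t x h; have a1 := h1 t x h; have a2 := h2 t x h; have a3 := h3 t x h
  norm_num at a0 a1 a2 a3
  have e0 := E_nonneg (1/2) t x; have e1 := E_nonneg (3/2) t x; have e2 := E_nonneg (5/2) t x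
  have q0 : 0 < t ^ ⊟ := ♭
  have q1 : 0 < t ^ (-1:ℝ) := ♭
  have q2 : 0 < t ^ ⊠ := ♭
  refine ⟨?_, ?_, ?_⟩
  · rw [Γ0, abs_mul, abs_of_pos hk, abs_of_nonneg e0, mul_assoc]; gcongr; nlinarith
  · rw [Γ1, abs_mul, abs_of_pos hk, abs_mul, abs_neg, abs_div, abs_of_nonneg e1, abs_two, mul_assoc]; refine mul_le_mul_of_nonneg_left ?_ hk.le
    have := abs_nonneg x; nlinarith
  · rw [Γ2, abs_mul, abs_of_pos hk, mul_assoc]; gcongr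
    have := sq_nonneg x
    rw [abs_le]; constructor <;> nlinarith [mul_nonneg this e2]
lemma Γ1_lin (t x : ℝ) (ht : 0 < t) : |Γ1 t x| ≤ k0 * t ^ ⊠ * |x| := by
  have hk := k0_pos
  have := (E_le (3/2) t x).resolve_right ♮
  have e1 := E_nonneg (3/2) t x
  rw [Γ1, abs_mul, abs_of_pos hk, abs_mul, abs_neg, abs_div, abs_of_nonneg e1, abs_two, mul_assoc]; refine mul_le_mul_of_nonneg_left ?_ hk.le
  have := abs_nonneg x
  nlinarith

def Ker (G : ℝ → ℝ → ℝ) : Prop := (∀ t x, t ≠ 0 ∨ x ≠ 0 → ContinuousAt (fun q : ℝ² => G q.1 q.2) (t, x)) ∧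
  (∀ δ > 0, ∃ C, 0 ≤ C ∧ ∀ t x, δ ≤ |t| ∨ δ ≤ |x| → |G t x| ≤ C) ∧ Measurable (fun q : ℝ² => G q.1 q.2)

lemma E_meas (a : ℝ) : Measurable (fun q : ℝ² => E a q.1 q.2) := by
  unfold E
  refine Measurable.ite (measurableSet_lt measurable_const measurable_fst) ?_ measurable_const
  exact (measurable_fst.pow_const _).mul (Real.measurable_exp.comp ♯)

lemma Ker_Γ : Ker Γ0 ∧ Ker Γ1 ∧ Ker Γ2 := by
  have h := fun δ hδ => Γ_far δ hδ
  have key : ∀ δ > ⓪, ∃ C, 0 ≤ C ∧ ∀ t x, δ ≤ |t| ∨ δ ≤ |x| → |Γ0 t x| ≤ C ∧ |Γ1 t x| ≤ C ∧ |Γ2 t x| ≤ C := by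
    intro δ hδ
    obtain ⟨C, hC, hb⟩ := Γ_far δ hδ
    refine ⟨C, hC, fun t x h => ?_⟩
    rcases le_or_gt t 0 with ht | ht
    · simp [Γ_zero t x ht, hC]
    · exact hb t x (by rwa [abs_of_pos ht] at h)
  refine ⟨⟨fun t x h => (Γ_cont t x h).1, fun δ hδ => ?_, measurable_const.mul (E_meas _)⟩,
    ⟨fun t x h => (Γ_cont t x h).2.1, fun δ hδ => ?_, measurable_const.mul (Measurable.mul ♯ (E_meas _))⟩,
    ⟨fun t x h => (Γ_cont t x h).2.2, fun δ hδ => ?_, measurable_const.mul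
      ((measurable_const.mul (E_meas _)).add (Measurable.mul ♯ (E_meas _)))⟩⟩
  all_goals obtain ⟨C, hC, hb⟩ := key δ hδ
  · exact ⟨C, hC, fun t x h => (hb t x h).1⟩
  · exact ⟨C, hC, fun t x h => (hb t x h).2.1⟩
  · exact ⟨C, hC, fun t x h => (hb t x h).2.2⟩

def pot (G : ℝ → ℝ → ℝ) (α β f : ℝ → ℝ) (μ : Measure ℝ) (t x : ℝ) : ℝ := ∫ w, G (t - α w) (x - β w) * f w ∂μ

def FarAt (α β : ℝ → ℝ) (t0 x0 : ℝ) : Prop :=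
  ∃ δ > 0, ∀ t x, |t - t0| < δ → |x - x0| < δ → ∀ w, δ ≤ |t - α w| ∨ δ ≤ |x - β w|

section
variable {G G' : ℝ → ℝ → ℝ} {α β f : ℝ → ℝ} {μ : Measure ℝ} {t0 x0 : ℝ}

lemma pot_aesm (hG : Ker G) (hα : Measurable α) (hβ : Measurable β) (hf : Integrable f μ) (t x : ℝ) :
    AEStronglyMeasurable (fun w => G (t - α w) (x - β w) * f w) μ := by
  refine AEStronglyMeasurable.mul ?_ hf.1
  exact (hG.2.2.comp (f := fun w => (t - α w, x - β w)) ♯).aestronglyMeasurable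

lemma pot_cont (hG : Ker G) (hα : Measurable α) (hβ : Measurable β) (hf : Integrable f μ) (hF : FarAt α β t0 x0) :
    ContinuousAt (fun q : ℝ² => pot G α β f μ q.1 q.2) (t0, x0) := by
  obtain ⟨δ, hδ, hF⟩ := hF
  obtain ⟨C, hC, hb⟩ := hG.2.1 δ hδ
  refine continuousAt_of_dominated (bound := fun w => C * |f w|) (Eventually.of_forall fun q => pot_aesm hG hα hβ hf _ _) ?_
    (hf.abs.const_mul C) (Eventually.of_forall fun w => ?_)
  · filter_upwards [Metric.ball_mem_nhds (t0, x0) hδ] with q hq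
    rw [← ball_prod_same, mem_prod, Metric.mem_ball, Metric.mem_ball, Real.dist_eq, Real.dist_eq] at hq
    refine Eventually.of_forall fun w => ?_
    rw [norm_mul]; exact mul_le_mul_of_nonneg_right (hb _ _ (hF _ _ hq.1 hq.2 w)) ◉
  · have h0 : t0 - α w ≠ 0 ∨ x0 - β w ≠ 0 := by
      rcases hF t0 x0 (by simpa) (by simpa) w with h | h
      · exact Or.inl (abs_pos.1 (hδ.trans_le h))
      · exact Or.inr (abs_pos.1 (hδ.trans_le h))
    refine ContinuousAt.mul ?_ continuousAt_const
    exact ContinuousAt.comp (f := fun q : ℝ² => (q.1 - α w, q.2 - β w)) (hG.1 _ _ h0) ♯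

lemma pot_int (hG : Ker G) (hα : Measurable α) (hβ : Measurable β) (hf : Integrable f μ) (hF : FarAt α β t0 x0) :
    Integrable (fun w => G (t0 - α w) (x0 - β w) * f w) μ := by
  obtain ⟨δ, hδ, hF⟩ := hF
  obtain ⟨C, hC, hb⟩ := hG.2.1 δ hδ
  refine (hf.abs.const_mul C).mono' (pot_aesm hG hα hβ hf _ _) (Eventually.of_forall fun w => ?_)
  rw [norm_mul]; exact mul_le_mul_of_nonneg_right (hb _ _ (hF _ _ (by simpa) (by simpa) w)) ◉

lemma pot_hx (hG : Ker G) (hG' : Ker G') (hd : ∀ t x, HasDerivAt (G t) (G' t x) x)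
    (hα : Measurable α) (hβ : Measurable β) (hf : Integrable f μ) (hF : FarAt α β t0 x0) :
    HasDerivAt (pot G α β f μ t0) (pot G' α β f μ t0 x0) x0 := by
  obtain ⟨δ, hδ, hF'⟩ := id hF
  obtain ⟨C, hC, hb⟩ := hG'.2.1 δ hδ
  refine (hasDerivAt_integral_of_dominated_loc_of_deriv_le (F := fun x w => G (t0 - α w) (x - β w) * f w)
    (F' := fun x w => G' (t0 - α w) (x - β w) * f w) (bound := fun w => C * |f w|)
    (Metric.ball_mem_nhds x0 hδ) (Eventually.of_forall fun x => pot_aesm hG hα hβ hf _ _) (pot_int hG hα hβ hf hF)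
    (pot_aesm hG' hα hβ hf _ _) (Eventually.of_forall fun w x hx => ?_) (hf.abs.const_mul C)
    (Eventually.of_forall fun w x hx => ?_)).2
  · rw [norm_mul]; exact mul_le_mul_of_nonneg_right (hb _ _ (hF' _ _ (by simpa) hx w)) ◉
  · exact ((hd _ _).comp_sub_const x (β w)).mul_const _

lemma pot_ht (hG : Ker G) (hG' : Ker G') (hd : ∀ t x, t ≠ 0 ∨ x ≠ 0 → HasDerivAt (fun t => G t x) (G' t x) t)
    (hα : Measurable α) (hβ : Measurable β) (hf : Integrable f μ) (hF : FarAt α β t0 x0) :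
    HasDerivAt (fun t => pot G α β f μ t x0) (pot G' α β f μ t0 x0) t0 := by
  obtain ⟨δ, hδ, hF'⟩ := id hF
  obtain ⟨C, hC, hb⟩ := hG'.2.1 δ hδ
  refine (hasDerivAt_integral_of_dominated_loc_of_deriv_le (F := fun t w => G (t - α w) (x0 - β w) * f w)
    (F' := fun t w => G' (t - α w) (x0 - β w) * f w) (bound := fun w => C * |f w|)
    (Metric.ball_mem_nhds t0 hδ) (Eventually.of_forall fun x => pot_aesm hG hα hβ hf _ _) (pot_int hG hα hβ hf hF)
    (pot_aesm hG' hα hβ hf _ _) (Eventually.of_forall fun w x hx => ?_) (hf.abs.const_mul C)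
    (Eventually.of_forall fun w x hx => ?_)).2
  · rw [norm_mul]; exact mul_le_mul_of_nonneg_right (hb _ _ (hF' _ _ hx (by simpa) w)) ◉
  · have h0 : x - α w ≠ 0 ∨ x0 - β w ≠ 0 := by
      rcases hF' x x0 hx (by simpa) w with h | h
      · exact Or.inl (abs_pos.1 (hδ.trans_le h))
      · exact Or.inr (abs_pos.1 (hδ.trans_le h))
    exact ((hd _ _ h0).comp_sub_const x (α w)).mul_const _
end

lemma FarAt_const {t0 : ℝ} (x0 : ℝ) (h : 0 < t0) : FarAt ◈ (fun y => y) t0 x0 := by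
  refine ⟨t0 / 2, ♭, fun t x h1 _ w => Or.inl ?_⟩
  rw [abs_lt] at h1; rw [sub_zero]; exact le_trans ♮ (le_abs_self t)

lemma FarAt_curve {c : ℝ → ℝ} (hc : Continuous c) {t0 x0 : ℝ} (h : x0 ≠ c t0) : FarAt (fun τ => τ) c t0 x0 := by
  have hd : 0 < |x0 - c t0| := abs_pos.2 (sub_ne_zero.2 h)
  obtain ⟨δ, hδ, hh⟩ := Metric.continuousAt_iff.1 (hc.continuousAt (x := t0)) (|x0 - c t0| / 3) ♭
  refine ⟨min (δ / 2) (|x0 - c t0| / 3), ♭, fun t x h1 h2 w => ?_⟩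
  by_contra hcon
  push Not at hcon
  obtain ⟨a1, a2⟩ := hcon
  have b1 : |w - t0| < δ := by
    have := abs_sub_abs_le_abs_sub (w - t0) (t - t0)
    have e : w - t0 = -(t - w) + (t - t0) := by ring
    rw [e]; refine (abs_add_le _ _).trans_lt ?_
    rw [abs_neg]; linarith [min_le_left (δ / 2) (|x0 - c t0| / 3)]
  have b2 := hh (show dist w t0 < δ from b1)
  rw [Real.dist_eq] at b2
  have e : x0 - c t0 = (x0 - x) + (x - c w) + (c w - c t0) := by ring
  have := (abs_add_le ((x0 - x) + (x - c w)) (c w - c t0)).trans (add_le_add_left (abs_add_le _ _) _)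
  rw [← e, abs_sub_comm x0 x] at this
  linarith [min_le_right (δ / 2) (|x0 - c t0| / 3)]

lemma sqrt_int (B : ℝ) (hB : 0 ≤ B) : IntegrableOn (fun σ : ℝ => σ ^ ⊟) (Ioc 0 B) ∧
    ∫ σ in Ioc 0 B, σ ^ ⊟ = 2 * √B := by
  constructor
  · rw [← intervalIntegrable_iff_integrableOn_Ioc_of_le hB]
    exact intervalIntegral.intervalIntegrable_rpow' ♩
  · rw [← intervalIntegral.integral_of_le hB, integral_rpow (Or.inl ♩)]
    norm_num; rw [sqrt_eq_rpow]; ring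

lemma volt {k : ℝ → ℝ} {C t : ℝ} (ht : 0 ≤ t) (hk : ∀ σ, 0 < σ → σ < t → |k σ| ≤ C * σ ^ ⊟)
    (hz : ∀ σ, t ≤ σ → k σ = 0) : |∫ σ in Ioi 0, k σ| ≤ 2 * C * √t := by
  obtain ⟨h1, h2⟩ := sqrt_int t ht
  have e : ∫ σ in Ioi 0, k σ = ∫ σ in Ioo 0 t, k σ := by
    rw [setIntegral_eq_of_subset_of_forall_sdiff_eq_zero measurableSet_Ioi Ioo_subset_Ioi_self]
    rintro σ ⟨h3, h4⟩; exact hz σ (by by_contra h; exact h4 ⟨h3, not_le.1 h⟩)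
  rw [e, ← integral_Ioc_eq_integral_Ioo] at *
  have := norm_integral_le_of_norm_le (μ := volume.restrict (Ioo 0 t)) (f := k) (g := fun σ => C * σ ^ ⊟)
    ((h1.mono_set Ioo_subset_Ioc_self).const_mul C)
    ((ae_restrict_iff' measurableSet_Ioo).2 (Eventually.of_forall fun σ h => hk σ h.1 h.2))
  rw [← integral_Ioc_eq_integral_Ioo, ← integral_Ioc_eq_integral_Ioo, integral_const_mul, h2] at this
  rw [Real.norm_eq_abs] at this; linarith

lemma volt_tendsto {Y : Type*} {l : Filter Y} [l.IsCountablyGenerated] {k : Y → ℝ → ℝ} {k' : ℝ → ℝ} {C B : ℝ}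
    (hB : 0 ≤ B) (hm : ∀ᶠ y in l, Measurable (k y))
    (hk : ∀ᶠ y in l, ∀ σ, 0 < σ → |k y σ| ≤ C * σ ^ ⊟) (hz : ∀ᶠ y in l, ∀ σ, B ≤ σ → k y σ = 0)
    (hl : ∀ᵐ σ, 0 < σ → Tendsto (fun y => k y σ) l (𝓝 (k' σ))) :
    Tendsto (fun y => ∫ σ in Ioi 0, k y σ) l (𝓝 (∫ σ in Ioi 0, k' σ)) := by
  refine tendsto_integral_filter_of_dominated_convergence ((Ioc 0 B).indicator fun σ => C * σ ^ ⊟) ?_ ?_ ?_ ?_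
  · filter_upwards [hm] with y h using h.aestronglyMeasurable
  · filter_upwards [hk, hz] with y h1 h2
    refine (ae_restrict_iff' measurableSet_Ioi).2 (Eventually.of_forall fun σ h => ?_)
    by_cases hs : σ ∈ Ioc 0 B
    · rw [indicator_of_mem hs]; exact h1 σ h
    · rw [indicator_of_notMem hs, h2 σ (by by_contra h3; exact hs ⟨h, (not_le.1 h3).le⟩)]; simp
  · exact ((integrable_indicator_iff measurableSet_Ioc).2 ((sqrt_int B hB).1.const_mul C)).integrableOn
  · exact (ae_restrict_iff' measurableSet_Ioi).2 hl

structure Den (f : ℝ → ℝ) (N : ℝ) : Prop where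
  m : Measurable f
  b : ∀ t, |f t| ≤ N
  z : ∀ t ≤ 0, f t = 0
  c : ∀ t, 0 < t → ContinuousAt f t

lemma Den.cont {f N} (h : Den f N) {t : ℝ} (ht : t ≠ 0) : ContinuousAt f t := by
  rcases lt_or_gt_of_ne ht with h1 | h1
  · exact continuousAt_const.congr (f := fun _ => ⓪) (by filter_upwards [Iio_mem_nhds h1] with y hy using (h.z y (le_of_lt hy)).symm)
  · exact h.c t h1

def Lay (G : ℝ → ℝ → ℝ) (c f : ℝ → ℝ) (t x : ℝ) : ℝ := ∫ σ in Ioi 0, G σ (x - c (t - σ)) * f (t - σ)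

section
variable {G G' : ℝ → ℝ → ℝ} {c f : ℝ → ℝ} {N : ℝ} {t0 x0 : ℝ}

lemma Lay_pot (hz : ∀ t x, t ≤ 0 → G t x = 0) (hf : Den f N) {t B : ℝ} (x : ℝ) (hB : t ≤ B) :
    Lay G c f t x = pot G (fun τ => τ) c f (volume.restrict (Ioc 0 B)) t x := by
  have h1 : Lay G c f t x = ∫ σ, G σ (x - c (t - σ)) * f (t - σ) :=
    setIntegral_eq_integral_of_forall_compl_eq_zero fun σ hσ => by
      rw [hz σ _ (by simpa using hσ)]; simp
  have h2 : pot G (fun τ => τ) c f (volume.restrict (Ioc 0 B)) t x = ∫ τ, G (t - τ) (x - c τ) * f τ :=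
    setIntegral_eq_integral_of_forall_compl_eq_zero fun τ hτ => by
      rcases le_or_gt τ 0 with h | h
      · rw [hf.z τ h]; simp
      · rw [hz (t - τ) _ (by by_contra h3; exact hτ ⟨h, ♮⟩)]; simp
  rw [h1, h2, ← integral_sub_left_eq_self (fun τ => G (t - τ) (x - c τ) * f τ) volume t]
  simp

lemma Den.int (hf : Den f N) (B : ℝ) : Integrable f (volume.restrict (Ioc 0 B)) :=
  Measure.integrableOn_of_bounded (M := N) (by simp) hf.m.aestronglyMeasurable (Eventually.of_forall fun t => hf.b t)

lemma Lay_cont (hG : Ker G) (hz : ∀ t x, t ≤ 0 → G t x = 0) (hf : Den f N) (hc : Continuous c) (h : x0 ≠ c t0) :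
    ContinuousAt (fun q : ℝ² => Lay G c f q.1 q.2) (t0, x0) := by
  refine (pot_cont hG measurable_id hc.measurable (hf.int (t0 + 1)) (FarAt_curve hc h)).congr ?_
  filter_upwards [(isOpen_Iio.preimage continuous_fst).mem_nhds (show (t0, x0).1 ∈ Iio (t0 + 1) by simp)] with q hq
  exact (Lay_pot hz hf q.2 (le_of_lt hq)).symm

lemma Lay_hx (hG : Ker G) (hG' : Ker G') (hz : ∀ t x, t ≤ 0 → G t x = 0) (hz' : ∀ t x, t ≤ 0 → G' t x = 0)
    (hd : ∀ t x, HasDerivAt (G t) (G' t x) x) (hf : Den f N) (hc : Continuous c) (h : x0 ≠ c t0) :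
    HasDerivAt (Lay G c f t0) (Lay G' c f t0 x0) x0 := by
  rw [show Lay G c f t0 = _ from funext fun x => Lay_pot hz hf x le_rfl, Lay_pot hz' hf x0 le_rfl]
  exact pot_hx hG hG' hd measurable_id hc.measurable (hf.int _) (FarAt_curve hc h)

lemma Lay_ht (hf : Den f N) (hc : Continuous c) (h : x0 ≠ c t0) :
    HasDerivAt (fun t => Lay Γ0 c f t x0) (Lay Γ2 c f t0 x0) t0 := by
  rw [Lay_pot (fun t x h => (Γ_zero t x h).2.2) hf x0 (le_add_of_nonneg_right zero_le_one : t0 ≤ t0 + 1)]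
  refine (pot_ht Ker_Γ.1 Ker_Γ.2.2 Γ0_ht measurable_id hc.measurable (hf.int (t0 + 1)) (FarAt_curve hc h)).congr_of_eventuallyEq ?_
  filter_upwards [Iio_mem_nhds (lt_add_one t0)] with t ht
  exact Lay_pot (fun t x h => (Γ_zero t x h).1) hf x0 (le_of_lt ht)

lemma Lay_int (hG : Ker G) (hz : ∀ t x, t ≤ 0 → G t x = 0) (hf : Den f N) (hc : Continuous c) (h : x0 ≠ c t0) :
    IntegrableOn (fun σ => G σ (x0 - c (t0 - σ)) * f (t0 - σ)) (Ioi 0) := by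
  have h1 := pot_int hG measurable_id hc.measurable (hf.int t0) (FarAt_curve hc h)
  have h2 : Integrable (fun w => G (t0 - w) (x0 - c w) * f w) := by
    refine (integrableOn_iff_integrable_of_support_subset (s := Ioc 0 t0) ?_).1 h1
    · intro w hw
      simp only [Function.mem_support] at hw
      by_contra h3
      rcases le_or_gt w 0 with h | h
      · exact hw (by rw [hf.z w h]; simp)
      · exact hw (by rw [hz (t0 - w) _ (by by_contra h4; exact h3 ⟨h, ♮⟩)]; simp)
  have := h2.comp_sub_left t0
  simp only [sub_sub_cancel] at this
  exact this.integrableOn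

lemma Lay0_bd : ∃ C, 0 < C ∧ ∀ (c f : ℝ → ℝ) (N : ℝ), Den f N → ∀ t x, 0 ≤ t → |Lay Γ0 c f t x| ≤ C * N * √t := by
  obtain ⟨C, hC, hb⟩ := Γ_near
  refine ⟨2 * C, ♭, fun c f N hf t x ht => ?_⟩
  have := volt (k := fun σ => Γ0 σ (x - c (t - σ)) * f (t - σ)) (C := C * N) ht (fun σ h1 h2 => ?_) (fun σ h => ?_)
  · calc _ ≤ _ := this
      _ = _ := by ring
  · rw [abs_mul]
    calc _ ≤ (C * σ ^ ⊟) * N := mul_le_mul (hb σ _ h1).1 (hf.b _) ◉ ♭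
      _ = _ := by ring
  · rw [hf.z _ ♮]; simp

lemma ae_ne (t : ℝ) : ∀ᵐ σ : ℝ, σ ≠ t := by
  simp [ae_iff]

lemma Lay0_cont (hf : Den f N) (hc : Continuous c) : Continuous (fun q : ℝ² => Lay Γ0 c f q.1 q.2) := by
  rw [continuous_iff_continuousAt]
  rintro ⟨t, x⟩
  obtain ⟨C, hC, hb⟩ := Γ_near
  refine volt_tendsto (C := C * N) (B := |t| + 1) ♭ (Eventually.of_forall fun q => ?_) (Eventually.of_forall fun q σ h1 => ?_) ?_ ?_
  · exact (Ker_Γ.1.2.2.comp (f := fun σ => (σ, q.2 - c (q.1 - σ))) ♯).mul (hf.m.comp ♯)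
  · rw [abs_mul]
    calc _ ≤ (C * σ ^ ⊟) * N := mul_le_mul (hb σ _ h1).1 (hf.b _) ◉ ♭
      _ = _ := by ring
  · filter_upwards [(isOpen_Iio.preimage continuous_fst).mem_nhds (show (t, x).1 ∈ Iio (t + 1) by simp)] with q hq σ hs
    have : q.1 < t + 1 := hq
    rw [hf.z _ (by linarith [le_abs_self t])]; simp
  · filter_upwards [ae_ne t] with σ hs h0
    refine ContinuousAt.tendsto (x := (t, x)) (f := fun q : ℝ² => Γ0 σ (q.2 - c (q.1 - σ)) * f (q.1 - σ)) (ContinuousAt.mul ?_ ?_)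
    · exact ContinuousAt.comp (f := fun q : ℝ² => (σ, q.2 - c (q.1 - σ))) (g := fun q : ℝ² => Γ0 q.1 q.2)
        (Γ_cont _ _ (Or.inl h0.ne')).1 ♯
    · exact ContinuousAt.comp (f := fun q : ℝ² => q.1 - σ) (g := f) (hf.cont (sub_ne_zero.2 hs.symm)) ♯
end

lemma E32 (y : ℝ) (hy : y ≠ 0) : IntegrableOn (fun r => E (3/2) r y) (Ioi 0) ∧
    (y = -1 → ∫ r in Ioi 0, E (3/2) r y = √(4 * π)) := by
  have hy2 : 0 < y ^ 2 / 4 := ♭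
  have hg : IntegrableOn (fun z : ℝ => exp (-(y ^ 2 / 4) * z ^ 2)) (Ioi 0) := (integrable_exp_neg_mul_sq hy2).integrableOn
  have e : EqOn (fun x : ℝ => (|⊟| * x ^ (⊟ - 1)) • exp (-(y ^ 2 / 4) * (x ^ ⊟) ^ 2))
      (fun r => (1/2) * E (3/2) r y) (Ioi 0) := by
    intro x hx
    have hx : 0 < x := hx
    have h1 : (x ^ ⊟) ^ 2 = x⁻¹ := by
      rw [← rpow_natCast, ← rpow_mul hx.le, ← rpow_neg_one]; norm_num
    simp only [E, if_pos hx, h1, smul_eq_mul]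
    rw [show ⊟ - 1 = -(3/2) by norm_num, abs_neg, abs_of_pos (by norm_num : ⓪ < 1/2)]
    rw [mul_assoc]; congr 3; field_simp
  constructor
  · have := (integrableOn_Ioi_comp_rpow_iff (fun z : ℝ => exp (-(y ^ 2 / 4) * z ^ 2)) (p := -(1/2)) ♩).2 hg
    rw [integrableOn_congr_fun e measurableSet_Ioi] at this
    have h2 := this.const_mul 2
    refine h2.congr (Eventually.of_forall fun r => ?_); simp
  · rintro rfl
    have := integral_comp_rpow_Ioi (fun z : ℝ => exp (-((-1:ℝ) ^ 2 / 4) * z ^ 2)) (p := -(1/2)) ♩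
    rw [setIntegral_congr_fun measurableSet_Ioi e, integral_const_mul, integral_gaussian_Ioi] at this
    have h3 : π / ((-1:ℝ) ^ 2 / 4) = 4 * π := by norm_num; ring
    rw [h3] at this; linarith

lemma E_scale (e r y : ℝ) (he : 0 < e) : E (3/2) (e ^ 2 * r) (e * y) = e⁻¹ ^ 3 * E (3/2) r y := by
  unfold E
  by_cases h : 0 < r
  · have h3 : (e ^ 2) ^ ⊠ = e⁻¹ ^ 3 := by
      rw [← rpow_natCast e 2, ← rpow_mul he.le, inv_pow, ← rpow_natCast e 3, ← rpow_neg he.le]; norm_num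
    have h4 : -(e * y) ^ 2 / (4 * (e ^ 2 * r)) = -y ^ 2 / (4 * r) := by field_simp
    rw [if_pos h, if_pos ♭, Real.mul_rpow ♭ h.le, h3, h4, mul_assoc]
  · rw [if_neg h, if_neg (by push Not at h ⊢; nlinarith [sq_nonneg e])]; simp

section
variable {c f : ℝ → ℝ} {N L : ℝ}

def T2k (c f : ℝ → ℝ) (t x σ : ℝ) : ℝ := k0 * (-((c t - c (t - σ)) / 2) * E (3/2) σ (x - c (t - σ))) * f (t - σ)

lemma LipC (hc : ∀ a b, |c a - c b| ≤ L * |a - b|) : Continuous c := by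
  rw [Metric.continuous_iff]
  intro b ε hε
  have hL : 0 ≤ L := by have := ◉.trans (hc 1 0); simpa using this
  refine ⟨ε / (L + 1), ♭, fun a ha => ?_⟩
  rw [Real.dist_eq] at *
  have := hc a b
  rw [lt_div_iff₀ ♭] at ha
  have := abs_nonneg (a - b)
  nlinarith

lemma T2k_bd (hf : Den f N) (hc : ∀ a b, |c a - c b| ≤ L * |a - b|) (t x σ : ℝ) (h : 0 < σ) :
    |T2k c f t x σ| ≤ k0 * L * N * σ ^ ⊟ := by
  have hk := k0_pos
  have h1 := hc t (t - σ)
  rw [sub_sub_cancel, abs_of_pos h] at h1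
  have h2 := (E_le (3/2) σ (x - c (t - σ))).resolve_right ♮
  have h3 := E_nonneg (3/2) σ (x - c (t - σ))
  have hN := ◉.trans (hf.b (t - σ))
  have e : σ ^ ⊟ = σ * σ ^ ⊠ := by
    rw [← rpow_one_add' h.le ♩]; norm_num
  rw [T2k, abs_mul, abs_mul, abs_mul, abs_neg, abs_div, abs_two, abs_of_pos hk, abs_of_nonneg h3, e]
  have hs : 0 ≤ L * σ := ◉.trans h1
  calc _ ≤ k0 * ((L * σ) * σ ^ ⊠) * N := by
        refine mul_le_mul ?_ (hf.b _) ◉ ♭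
        refine mul_le_mul_of_nonneg_left ?_ hk.le
        exact mul_le_mul ♮ h2 h3 hs
    _ = _ := by ring

lemma T2k_meas (hf : Den f N) (hc : ∀ a b, |c a - c b| ≤ L * |a - b|) (t x : ℝ) : Measurable (T2k c f t x) := by
  have := LipC hc
  unfold T2k
  exact (measurable_const.mul (Measurable.mul ♯
    ((E_meas _).comp (f := fun σ => (σ, x - c (t - σ))) ♯))).mul (hf.m.comp ♯)

lemma T2_cont (hf : Den f N) (hc : ∀ a b, |c a - c b| ≤ L * |a - b|) :
    Continuous (fun q : ℝ² => ∫ σ in Ioi 0, T2k c f q.1 q.2 σ) := by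
  have hcc := LipC hc
  rw [continuous_iff_continuousAt]
  rintro ⟨t, x⟩
  refine volt_tendsto (C := k0 * L * N) (B := |t| + 1) ♭ (Eventually.of_forall fun q => T2k_meas hf hc _ _)
    (Eventually.of_forall fun q σ h1 => T2k_bd hf hc _ _ _ h1) ?_ ?_
  · filter_upwards [(isOpen_Iio.preimage continuous_fst).mem_nhds (show (t, x).1 ∈ Iio (t + 1) by simp)] with q hq σ hs
    have : q.1 < t + 1 := hq
    rw [T2k, hf.z _ (by linarith [le_abs_self t])]; simp
  · filter_upwards [ae_ne t] with σ hs h0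
    refine ContinuousAt.tendsto (x := (t, x)) (f := fun q : ℝ² => T2k c f q.1 q.2 σ) (ContinuousAt.mul
      (continuousAt_const.mul (ContinuousAt.mul ♯ ?_)) ?_)
    · exact ContinuousAt.comp (f := fun q : ℝ² => (σ, q.2 - c (q.1 - σ))) (g := fun q : ℝ² => E (3/2) q.1 q.2)
        (E_cont _ _ _ (Or.inl h0.ne')) ♯
    · exact ContinuousAt.comp (f := fun q : ℝ² => q.1 - σ) (g := f) (hf.cont (sub_ne_zero.2 hs.symm)) ♯

lemma T2k_int (hf : Den f N) (hc : ∀ a b, |c a - c b| ≤ L * |a - b|) (t x : ℝ) :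
    IntegrableOn (T2k c f t x) (Ioi 0) := by
  have h1 : IntegrableOn (fun σ : ℝ => (Ioc 0 |t|).indicator (fun σ => k0 * L * N * σ ^ ⊟) σ) (Ioi 0) :=
    ((integrable_indicator_iff measurableSet_Ioc).2 ((sqrt_int |t| (abs_nonneg t)).1.const_mul _)).integrableOn
  refine h1.mono' (T2k_meas hf hc t x).aestronglyMeasurable ((ae_restrict_iff' measurableSet_Ioi).2 (Eventually.of_forall fun σ h => ?_))
  by_cases hs : σ ≤ |t|
  · rw [indicator_of_mem (show σ ∈ Ioc 0 |t| from ⟨h, hs⟩)]; exact T2k_bd hf hc t x σ h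
  · rw [indicator_of_notMem (fun h => hs h.2), T2k, hf.z _ (by linarith [le_abs_self t])]; simp

lemma Lay1_curve (t : ℝ) : Lay Γ1 c f t (c t) = ∫ σ in Ioi 0, T2k c f t (c t) σ := rfl

lemma Lay1_left (hf : Den f N) (hc : ∀ a b, |c a - c b| ≤ L * |a - b|) (t x : ℝ) (h : x < c t) :
    Lay Γ1 c f t x = (∫ σ in Ioi 0, T2k c f t x σ) + k0 / 2 * ∫ r in Ioi 0,
      E (3/2) r (-1 + (c t - c (t - (c t - x) ^ 2 * r)) / (c t - x)) * f (t - (c t - x) ^ 2 * r) := by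
  have hi := Lay_int Ker_Γ.2.1 (fun t x h => (Γ_zero t x h).2.1) hf (LipC hc) h.ne
  set e := c t - x with he
  have hep : 0 < e := by simp only [he]; linarith
  have h1 := integral_sub hi (T2k_int hf hc t x)
  have h2 : ∀ σ, Γ1 σ (x - c (t - σ)) * f (t - σ) - T2k c f t x σ =
      k0 * (e / 2) * (E (3/2) σ (x - c (t - σ)) * f (t - σ)) := by
    intro σ; simp only [Γ1, T2k, he]; ring
  simp only [h2] at h1
  rw [integral_const_mul] at h1
  have h3 := integral_comp_mul_left_Ioi (fun σ => E (3/2) σ (x - c (t - σ)) * f (t - σ)) 0 (b := e ^ 2) ♭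
  have h4 : ∀ r, E (3/2) (e ^ 2 * r) (x - c (t - e ^ 2 * r)) = e⁻¹ ^ 3 * E (3/2) r (-1 + (c t - c (t - e ^ 2 * r)) / e) := by
    intro r; rw [← E_scale e r _ hep]; congr 1; field_simp; simp only [he]; ring
  simp only [h4, mul_zero, smul_eq_mul, mul_assoc] at h3
  rw [integral_const_mul] at h3
  have h5 : ∫ σ in Ioi 0, E (3/2) σ (x - c (t - σ)) * f (t - σ) = e⁻¹ * ∫ r in Ioi 0,
      E (3/2) r (-1 + (c t - c (t - e ^ 2 * r)) / e) * f (t - e ^ 2 * r) := by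
    field_simp at h3 ⊢; linarith
  rw [h5] at h1
  unfold Lay
  rw [← sub_eq_iff_eq_add', ← h1]; field_simp

lemma jumpL (hf : Den f N) (hc : ∀ a b, |c a - c b| ≤ L * |a - b|) (t : ℝ) (ht : 0 < t) :
    Tendsto (fun q : ℝ² => Lay Γ1 c f q.1 q.2) (𝓝[{q | q.2 < c q.1}] (t, c t))
      (𝓝 (Lay Γ1 c f t (c t) + f t / 2)) := by
  have hcc := LipC hc
  have hL : 0 ≤ L := by have := ◉.trans (hc 1 0); simpa using this
  have hN : 0 ≤ N := ◉.trans (hf.b 0)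
  have hA : Tendsto (fun q : ℝ² => ∫ σ in Ioi 0, T2k c f q.1 q.2 σ) (𝓝[{q | q.2 < c q.1}] (t, c t))
      (𝓝 (Lay Γ1 c f t (c t))) := by
    rw [Lay1_curve]; exact ((T2_cont hf hc).tendsto (t, c t)).mono_left nhdsWithin_le_nhds
  have hdlim : Tendsto (fun q : ℝ² => c q.1 - q.2) (𝓝 (t, c t)) (𝓝 0) := by
    have : Continuous (fun q : ℝ² => c q.1 - q.2) := by fun_prop
    simpa using this.tendsto (t, c t)
  have hB : Tendsto (fun q : ℝ² => ∫ r in Ioi 0, E (3/2) r (-1 + (c q.1 - c (q.1 - (c q.1 - q.2) ^ 2 * r)) / (c q.1 - q.2))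
      * f (q.1 - (c q.1 - q.2) ^ 2 * r)) (𝓝[{q | q.2 < c q.1}] (t, c t)) (𝓝 (∫ r in Ioi 0, E (3/2) r (-1) * f t)) := by
    have hin : ∀ (q : ℝ²) (r : ℝ), 0 < r → 0 < c q.1 - q.2 →
        |(c q.1 - c (q.1 - (c q.1 - q.2) ^ 2 * r)) / (c q.1 - q.2)| ≤ L * (c q.1 - q.2) * r := by
      intro q r hr hd
      rw [abs_div, abs_of_pos hd, div_le_iff₀ hd]
      refine (hc _ _).trans (le_of_eq ?_)
      rw [sub_sub_cancel, abs_of_pos ♭]; ring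
    refine tendsto_integral_filter_of_dominated_convergence (fun r => 3 * E (3/2) r (1/2) * N) ?_ ?_ ?_ ?_
    · refine Eventually.of_forall fun q => Measurable.aestronglyMeasurable ?_
      exact Measurable.mul ((E_meas _).comp (f := fun r => (r, -1 + (c q.1 - c (q.1 - (c q.1 - q.2) ^ 2 * r)) / (c q.1 - q.2))) ♯)
        (hf.m.comp ♯)
    · have h1 := (hdlim.eventually (gt_mem_nhds (show ⓪ < 1 / (2 * (L + 1)) by positivity))).filter_mono
        (nhdsWithin_le_nhds (s := {q | q.2 < c q.1}))
      filter_upwards [h1, self_mem_nhdsWithin] with q hq hq2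
      have hd : 0 < c q.1 - q.2 := sub_pos.2 hq2
      refine (ae_restrict_iff' measurableSet_Ioi).2 (Eventually.of_forall fun r (hr : 0 < r) => ?_)
      rw [norm_mul]
      refine mul_le_mul ?_ (hf.b _) (norm_nonneg _) (mul_nonneg ♩ (E_nonneg _ _ _))
      rw [norm_of_nonneg (E_nonneg _ _ _)]
      have h2 := hin q r hr hd
      set z := (c q.1 - c (q.1 - (c q.1 - q.2) ^ 2 * r)) / (c q.1 - q.2)
      have hq3 : L * (c q.1 - q.2) ≤ 1 / 2 := by
        rw [lt_div_iff₀ ♭] at hq; nlinarith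
      simp only [E, if_pos hr]
      have hrp : 0 < r ^ ⊠ := ♭
      suffices h : exp (-(-1 + z) ^ 2 / (4 * r)) ≤ 3 * exp (-(1/2) ^ 2 / (4 * r)) by nlinarith
      rcases le_or_gt r 1 with hr1 | hr1
      · have hz : |z| ≤ 1 / 2 := h2.trans (by nlinarith)
        rw [abs_le] at hz
        have : exp (-(-1 + z) ^ 2 / (4 * r)) ≤ exp (-(1/2) ^ 2 / (4 * r)) := by
          apply exp_le_exp.2; rw [neg_div, neg_div]
          exact neg_le_neg (div_le_div_of_nonneg_right (by nlinarith) ♭)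
        linarith [exp_pos (-(1/2) ^ 2 / (4 * r))]
      · have a1 : exp (-(-1 + z) ^ 2 / (4 * r)) ≤ 1 := exp_le_one_iff.2 (by rw [neg_div]; simp; positivity)
        have a2 : 1 - 1/16 ≤ exp (-(1/2) ^ 2 / (4 * r)) := by
          have := add_one_le_exp (-(1/2) ^ 2 / (4 * r))
          have : (1/2:ℝ) ^ 2 / (4 * r) ≤ 1 / 16 := by rw [div_le_iff₀ ♭]; nlinarith
          rw [neg_div] at *; linarith
        linarith
    · exact ((E32 (1/2) ♩).1.const_mul 3).mul_const N
    · refine (ae_restrict_iff' measurableSet_Ioi).2 (Eventually.of_forall fun r (hr : 0 < r) => ?_)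
      have hz : Tendsto (fun q : ℝ² => (c q.1 - c (q.1 - (c q.1 - q.2) ^ 2 * r)) / (c q.1 - q.2))
          (𝓝[{q | q.2 < c q.1}] (t, c t)) (𝓝 0) := by
        refine squeeze_zero_norm' ?_ (show Tendsto (fun q : ℝ² => L * (c q.1 - q.2) * r) _ _ from ?_)
        · filter_upwards [self_mem_nhdsWithin] with q hq using hin q r hr (sub_pos.2 hq)
        · have := ((hdlim.const_mul L).mul_const r).mono_left (nhdsWithin_le_nhds (s := {q | q.2 < c q.1}))
          simpa using this
      refine Tendsto.mul ?_ ?_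
      · have h1 : Tendsto (fun q : ℝ² => (r, -1 + (c q.1 - c (q.1 - (c q.1 - q.2) ^ 2 * r)) / (c q.1 - q.2)))
          (𝓝[{q | q.2 < c q.1}] (t, c t)) (𝓝 (r, -1)) := by
          have := (tendsto_const_nhds (x := (-1:ℝ))).add hz
          rw [add_zero] at this
          exact tendsto_const_nhds.prodMk_nhds this
        exact (E_cont (3/2) r (-1) (Or.inl hr.ne')).tendsto.comp h1
      · have h1 : Tendsto (fun q : ℝ² => q.1 - (c q.1 - q.2) ^ 2 * r) (𝓝 (t, c t)) (𝓝 t) := by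
          have : Continuous (fun q : ℝ² => q.1 - (c q.1 - q.2) ^ 2 * r) := by fun_prop
          simpa using this.tendsto (t, c t)
        exact ((hf.c t ht).tendsto.comp h1).mono_left nhdsWithin_le_nhds
  have hlim : k0 / 2 * (∫ r in Ioi 0, E (3/2) r (-1) * f t) = f t / 2 := by
    rw [integral_mul_const, (E32 (-1) ♩).2 rfl, k0]
    have : 0 < √(4 * π) := ♭
    field_simp
  have := hA.add (hB.const_mul (k0 / 2))
  rw [hlim] at this
  refine this.congr' ?_
  filter_upwards [self_mem_nhdsWithin] with q hq
  exact (Lay1_left hf hc q.1 q.2 hq).symm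

def Lm (c f : ℝ → ℝ) (t x : ℝ) : ℝ := if x < c t then Lay Γ1 c f t x else Lay Γ1 c f t (c t) + f t / 2

lemma Lm_cont (hf : Den f N) (hc : ∀ a b, |c a - c b| ≤ L * |a - b|) :
    ContinuousOn (fun q : ℝ² => Lm c f q.1 q.2) {q | 0 < q.1 ∧ q.2 ≤ c q.1} := by
  have hcc := LipC hc
  rintro ⟨t, x⟩ ⟨ht, hx⟩
  simp only at ht hx
  have hop : IsOpen {q : ℝ² | q.2 < c q.1} := isOpen_lt continuous_snd (hcc.comp continuous_fst)
  rcases lt_or_eq_of_le hx with h | h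
  · refine ContinuousAt.continuousWithinAt ((Lay_cont Ker_Γ.2.1 (fun t x h => (Γ_zero t x h).2.1) hf hcc h.ne).congr ?_)
    filter_upwards [hop.mem_nhds (show (t, x) ∈ {q : ℝ² | q.2 < c q.1} from h)] with q hq
    exact (if_pos hq).symm
  · subst h
    have e : {q : ℝ² | 0 < q.1 ∧ q.2 ≤ c q.1} ⊆ {q | q.2 < c q.1} ∪ {q | q.2 = c q.1} := fun q hq => lt_or_eq_of_le hq.2
    have hv : Lm c f t (c t) = Lay Γ1 c f t (c t) + f t / 2 := if_neg (lt_irrefl _)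
    refine ContinuousWithinAt.mono (ContinuousWithinAt.union ?_ ?_) e
    · unfold ContinuousWithinAt; simp only [hv]
      refine (jumpL hf hc t ht).congr' ?_
      filter_upwards [self_mem_nhdsWithin] with q hq
      exact (if_pos hq).symm
    · unfold ContinuousWithinAt; simp only [hv]
      have h1 : Tendsto (fun q : ℝ² => (∫ σ in Ioi 0, T2k c f q.1 (c q.1) σ) + f q.1 / 2) (𝓝 (t, c t))
          (𝓝 ((∫ σ in Ioi 0, T2k c f t (c t) σ) + f t / 2)) := by
        refine Tendsto.add ?_ (Tendsto.div_const ?_ 2)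
        · have : Continuous (fun q : ℝ² => ∫ σ in Ioi 0, T2k c f q.1 (c q.1) σ) :=
            (T2_cont hf hc).comp (by fun_prop : Continuous fun q : ℝ² => (q.1, c q.1))
          exact this.tendsto (t, c t)
        · exact (hf.c t ht).tendsto.comp (continuous_fst.tendsto (t, c t))
      refine (h1.mono_left nhdsWithin_le_nhds).congr' ?_
      filter_upwards [self_mem_nhdsWithin] with q hq
      have hq : q.2 = c q.1 := hq
      rw [Lm, if_neg (by rw [hq]; exact lt_irrefl _), Lay1_curve]
end

lemma Γ_neg (t x : ℝ) : Γ0 t (-x) = Γ0 t x ∧ Γ1 t (-x) = -Γ1 t x ∧ Γ2 t (-x) = Γ2 t x := by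
  simp only [Γ0, Γ1, Γ2, E, neg_sq]; refine ⟨trivial, ?_, trivial⟩; ring
lemma Lay_neg (c f : ℝ → ℝ) (t x : ℝ) : Lay Γ0 (fun t => -c t) f t x = Lay Γ0 c f t (-x) ∧
    Lay Γ1 (fun t => -c t) f t x = -Lay Γ1 c f t (-x) ∧ Lay Γ2 (fun t => -c t) f t x = Lay Γ2 c f t (-x) := by
  unfold Lay
  have h : ∀ σ, x - -c (t - σ) = -(-x - c (t - σ)) := fun σ => by ring
  simp only [h, Γ_neg]
  refine ⟨trivial, ?_, trivial⟩
  rw [← integral_neg]; simp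

structure Ini0 (ψ : ℝ → ℝ) (K M R : ℝ) : Prop where
  lip : ∀ a b, |ψ a - ψ b| ≤ K * |a - b|
  pos : ∀ x, 0 ≤ ψ x
  le : ∀ x, ψ x ≤ M
  supp : ∀ x, R ≤ |x| → ψ x = 0
  even : ∀ x, ψ (-x) = ψ x

def Ini (G : ℝ → ℝ → ℝ) (ψ : ℝ → ℝ) (t x : ℝ) : ℝ := pot G ◈ (fun y => y) ψ volume t x

lemma Ini_conv (G : ℝ → ℝ → ℝ) (ψ : ℝ → ℝ) (t x : ℝ) : Ini G ψ t x = ∫ y, G t y * ψ (x - y) := by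
  rw [Ini, pot, ← integral_sub_left_eq_self (fun y => G t y * ψ (x - y)) volume x]
  simp

lemma Γ0_eq {t : ℝ} (ht : 0 < t) : Γ0 t = fun y => k0 * t ^ ⊟ * exp (-(1 / (4 * t)) * y ^ 2) := by
  funext y; simp only [Γ0, E, if_pos ht]; rw [mul_assoc]; congr 3; field_simp

lemma Γ0_nonneg (t x : ℝ) : 0 ≤ Γ0 t x := mul_nonneg k0_pos.le (E_nonneg _ _ _)

lemma Γ0_int {t : ℝ} (ht : 0 < t) : Integrable (Γ0 t) ∧ ∫ y, Γ0 t y = 1 := by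
  rw [Γ0_eq ht]
  refine ⟨(integrable_exp_neg_mul_sq ♭).const_mul _, ?_⟩
  rw [integral_const_mul, integral_gaussian]
  have : π / (1 / (4 * t)) = (4 * π) * t := by field_simp
  rw [this, sqrt_mul ♭, k0, rpow_neg ht.le, ← sqrt_eq_rpow]
  have : 0 < √(4 * π) := ♭
  have : 0 < √t := ♭
  field_simp

lemma Γ0_mom {t : ℝ} (ht : 0 < t) : Integrable (fun y => |y| * Γ0 t y) ∧ ∫ y, |y| * Γ0 t y ≤ 3 * √t := by
  have hst : 0 < √t := ♭
  have hk := k0_pos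
  have hb : ∀ y : ℝ, |y| * Γ0 t y ≤ 2 * k0 * exp (-(1 / (8 * t)) * y ^ 2) := by
    intro y
    have h1 : |y| ≤ 2 * √t * exp (1 / (8 * t) * y ^ 2) := by
      have := add_one_le_exp (1 / (8 * t) * y ^ 2)
      have h2 : |y| ≤ 2 * √t * (1 / (8 * t) * y ^ 2 + 1) := by
        have : 2 * √t * (1 / (8 * t) * y ^ 2 + 1) - |y| = (1 / (4 * √t)) * ((|y| - 2 * √t) ^ 2 + 4 * √t ^ 2) := by
          rw [show t = √t ^ 2 from (sq_sqrt ht.le).symm, sqrt_sq hst.le, ← sq_abs y]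
          field_simp; ring
        have : 0 ≤ 2 * √t * (1 / (8 * t) * y ^ 2 + 1) - |y| := by rw [this]; positivity
        linarith
      nlinarith
    rw [Γ0_eq ht]
    have h3 : t ^ ⊟ = (√t)⁻¹ := by rw [rpow_neg ht.le, sqrt_eq_rpow]
    have h4 : exp (1 / (8 * t) * y ^ 2) * exp (-(1 / (4 * t)) * y ^ 2) = exp (-(1 / (8 * t)) * y ^ 2) := by
      rw [← exp_add]; congr 1; field_simp; ring
    calc |y| * (k0 * t ^ ⊟ * exp (-(1 / (4 * t)) * y ^ 2))
        ≤ 2 * √t * exp (1 / (8 * t) * y ^ 2) * (k0 * t ^ ⊟ * exp (-(1 / (4 * t)) * y ^ 2)) := by gcongr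
      _ = _ := by rw [← h4, h3]; field_simp
  have hi : Integrable (fun y : ℝ => 2 * k0 * exp (-(1 / (8 * t)) * y ^ 2)) := (integrable_exp_neg_mul_sq ♭).const_mul _
  have hI : Integrable (fun y => |y| * Γ0 t y) := hi.mono' (by
      refine AEStronglyMeasurable.mul ♯ (Γ0_int ht).1.1) (Eventually.of_forall fun y => by
      rw [norm_of_nonneg (mul_nonneg ◉ (Γ0_nonneg _ _))]; exact hb y)
  refine ⟨hI, (integral_mono hI hi hb).trans ?_⟩
  rw [integral_const_mul, integral_gaussian]
  have : π / (1 / (8 * t)) = (4 * π) * (2 * t) := by field_simp; norm_num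
  rw [this, sqrt_mul ♭, k0, sqrt_mul (by norm_num : ⓪ ≤ 2) t]
  have h4 : 0 < √(4 * π) := ♭
  have h2 : √2 ≤ 3 / 2 := by rw [sqrt_le_left ♩]; norm_num
  have : 2 * (√(4 * π))⁻¹ * (√(4 * π) * (√2 * √t)) = 2 * √2 * √t := by field_simp
  rw [this]; nlinarith

section
variable {ψ : ℝ → ℝ} {K M R : ℝ}

lemma Ini0.cont (h : Ini0 ψ K M R) : Continuous ψ := LipC h.lip

lemma Ini0.int (h : Ini0 ψ K M R) : Integrable ψ :=
  h.cont.integrable_of_hasCompactSupport (HasCompactSupport.intro (isCompact_Icc (a := -R) (b := R)) fun x hx => h.supp x (by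
    by_contra hc; push Not at hc; rw [abs_lt] at hc; exact hx ⟨hc.1.le, hc.2.le⟩))

lemma Ini_cont (h : Ini0 ψ K M R) {G : ℝ → ℝ → ℝ} (hG : Ker G) {t x : ℝ} (ht : 0 < t) :
    ContinuousAt (fun q : ℝ² => Ini G ψ q.1 q.2) (t, x) :=
  pot_cont hG measurable_const measurable_id h.int (FarAt_const x ht)

lemma Ini_hx (h : Ini0 ψ K M R) {t : ℝ} (x : ℝ) (ht : 0 < t) : HasDerivAt (Ini Γ0 ψ t) (Ini Γ1 ψ t x) x :=
  pot_hx Ker_Γ.1 Ker_Γ.2.1 Γ0_hx measurable_const measurable_id h.int (FarAt_const x ht)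
lemma Ini_hxx (h : Ini0 ψ K M R) {t : ℝ} (x : ℝ) (ht : 0 < t) : HasDerivAt (Ini Γ1 ψ t) (Ini Γ2 ψ t x) x :=
  pot_hx Ker_Γ.2.1 Ker_Γ.2.2 Γ1_hx measurable_const measurable_id h.int (FarAt_const x ht)
lemma Ini_ht (h : Ini0 ψ K M R) {t : ℝ} (x : ℝ) (ht : 0 < t) : HasDerivAt (fun t => Ini Γ0 ψ t x) (Ini Γ2 ψ t x) t :=
  pot_ht Ker_Γ.1 Ker_Γ.2.2 Γ0_ht measurable_const measurable_id h.int (FarAt_const x ht)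

lemma Ini_int (h : Ini0 ψ K M R) {g : ℝ → ℝ} (hg : Integrable g) (x : ℝ) : Integrable (fun y => g y * ψ (x - y)) :=
  hg.mul_bdd (c := M) (h.cont.comp ♯).aestronglyMeasurable
    (Eventually.of_forall fun y => by rw [norm_of_nonneg (h.pos _)]; exact h.le _)

lemma Ini_diff (h : Ini0 ψ K M R) {g : ℝ → ℝ} (hg : Integrable g) (x x' : ℝ) :
    |(∫ y, g y * ψ (x - y)) - ∫ y, g y * ψ (x' - y)| ≤ K * |x - x'| * ∫ y, |g y| := by
  rw [← integral_sub (Ini_int h hg x) (Ini_int h hg x'), ← integral_const_mul]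
  rw [← Real.norm_eq_abs]
  refine norm_integral_le_of_norm_le (f := fun y => g y * ψ (x - y) - g y * ψ (x' - y)) (g := fun y => K * |x - x'| * |g y|) (hg.abs.const_mul _) (Eventually.of_forall fun y => ?_)
  rw [← mul_sub, norm_mul, mul_comm]
  refine mul_le_mul_of_nonneg_right ?_ ◉
  refine (h.lip _ _).trans (le_of_eq ?_); congr 2; ring

lemma Ini0.K0 (h : Ini0 ψ K M R) : 0 ≤ K := by have := ◉.trans (h.lip 1 0); simpa using this

lemma Ini1_bd (h : Ini0 ψ K M R) {t : ℝ} (x : ℝ) (ht : 0 < t) : |Ini Γ1 ψ t x| ≤ K := by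
  have hl : LipschitzWith (Real.toNNReal K) (Ini Γ0 ψ t) := LipschitzWith.of_dist_le_mul fun a b => by
    rw [Real.dist_eq, Real.dist_eq, Real.coe_toNNReal _ h.K0, Ini_conv, Ini_conv]
    refine (Ini_diff h (Γ0_int ht).1 a b).trans (le_of_eq ?_)
    simp only [abs_of_nonneg (Γ0_nonneg _ _), (Γ0_int ht).2, mul_one]
  have := (Ini_hx h x ht).le_of_lipschitz hl
  rwa [Real.coe_toNNReal _ h.K0] at this

lemma Γ1_int {t : ℝ} (ht : 0 < t) : Integrable (Γ1 t) ∧ ∫ y, |Γ1 t y| ≤ 3 * t ^ ⊟ := by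
  have e : ∀ y, |Γ1 t y| = 1 / (2 * t) * (|y| * Γ0 t y) := by
    intro y
    have : E (3/2) t y = t⁻¹ * E (1/2) t y := by
      simp only [E, if_pos ht]; rw [← mul_assoc, ← rpow_neg_one, ← rpow_add ht]; norm_num
    rw [Γ1, Γ0, this, abs_mul, abs_mul, abs_mul, abs_neg, abs_div, abs_two, abs_of_pos k0_pos, abs_of_nonneg (E_nonneg _ _ _), abs_of_pos (by positivity : 0 < t⁻¹)]
    field_simp
  obtain ⟨h1, h2⟩ := Γ0_mom ht
  constructor
  · refine (h1.const_mul (1 / (2 * t))).mono' ?_ (Eventually.of_forall fun y => (e y).le)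
    exact (Ker_Γ.2.1.2.2.comp (f := fun y => (t, y)) ♯).aestronglyMeasurable
  · simp only [e, integral_const_mul]
    rw [rpow_neg ht.le, ← sqrt_eq_rpow]
    have hs : 0 < √t := ♭
    calc _ ≤ 1 / (2 * t) * (3 * √t) := by gcongr
      _ ≤ _ := by
        have : t = √t ^ 2 := (sq_sqrt ht.le).symm
        rw [this, sqrt_sq hs.le]; field_simp; norm_num

lemma Ini1_lip (h : Ini0 ψ K M R) {t : ℝ} (x x' : ℝ) (ht : 0 < t) :
    |Ini Γ1 ψ t x - Ini Γ1 ψ t x'| ≤ 3 * K * t ^ ⊟ * |x - x'| := by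
  rw [Ini_conv, Ini_conv]
  refine (Ini_diff h (Γ1_int ht).1 x x').trans ?_
  have := (Γ1_int ht).2
  have : K * |x - x'| * ∫ y, |Γ1 t y| ≤ K * |x - x'| * (3 * t ^ ⊟) :=
    mul_le_mul_of_nonneg_left this (mul_nonneg h.K0 ◉)
  linarith

lemma Ini0_bd (h : Ini0 ψ K M R) {t : ℝ} (x : ℝ) (ht : 0 < t) : |Ini Γ0 ψ t x| ≤ M ∧ |Ini Γ0 ψ t x - ψ x| ≤ 3 * K * √t := by
  obtain ⟨h1, h2⟩ := Γ0_int ht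
  rw [Ini_conv]
  constructor
  · have := norm_integral_le_of_norm_le (f := fun y => Γ0 t y * ψ (x - y)) (h1.mul_const M) (Eventually.of_forall fun y => by
      rw [norm_mul, norm_of_nonneg (Γ0_nonneg _ _), norm_of_nonneg (h.pos _)]
      exact mul_le_mul_of_nonneg_left (h.le _) (Γ0_nonneg _ _))
    rwa [integral_mul_const, h2, one_mul] at this
  · have e : ψ x = ∫ y, Γ0 t y * ψ x := by rw [integral_mul_const, h2, one_mul]
    rw [e, ← integral_sub (Ini_int h h1 x) (h1.mul_const _)]
    obtain ⟨m1, m2⟩ := Γ0_mom ht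
    have := norm_integral_le_of_norm_le (f := fun y => Γ0 t y * ψ (x - y) - Γ0 t y * ψ x) (m1.const_mul K) (Eventually.of_forall fun y => by
      rw [← mul_sub, norm_mul, norm_of_nonneg (Γ0_nonneg _ _)]
      have := h.lip (x - y) x
      rw [show x - y - x = -y by ring, abs_neg] at this
      calc _ ≤ Γ0 t y * (K * |y|) := mul_le_mul_of_nonneg_left this (Γ0_nonneg _ _)
        _ = _ := by ring)
    rw [integral_const_mul] at this
    have h3 := mul_le_mul_of_nonneg_left m2 h.K0
    rw [Real.norm_eq_abs] at this; linarith

def Iex (ψ : ℝ → ℝ) (t x : ℝ) : ℝ := if 0 < t then Ini Γ0 ψ t x else ψ x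

lemma Iex_cont (h : Ini0 ψ K M R) : ContinuousOn (fun q : ℝ² => Iex ψ q.1 q.2) {q | 0 ≤ q.1} := by
  rintro ⟨t, x⟩ (ht : 0 ≤ t)
  rcases eq_or_lt_of_le ht with rfl | ht
  · have hv : Iex ψ 0 x = ψ x := if_neg (lt_irrefl _)
    unfold ContinuousWithinAt; simp only [hv]
    rw [tendsto_iff_norm_sub_tendsto_zero]
    have hc : Continuous (fun q : ℝ² => 3 * K * √q.1 + K * |q.2 - x|) := by fun_prop
    have hl : Tendsto (fun q : ℝ² => 3 * K * √q.1 + K * |q.2 - x|) (𝓝 (0, x)) (𝓝 0) := by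
      simpa using hc.tendsto (0, x)
    refine squeeze_zero' (Eventually.of_forall fun _ => norm_nonneg _) ?_ (hl.mono_left nhdsWithin_le_nhds)
    refine Eventually.of_forall fun q => ?_
    have h1 := h.lip q.2 x
    have hK := h.K0
    unfold Iex; split_ifs with hq
    · have h2 := (Ini0_bd h q.2 hq).2
      rw [show Ini Γ0 ψ q.1 q.2 - ψ x = (Ini Γ0 ψ q.1 q.2 - ψ q.2) + (ψ q.2 - ψ x) by ring]
      exact (norm_add_le _ _).trans (add_le_add h2 h1)
    · have : 0 ≤ 3 * K * √q.1 := ♭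
      rw [Real.norm_eq_abs]; linarith
  · refine ((Ini_cont h Ker_Γ.1 ht).congr ?_).continuousWithinAt
    filter_upwards [(isOpen_Ioi.preimage continuous_fst).mem_nhds (show (t, x).1 ∈ Ioi 0 from ht)] with q hq
    exact (if_pos hq).symm

lemma Ini1_zero (h : Ini0 ψ K M R) (t : ℝ) : Ini Γ1 ψ t 0 = 0 := by
  have h1 : Ini Γ1 ψ t 0 = -Ini Γ1 ψ t 0 := by
    rw [Ini_conv, ← integral_neg, ← integral_neg_eq_self]
    congr 1; funext y; rw [(Γ_neg t y).2.1]; simp [h.even]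
  linarith
end

def F1 (ψ h q s : ℝ → ℝ) (t : ℝ) : ℝ := Ini Γ0 ψ t 0 + 2 * Lay Γ0 ◈ h t 0 - 2 * Lay Γ0 s q t 0
def F2 (ψ h q s : ℝ → ℝ) (t : ℝ) : ℝ := -2 * Ini Γ1 ψ t (s t) - 4 * Lay Γ1 ◈ h t (s t) +
  2 * (Lay Γ1 s q t (s t) + Lay Γ1 (fun t => -s t) q t (s t))

lemma volt_sub {k1 k2 : ℝ → ℝ} {C t : ℝ} (ht : 0 ≤ t) (h1 : IntegrableOn k1 (Ioi 0)) (h2 : IntegrableOn k2 (Ioi 0))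
    (hk : ∀ σ, 0 < σ → σ < t → |k1 σ - k2 σ| ≤ C * σ ^ ⊟) (hz : ∀ σ, t ≤ σ → k1 σ = 0 ∧ k2 σ = 0) :
    |(∫ σ in Ioi 0, k1 σ) - ∫ σ in Ioi 0, k2 σ| ≤ 2 * C * √t := by
  rw [← integral_sub h1 h2]
  exact volt (k := fun σ => k1 σ - k2 σ) ht hk fun σ h => by simp [hz σ h]

lemma mvt_lip {G G' : ℝ → ℝ} {D : Set ℝ} {A : ℝ} (hD : Convex ℝ D) (hd : ∀ x, HasDerivAt G (G' x) x) (hA : ∀ x ∈ D, |G' x| ≤ A)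
    {x y : ℝ} (hx : x ∈ D) (hy : y ∈ D) : |G x - G y| ≤ A * |x - y| :=
  hD.norm_image_sub_le_of_norm_hasDerivWithin_le (fun z _ => (hd z).hasDerivWithinAt) hA hy hx

lemma prod_diff {g1 g2 f1 f2 A N B d y : ℝ} (h : |g1 - g2| ≤ A * y) (hf : |f1| ≤ N) (hg : |g2| ≤ B) (hd : |f1 - f2| ≤ d) :
    |g1 * f1 - g2 * f2| ≤ A * y * N + B * d := by
  rw [show g1 * f1 - g2 * f2 = (g1 - g2) * f1 + g2 * (f1 - f2) by ring]
  refine (abs_add_le _ _).trans (add_le_add ?_ ?_)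
  · rw [abs_mul]; exact mul_le_mul h hf ◉ (◉.trans h)
  · rw [abs_mul]; exact mul_le_mul hg hd ◉ (◉.trans hg)

lemma one_le_rs {σ : ℝ} (h0 : 0 < σ) (h1 : σ ≤ 1) : 1 ≤ σ ^ ⊟ := one_le_rpow_of_pos_of_le_one_of_nonpos h0 h1 ♩

structure Dat (b τ N H L S : ℝ) (h q s : ℝ → ℝ) : Prop where
  hd : Den h H
  qd : Den q N
  l : ∀ a b, |s a - s b| ≤ L * |a - b|
  g : ∀ t ∈ Icc 0 τ, b / 2 ≤ s t
  i : s 0 = S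

lemma Lay_far (G G' : ℝ → ℝ → ℝ) (hG : Ker G) (hz : ∀ t x, t ≤ 0 → G t x = 0) (hd : ∀ t x, HasDerivAt (G t) (G' t x) x)
    {C δ : ℝ} (hC : 0 ≤ C) (hδ : 0 < δ) (hb : ∀ t x : ℝ, δ ≤ |x| → |G t x| ≤ C ∧ |G' t x| ≤ C)
    {c1 c2 f1 f2 : ℝ → ℝ} {N D d t x1 x2 : ℝ} (hN : 0 ≤ N) (hD : 0 ≤ D) (hc1 : Continuous c1) (hc2 : Continuous c2) (hf1 : Den f1 N) (hf2 : Den f2 N) (ht : 0 < t) (ht1 : t ≤ 1)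
    (g1 : ∀ τ ∈ Icc 0 t, δ ≤ x1 - c1 τ) (g2 : ∀ τ ∈ Icc 0 t, δ ≤ x2 - c2 τ) (gD : ∀ τ ∈ Icc 0 t, |(x1 - c1 τ) - (x2 - c2 τ)| ≤ D)
    (hdd : ∀ τ, |f1 τ - f2 τ| ≤ d) :
    |Lay G c1 f1 t x1 - Lay G c2 f2 t x2| ≤ 2 * (C * D * N + C * d) * √t := by
  have hd0 : 0 ≤ d := ◉.trans (hdd 0)
  refine volt_sub ht.le (Lay_int hG hz hf1 hc1 ?_) (Lay_int hG hz hf2 hc2 ?_) (fun σ h0 h1 => ?_) fun σ h => ?_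
  · have := g1 t ⟨ht.le, le_rfl⟩; intro h; linarith
  · have := g2 t ⟨ht.le, le_rfl⟩; intro h; linarith
  · have hm : t - σ ∈ Icc 0 t := ⟨♮, ♮⟩
    have m1 := mvt_lip (G := G σ) (G' := G' σ) (A := C) (convex_Ici δ) (hd σ) (fun x hx => (hb σ x (le_trans hx (le_abs_self x))).2) (g1 _ hm) (g2 _ hm)
    have m2 : |G σ (x1 - c1 (t - σ)) - G σ (x2 - c2 (t - σ))| ≤ C * D := m1.trans (mul_le_mul_of_nonneg_left (gD _ hm) hC)
    have := prod_diff m2 (hf1.b (t - σ)) (hb σ (x2 - c2 (t - σ)) (le_trans (g2 _ hm) (le_abs_self _))).1 (hdd (t - σ))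
    refine this.trans (le_mul_of_one_le_right ♭ (one_le_rs h0 ♮))
  · rw [hf1.z _ ♮, hf2.z _ ♮]; simp

lemma Γ_far' (δ : ℝ) (hd : 0 < δ) : ∃ C, 0 ≤ C ∧ ∀ t x : ℝ, δ ≤ |x| → |Γ0 t x| ≤ C ∧ |Γ1 t x| ≤ C ∧ |Γ2 t x| ≤ C := by
  obtain ⟨C, h, hb⟩ := Γ_far δ hd
  exact ⟨C, h, fun t x hx => hb t x (Or.inr hx)⟩

lemma Lay_near : ∃ C, 0 ≤ C ∧ ∀ {c1 c2 f1 f2 : ℝ → ℝ} {N L d d' t : ℝ} (_ : 0 ≤ N) (_ : ∀ a b, |c1 a - c1 b| ≤ L * |a - b|)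
    (_ : ∀ a b, |c2 a - c2 b| ≤ L * |a - b|) (_ : Den f1 N) (_ : Den f2 N) (_ : 0 < t)
    (_ : ∀ a b, |(c1 a - c2 a) - (c1 b - c2 b)| ≤ d' * |a - b|) (_ : ∀ τ, |f1 τ - f2 τ| ≤ d),
    |Lay Γ1 c1 f1 t (c1 t) - Lay Γ1 c2 f2 t (c2 t)| ≤ 2 * (C * d' * N + C * L * d) * √t := by
  obtain ⟨C, hC, hb⟩ := Γ_near
  refine ⟨C + k0, by have := k0_pos; positivity, fun {c1 c2 f1 f2 N L d d' t} hN l1 l2 hf1 hf2 ht hdc hd => ?_⟩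
  have hd0 : 0 ≤ d := ◉.trans (hd 0)
  have hk := k0_pos
  have hL : 0 ≤ L := by have := ◉.trans (l1 1 0); simpa using this
  have hd'0 : 0 ≤ d' := by have := ◉.trans (hdc 1 0); simpa using this
  refine volt_sub ht.le (T2k_int hf1 l1 t (c1 t)) (T2k_int hf2 l2 t (c2 t)) (fun σ h0 h1 => ?_) fun σ h => ?_
  · have y2 : |c2 t - c2 (t - σ)| ≤ L * σ := by simpa [abs_of_pos h0] using l2 t (t - σ)
    have y12 : |(c1 t - c1 (t - σ)) - (c2 t - c2 (t - σ))| ≤ d' * σ := by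
      have := hdc t (t - σ)
      rw [sub_sub_cancel, abs_of_pos h0] at this
      rwa [show (c1 t - c1 (t - σ)) - (c2 t - c2 (t - σ)) = c1 t - c2 t - (c1 (t - σ) - c2 (t - σ)) by ring]
    have m1 := mvt_lip (G := Γ1 σ) (G' := Γ2 σ) (D := univ) (A := C * σ ^ ⊠) convex_univ (Γ1_hx σ) (fun x _ => (hb σ x h0).2.2) (mem_univ (c1 t - c1 (t - σ))) (mem_univ (c2 t - c2 (t - σ)))
    have e : σ ^ ⊠ * σ = σ ^ ⊟ := by
      nth_rewrite 2 [← rpow_one σ]; rw [← rpow_add h0]; norm_num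
    have m2 : |Γ1 σ (c1 t - c1 (t - σ)) - Γ1 σ (c2 t - c2 (t - σ))| ≤ C * σ ^ ⊠ * (d' * σ) := m1.trans (mul_le_mul_of_nonneg_left y12 ♭)
    have m3 : |Γ1 σ (c2 t - c2 (t - σ))| ≤ k0 * σ ^ ⊠ * (L * σ) := (Γ1_lin _ _ h0).trans (mul_le_mul_of_nonneg_left y2 ♭)
    refine (prod_diff m2 (hf1.b (t - σ)) m3 (hd (t - σ))).trans ?_
    rw [show C * σ ^ ⊠ * (d' * σ) * N + k0 * σ ^ ⊠ * (L * σ) * d = (C * d' * N + k0 * L * d) * (σ ^ ⊠ * σ) by ring, e]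
    refine mul_le_mul_of_nonneg_right ?_ ♭
    have : 0 ≤ k0 * d' * N := ♭
    have : 0 ≤ C * L * d := ♭
    linarith
  · have e1 := hf1.z (t - σ) ♮
    have e2 := hf2.z (t - σ) ♮
    simp [e1, e2]

lemma Φ_diff (b N H L K : ℝ) (hb : 0 < b) (hN : 0 ≤ N) (hH : 0 ≤ H) (hL : 0 ≤ L) (hK : 0 ≤ K) : ∃ C, 0 ≤ C ∧ ∀ {ψ M R}, Ini0 ψ K M R → ∀ {S τ h1 q1 s1 h2 q2 s2 dh dq}, τ ≤ 1 →
    Dat b τ N H L S h1 q1 s1 → Dat b τ N H L S h2 q2 s2 →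
    (∀ a b, |(s1 a - s2 a) - (s1 b - s2 b)| ≤ dq * |a - b|) → (∀ t, |h1 t - h2 t| ≤ dh) → (∀ t, |q1 t - q2 t| ≤ dq) →
    ∀ t, 0 < t → t ≤ τ → |F1 ψ h1 q1 s1 t - F1 ψ h2 q2 s2 t| ≤ C * (dh + dq) * √t ∧
      |F2 ψ h1 q1 s1 t - F2 ψ h2 q2 s2 t| ≤ C * (dh + dq) * √t := by
  obtain ⟨C0, hC0, h0⟩ := Lay0_bd
  obtain ⟨C1, hC1, hf⟩ := Γ_far' (b / 2) ♭
  obtain ⟨C2, hC2, hn⟩ := Lay_near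
  refine ⟨2 * C0 + 4 * (C1 * N + C1) + 6 * K + 8 * (C1 * H + C1) + 4 * (C2 * N + C2 * L) + 4 * (2 * C1 * N + C1), ♭, ?_⟩
  intro ψ M R hψ S τ h1 q1 s1 h2 q2 s2 dh dq hτ D1 D2 hs hh hq t t0 tτ
  have hdh : 0 ≤ dh := ◉.trans (hh 0)
  have hdq : 0 ≤ dq := ◉.trans (hq 0)
  have ds : ∀ r ∈ Icc 0 t, |s1 r - s2 r| ≤ dq * r := fun r hr => by
    have := hs r 0; rwa [D1.i, D2.i, sub_self, sub_zero, sub_zero, abs_of_nonneg hr.1] at this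
  have ds' : ∀ r ∈ Icc 0 t, |s1 r - s2 r| ≤ dq := fun r hr => (ds r hr).trans (mul_le_of_le_one_right hdq (by linarith [hr.2]))
  have sub : Icc 0 t ⊆ Icc 0 τ := Icc_subset_Icc_right tτ
  have c1 := LipC D1.l
  have c2 := LipC D2.l
  have tt : t ∈ Icc 0 t := ⟨t0.le, le_rfl⟩
  have dst := ds' t tt
  have A1 : |Lay Γ0 ◈ h1 t 0 - Lay Γ0 ◈ h2 t 0| ≤ C0 * dh * √t := by
    have i : ∀ h, Den h H → IntegrableOn (fun σ => Γ0 σ (0 - (fun _ => ⓪) (t - σ)) * h (t - σ)) (Ioi 0) := fun h hh => by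
      have hg := Γ_near
      obtain ⟨C, hC, hb⟩ := hg
      have i1 : IntegrableOn (fun σ : ℝ => C * H * σ ^ ⊟) (Ioc 0 t) := (sqrt_int t t0.le).1.const_mul _
      have : IntegrableOn (fun σ => Γ0 σ (0 - (fun _ => ⓪) (t - σ)) * h (t - σ)) (Ioc 0 t) := by
        refine i1.mono' (Measurable.aestronglyMeasurable ?_) ((ae_restrict_iff' measurableSet_Ioc).2 (Eventually.of_forall fun σ hσ => ?_))
        · exact (Ker_Γ.1.2.2.comp (f := fun σ => (σ, 0 - ⓪)) ♯).mul (hh.m.comp ♯)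
        · rw [norm_mul]
          calc _ ≤ (C * σ ^ ⊟) * H := mul_le_mul (hb σ _ hσ.1).1 (hh.b _) ◉ (by have := hσ.1; positivity)
            _ = _ := by ring
      refine this.of_forall_sdiff_eq_zero measurableSet_Ioi fun σ hσ => ?_
      rw [hh.z _ (by by_contra h; exact hσ.2 ⟨hσ.1, ♮⟩)]; simp
    have e : Lay Γ0 ◈ h1 t 0 - Lay Γ0 ◈ h2 t 0 = Lay Γ0 ◈ (fun t => h1 t - h2 t) t 0 := by
      unfold Lay; rw [← integral_sub (i h1 D1.hd) (i h2 D2.hd)]; congr 1; funext σ; ring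
    rw [e]
    refine h0 _ (fun t => h1 t - h2 t) dh ⟨D1.hd.m.sub D2.hd.m, hh, fun t ht => by show h1 t - h2 t = 0; rw [D1.hd.z t ht, D2.hd.z t ht, sub_zero], fun t ht => (D1.hd.c t ht).sub (D2.hd.c t ht)⟩ t 0 t0.le
  have A2 : |Lay Γ0 s1 q1 t 0 - Lay Γ0 s2 q2 t 0| ≤ 2 * (C1 * dq * N + C1 * dq) * √t := by
    have e : ∀ s q, Lay Γ0 s q t 0 = Lay Γ0 (fun t => -s t) q t 0 := fun s q => by rw [(Lay_neg s q t 0).1, neg_zero]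
    rw [e, e s2]
    refine Lay_far Γ0 Γ1 Ker_Γ.1 (fun t x h => (Γ_zero t x h).1) Γ0_hx hC1 ♭ (fun t x h => ⟨(hf t x h).1, (hf t x h).2.1⟩) hN hdq ♯ ♯ D1.qd D2.qd t0 ♮ (fun r hr => ?_) (fun r hr => ?_) (fun r hr => ?_) hq
    · linarith [D1.g r (sub hr)]
    · linarith [D2.g r (sub hr)]
    · simpa using ds' r hr
  have B1 : |Ini Γ1 ψ t (s1 t) - Ini Γ1 ψ t (s2 t)| ≤ 3 * K * dq * √t := by
    refine (Ini1_lip hψ _ _ t0).trans ?_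
    have e : t ^ ⊟ * t = √t := by
      nth_rewrite 2 [← rpow_one t]; rw [← rpow_add t0, sqrt_eq_rpow]; norm_num
    calc _ ≤ 3 * K * t ^ ⊟ * (dq * t) := mul_le_mul_of_nonneg_left (ds t tt) ♭
      _ = 3 * K * dq * (t ^ ⊟ * t) := by ring
      _ = _ := by rw [e]
  have B2 : |Lay Γ1 ◈ h1 t (s1 t) - Lay Γ1 ◈ h2 t (s2 t)| ≤ 2 * (C1 * dq * H + C1 * dh) * √t := by
    refine Lay_far Γ1 Γ2 Ker_Γ.2.1 (fun t x h => (Γ_zero t x h).2.1) Γ1_hx hC1 ♭ (fun t x h => ⟨(hf t x h).2.1, (hf t x h).2.2⟩) hH hdq ♯ ♯ D1.hd D2.hd t0 ♮ (fun r hr => ?_) (fun r hr => ?_) (fun r hr => ?_) hh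
    · linarith [D1.g t (sub tt)]
    · linarith [D2.g t (sub tt)]
    · simpa using dst
  have B3 := hn hN D1.l D2.l D1.qd D2.qd t0 hs hq
  have B4 : |Lay Γ1 (fun t => -s1 t) q1 t (s1 t) - Lay Γ1 (fun t => -s2 t) q2 t (s2 t)| ≤ 2 * (C1 * (2 * dq) * N + C1 * dq) * √t := by
    refine Lay_far Γ1 Γ2 Ker_Γ.2.1 (fun t x h => (Γ_zero t x h).2.1) Γ1_hx hC1 ♭ (fun t x h => ⟨(hf t x h).2.1, (hf t x h).2.2⟩) hN ♭ ♯ ♯ D1.qd D2.qd t0 ♮ (fun r hr => ?_) (fun r hr => ?_) (fun r hr => ?_) hq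
    · linarith [D1.g t (sub tt), D1.g r (sub hr)]
    · linarith [D2.g t (sub tt), D2.g r (sub hr)]
    · rw [show s1 t - -s1 r - (s2 t - -s2 r) = (s1 t - s2 t) + (s1 r - s2 r) by ring]
      refine (abs_add_le _ _).trans (by linarith [ds' r hr])
  have hst := sqrt_nonneg t
  rw [abs_le] at A1 A2 B1 B2 B3 B4
  have key : ∀ a1 a2 : ℝ, 0 ≤ a1 → 0 ≤ a2 → 0 ≤ a1 * (a2 * √t) := fun a1 a2 x y => ♭
  have k1 := key C0 dq hC0.le hdq
  have k2 := key (C1 * N) dh ♭ hdh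
  have k3 := key C1 dh hC1 hdh
  have k4 := key K dh hK hdh
  have k5 := key (C1 * H) dh ♭ hdh
  have k6 := key (C2 * N) dh ♭ hdh
  have k7 := key (C2 * L) dh ♭ hdh
  have k1' := key C0 dh hC0.le hdh
  have k2' := key (C1 * N) dq ♭ hdq
  have k3' := key C1 dq hC1 hdq
  have k4' := key K dq hK hdq
  have k5' := key (C1 * H) dq ♭ hdq
  have k6' := key (C2 * N) dq ♭ hdq
  have k7' := key (C2 * L) dq ♭ hdq
  constructor
  · unfold F1; rw [abs_le]; constructor <;> nlinarith only [A1.1, A1.2, A2.1, A2.2, k1, k2, k3, k4, k5, k6, k7, k1', k2', k3', k4', k5', k6', k7']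
  · unfold F2; rw [abs_le]; constructor <;> nlinarith only [B1.1, B1.2, B2.1, B2.2, B3.1, B3.2, B4.1, B4.2, k1, k2, k3, k4, k5, k6, k7, k1', k2', k3', k4', k5', k6', k7']

open Classical in
def ext0 (g : Ioi ⓪ → ℝ) (t : ℝ) : ℝ := if h : t ∈ Ioi ⓪ then g ⟨t, h⟩ else 0

lemma ext0_pos (g : Ioi ⓪ → ℝ) (t : Ioi ⓪) : ext0 g t = g t := by
  unfold ext0; rw [dif_pos t.2]

lemma ext0_Den {g : Ioi ⓪ → ℝ} {N : ℝ} (hg : Continuous g) (hb : ∀ t, |g t| ≤ N) (hN : 0 ≤ N) : Den (ext0 g) N := by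
  refine ⟨?_, ?_, ?_, ?_⟩
  · exact Measurable.dite (s := Ioi ⓪) (f := g) (g := fun _ => 0) hg.measurable measurable_const measurableSet_Ioi
  · intro t; unfold ext0; split_ifs with h
    · exact hb _
    · simpa using hN
  · intro t ht; exact dif_neg (not_lt.2 ht)
  · intro t ht
    have : ContinuousOn (ext0 g) (Ioi 0) := by
      rw [continuousOn_iff_continuous_domRestrict]
      convert hg using 1
      funext x; exact ext0_pos g x
    exact this.continuousAt (Ioi_mem_nhds ht)

def sOf (S ε : ℝ) (q : ℝ → ℝ) (t : ℝ) : ℝ := S + ∫ r in ⓪..t, (q r + ε)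

section
variable {q q1 q2 : ℝ → ℝ} {N S ε : ℝ}

lemma Den.ii (h : Den q N) (a b : ℝ) : IntervalIntegrable q volume a b := by
  rw [intervalIntegrable_iff]
  exact Measure.integrableOn_of_bounded (M := N) (by simp) h.m.aestronglyMeasurable (Eventually.of_forall fun t => h.b t)

lemma sOf_sub (h : Den q N) (a b : ℝ) : sOf S ε q a - sOf S ε q b = ∫ r in b..a, (q r + ε) := by
  unfold sOf
  have i : ∀ a b, IntervalIntegrable (fun r => q r + ε) volume a b := fun a b => (h.ii a b).add intervalIntegrable_const
  rw [add_sub_add_left_eq_sub, intervalIntegral.integral_interval_sub_left (i _ _) (i _ _)]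

lemma sOf_lip (h : Den q N) (h0 : 0 ≤ ε) (h1 : ε ≤ 1) (a b : ℝ) : |sOf S ε q a - sOf S ε q b| ≤ (N + 1) * |a - b| := by
  rw [sOf_sub h, ← Real.norm_eq_abs]
  refine intervalIntegral.norm_integral_le_of_norm_le_const fun r _ => ?_
  refine (norm_add_le _ _).trans (add_le_add (h.b r) ?_)
  rw [norm_of_nonneg h0]; exact h1

lemma sOf_diff (d1 : Den q1 N) (d2 : Den q2 N) {d : ℝ} (hd : ∀ t, |q1 t - q2 t| ≤ d) (a b : ℝ) :
    |(sOf S ε q1 a - sOf S ε q2 a) - (sOf S ε q1 b - sOf S ε q2 b)| ≤ d * |a - b| := by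
  have e : (sOf S ε q1 a - sOf S ε q2 a) - (sOf S ε q1 b - sOf S ε q2 b) = ∫ r in b..a, (q1 r - q2 r) := by
    have h1 := sOf_sub (S := S) (ε := ε) d1 a b
    have h2 := sOf_sub (S := S) (ε := ε) d2 a b
    have : ∫ r in b..a, (q1 r - q2 r) = (∫ r in b..a, (q1 r + ε)) - ∫ r in b..a, (q2 r + ε) := by
      rw [← intervalIntegral.integral_sub ((d1.ii _ _).add intervalIntegrable_const) ((d2.ii _ _).add intervalIntegrable_const)]
      congr 1; funext r; ring
    rw [this]; linarith
  rw [e, ← Real.norm_eq_abs]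
  exact intervalIntegral.norm_integral_le_of_norm_le_const fun r _ => hd r

lemma sOf_deriv (h : Den q N) {t : ℝ} (ht : 0 < t) : HasDerivAt (sOf S ε q) (q t + ε) t := by
  unfold sOf
  refine HasDerivAt.const_add S ?_
  refine intervalIntegral.integral_hasDerivAt_right ((h.ii _ _).add intervalIntegrable_const) ?_ ((h.c t ht).add continuousAt_const)
  exact (h.m.add_const ε).stronglyMeasurable.stronglyMeasurableAtFilter
end

lemma F_cont {b τ N H L S K M R : ℝ} {ψ h q s : ℝ → ℝ} (hb : 0 < b) (hψ : Ini0 ψ K M R) (D : Dat b τ N H L S h q s) {t : ℝ} (t0 : 0 < t) (t1 : t ≤ τ) :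
    ContinuousAt (fun t => (F1 ψ h q s t, F2 ψ h q s t)) t := by
  have hc := LipC D.l
  have hs := D.g t ⟨t0.le, t1⟩
  have p2 : ContinuousAt (fun t => (t, s t)) t := (continuous_id.prodMk hc).continuousAt
  have p1 : ContinuousAt (fun t : ℝ => (t, ⓪)) t := by fun_prop
  have z0 := fun t x h => (Γ_zero t x h).1
  have z1 := fun t x h => (Γ_zero t x h).2.1
  refine ContinuousAt.prodMk ?_ ?_
  · unfold F1
    refine ((ContinuousAt.comp (f := fun t : ℝ => (t, ⓪)) (Ini_cont hψ Ker_Γ.1 t0) p1).add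
      (((Lay0_cont D.hd continuous_const).comp (f := fun t : ℝ => (t, ⓪)) ♯).continuousAt.const_mul 2)).sub
      (((Lay0_cont D.qd hc).comp (f := fun t : ℝ => (t, ⓪)) ♯).continuousAt.const_mul 2)
  · unfold F2
    refine (((ContinuousAt.comp (f := fun t : ℝ => (t, s t)) (Ini_cont hψ Ker_Γ.2.1 t0) p2).const_mul (-2)).sub
      ((ContinuousAt.comp (f := fun t : ℝ => (t, s t)) (Lay_cont Ker_Γ.2.1 z1 D.hd continuous_const ?_) p2).const_mul 4)).add
      (ContinuousAt.const_mul (ContinuousAt.add ?_ (ContinuousAt.comp (f := fun t : ℝ => (t, s t)) (Lay_cont Ker_Γ.2.1 z1 D.qd hc.neg ?_) p2)) 2)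
    · intro h; linarith
    · exact ((T2_cont D.qd D.l).comp (continuous_id.prodMk hc)).continuousAt
    · intro h; have : s t = - s t := h
      linarith

lemma Lay_z (G : ℝ → ℝ → ℝ) (c : ℝ → ℝ) (t x : ℝ) : Lay G c ◈ t x = 0 := by simp [Lay]

lemma clamp_lip (a b x y : ℝ) : |max a (min b x) - max a (min b y)| ≤ |x - y| := by
  refine (abs_max_sub_max_le_max _ _ _ _).trans ?_
  rw [sub_self, abs_zero, max_eq_right ◉]
  refine (abs_min_sub_min_le_max _ _ _ _).trans ?_
  rw [sub_self, abs_zero, max_eq_right ◉]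

lemma FIX (p K M b : ℝ) (hp : 1 < p) (hK : 0 ≤ K) (hM : 0 ≤ M) (hb : 0 < b) : ∃ τ N, 0 < τ ∧ τ ≤ 1 ∧ 0 < N ∧ ∀ ψ R, Ini0 ψ K M R → ∀ S, b ≤ S →
    ∀ ε, 0 ≤ ε → ε ≤ 1 → ∃ h q s, Dat b τ N (N ^ p) (N + 1) S h q s ∧ (∀ t, 0 < t → HasDerivAt s (q t + ε) t) ∧
      ∀ t, 0 < t → t ≤ τ → h t = (max 0 (F1 ψ h q s t)) ^ p ∧ q t = F2 ψ h q s t ∧ |F1 ψ h q s t| ≤ N := by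
  set N := 2 * K + M + 1
  have hN : 0 < N := ♭
  obtain ⟨C, hC, hdiff⟩ := Φ_diff b N (N ^ p) (N + 1) K hb hN.le ♭ ♭ hK
  set P := p * N ^ (p - 1)
  have hP0 : 0 ≤ P := ♭
  obtain ⟨e, he, he1, he2⟩ : ∃ e : ℝ, 0 < e ∧ C * (P + 1) * e ≤ 1 / 2 ∧ C * (N ^ p + N) * e ≤ 1 := by
    refine ⟨1 / (2 * C * (P + 1) + C * (N ^ p + N) + 1), ♭, ?_, ?_⟩
    · rw [mul_one_div, div_le_iff₀ ♭]
      have : 0 ≤ C * (N ^ p + N) := ♭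
      linarith
    · rw [mul_one_div, div_le_iff₀ ♭]
      have : 0 ≤ C * (P + 1) := ♭
      linarith
  set τ := min (min 1 (e ^ 2)) (b / (2 * (N + 1)))
  have hτ0 : 0 < τ := ♭
  have hτ1 : τ ≤ 1 := ◧.trans ◧
  have hτe : ∀ t, t ≤ τ → √t ≤ e := fun t ht => (sqrt_le_left he.le).2 (ht.trans (◧.trans ◨))
  have hτb : (N + 1) * τ ≤ b / 2 := by
    have : τ ≤ b / (2 * (N + 1)) := min_le_right _ _
    rw [le_div_iff₀ ♭] at this; linarith
  refine ⟨τ, N, hτ0, hτ1, hN, fun ψ R hψ S hS ε he0 hε1 => ?_⟩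
  let X := BoundedContinuousFunction (Ioi ⓪) (ℝ²)
  let hh : X → ℝ → ℝ := fun x => ext0 fun t => (max 0 (min N (x t).1)) ^ p
  let qq : X → ℝ → ℝ := fun x => ext0 fun t => max (-N) (min N (x t).2)
  let ss : X → ℝ → ℝ := fun x => sOf S ε (qq x)
  have c0 : ∀ y : ℝ, 0 ≤ max 0 (min N y) ∧ max 0 (min N y) ≤ N := fun y => ⟨le_max_left _ _, max_le hN.le ◧⟩
  have Dh : ∀ x, Den (hh x) (N ^ p) := fun x => ext0_Den (by
    refine Continuous.rpow_const ?_ (fun _ => Or.inr ♮); fun_prop) (fun t => by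
      have := c0 (x t).1
      rw [abs_of_nonneg (rpow_nonneg this.1 p)]; exact rpow_le_rpow this.1 this.2 ♮) ♭
  have Dq : ∀ x, Den (qq x) N := fun x => ext0_Den ♯ (fun t => by
    rw [abs_le]; exact ⟨le_max_left _ _, max_le ♮ ◧⟩) hN.le
  have mk : ∀ (h q : ℝ → ℝ), Den h (N ^ p) → Den q N → Dat b τ N (N ^ p) (N + 1) S h q (sOf S ε q) := fun h q d1 d2 => by
    refine ⟨d1, d2, sOf_lip d2 he0 hε1, fun t ht => ?_, by simp [sOf]⟩
    have h1 := sOf_lip (S := S) d2 he0 hε1 t 0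
    rw [sub_zero, abs_of_nonneg ht.1, abs_le] at h1
    have h0 : sOf S ε q 0 = S := by simp [sOf]
    have : (N + 1) * t ≤ (N + 1) * τ := mul_le_mul_of_nonneg_left ht.2 ♭
    linarith [h1.1]
  have Dt : ∀ x, Dat b τ N (N ^ p) (N + 1) S (hh x) (qq x) (ss x) := fun x => mk _ _ (Dh x) (Dq x)
  have z1 : Den (fun _ : ℝ => ⓪) (N ^ p) := ⟨measurable_const, fun _ => by simp; positivity, fun _ _ => rfl, fun _ _ => continuousAt_const⟩
  have z2 : Den (fun _ : ℝ => ⓪) N := ⟨measurable_const, fun _ => by simp; positivity, fun _ _ => rfl, fun _ _ => continuousAt_const⟩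
  have bd : ∀ x t, 0 < t → t ≤ τ → |F1 ψ (hh x) (qq x) (ss x) t| ≤ N ∧ |F2 ψ (hh x) (qq x) (ss x) t| ≤ N := by
    intro x t t0 t1
    have := hdiff hψ hτ1 (Dt x) (mk _ _ z1 z2) (sOf_diff (Dq x) z2 (d := N) fun t => by simpa using (Dq x).b t) (fun t => by simpa using (Dh x).b t)
      (fun t => by simpa using (Dq x).b t) t t0 t1
    have e1 : C * (N ^ p + N) * √t ≤ 1 := (mul_le_mul_of_nonneg_left (hτe t t1) ♭).trans he2
    have f1 : |F1 ψ ◈ ◈ (sOf S ε fun _ => 0) t| ≤ M := by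
      simp only [F1, Lay_z]; simpa using (Ini0_bd hψ 0 t0).1
    have f2 : |F2 ψ ◈ ◈ (sOf S ε fun _ => 0) t| ≤ 2 * K := by
      simp only [F2, Lay_z]
      have := Ini1_bd hψ (sOf S ε ◈ t) t0
      rw [abs_le] at this ⊢
      constructor <;> linarith [this.1, this.2]
    have t1 := this.1.trans e1
    have t2 := this.2.trans e1
    simp only [abs_le] at *
    refine ⟨⟨?_, ?_⟩, ?_, ?_⟩ <;> linarith
  have hmin : ∀ t : Ioi ⓪, 0 < min (t:ℝ) τ := fun t => lt_min t.2 hτ0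
  let Φ : X → X := fun x => BoundedContinuousFunction.ofNormedAddCommGroup (fun t : Ioi ⓪ => (F1 ψ (hh x) (qq x) (ss x) (min t τ), F2 ψ (hh x) (qq x) (ss x) (min t τ)))
    (by
      rw [continuous_iff_continuousAt]; intro t
      exact ContinuousAt.comp (g := fun t => (F1 ψ (hh x) (qq x) (ss x) t, F2 ψ (hh x) (qq x) (ss x) t)) (f := fun t : Ioi ⓪ => min (t:ℝ) τ)
        (F_cont hb hψ (Dt x) (hmin t) ◨) ♯) N
    (fun t => by
      have := bd x _ (hmin t) ◨
      rw [Prod.norm_def]; exact max_le this.1 this.2)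
  have Φa : ∀ x (t : Ioi ⓪), Φ x t = (F1 ψ (hh x) (qq x) (ss x) (min t τ), F2 ψ (hh x) (qq x) (ss x) (min t τ)) := fun x t => rfl
  have hcon : ContractingWith (1/2) Φ := by
    refine ⟨by rw [div_lt_one ♩]; norm_num, LipschitzWith.of_dist_le_mul fun x y => ?_⟩
    have hd0 := dist_nonneg (x := x) (y := y)
    have l1 : ∀ t : Ioi ⓪, |(x t).1 - (y t).1| ≤ dist x y ∧ |(x t).2 - (y t).2| ≤ dist x y := fun t => by
      have := BoundedContinuousFunction.dist_coe_le_dist (f := x) (g := y) t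
      rw [Prod.dist_eq] at this
      exact ⟨(le_max_left _ _).trans this, (le_max_right _ _).trans this⟩
    have dh : ∀ t, |hh x t - hh y t| ≤ P * dist x y := fun t => by
      simp only [hh, ext0]; split_ifs with h
      · have := mvt_lip (G := fun x => x ^ p) (G' := fun x => p * x ^ (p - 1)) (A := P) (convex_Icc 0 N) (fun x => Real.hasDerivAt_rpow_const (Or.inr hp.le))
          (fun x hx => by
            rw [abs_of_nonneg (mul_nonneg ♮ (rpow_nonneg hx.1 _))]
            exact mul_le_mul_of_nonneg_left (rpow_le_rpow hx.1 hx.2 ♮) ♮) (c0 (x ⟨t, h⟩).1) (c0 (y ⟨t, h⟩).1)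
        exact this.trans (mul_le_mul_of_nonneg_left ((clamp_lip _ _ _ _).trans (l1 ⟨t, h⟩).1) hP0)
      · simp; positivity
    have dq : ∀ t, |qq x t - qq y t| ≤ dist x y := fun t => by
      simp only [qq, ext0]; split_ifs with h
      · exact (clamp_lip _ _ _ _).trans (l1 ⟨t, h⟩).2
      · rw [sub_self, abs_zero]; exact hd0
    rw [BoundedContinuousFunction.dist_le ♭]
    intro t
    have := hdiff hψ hτ1 (Dt x) (Dt y) (sOf_diff (Dq x) (Dq y) dq) dh dq _ (hmin t) ◨
    have e1 : C * (P * dist x y + dist x y) * √(min t τ) ≤ 1 / 2 * dist x y :=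
      calc C * (P * dist x y + dist x y) * √(min t τ) ≤ C * (P * dist x y + dist x y) * e := mul_le_mul_of_nonneg_left (hτe _ ◨) ♭
        _ = (C * (P + 1) * e) * dist x y := by ring
        _ ≤ _ := mul_le_mul_of_nonneg_right he1 hd0
    rw [Φa, Φa, Prod.dist_eq, NNReal.coe_div, NNReal.coe_one, NNReal.coe_ofNat]
    exact max_le (this.1.trans e1) (this.2.trans e1)
  have : Nonempty X := ⟨0⟩
  set x := ContractingWith.fixedPoint Φ hcon
  have hfix : Φ x = x := ContractingWith.fixedPoint_isFixedPt hcon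
  refine ⟨hh x, qq x, ss x, Dt x, fun t ht => sOf_deriv (Dq x) ht, fun t t0 t1 => ?_⟩
  have hv : x ⟨t, t0⟩ = (F1 ψ (hh x) (qq x) (ss x) t, F2 ψ (hh x) (qq x) (ss x) t) := by
    conv_lhs => rw [← hfix]
    rw [Φa]; simp only [min_eq_left t1]
  have B := bd x t t0 t1
  have e1 : hh x t = (max 0 (min N (x ⟨t, t0⟩).1)) ^ p := dif_pos t0
  have e2 : qq x t = max (-N) (min N (x ⟨t, t0⟩).2) := dif_pos t0
  have b1 := abs_le.1 B.1
  have b2 := abs_le.1 B.2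
  rw [hv] at e1 e2
  refine ⟨?_, ?_, B.1⟩
  · rw [e1]; simp only; rw [min_eq_right b1.2]
  · rw [e2]; simp only; rw [min_eq_right b2.2, max_eq_right b2.1]

structure Sl (ε p T : ℝ) (s : ℝ → ℝ) (u q r : ℝ → ℝ → ℝ) : Prop where
  T0 : 0 < T
  sc : ContinuousOn s (Icc 0 T)
  sp : ∀ t ∈ Icc 0 T, 0 < s t
  sd : ∀ t ∈ Ioc 0 T, HasDerivAt s (-q t (s t) + ε) t
  ut : ∀ t ∈ Ioc 0 T, ∀ x ∈ Ioo 0 (s t), HasDerivAt (fun τ => u τ x) (r t x) t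
  ux : ∀ t ∈ Ioc 0 T, ∀ x ∈ Ioo 0 (s t), HasDerivAt (u t) (q t x) x
  uxx : ∀ t ∈ Ioc 0 T, ∀ x ∈ Ioo 0 (s t), HasDerivAt (q t) (r t x) x
  rc : ContinuousOn (fun z : ℝ² => r z.1 z.2) {z | z.1 ∈ Ioc 0 T ∧ z.2 ∈ Ioo 0 (s z.1)}
  qc : ContinuousOn (fun z : ℝ² => q z.1 z.2) {z | z.1 ∈ Ioc 0 T ∧ z.2 ∈ Icc 0 (s z.1)}
  uc : ContinuousOn (fun z : ℝ² => u z.1 z.2) {z | z.1 ∈ Icc 0 T ∧ z.2 ∈ Icc 0 (s z.1)}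
  u0 : ∀ t ∈ Icc 0 T, ∀ x ∈ Icc 0 (s t), 0 ≤ u t x
  b0 : ∀ t ∈ Ioc 0 T, q t 0 = -(u t 0) ^ p
  bs : ∀ t ∈ Icc 0 T, u t (s t) = 0

lemma rdv {f f' : ℝ → ℝ} {a b : ℝ} (hab : a < b) (hc : ContinuousOn f (Icc a b)) (hd : ∀ x ∈ Ioo a b, HasDerivAt f (f' x) x)
    (hc' : ContinuousWithinAt f' (Icc a b) a) : HasDerivWithinAt f (f' a) (Ici a) a := by
  refine hasDerivWithinAt_Ici_of_tendsto_deriv (s := Ioo a b) (fun x hx => (hd x hx).differentiableAt.differentiableWithinAt)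
    ((hc a ⟨le_rfl, hab.le⟩).mono Ioo_subset_Icc_self) (Ioo_mem_nhdsGT hab) ?_
  have : Tendsto f' (𝓝[>] a) (𝓝 (f' a)) := hc'.mono_left (by
    rw [← nhdsWithin_Ioo_eq_nhdsGT hab]; exact nhdsWithin_mono _ Ioo_subset_Icc_self)
  refine this.congr' ?_
  filter_upwards [Ioo_mem_nhdsGT hab] with x hx using (hd x hx).deriv.symm

section
variable {b τ N H L S K M R : ℝ} {ψ h q s : ℝ → ℝ}

def uS (ψ h q s : ℝ → ℝ) (t x : ℝ) : ℝ := Iex ψ t x + 2 * Lay Γ0 ◈ h t x - Lay Γ0 s q t x - Lay Γ0 (fun t => -s t) q t x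
def uG (G : ℝ → ℝ → ℝ) (ψ h q s : ℝ → ℝ) (t x : ℝ) : ℝ := Ini G ψ t x + 2 * Lay G ◈ h t x - Lay G s q t x - Lay G (fun t => -s t) q t x

lemma uS_cont (hψ : Ini0 ψ K M R) (D : Dat b τ N H L S h q s) : ContinuousOn (fun z : ℝ² => uS ψ h q s z.1 z.2) {z | 0 ≤ z.1} := by
  have hc := LipC D.l
  exact (((Iex_cont hψ).add ((Lay0_cont D.hd continuous_const).continuousOn.const_smul (2:ℝ))).sub (Lay0_cont D.qd hc).continuousOn).sub
    (Lay0_cont D.qd hc.neg).continuousOn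

lemma uS_eq (t x : ℝ) (ht : 0 < t) : uS ψ h q s t x = uG Γ0 ψ h q s t x := by unfold uS uG Iex; rw [if_pos ht]

lemma uS_zero (D : Dat b τ N H L S h q s) (x : ℝ) : uS ψ h q s 0 x = ψ x := by
  have : ∀ c f N, Den f N → Lay Γ0 c f 0 x = 0 := fun c f N hf => by
    unfold Lay; rw [setIntegral_eq_zero_of_forall_eq_zero]
    intro σ hσ; rw [hf.z (0 - σ) (by simp at *; linarith)]; simp
  unfold uS Iex; rw [this _ _ _ D.hd, this _ _ _ D.qd, this _ _ _ D.qd]; simp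

variable {t x : ℝ}

lemma uS_diff (hψ : Ini0 ψ K M R) (D : Dat b τ N H L S h q s) (ht : 0 < t) (h1 : x ≠ 0) (h2 : x ≠ s t) (h3 : x ≠ -s t) :
    HasDerivAt (fun t => uS ψ h q s t x) (uG Γ2 ψ h q s t x) t ∧ HasDerivAt (uS ψ h q s t) (uG Γ1 ψ h q s t x) x ∧
    HasDerivAt (uG Γ1 ψ h q s t) (uG Γ2 ψ h q s t x) x ∧ ContinuousAt (fun z : ℝ² => uG Γ1 ψ h q s z.1 z.2) (t, x) ∧
    ContinuousAt (fun z : ℝ² => uG Γ2 ψ h q s z.1 z.2) (t, x) := by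
  have hc := LipC D.l
  have z0 := fun t x h => (Γ_zero t x h).1
  have z1 := fun t x h => (Γ_zero t x h).2.1
  have z2 := fun t x h => (Γ_zero t x h).2.2
  refine ⟨?_, ?_, ?_, ?_, ?_⟩
  · have := (((Ini_ht hψ x ht).add ((Lay_ht D.hd (c := fun _ => 0) continuous_const h1).const_mul 2)).sub (Lay_ht D.qd hc h2)).sub (Lay_ht D.qd hc.neg h3)
    refine this.congr_of_eventuallyEq ?_
    filter_upwards [Ioi_mem_nhds ht] with y hy using uS_eq y x hy
  · rw [show uS ψ h q s t = uG Γ0 ψ h q s t from funext fun x => uS_eq t x ht]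
    have l := fun c f N (hf : Den f N) hc h => Lay_hx (c := c) (x0 := x) (t0 := t) Ker_Γ.1 Ker_Γ.2.1 z0 z1 Γ0_hx hf hc h
    exact (((Ini_hx hψ x ht).add ((l _ _ _ D.hd continuous_const h1).const_mul 2)).sub (l _ _ _ D.qd hc h2)).sub (l _ _ _ D.qd hc.neg h3)
  · have l := fun c f N (hf : Den f N) hc h => Lay_hx (c := c) (x0 := x) (t0 := t) Ker_Γ.2.1 Ker_Γ.2.2 z1 z2 Γ1_hx hf hc h
    exact (((Ini_hxx hψ x ht).add ((l _ _ _ D.hd continuous_const h1).const_mul 2)).sub (l _ _ _ D.qd hc h2)).sub (l _ _ _ D.qd hc.neg h3)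
  · have l := fun c f N (hf : Den f N) hc h => Lay_cont (c := c) (x0 := x) (t0 := t) Ker_Γ.2.1 z1 hf hc h
    exact (((Ini_cont hψ Ker_Γ.2.1 ht).add ((l _ _ _ D.hd continuous_const h1).const_mul 2)).sub (l _ _ _ D.qd hc h2)).sub (l _ _ _ D.qd hc.neg h3)
  · have l := fun c f N (hf : Den f N) hc h => Lay_cont (c := c) (x0 := x) (t0 := t) Ker_Γ.2.2 z2 hf hc h
    exact (((Ini_cont hψ Ker_Γ.2.2 ht).add ((l _ _ _ D.hd continuous_const h1).const_mul 2)).sub (l _ _ _ D.qd hc h2)).sub (l _ _ _ D.qd hc.neg h3)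

def qS (ψ h q s : ℝ → ℝ) (t x : ℝ) : ℝ := Ini Γ1 ψ t x - 2 * Lm ◈ h t (-x) - Lm s q t x - Lay Γ1 (fun t => -s t) q t x
def qR (ψ h q s : ℝ → ℝ) (t x : ℝ) : ℝ := Ini Γ1 ψ t x + 2 * Lay Γ1 ◈ h t x + Lm (fun t => -s t) q t (-x) - Lay Γ1 (fun t => -s t) q t x

lemma Lay1_0 (h : ℝ → ℝ) (t x : ℝ) : Lay Γ1 ◈ h t (-x) = -Lay Γ1 ◈ h t x := by
  have := (Lay_neg ◈ h t x).2.1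
  simp only [neg_zero] at this; rw [this, neg_neg]

lemma qS_in (h0 : 0 < x) (h1 : x < s t) : qS ψ h q s t x = uG Γ1 ψ h q s t x := by
  unfold qS uG Lm; rw [if_pos ♮, if_pos h1, Lay1_0]; ring

lemma qR_in (h1 : s t < x) : qR ψ h q s t x = uG Γ1 ψ h q s t x := by
  unfold qR uG Lm; rw [if_pos ♮]
  have := (Lay_neg (fun t => -s t) q t x).2.1
  simp only [neg_neg] at this; rw [this]; ring

lemma qS_zero (hψ : Ini0 ψ K M R) (hs : 0 < s t) : qS ψ h q s t 0 = -h t := by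
  have e0 : Lay Γ1 ◈ h t 0 = 0 := by simp [Lay, Γ1]
  have := (Lay_neg s q t 0).2.1
  unfold qS Lm; rw [neg_zero, if_neg (lt_irrefl _), if_pos hs, e0, Ini1_zero hψ, this, neg_zero]; ring

lemma qS_s (hs : 0 < s t) (hq : q t = F2 ψ h q s t) : qS ψ h q s t (s t) = -q t := by
  have : q t = _ := hq
  unfold F2 at this
  unfold qS Lm; rw [if_pos ♮, if_neg (lt_irrefl _), Lay1_0]; linarith

lemma qR_s (hq : q t = F2 ψ h q s t) : qR ψ h q s t (s t) = 0 := by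
  have h1 : q t = _ := hq
  unfold F2 at h1
  have := (Lay_neg (fun t => -s t) q t (s t)).2.1
  simp only [neg_neg] at this
  unfold qR Lm; rw [if_neg (lt_irrefl _)]; linarith

lemma qS_cont (hb : 0 < b) (hψ : Ini0 ψ K M R) (D : Dat b τ N H L S h q s) :
    ContinuousOn (fun z : ℝ² => qS ψ h q s z.1 z.2) {z | z.1 ∈ Ioc 0 τ ∧ z.2 ∈ Icc 0 (s z.1)} := by
  have hc := LipC D.l
  refine ContinuousOn.sub (ContinuousOn.sub (ContinuousOn.sub ?_ (ContinuousOn.const_smul ?_ (2:ℝ))) ?_) ?_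
  · exact fun z hz => (Ini_cont hψ Ker_Γ.2.1 hz.1.1).continuousWithinAt
  · have := Lm_cont (c := fun _ => 0) (L := 0) D.hd (by simp)
    exact this.comp (f := fun z : ℝ² => (z.1, -z.2)) ♯ fun z hz => ⟨hz.1.1, by simpa using hz.2.1⟩
  · exact (Lm_cont D.qd D.l).mono fun z hz => ⟨hz.1.1, hz.2.2⟩
  · exact fun z hz => (Lay_cont Ker_Γ.2.1 (fun t x h => (Γ_zero t x h).2.1) D.qd hc.neg (by
      have := D.g z.1 ⟨hz.1.1.le, hz.1.2⟩
      have := hz.2.1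
      intro h
      have : z.2 = - s z.1 := h
      linarith)).continuousWithinAt

lemma qR_cont (hb : 0 < b) (hψ : Ini0 ψ K M R) (D : Dat b τ N H L S h q s) (ht : t ∈ Ioc 0 τ) (B : ℝ) :
    ContinuousOn (qR ψ h q s t) (Icc (s t) B) := by
  have hc := LipC D.l
  have hs := D.g t ⟨ht.1.le, ht.2⟩
  have p : Continuous (fun x : ℝ => (t, x)) := by fun_prop
  have z1 := fun t x h => (Γ_zero t x h).2.1
  refine ContinuousOn.sub (ContinuousOn.add (ContinuousOn.add ?_ (ContinuousOn.const_smul ?_ (2:ℝ))) ?_) ?_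
  · exact fun x hx => ((Ini_cont hψ Ker_Γ.2.1 ht.1).comp (f := fun x : ℝ => (t, x)) p.continuousAt).continuousWithinAt
  · exact fun x hx => ((Lay_cont Ker_Γ.2.1 z1 D.hd (c := fun _ => 0) continuous_const (by have := hx.1; intro h; linarith)).comp (f := fun x : ℝ => (t, x)) p.continuousAt).continuousWithinAt
  · have := Lm_cont (c := fun t => -s t) D.qd (L := L) (fun a b => by rw [show -s a - -s b = -(s a - s b) by ring, abs_neg]; exact D.l a b)
    exact this.comp (f := fun x : ℝ => (t, -x)) ♯ fun z hz => ⟨ht.1, by simpa using hz.1⟩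
  · exact fun x hx => ((Lay_cont Ker_Γ.2.1 z1 D.qd hc.neg (by have := hx.1; intro h; have : x = -s t := h; linarith)).comp (f := fun x : ℝ => (t, x)) p.continuousAt).continuousWithinAt

lemma uS_bd : ∃ C, 0 < C ∧ ∀ {b τ N H L S K M R : ℝ} {ψ h q s : ℝ → ℝ}, Ini0 ψ K M R → Dat b τ N H L S h q s → τ ≤ 1 → ∀ t ∈ Icc 0 τ, ∀ x, |uS ψ h q s t x| ≤ M + C * (H + N) := by
  obtain ⟨C, hC, hb⟩ := Lay0_bd
  refine ⟨2 * C, ♭, ?_⟩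
  intro b τ N H L S K M R ψ h q s hψ D hτ t ht x
  have hH : 0 ≤ H := ◉.trans (D.hd.b 0)
  have hN : 0 ≤ N := ◉.trans (D.qd.b 0)
  have hst : √t ≤ 1 := sqrt_le_one.2 (ht.2.trans hτ)
  have lb : ∀ c f N, Den f N → |Lay Γ0 c f t x| ≤ C * N := fun c f N hf => by
    have hN : 0 ≤ N := ◉.trans (hf.b 0)
    exact (hb c f N hf t x ht.1).trans (mul_le_of_le_one_right ♭ hst)
  have i0 : |Iex ψ t x| ≤ M := by
    unfold Iex; split_ifs with h0
    · exact (Ini0_bd hψ x h0).1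
    · rw [abs_of_nonneg (hψ.pos x)]; exact hψ.le x
  have l1 := lb ◈ _ _ D.hd
  have l2 := lb s _ _ D.qd
  have l3 := lb (fun t => -s t) _ _ D.qd
  simp only [abs_le] at *
  unfold uS
  constructor <;> nlinarith [l1.1, l1.2, l2.1, l2.2, l3.1, l3.2, i0.1, i0.2]

lemma uS_out (hb : 0 < b) (hψ : Ini0 ψ K M S) (D : Dat b τ N H L S h q s) (hτ0 : 0 < τ) (hτ : τ ≤ 1)
    (hq : ∀ t, 0 < t → t ≤ τ → q t = F2 ψ h q s t) (c : ℝ) (hc1 : |c| = 1) : ∀ t ∈ Icc 0 τ, ∀ x, s t ≤ x → c * uS ψ h q s t x ≤ 0 := by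
  intro t1 ht1 x1 hx1
  have hc := LipC D.l
  obtain ⟨C, hC, hbd⟩ := uS_bd
  have hbd := hbd hψ D hτ
  set B := M + C * (H + N)
  have hH : 0 ≤ H := ◉.trans (D.hd.b 0)
  have hN : 0 ≤ N := ◉.trans (D.qd.b 0)
  have hM : 0 ≤ M := (hψ.pos 0).trans (hψ.le 0)
  have hL : 0 ≤ L := by have := ◉.trans (D.l 1 0); simpa using this
  set X := |S| + L
  have hsX : ∀ t ∈ Icc 0 τ, s t ≤ X := fun t ht => by
    have h1 := D.l t 0
    rw [D.i, sub_zero, abs_of_nonneg ht.1, abs_le] at h1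
    have h2 : L * t ≤ L := mul_le_of_le_one_right hL (ht.2.trans hτ)
    have := le_abs_self S
    linarith [h1.2]
  have key : ∀ η, 0 < η → c * uS ψ h q s t1 x1 ≤ η * (exp t1 * cosh (x1 - X)) := by
    intro η hη
    set R' := max x1 (X + 2 * B / η)
    have hBR : B ≤ η * cosh (R' - X) := by
      have h1 : 2 * B / η ≤ R' - X := by linarith [le_max_right x1 (X + 2 * B / η)]
      have h2 : R' - X ≤ 2 * cosh (R' - X) := by
        rw [cosh_eq]
        have := add_one_le_exp (R' - X)
        have := exp_pos (-(R' - X)); linarith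
      have h3 := h1.trans h2
      rw [div_le_iff₀ hη] at h3; linarith
    have := MPL (t0 := 0) (t1 := τ) (C := 0) (l := s) (r := fun _ => R') (w := fun t x => c * uS ψ h q s t x - η * (exp t * cosh (x - X)))
      hc.continuousOn continuousOn_const ?_ ?_ ?_ ?_ ?_ t1 ht1 x1 ⟨hx1, le_max_left _ _⟩
    · linarith
    · refine ContinuousOn.sub (continuousOn_const.mul ((uS_cont hψ D).mono fun z hz => hz.1.1)) ?_
      have : Continuous (fun q : ℝ² => η * (rexp q.1 * cosh (q.2 - X))) := by fun_prop
      exact this.continuousOn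
    · intro x hx
      rw [uS_zero D, hψ.supp x (by rw [D.i] at hx; exact hx.1.trans (le_abs_self x))]
      have := cosh_pos (x - X); simp only [mul_zero, zero_sub, Left.neg_nonpos_iff]; positivity
    · intro t ht x hx _
      have hs := D.g t ⟨ht.1.le, ht.2⟩
      have hd : ∀ y, s t < y → _ := fun y (hy : s t < y) => uS_diff (x := y) hψ D ht.1 ♮ ♮ ♮
      have := hd x hx.1
      have ch : ∀ y, HasDerivAt (fun y => cosh (y - X)) (sinh (y - X)) y := fun y => by
        simpa using ((hasDerivAt_id y).sub_const X).cosh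
      have sh : ∀ y, HasDerivAt (fun y => sinh (y - X)) (cosh (y - X)) y := fun y => by
        simpa using ((hasDerivAt_id y).sub_const X).sinh
      refine ⟨_, _, fun y => c * uG Γ1 ψ h q s t y - η * (exp t * sinh (y - X)), (this.1.const_mul c).sub (((hasDerivAt_exp t).mul_const (cosh (x - X))).const_mul η), ?_,
        (this.2.2.1.const_mul c).sub (((sh x).const_mul (exp t)).const_mul η), ♮⟩
      filter_upwards [Ioi_mem_nhds hx.1] with y hy
      exact ((hd y hy).2.1.const_mul c).sub (((ch y).const_mul (exp t)).const_mul η)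
    · intro t ht hlr _
      have hs := D.g t ⟨ht.1.le, ht.2⟩
      have hd : ∀ y ∈ Ioo (s t) R', HasDerivAt (uS ψ h q s t) (qR ψ h q s t y) y := fun y hy => by
        rw [qR_in hy.1]; exact (uS_diff (x := y) hψ D ht.1 (by linarith [hy.1]) (by linarith [hy.1]) (by linarith [hy.1])).2.1
      have h1 := rdv hlr ((uS_cont hψ D).comp (f := fun x : ℝ => (t, x)) ♯ fun x _ => ht.1.le) hd (qR_cont hb hψ D ht R' _ ⟨le_rfl, hlr.le⟩)
      rw [qR_s (hq t ht.1 ht.2)] at h1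
      have ch : HasDerivAt (fun y => cosh (y - X)) (sinh (s t - X)) (s t) := by
        simpa using ((hasDerivAt_id (s t)).sub_const X).cosh
      refine ⟨_, (h1.const_mul c).sub ((ch.const_mul (exp t)).const_mul η).hasDerivWithinAt, ?_⟩
      have : sinh (s t - X) ≤ 0 := sinh_nonpos_iff.2 (by linarith [hsX t ⟨ht.1.le, ht.2⟩])
      have := mul_nonneg (mul_pos hη (exp_pos t)).le (neg_nonneg.2 this)
      linarith
    · intro t ht _
      have h1 := hbd t ⟨ht.1.le, ht.2⟩ R'
      have h2 : c * uS ψ h q s t R' ≤ B := (le_abs_self _).trans (by rw [abs_mul, hc1, one_mul]; exact h1)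
      have h3 : 1 ≤ exp t := one_le_exp ht.1.le
      have h4 : 0 ≤ η * cosh (R' - X) := by have := cosh_pos (R' - X); positivity
      have : η * cosh (R' - X) ≤ η * (exp t * cosh (R' - X)) := by nlinarith
      linarith
  have hcp : 0 < exp t1 * cosh (x1 - X) := by have := cosh_pos (x1 - X); positivity
  by_contra hneg
  push Not at hneg
  have := key (c * uS ψ h q s t1 x1 / (2 * (exp t1 * cosh (x1 - X)))) ♭
  rw [div_mul_eq_mul_div, mul_div_mul_right _ _ hcp.ne'] at this
  linarith
end

lemma EX (p K M b : ℝ) (hp : 1 < p) (hK : 0 ≤ K) (hM : 0 ≤ M) (hb : 0 < b) : ∃ τ N, 0 < τ ∧ ∀ S, b ≤ S → ∀ ψ : ℝ → ℝ,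
    (∀ x ∈ Icc 0 S, ∀ y ∈ Icc 0 S, |ψ x - ψ y| ≤ K * |x - y|) → (∀ x ∈ Icc 0 S, 0 ≤ ψ x ∧ ψ x ≤ M) → ψ S = 0 →
    ∀ ε, 0 ≤ ε → ε ≤ 1 → ∃ s u q r, Sl ε p τ s u q r ∧ s 0 = S ∧ (∀ x ∈ Icc 0 S, u 0 x = ψ x) ∧
      ∀ t ∈ Icc 0 τ, ∀ x ∈ Icc 0 (s t), u t x ≤ N := by
  obtain ⟨τ, N, hτ0, hτ1, hN, H⟩ := FIX p K M b hp hK hM hb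
  obtain ⟨C, hC, hbd⟩ := uS_bd
  refine ⟨τ, M + C * (N ^ p + N), hτ0, fun S hS ψ0 hl hpos hz ε he0 he1 => ?_⟩
  have hS0 : 0 ≤ S := ♮
  set ψ : ℝ → ℝ := fun x => ψ0 (min |x| S) with hψd
  have hm : ∀ x : ℝ, min |x| S ∈ Icc 0 S := fun x => ⟨le_min ◉ hS0, min_le_right _ _⟩
  have hψ : Ini0 ψ K M S := by
    refine ⟨fun x y => (hl _ (hm x) _ (hm y)).trans (mul_le_mul_of_nonneg_left ?_ hK), fun x => (hpos _ (hm x)).1, fun x => (hpos _ (hm x)).2, fun x hx => ?_, fun x => ?_⟩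
    · refine (abs_min_sub_min_le_max _ _ _ _).trans ?_
      rw [sub_self, abs_zero, max_eq_left ◉]; exact abs_abs_sub_abs_le _ _
    · simp only [hψd]; rw [min_eq_right hx, hz]
    · simp only [hψd, abs_neg]
  obtain ⟨h, q, s, D, sd, hF⟩ := H ψ S hψ S hS ε he0 he1
  have hc := LipC D.l
  have sp : ∀ t ∈ Icc 0 τ, 0 < s t := fun t ht => by linarith [D.g t ht]
  have hq : ∀ t, 0 < t → t ≤ τ → q t = F2 ψ h q s t := fun t a b => (hF t a b).2.1
  have out0 : ∀ t ∈ Icc 0 τ, uS ψ h q s t (s t) = 0 := fun t ht => by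
    have h1 := uS_out hb hψ D hτ0 hτ1 hq 1 (by simp) t ht (s t) le_rfl
    have h2 := uS_out hb hψ D hτ0 hτ1 hq (-1) (by simp) t ht (s t) le_rfl
    linarith
  have uF : ∀ t, 0 < t → uS ψ h q s t 0 = F1 ψ h q s t := fun t ht => by
    have := (Lay_neg s q t 0).1
    rw [uS_eq t 0 ht]; unfold uG F1; rw [this, neg_zero]; ring
  have dif : ∀ t ∈ Ioc 0 τ, ∀ x ∈ Ioo 0 (s t), _ := fun t (ht : t ∈ Ioc 0 τ) x (hx : x ∈ Ioo 0 (s t)) =>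
    uS_diff (t := t) (x := x) hψ D ht.1 hx.1.ne' hx.2.ne (by linarith [hx.1, hx.2])
  have dx : ∀ t ∈ Ioc 0 τ, ∀ x ∈ Ioo 0 (s t), HasDerivAt (uS ψ h q s t) (qS ψ h q s t x) x := fun t ht x hx => by
    rw [qS_in hx.1 hx.2]; exact (dif t ht x hx).2.1
  have dxx : ∀ t ∈ Ioc 0 τ, ∀ x ∈ Ioo 0 (s t), HasDerivAt (qS ψ h q s t) (uG Γ2 ψ h q s t x) x := fun t ht x hx => by
    refine (dif t ht x hx).2.2.1.congr_of_eventuallyEq ?_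
    filter_upwards [Ioo_mem_nhds hx.1 hx.2] with y hy using qS_in hy.1 hy.2
  have qc := qS_cont hb hψ D
  have uc : ContinuousOn (fun z : ℝ² => uS ψ h q s z.1 z.2) {z | z.1 ∈ Icc 0 τ ∧ z.2 ∈ Icc 0 (s z.1)} := (uS_cont hψ D).mono fun z hz => hz.1.1
  have upos : ∀ t ∈ Icc 0 τ, ∀ x ∈ Icc 0 (s t), 0 ≤ uS ψ h q s t x := by
    have := MPL (t0 := 0) (t1 := τ) (C := 0) (l := fun _ => 0) (r := s) (w := fun t x => -uS ψ h q s t x)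
      continuousOn_const hc.continuousOn uc.neg ?_ ?_ ?_ ?_
    · intro t ht x hx; linarith [this t ht x hx]
    · intro x hx; rw [uS_zero D]; linarith [hψ.pos x]
    · intro t ht x hx _
      have := dif t ht x hx
      refine ⟨_, _, fun y => -qS ψ h q s t y, this.1.neg, ?_, (dxx t ht x hx).neg, ♮⟩
      filter_upwards [Ioo_mem_nhds hx.1 hx.2] with y hy using (dx t ht y hy).neg
    · intro t ht hlt hw
      have h1 := rdv hlt ((uS_cont hψ D).comp (f := fun x : ℝ => (t, x)) ♯ fun x _ => ht.1.le) (dx t ht)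
        ((qc (t, 0) ⟨ht, le_rfl, hlt.le⟩).comp (f := fun x : ℝ => (t, x)) ♯ fun x hx => ⟨ht, hx⟩)
      refine ⟨_, h1.neg, ?_⟩
      have e : h t = 0 := by
        rw [(hF t ht.1 ht.2).1, ← uF t ht.1, max_eq_left ♮, zero_rpow ♮]
      rw [qS_zero hψ hlt, e]; simp
    · intro t ht _; rw [out0 t ⟨ht.1.le, ht.2⟩]; simp
  refine ⟨s, uS ψ h q s, qS ψ h q s, uG Γ2 ψ h q s, ⟨hτ0, hc.continuousOn, sp, ?_, fun t ht x hx => (dif t ht x hx).1, dx, dxx, ?_, qc, uc, upos, ?_, out0⟩, D.i, ?_, ?_⟩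
  · intro t ht
    rw [qS_s (sp t ⟨ht.1.le, ht.2⟩) (hq t ht.1 ht.2), neg_neg]; exact sd t ht.1
  · exact fun z hz => (dif z.1 hz.1 z.2 hz.2).2.2.2.2.continuousWithinAt
  · intro t ht
    have hs := sp t ⟨ht.1.le, ht.2⟩
    rw [qS_zero hψ hs, (hF t ht.1 ht.2).1, ← uF t ht.1, max_eq_right (upos t ⟨ht.1.le, ht.2⟩ 0 ⟨le_rfl, hs.le⟩)]
  · intro x hx
    rw [uS_zero D]; simp only [hψd]; rw [abs_of_nonneg hx.1, min_eq_left hx.2]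
  · intro t ht x hx
    exact (le_abs_self _).trans (hbd hψ D hτ1 t ht x)

section
variable {ε p T T' a : ℝ} {s : ℝ → ℝ} {u q r : ℝ → ℝ → ℝ}

lemma Sl.mono (h : Sl ε p T s u q r) (h0 : 0 < T') (hT : T' ≤ T) : Sl ε p T' s u q r where
  T0 := h0
  sc := h.sc.mono (Icc_subset_Icc le_rfl hT)
  sp t ht := h.sp t ⟨ht.1, ht.2.trans hT⟩
  sd t ht := h.sd t ⟨ht.1, ht.2.trans hT⟩
  ut t ht := h.ut t ⟨ht.1, ht.2.trans hT⟩
  ux t ht := h.ux t ⟨ht.1, ht.2.trans hT⟩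
  uxx t ht := h.uxx t ⟨ht.1, ht.2.trans hT⟩
  rc := h.rc.mono fun _ hz => ⟨⟨hz.1.1, hz.1.2.trans hT⟩, hz.2⟩
  qc := h.qc.mono fun _ hz => ⟨⟨hz.1.1, hz.1.2.trans hT⟩, hz.2⟩
  uc := h.uc.mono fun _ hz => ⟨⟨hz.1.1, hz.1.2.trans hT⟩, hz.2⟩
  u0 t ht := h.u0 t ⟨ht.1, ht.2.trans hT⟩
  b0 t ht := h.b0 t ⟨ht.1, ht.2.trans hT⟩
  bs t ht := h.bs t ⟨ht.1, ht.2.trans hT⟩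

lemma Sl.shift (h : Sl ε p T s u q r) (h0 : 0 ≤ a) (hT : a < T) :
    Sl ε p (T - a) (fun t => s (t + a)) (fun t => u (t + a)) (fun t => q (t + a)) (fun t => r (t + a)) := by
  have i1 : ∀ t ∈ Ioc 0 (T - a), t + a ∈ Ioc 0 T := fun t ht => ⟨by linarith [ht.1], by linarith [ht.2]⟩
  have i2 : ∀ t ∈ Icc 0 (T - a), t + a ∈ Icc 0 T := fun t ht => ⟨by linarith [ht.1], by linarith [ht.2]⟩
  have c : Continuous (fun z : ℝ² => (z.1 + a, z.2)) := by fun_prop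
  exact {
    T0 := ♮
    sc := h.sc.comp ♯ i2
    sp := fun t ht => h.sp _ (i2 t ht)
    sd := fun t ht => (h.sd _ (i1 t ht)).comp_add_const t a
    ut := fun t ht x hx => (h.ut _ (i1 t ht) x hx).comp_add_const t a
    ux := fun t ht => h.ux _ (i1 t ht)
    uxx := fun t ht => h.uxx _ (i1 t ht)
    rc := h.rc.comp c.continuousOn fun z hz => ⟨i1 _ hz.1, hz.2⟩
    qc := h.qc.comp c.continuousOn fun z hz => ⟨i1 _ hz.1, hz.2⟩
    uc := h.uc.comp c.continuousOn fun z hz => ⟨i2 _ hz.1, hz.2⟩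
    u0 := fun t ht => h.u0 _ (i2 t ht)
    b0 := fun t ht => h.b0 _ (i1 t ht)
    bs := fun t ht => h.bs _ (i2 t ht) }

variable {t x : ℝ}

lemma Sl.cu (h : Sl ε p T s u q r) (ht : t ∈ Icc 0 T) : ContinuousOn (u t) (Icc 0 (s t)) :=
  h.uc.comp (f := fun x : ℝ => (t, x)) ♯ fun _ hx => ⟨ht, hx⟩

lemma Sl.cq (h : Sl ε p T s u q r) (ht : t ∈ Ioc 0 T) : ContinuousOn (q t) (Icc 0 (s t)) :=
  h.qc.comp (f := fun x : ℝ => (t, x)) ♯ fun _ hx => ⟨ht, hx⟩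

lemma Ioc_Icc {t T : ℝ} (h : t ∈ Ioc 0 T) : t ∈ Icc 0 T := ⟨h.1.le, h.2⟩

lemma Sl.c0 (h : Sl ε p T s u q r) : ContinuousOn (fun t => u t 0) (Icc 0 T) :=
  h.uc.comp (f := fun t : ℝ => (t, ⓪)) ♯ fun t ht => ⟨ht, le_rfl, (h.sp t ht).le⟩

lemma Sl.d0 (h : Sl ε p T s u q r) (ht : t ∈ Ioc 0 T) : HasDerivWithinAt (u t) (-(u t 0) ^ p) (Ici 0) 0 := by
  have hs := h.sp t (Ioc_Icc ht)
  rw [← h.b0 t ht]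
  exact rdv hs (h.cu (Ioc_Icc ht)) (h.ux t ht) (h.cq ht 0 ⟨le_rfl, hs.le⟩)

lemma Sl.ds (h : Sl ε p T s u q r) (ht : t ∈ Ioc 0 T) : HasDerivWithinAt (u t) (q t (s t)) (Iic (s t)) (s t) := by
  have hs := h.sp t (Ioc_Icc ht)
  have e := rdv (f := fun x => u t (-x)) (f' := fun x => -q t (-x)) (a := -s t) (b := 0) ♮
    ((h.cu (Ioc_Icc ht)).comp ♯ fun x hx => ⟨by linarith [hx.2], by linarith [hx.1]⟩)
    (fun x hx => by
      have := (h.ux t ht (-x) ⟨by linarith [hx.2], by linarith [hx.1]⟩).scomp x (hasDerivAt_neg x)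
      refine this.congr_deriv ?_; simp)
    ((((h.cq ht).comp (f := fun x => -x) (s := Icc (-s t) 0) ♯
      fun x hx => ⟨by linarith [hx.2], by linarith [hx.1]⟩) (-s t) ⟨le_rfl, ♮⟩).neg)
  have e2 := (e.congr_of_eventuallyEq_of_mem (f₁ := fun x => u t (-x)) (by rfl) (by simp)).scomp_of_eq (h := fun x : ℝ => -x) (s := Iic (s t)) (h' := -1) (s t)
    ((hasDerivAt_neg (s t)).hasDerivWithinAt) (fun x hx => by simpa using hx) rfl
  simp only [neg_neg, smul_eq_mul] at e2
  have e3 : ((fun x => u t (-x)) ∘ fun x => -x) = u t := by ext; simp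
  rw [e3] at e2
  refine e2.congr_deriv ?_; ring

lemma ldtw {f : ℝ → ℝ} {t a : ℝ} (h : HasDerivWithinAt f a (Iic t) t) (hm : ∀ᶠ τ in 𝓝[<] t, f t ≤ f τ) : a ≤ 0 := by
  have := hasDerivWithinAt_iff_tendsto_slope.1 h
  have e : Iic t \ {t} = Iio t := by ext y; simp [lt_iff_le_and_ne]
  rw [e] at this
  refine le_of_tendsto this ?_
  filter_upwards [hm, self_mem_nhdsWithin] with y hy hlt
  rw [slope_def_field]
  exact div_nonpos_of_nonneg_of_nonpos ♮ (by simp at hlt; linarith)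

lemma Sl.qs (h : Sl ε p T s u q r) (ht : t ∈ Ioc 0 T) : q t (s t) ≤ 0 := by
  refine ldtw (h.ds ht) ?_
  have hs := h.sp t (Ioc_Icc ht)
  filter_upwards [Ioo_mem_nhdsLT hs] with x hx
  rw [h.bs t (Ioc_Icc ht)]
  exact h.u0 t (Ioc_Icc ht) x ⟨hx.1.le, hx.2.le⟩

lemma Sl.sm (h : Sl ε p T s u q r) (hε : 0 ≤ ε) : MonotoneOn s (Icc 0 T) := by
  refine monotoneOn_of_deriv_nonneg (convex_Icc _ _) h.sc ?_ ?_
  · intro t ht; rw [interior_Icc] at ht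
    exact (h.sd t ⟨ht.1, ht.2.le⟩).differentiableAt.differentiableWithinAt
  · intro t ht; rw [interior_Icc] at ht
    rw [(h.sd t ⟨ht.1, ht.2.le⟩).deriv]
    linarith [h.qs ⟨ht.1, ht.2.le⟩]

lemma Sl.Reg_sub {t0 t1 : ℝ} {r' : ℝ → ℝ} {l : ℝ → ℝ} (h0 : 0 ≤ t0) (h1 : t1 ≤ T) (hl : ∀ t ∈ Icc t0 t1, 0 ≤ l t) (hr : ∀ t ∈ Icc t0 t1, r' t ≤ s t) :
    Reg t0 t1 l r' ⊆ {z | z.1 ∈ Icc 0 T ∧ z.2 ∈ Icc 0 (s z.1)} :=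
  fun z hz => ⟨⟨h0.trans hz.1.1, hz.1.2.trans h1⟩, (hl _ hz.1).trans hz.2.1, hz.2.2.trans (hr _ hz.1)⟩

lemma Sl.uev (h : Sl ε p T s u q r) (ht : t ∈ Ioc 0 T) (hx : x ∈ Ioo 0 (s t)) : ∀ᶠ y in 𝓝 x, HasDerivAt (u t) (q t y) y := by
  filter_upwards [Ioo_mem_nhds hx.1 hx.2] with y hy using h.ux t ht y hy

/-- upper barrier -/
lemma Sl.upper (h : Sl ε p T s u q r) {C : ℝ} {v vt vx vxx : ℝ → ℝ → ℝ}
    (hc : ContinuousOn (fun z : ℝ² => v z.1 z.2) {z | z.1 ∈ Icc 0 T ∧ z.2 ∈ Icc 0 (s z.1)})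
    (hi : ∀ x ∈ Icc 0 (s 0), u 0 x ≤ v 0 x)
    (hvt : ∀ t ∈ Ioc 0 T, ∀ x ∈ Ioo 0 (s t), HasDerivAt (fun τ => v τ x) (vt t x) t)
    (hvx : ∀ t ∈ Ioc 0 T, ∀ x, HasDerivAt (v t) (vx t x) x)
    (hvxx : ∀ t ∈ Ioc 0 T, ∀ x ∈ Ioo 0 (s t), HasDerivAt (vx t) (vxx t x) x)
    (hv : ∀ t ∈ Ioc 0 T, ∀ x ∈ Ioo 0 (s t), v t x < u t x → vxx t x ≤ vt t x + C * (u t x - v t x))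
    (hl : ∀ t ∈ Ioc 0 T, v t 0 < u t 0 → -C * (u t 0 - v t 0) ≤ -(u t 0) ^ p - vx t 0)
    (hr : ∀ t ∈ Ioc 0 T, 0 ≤ v t (s t)) : ∀ t ∈ Icc 0 T, ∀ x ∈ Icc 0 (s t), u t x ≤ v t x := by
  have := MPL (t0 := 0) (t1 := T) (C := C) (l := fun _ => 0) (r := s) (w := fun t x => u t x - v t x) continuousOn_const h.sc
    (h.uc.sub hc) (fun x hx => by linarith [hi x hx])
    (fun t ht x hx hw => ⟨r t x - vt t x, r t x - vxx t x, fun y => q t y - vx t y, (h.ut t ht x hx).sub (hvt t ht x hx),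
      by filter_upwards [h.uev ht hx] with y hy using hy.sub (hvx t ht y), (h.uxx t ht x hx).sub (hvxx t ht x hx), by
        have := hv t ht x hx ♮; linarith⟩)
    (fun t ht _ hw => ⟨_, (h.d0 ht).sub (hvx t ht 0).hasDerivWithinAt, hl t ht ♮⟩)
    (fun t ht _ => by rw [h.bs t (Ioc_Icc ht)]; linarith [hr t ht])
  intro t ht x hx
  linarith [this t ht x hx]

lemma Sl.sup (h : Sl ε p T s u q r) {M : ℝ} (hM : 0 ≤ M) (hi : ∀ x ∈ Icc 0 (s 0), u 0 x ≤ M) (hl : ∀ t ∈ Icc 0 T, u t 0 ≤ M) :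
    ∀ t ∈ Icc 0 T, ∀ x ∈ Icc 0 (s t), u t x ≤ M :=
  h.upper (C := 0) (v := fun _ _ => M) (vt := fun _ _ => 0) (vx := fun _ _ => 0) (vxx := fun _ _ => 0) continuousOn_const hi
    (fun _ _ _ _ => hasDerivAt_const _ _) (fun _ _ _ => hasDerivAt_const _ _) (fun _ _ _ _ => hasDerivAt_const _ _)
    (fun _ _ _ _ _ => by simp) (fun t ht hh => absurd (hl t (Ioc_Icc ht)) ♮) (fun _ _ => hM)

lemma rpow_lip {p a b N : ℝ} (hp : 1 < p) (ha : 0 ≤ a) (hab : a ≤ b) (hb : b ≤ N) : b ^ p - a ^ p ≤ p * N ^ (p - 1) * (b - a) := by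
  have := Convex.image_sub_le_mul_sub_of_deriv_le (convex_Icc 0 N) (f := fun x => x ^ p) (C := p * N ^ (p - 1))
    ((continuous_rpow_const ♮).continuousOn) (fun x hx => by
      rw [interior_Icc] at hx
      exact (hasDerivAt_rpow_const (Or.inl hx.1.ne')).differentiableAt.differentiableWithinAt) (fun x hx => by
      rw [interior_Icc] at hx
      rw [(hasDerivAt_rpow_const (Or.inl hx.1.ne')).deriv]
      exact mul_le_mul_of_nonneg_left (rpow_le_rpow hx.1.le hx.2.le ♮) ♮) a ⟨ha, hab.trans hb⟩ b ⟨ha.trans hab, hb⟩ hab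
  simpa using this

end

section
variable {p T : ℝ} {s : ℝ → ℝ} {u q r : ℝ → ℝ → ℝ}

lemma BL0 (hp : 1 < p) (h : Sl 0 p T s u q r) {e M t1 : ℝ} {a : ℝ → ℝ} (he : 0 < e) (he8 : e ≤ 1 / 8) (ht1 : 0 ≤ t1) (ht1T : t1 ≤ T)
    (ha : ∀ t ∈ Icc 0 t1, 0 < a t ∧ a 0 ≤ a t ∧ a t ≤ M) (had : ∀ t ∈ Icc 0 t1, HasDerivAt a (2 * e * (a t * (a t ^ (p - 1)) ^ 2)) t)
    (hs : (1 + 2 * e) / (a 0) ^ (p - 1) ≤ s 0)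
    (hu : ∀ x ∈ Icc 0 ((1 + 2 * e) / (a 0) ^ (p - 1)), a 0 * (1 - a 0 ^ (p - 1) * x + e * (a 0 ^ (p - 1) * x) ^ 2) ≤ u 0 x) : ∀ t ∈ Icc 0 t1, a t ≤ u t 0 := by
  set b : ℝ → ℝ := fun t => a t ^ (p - 1) with hb
  have bp : ∀ t ∈ Icc 0 t1, 0 < b t := fun t ht => rpow_pos_of_pos (ha t ht).1 _
  have bm : ∀ t ∈ Icc 0 t1, b 0 ≤ b t := fun t ht => rpow_le_rpow (ha 0 ⟨le_rfl, ht1⟩).1.le (ha t ht).2.1 ♮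
  have bd : ∀ t ∈ Icc 0 t1, HasDerivAt b (2 * e * (p - 1) * (b t) ^ 3) t := fun t ht => by
    refine ((had t ht).rpow_const (Or.inl (ha t ht).1.ne')).congr_deriv ?_
    have : a t ^ (p - 1 - 1) * a t = b t := by rw [← rpow_add_one (ha t ht).1.ne']; simp [hb]
    calc _ = 2 * e * (p - 1) * (a t ^ (p - 1 - 1) * a t) * b t ^ 2 := by simp only [hb]; ring
      _ = _ := by rw [this]; ring
  have ap : ∀ t ∈ Icc 0 t1, a t ^ p = a t * b t := fun t ht => by
    rw [hb, mul_comm, ← rpow_add_one (ha t ht).1.ne']; simp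
  have ac : ContinuousOn a (Icc 0 t1) := fun t ht => (had t ht).continuousAt.continuousWithinAt
  have bc : ContinuousOn b (Icc 0 t1) := fun t ht => (bd t ht).continuousAt.continuousWithinAt
  have rs : ∀ t ∈ Icc 0 t1, (1 + 2 * e) / b t ≤ s t := fun t ht =>
    (div_le_div_of_nonneg_left ♮ (bp 0 ⟨le_rfl, ht1⟩) (bm t ht)).trans (hs.trans (h.sm le_rfl ⟨le_rfl, h.T0.le⟩ ⟨ht.1, ht.2.trans ht1T⟩ ht.1))
  have := MPL (t0 := 0) (t1 := t1) (C := p * M ^ (p - 1)) (l := fun _ => 0) (r := fun t => (1 + 2 * e) / b t)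
    (w := fun t x => a t * (1 - b t * x + e * (b t * x) ^ 2) - u t x) continuousOn_const (continuousOn_const.div bc fun t ht => (bp t ht).ne')
    (by
      have m1 : MapsTo (fun z : ℝ² => z.1) (Reg 0 t1 ◈ (fun t => (1 + 2 * e) / b t)) (Icc 0 t1) := fun z hz => hz.1
      have a1 := ac.comp continuousOn_fst m1
      have b1 := bc.comp continuousOn_fst m1
      refine ContinuousOn.sub (a1.mul ((continuousOn_const.sub (b1.mul continuousOn_snd)).add (((b1.mul continuousOn_snd).pow 2).const_smul e)))
        (h.uc.mono (Sl.Reg_sub le_rfl ht1T (fun _ _ => le_rfl) rs)))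
    (fun x hx => by linarith [hu x hx])
    (fun t ht x hx hw => by
      have htI := Ioc_Icc ht
      have htT : t ∈ Ioc 0 T := ⟨ht.1, ht.2.trans ht1T⟩
      have hxs : x ∈ Ioo 0 (s t) := ⟨hx.1, hx.2.trans_le (rs t htI)⟩
      refine ⟨_, 2 * e * a t * b t ^ 2 - r t x, fun y => a t * (-b t + 2 * e * b t ^ 2 * y) - q t y,
        ((had t htI).mul ((((bd t htI).mul_const x).const_sub 1).add ((((bd t htI).mul_const x).pow 2).const_mul e))).sub (h.ut t htT x hxs), ?_, ?_, ?_⟩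
      · filter_upwards [h.uev htT hxs] with y hy
        refine HasDerivAt.sub (HasDerivAt.const_mul _ ?_) hy
        have := (((hasDerivAt_id y).const_mul (b t)).const_sub 1).add ((((hasDerivAt_id y).const_mul (b t)).pow 2).const_mul e)
        refine this.congr_deriv ?_; simp; ring
      · refine HasDerivAt.sub ?_ (h.uxx t htT x hxs)
        have := (((hasDerivAt_id x).const_mul (2 * e * b t ^ 2)).const_add (-b t)).const_mul (a t)
        refine this.congr_deriv ?_; ring
      · have hCw : 0 ≤ p * M ^ (p - 1) * (a t * (1 - b t * x + e * (b t * x) ^ 2) - u t x) :=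
          mul_nonneg (mul_nonneg ♮ (rpow_nonneg ((ha t htI).1.le.trans (ha t htI).2.2) _)) hw.le
        have hy : b t * x ≤ 5 / 4 := by
          have := (lt_div_iff₀ (bp t htI)).1 hx.2
          nlinarith
        have hy0 : 0 < b t * x := mul_pos (bp t htI) hx.1
        set y := b t * x with hyd
        have hat := (ha t htI).1
        have k1 : 2 * e * (a t * b t ^ 2) * (-p * y + e * (2 * p - 1) * y ^ 2) ≤ 0 := by
          have : y * (-p + e * (2 * p - 1) * y) ≤ 0 := by
            have : e * (2 * p - 1) * y ≤ 1 / 8 * (2 * p - 1) * (5 / 4) := by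
              apply mul_le_mul _ hy hy0.le (by nlinarith); apply mul_le_mul_of_nonneg_right he8 ♮
            nlinarith
          have h2 : 0 ≤ 2 * e * (a t * b t ^ 2) := ♭
          nlinarith
        have e2 : b t * x = y := rfl
        have : 2 * e * (p - 1) * b t ^ 3 * x = 2 * e * (p - 1) * b t ^ 2 * y := by rw [← e2]; ring
        have hbt : a t ^ (p - 1) = b t := rfl
        simp only [Nat.cast_ofNat, Nat.add_one_sub_one, pow_one, Pi.add_apply, Pi.pow_apply]
        rw [this, hbt, e2]
        nlinarith)
    (fun t ht _ hw => by
      have htI := Ioc_Icc ht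
      have htT : t ∈ Ioc 0 T := ⟨ht.1, ht.2.trans ht1T⟩
      refine ⟨a t * (-b t) + u t 0 ^ p, ?_, ?_⟩
      · have := (((hasDerivAt_id ⓪).const_mul (b t)).const_sub 1).add ((((hasDerivAt_id ⓪).const_mul (b t)).pow 2).const_mul e)
        refine ((this.const_mul (a t)).hasDerivWithinAt.sub (h.d0 htT)).congr_deriv ?_
        simp
      · simp only [mul_zero, sub_zero, ne_eq, OfNat.ofNat_ne_zero, not_false_eq_true, zero_pow, add_zero, mul_one] at hw ⊢
        have := rpow_lip hp (h.u0 t (Ioc_Icc htT) 0 ⟨le_rfl, (h.sp t (Ioc_Icc htT)).le⟩) (by linarith : u t 0 ≤ a t) (ha t htI).2.2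
        rw [ap t htI] at this; linarith)
    (fun t ht _ => by
      have htI := Ioc_Icc ht
      have htT : t ∈ Ioc 0 T := ⟨ht.1, ht.2.trans ht1T⟩
      have hb0 := bp t htI
      have e1 : b t * ((1 + 2 * e) / b t) = 1 + 2 * e := by field_simp
      have := h.u0 t (Ioc_Icc htT) _ ⟨♭, rs t htI⟩
      have h3 : 1 - (1 + 2 * e) + e * (1 + 2 * e) ^ 2 ≤ 0 := by
        have : (1 + 2 * e) ^ 2 ≤ 2 := by nlinarith
        nlinarith [mul_le_mul_of_nonneg_left this he.le]
      simp only [e1]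
      nlinarith [mul_nonneg (ha t htI).1.le (neg_nonneg.2 h3)])
  intro t ht
  have := this t ht 0 ⟨le_rfl, div_nonneg ♮ (bp t ht).le⟩
  simp at this; linarith

lemma BL (hp : 1 < p) (h : Sl 0 p T s u q r) {e A : ℝ} (he : 0 < e) (he8 : e ≤ 1 / 8) (hA : 0 < A)
    (hs : (1 + 2 * e) / A ^ (p - 1) ≤ s 0)
    (hu : ∀ x ∈ Icc 0 ((1 + 2 * e) / A ^ (p - 1)), A * (1 - A ^ (p - 1) * x + e * (A ^ (p - 1) * x) ^ 2) ≤ u 0 x) :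
    T < A ^ (-(2 * p - 2)) / ((2 * p - 2) * (2 * e)) := by
  by_contra hT
  push Not at hT
  set k := (2 * p - 2) * (2 * e) with hk
  set m := 1 / (2 * p - 2) with hm
  set c := A ^ (-(2 * p - 2)) with hc
  have p2 : 0 < 2 * p - 2 := ♮
  have k0 : 0 < k := ♭
  have m0 : 0 < m := ♭
  have hm1 : m * (2 * p - 2) = 1 := one_div_mul_cancel p2.ne'
  have c0 : 0 < c := rpow_pos_of_pos hA _
  obtain ⟨N, hN⟩ := isCompact_Icc.bddAbove_image h.c0
  have hN' : ∀ t ∈ Icc 0 T, u t 0 ≤ N := fun t ht => hN (mem_image_of_mem _ ht)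
  have N0 : 0 ≤ N := (h.u0 0 ⟨le_rfl, h.T0.le⟩ 0 ⟨le_rfl, (h.sp 0 ⟨le_rfl, h.T0.le⟩).le⟩).trans (hN' 0 ⟨le_rfl, h.T0.le⟩)
  set d := min c ((N + 1) ^ (-(2 * p - 2))) with hd
  have d0 : 0 < d := lt_min c0 (rpow_pos_of_pos ♮ _)
  set t1 := (c - d) / k with ht1
  have hd1 : c - k * t1 = d := by rw [ht1]; field_simp; ring
  have t10 : 0 ≤ t1 := div_nonneg (by linarith [min_le_left c ((N + 1) ^ (-(2 * p - 2)))]) k0.le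
  have t1T : t1 ≤ T := le_trans (div_le_div_of_nonneg_right ♮ k0.le) hT
  have pos : ∀ t ∈ Icc 0 t1, 0 < c - k * t := fun t ht => by nlinarith [ht.2]
  have hpm : -(2 * p - 2) * -m = 1 := by linear_combination hm1
  have a0 : (c - k * 0) ^ (-m) = A := by
    rw [mul_zero, sub_zero]; rw [hc, ← rpow_mul hA.le, hpm, rpow_one]
  have := BL0 hp h (e := e) (M := d ^ (-m)) (t1 := t1) (a := fun t => (c - k * t) ^ (-m)) he he8 t10 t1T
    (fun t ht => ⟨rpow_pos_of_pos (pos t ht) _, rpow_le_rpow_of_nonpos (pos t ht) (by nlinarith [ht.1]) ♮,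
      rpow_le_rpow_of_nonpos d0 (by nlinarith [ht.2]) ♮⟩)
    (fun t ht => by
      have h1 : HasDerivAt (fun t => c - k * t) (-k) t := by
        simpa using ((hasDerivAt_id t).const_mul k).const_sub c
      refine (h1.rpow_const (Or.inl (pos t ht).ne')).congr_deriv ?_
      have hy := pos t ht
      set y := c - k * t
      rw [← rpow_mul hy.le, ← rpow_natCast, ← rpow_mul hy.le, ← rpow_add hy]
      have : -m + -m * (p - 1) * ((2:ℕ):ℝ) = -m - 1 := by push_cast; linear_combination -hm1
      rw [this, hk]
      linear_combination (2 * e * y ^ (-m - 1)) * hm1)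
    (by rw [a0]; exact hs) (by rw [a0]; exact hu) t1 ⟨t10, le_rfl⟩
  simp only [hd1] at this
  have h2 : N + 1 ≤ d ^ (-m) := by
    have : (N + 1) ^ (-(2 * p - 2) * -m) = N + 1 := by rw [hpm, rpow_one]
    rw [← this, rpow_mul ♮]
    exact rpow_le_rpow_of_nonpos d0 ◨ ♮
  linarith [hN' t1 ⟨t10, t1T⟩]

lemma pos_pow_deriv (y : ℝ) (n : ℕ) : HasDerivAt (fun y : ℝ => max y 0 ^ (n + 2)) ((n + 2) * max y 0 ^ (n + 1)) y := by
  rcases lt_trichotomy y 0 with h | h | h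
  · have : (fun y : ℝ => max y 0 ^ (n + 2)) =ᶠ[𝓝 y] fun _ => 0 := by
      filter_upwards [Iio_mem_nhds h] with z hz; simp [max_eq_right (le_of_lt (mem_Iio.1 hz))]
    refine ((hasDerivAt_const y ⓪).congr_of_eventuallyEq this).congr_deriv ?_
    simp [max_eq_right h.le]
  · subst h
    rw [hasDerivAt_iff_isLittleO_nhds_zero]
    simp only [zero_add, max_self, ne_eq, Nat.add_eq_zero_iff, one_ne_zero, and_false, not_false_eq_true, zero_pow, sub_zero, mul_zero, smul_zero, OfNat.ofNat_ne_zero]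
    have : (fun x : ℝ => x ^ (n + 2)) =o[𝓝 0] fun x : ℝ => x := by
      simpa using Asymptotics.isLittleO_pow_pow (𝕜 := ℝ) (m := 1) (n := n + 2) (by omega)
    refine Asymptotics.IsBigO.trans_isLittleO (Asymptotics.IsBigO.of_bound 1 (Eventually.of_forall fun x => ?_)) this
    rw [norm_pow, norm_pow, one_mul]
    refine pow_le_pow_left₀ (norm_nonneg _) ?_ _
    rw [Real.norm_eq_abs, Real.norm_eq_abs, abs_of_nonneg (le_max_right _ _)]
    exact max_le (le_abs_self _) ◉
  · have : (fun y : ℝ => max y 0 ^ (n + 2)) =ᶠ[𝓝 y] fun y => y ^ (n + 2) := by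
      filter_upwards [Ioi_mem_nhds h] with z hz; rw [max_eq_left (le_of_lt (mem_Ioi.1 hz))]
    refine ((hasDerivAt_pow (n + 2) y).congr_of_eventuallyEq this).congr_deriv ?_
    rw [max_eq_left h.le]; push_cast; simp

lemma BUMP {t1 R C η z0 ρ x1 : ℝ} {z zt zx zxx : ℝ → ℝ → ℝ} {z0' : ℝ → ℝ} (ht1 : 0 < t1) (hC : 0 ≤ C) (hη : 0 < η) (hρ : 0 < ρ)
    (hzR : z0 + ρ ≤ R) (hx1 : x1 ∈ Icc 0 z0)
    (zc : ContinuousOn (fun q : ℝ² => z q.1 q.2) (Reg 0 t1 ◈ (fun _ => R)))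
    (hzt : ∀ t ∈ Ioc 0 t1, ∀ x ∈ Ioo 0 R, HasDerivAt (fun τ => z τ x) (zt t x) t)
    (hzx : ∀ t ∈ Ioc 0 t1, ∀ x ∈ Ioo 0 R, HasDerivAt (z t) (zx t x) x)
    (hzxx : ∀ t ∈ Ioc 0 t1, ∀ x ∈ Ioo 0 R, HasDerivAt (zx t) (zxx t x) x)
    (hz : ∀ t ∈ Ioc 0 t1, ∀ x ∈ Ioo 0 R, zxx t x ≤ zt t x)
    (hl : ∀ t ∈ Ioc 0 t1, HasDerivWithinAt (z t) (z0' t) (Ici 0) 0 ∧ z0' t ≤ -C * z t 0)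
    (hr : ∀ t ∈ Ioc 0 t1, 0 ≤ z t R)
    (hi : ∀ x ∈ Icc 0 R, 0 ≤ z 0 x) (hi2 : ∀ x ∈ Icc 0 R, x ∈ Icc (z0 - ρ) (z0 + ρ) → η ≤ z 0 x) :
    η * exp (-((6 * ρ * z0 / t1 + 30) ^ 2 / (96 * ρ ^ 2)) * t1) ≤ z t1 x1 := by
  set κ := (6 * ρ * z0 / t1 + 30) ^ 2 / (96 * ρ ^ 2) with hκ
  have z00 : 0 ≤ z0 := hx1.1.trans hx1.2
  set v := (x1 - z0) / t1 with hv
  set c : ℝ → ℝ := fun t => z0 + v * t with hc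
  have v0 : v ≤ 0 := div_nonpos_of_nonpos_of_nonneg (by linarith [hx1.2]) ht1.le
  have vt : v * t1 = x1 - z0 := by rw [hv]; field_simp
  have hv2 : -v ≤ z0 / t1 := by rw [hv, ← neg_div]; exact div_le_div_of_nonneg_right (by linarith [hx1.1]) ht1.le
  have cr : ∀ t ∈ Icc 0 t1, 0 ≤ c t ∧ c t ≤ z0 := fun t ht => ⟨by simp only [hc]; nlinarith [ht.1, ht.2, hx1.1], by simp only [hc]; nlinarith [ht.1]⟩
  set m : ℝ → ℝ → ℝ := fun t x => max (ρ ^ 2 - (x - c t) ^ 2) 0 with hm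
  set a : ℝ → ℝ := fun t => η / ρ ^ 6 * exp (-κ * t) with ha
  have a0 : ∀ t, 0 < a t := fun t => ♭
  have m0 : ∀ t x, 0 ≤ m t x := fun t x => le_max_right _ _
  have ad : ∀ t, HasDerivAt a (-κ * a t) t := fun t => by
    have := (((hasDerivAt_id t).const_mul (-κ)).exp).const_mul (η / ρ ^ 6)
    refine this.congr_deriv ?_; simp [ha]; ring
  have qx : ∀ t x, HasDerivAt (fun x => ρ ^ 2 - (x - c t) ^ 2) (-2 * (x - c t)) x := fun t x => by
    have := (((hasDerivAt_id x).sub_const (c t)).pow 2).const_sub (ρ ^ 2)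
    refine this.congr_deriv ?_; simp
  have qt : ∀ t x, HasDerivAt (fun t => ρ ^ 2 - (x - c t) ^ 2) (2 * (x - c t) * v) t := fun t x => by
    have := (((((hasDerivAt_id t).const_mul v).const_add z0).const_sub x).pow 2).const_sub (ρ ^ 2)
    refine this.congr_deriv ?_; simp [hc]
  have mx : ∀ (n : ℕ) t x, HasDerivAt (fun x => m t x ^ (n + 2)) ((n + 2) * m t x ^ (n + 1) * (-2 * (x - c t))) x := fun n t x =>
    (pos_pow_deriv _ n).comp x (qx t x)
  have mt : ∀ t x, HasDerivAt (fun t => m t x ^ (1 + 2)) ((1 + 2) * m t x ^ (1 + 1) * (2 * (x - c t) * v)) t := fun t x => by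
    have := (pos_pow_deriv (ρ ^ 2 - (x - c t) ^ 2) 1).comp t (qt t x)
    refine this.congr_deriv ?_; simp [hm]
  have gx : ∀ t x, HasDerivAt (fun x => a t * m t x ^ 3) (a t * (3 * m t x ^ 2 * (-2 * (x - c t)))) x := fun t x => by
    refine ((mx 1 t x).const_mul (a t)).congr_deriv ?_; norm_num
  have gxx : ∀ t x, HasDerivAt (fun x => a t * (3 * m t x ^ 2 * (-2 * (x - c t))))
      (a t * (3 * (2 * m t x * (-2 * (x - c t))) * (-2 * (x - c t)) + 3 * m t x ^ 2 * (-2))) x := fun t x => by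
    refine ((((mx 0 t x).const_mul 3).mul (((hasDerivAt_id x).sub_const (c t)).const_mul (-2))).const_mul (a t)).congr_deriv ?_
    simp
  have hend : ∀ t ∈ Icc 0 t1, ∀ x ∈ Icc 0 R, a t * m t x ^ 3 - z t x ≤ 0 := by
    refine MPL (t0 := 0) (t1 := t1) (C := C) (l := fun _ => 0) (r := fun _ => R) (w := fun t x => a t * m t x ^ 3 - z t x)
      continuousOn_const continuousOn_const (ContinuousOn.sub (Continuous.continuousOn (by simp only [ha, hm, hc]; fun_prop)) zc) ?_ ?_ ?_ ?_
    · intro x hx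
      have e0 : a 0 = η / ρ ^ 6 := by simp [ha]
      have c0 : c 0 = z0 := by simp [hc]
      by_cases hxx : x ∈ Icc (z0 - ρ) (z0 + ρ)
      · have := hi2 x hx hxx
        have h1 : m 0 x ≤ ρ ^ 2 := max_le (by nlinarith [sq_nonneg (x - c 0)]) ♭
        have h2 : m 0 x ^ 3 ≤ ρ ^ 6 := by
          calc m 0 x ^ 3 ≤ (ρ ^ 2) ^ 3 := pow_le_pow_left₀ (m0 0 x) h1 3
            _ = ρ ^ 6 := by ring
        have h3 : a 0 * m 0 x ^ 3 ≤ η := by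
          rw [e0]; calc _ ≤ η / ρ ^ 6 * ρ ^ 6 := mul_le_mul_of_nonneg_left h2 ♭
            _ = η := by field_simp
        linarith
      · have : m 0 x = 0 := max_eq_right (by
          rw [c0]
          simp only [mem_Icc, not_and_or, not_le] at hxx
          rcases hxx with h | h <;> nlinarith)
        rw [this]; simp; exact hi x hx
    · intro t ht x hx hw
      refine ⟨_, _, fun y => a t * (3 * m t y ^ 2 * (-2 * (y - c t))) - zx t y, ((ad t).mul (mt t x)).sub (hzt t ht x hx), ?_,
        (gxx t x).sub (hzxx t ht x hx), ?_⟩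
      · filter_upwards [Ioo_mem_nhds hx.1 hx.2] with y hy using (gx t y).sub (hzx t ht y hy)
      · have h1 := hz t ht x hx
        have h2 := mul_nonneg hC hw.le
        suffices hh : -κ * m t x ^ 3 + 3 * m t x ^ 2 * (2 * (x - c t) * v) ≤ 3 * (2 * m t x * (-2 * (x - c t))) * (-2 * (x - c t)) + 3 * m t x ^ 2 * (-2) by
          have := mul_le_mul_of_nonneg_left hh (a0 t).le
          simp at this ⊢
          linarith
        rcases le_or_gt (ρ ^ 2 - (x - c t) ^ 2) 0 with h | h
        · have : m t x = 0 := max_eq_right h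
          rw [this]; simp
        · have e1 : m t x = ρ ^ 2 - (x - c t) ^ 2 := max_eq_left h.le
          have hm0 : 0 < m t x := by rw [e1]; exact h
          set M := m t x
          set ξ := x - c t
          have hξ : |ξ| ≤ ρ := abs_le_of_sq_le_sq ♮ hρ.le
          have hξv : ξ * v ≤ ρ * (z0 / t1) := by
            calc ξ * v ≤ |ξ * v| := le_abs_self _
              _ = |ξ| * -v := by rw [abs_mul, abs_of_nonpos v0]
              _ ≤ ρ * (z0 / t1) := mul_le_mul hξ hv2 ♮ hρ.le
          set B := 6 * ρ * z0 / t1 + 30 with hB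
          have hB2 : 6 * (ξ * v) + 30 ≤ B := by rw [hB]; calc _ ≤ 6 * (ρ * (z0 / t1)) + 30 := ♮
                                                          _ = _ := by ring
          have hκ2 : κ * (96 * ρ ^ 2) = B ^ 2 := by rw [hκ]; field_simp
          have h4 : 0 ≤ 24 * ρ ^ 2 - M * B + κ * M ^ 2 := by
            have : 0 ≤ (24 * ρ ^ 2 - M * B + κ * M ^ 2) * (96 * ρ ^ 2) := by
              have : (24 * ρ ^ 2 - M * B + κ * M ^ 2) * (96 * ρ ^ 2) = (48 * ρ ^ 2 - M * B) ^ 2 := by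
                linear_combination M ^ 2 * hκ2
              rw [this]; positivity
            exact nonneg_of_mul_nonneg_left this ♭
          have h5 : 0 ≤ M * (24 * ρ ^ 2 - M * (6 * (ξ * v) + 30) + κ * M ^ 2) := by
            refine mul_nonneg hm0.le ?_
            have := mul_le_mul_of_nonneg_left hB2 hm0.le
            linarith
          have h6 : ξ ^ 2 = ρ ^ 2 - M := by rw [e1]; ring
          nlinarith
    · intro t ht _ hw
      obtain ⟨h1, h2⟩ := hl t ht
      refine ⟨_, (gx t 0).hasDerivWithinAt.sub h1, ?_⟩
      have h3 : 0 ≤ a t * (3 * m t 0 ^ 2 * (-2 * (0 - c t))) := by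
        have := (cr t (Ioc_Icc ht)).1
        have := a0 t
        have := m0 t 0
        have : -2 * (0 - c t) = 2 * c t := by ring
        rw [this]; positivity
      have h4 : 0 ≤ C * (a t * m t 0 ^ 3) := mul_nonneg hC (mul_nonneg (a0 t).le (pow_nonneg (m0 _ _) _))
      linarith
    · intro t ht _
      have hh := cr t (Ioc_Icc ht)
      have : m t R = 0 := max_eq_right (by nlinarith)
      rw [this]; simp; exact hr t ht
  have := hend t1 ⟨ht1.le, le_rfl⟩ x1 ⟨hx1.1, by linarith [hx1.2]⟩
  have c1 : c t1 = x1 := by simp only [hc]; linarith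
  have m1 : m t1 x1 = ρ ^ 2 := by simp only [hm, c1]; simp; positivity
  rw [m1] at this
  have e1 : a t1 * (ρ ^ 2) ^ 3 = η * exp (-κ * t1) := by simp only [ha]; field_simp
  linarith
end

section
variable {p T : ℝ} {s : ℝ → ℝ} {u q r : ℝ → ℝ → ℝ}

lemma rpow_tan {p a u : ℝ} (hp : 1 < p) (ha : 0 < a) (hu : 0 ≤ u) : a ^ p + p * a ^ (p - 1) * (u - a) ≤ u ^ p := by
  have h1 := one_add_mul_self_le_rpow_one_add (s := u / a - 1) (by linarith [div_nonneg hu ha.le]) hp.le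
  have h2 : (1 + (u / a - 1)) ^ p = u ^ p / a ^ p := by rw [← div_rpow hu ha.le]; congr 1; ring
  have h3 : a ^ p = a * a ^ (p - 1) := by rw [mul_comm, ← rpow_add_one ha.ne']; simp
  rw [h2, le_div_iff₀ (rpow_pos_of_pos ha _)] at h1
  calc _ = (1 + p * (u / a - 1)) * a ^ p := by rw [h3]; field_simp
    _ ≤ _ := h1

lemma KEY1 {a b η P μ H R z0 ρ η1 ε : ℝ} (hp : 1 < p) (ha : 0 < a) (hη : 0 < η) (hb : b = a ^ (p - 1)) (b0 : 0 < b) (apb : a ^ p = a * b)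
    (hz0 : z0 = 1 / b + η / 2) (hρ : ρ = η / 4) (hη1 : η1 = a * b * η / 4) (hP : P = p * b) (P0 : 0 < P) (hμ : μ = P + 1)
    (ε0 : 0 < ε) (hR : R = 1 / b + η) (hH : H = (1 + P) * ε) (hT : 1 < T) (h : Sl 0 p T s u q r) (hs : R ≤ s 0)
    (hu : ∀ x ∈ Icc 0 (s 0), a - ε - (a ^ p + ε) * x ≤ u 0 x) {x1 : ℝ} (hx1 : x1 ∈ Icc 0 z0) :
    η1 * exp (-((6 * ρ * z0 / 1 + 30) ^ 2 / (96 * ρ ^ 2)) * 1) ≤ u 1 x1 - (a - ε - (a * b + ε) * x1) + H * exp (μ ^ 2 * 1 - μ * x1) := by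
  have η10 : 0 < η1 := by rw [hη1]; positivity
  have R0 : 0 < R := by rw [hR]; positivity
  have Rs : ∀ t ∈ Icc 0 T, R ≤ s t := fun t ht => hs.trans (h.sm le_rfl ⟨le_rfl, ♮⟩ ht ht.1)
  have tT : ∀ t ∈ Ioc ⓪ 1, t ∈ Ioc 0 T := fun t ht => ⟨ht.1, by linarith [ht.2]⟩
  have tx : ∀ t ∈ Ioc ⓪ 1, ∀ x ∈ Ioo 0 R, x ∈ Ioo 0 (s t) := fun t ht x hx => ⟨hx.1, hx.2.trans_le (Rs t (Ioc_Icc (tT t ht)))⟩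
  have H0 : 0 < H := by rw [hH]; positivity
  have bb : b * (1 / b) = 1 := by field_simp
  have hdx : ∀ t x, HasDerivAt (fun x => exp (μ ^ 2 * t - μ * x)) (-μ * exp (μ ^ 2 * t - μ * x)) x := fun t x => by
    refine ((((hasDerivAt_id x).const_mul μ).const_sub (μ ^ 2 * t)).exp).congr_deriv ?_; simp; ring
  have hdt : ∀ t x, HasDerivAt (fun t => exp (μ ^ 2 * t - μ * x)) (μ ^ 2 * exp (μ ^ 2 * t - μ * x)) t := fun t x => by
    refine ((((hasDerivAt_id t).const_mul (μ ^ 2)).sub_const (μ * x)).exp).congr_deriv ?_; simp; ring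
  have lin : ∀ x, HasDerivAt (fun x => a - ε - (a * b + ε) * x) (-(a * b + ε)) x := fun x => by
    refine (((hasDerivAt_id x).const_mul (a * b + ε)).const_sub (a - ε)).congr_deriv ?_; simp
  refine BUMP (t1 := 1) (R := R) (C := P) (η := η1) (z0 := z0) (ρ := ρ) (x1 := x1)
    (z := fun t x => u t x - (a - ε - (a * b + ε) * x) + H * exp (μ ^ 2 * t - μ * x))
    (zt := fun t x => r t x + H * (μ ^ 2 * exp (μ ^ 2 * t - μ * x)))
    (zx := fun t x => q t x - (-(a * b + ε)) + H * (-μ * exp (μ ^ 2 * t - μ * x)))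
    (zxx := fun t x => r t x + H * (-μ * (-μ * exp (μ ^ 2 * t - μ * x))))
    (z0' := fun t => -(u t 0) ^ p - (-(a * b + ε)) + H * (-μ * exp (μ ^ 2 * t - μ * 0)))
    one_pos P0.le η10 (by rw [hρ]; positivity) (by rw [hz0, hρ, hR]; linarith) hx1
    (ContinuousOn.add (ContinuousOn.sub (h.uc.mono (Sl.Reg_sub le_rfl ♮ (fun _ _ => le_rfl)
      fun t ht => Rs t ⟨ht.1, by linarith [ht.2]⟩)) ♯) ♯)
    (fun t ht x hx => ((h.ut t (tT t ht) x (tx t ht x hx)).sub_const _).add ((hdt t x).const_mul H))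
    (fun t ht x hx => ((h.ux t (tT t ht) x (tx t ht x hx)).sub (lin x)).add ((hdx t x).const_mul H))
    (fun t ht x hx => ((h.uxx t (tT t ht) x (tx t ht x hx)).sub_const _).add (((hdx t x).const_mul (-μ)).const_mul H))
    (fun t ht x hx => by ring_nf; exact le_rfl)
    (fun t ht => ⟨((h.d0 (tT t ht)).sub (lin 0).hasDerivWithinAt).add ((hdx t 0).const_mul H).hasDerivWithinAt, by
      have h1 := rpow_tan hp ha (h.u0 t (Ioc_Icc (tT t ht)) 0 ⟨le_rfl, (h.sp t (Ioc_Icc (tT t ht))).le⟩)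
      rw [apb, ← hb, ← hP] at h1
      have h2 : 1 ≤ exp (μ ^ 2 * t - μ * 0) := by
        rw [mul_zero, sub_zero]; exact one_le_exp (mul_nonneg (sq_nonneg _) ht.1.le)
      set X := exp (μ ^ 2 * t - μ * 0)
      have h3 : H ≤ H * X := le_mul_of_one_le_right H0.le h2
      rw [hμ]; simp only [mul_zero, sub_zero]
      nlinarith⟩)
    (fun t ht => by
      have h1 := h.u0 t (Ioc_Icc (tT t ht)) R ⟨R0.le, Rs t (Ioc_Icc (tT t ht))⟩
      have h2 : 0 ≤ H * exp (μ ^ 2 * t - μ * R) := ♭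
      have h3 : b * R = 1 + b * η := by rw [hR]; linear_combination bb
      have h4 : a * (b * R) = a * (1 + b * η) := by rw [h3]
      have h5 : 0 < a * (b * η) := ♭
      have h6 : 0 < ε * R := ♭
      show 0 ≤ u t R - (a - ε - (a * b + ε) * R) + _
      nlinarith)
    (fun x hx => by
      have := hu x ⟨hx.1, hx.2.trans hs⟩
      have h2 : 0 ≤ H * exp (μ ^ 2 * 0 - μ * x) := ♭
      rw [apb] at this; show 0 ≤ u 0 x - _ + _; linarith)
    (fun x hx hx2 => by
      have h1 := h.u0 0 ⟨le_rfl, ♮⟩ x ⟨hx.1, hx.2.trans hs⟩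
      have h2 : 0 ≤ H * exp (μ ^ 2 * 0 - μ * x) := ♭
      have h3 : 1 / b + η / 4 ≤ x := by have := hx2.1; rw [hz0, hρ] at this; linarith
      have h4 : a * b * (1 / b + η / 4) ≤ a * b * x := mul_le_mul_of_nonneg_left h3 ♭
      have h5 : a * b * (1 / b + η / 4) = a + η1 := by rw [hη1]; linear_combination a * bb
      have h6 : 0 ≤ ε * x := mul_nonneg ε0.le hx.1
      show η1 ≤ u 0 x - _ + _
      linarith)

lemma KEY {a η : ℝ} (hp : 1 < p) (ha : 0 < a) (hη : 0 < η) : ∃ ε T0, 0 < ε ∧ 0 < T0 ∧ ∀ s u q r, Sl 0 p T0 s u q r →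
    1 / a ^ (p - 1) + η ≤ s 0 → ¬ ∀ x ∈ Icc 0 (s 0), a - ε - (a ^ p + ε) * x ≤ u 0 x := by
  obtain ⟨b, hb⟩ : ∃ y, y = a ^ (p - 1) := ◇
  have b0 : 0 < b := by rw [hb]; exact rpow_pos_of_pos ha _
  have apb : a ^ p = a * b := by rw [mul_comm, hb, ← rpow_add_one ha.ne']; simp
  obtain ⟨z0, hz0⟩ : ∃ y, y = 1 / b + η / 2 := ◇
  have z00 : 0 < z0 := by rw [hz0]; positivity
  obtain ⟨ρ, hρ⟩ : ∃ y, y = η / 4 := ◇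
  obtain ⟨κ, hκ⟩ : ∃ y, y = (6 * ρ * z0 / 1 + 30) ^ 2 / (96 * ρ ^ 2) := ◇
  obtain ⟨η1, hη1⟩ : ∃ y, y = a * b * η / 4 := ◇
  have η10 : 0 < η1 := by rw [hη1]; positivity
  obtain ⟨η2, hη2⟩ : ∃ y, y = η1 * exp (-κ * 1) / 2 := ◇
  have η20 : 0 < η2 := by rw [hη2]; positivity
  obtain ⟨P, hP⟩ : ∃ y, y = p * b := ◇
  have P0 : 0 < P := by rw [hP]; exact mul_pos ♮ b0
  obtain ⟨μ, hμ⟩ : ∃ y, y = P + 1 := ◇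
  have μ0 : 0 < μ := by rw [hμ]; linarith
  obtain ⟨D, hD⟩ : ∃ y, y = 1 + z0 + (1 + P) * exp (μ ^ 2) := ◇
  have D0 : 0 < D := by rw [hD]; positivity
  obtain ⟨ε, hε⟩ : ∃ y, y = η2 / D := ◇
  have ε0 : 0 < ε := by rw [hε]; positivity
  have εD : ε * D = η2 := by rw [hε]; field_simp
  obtain ⟨e, he⟩ : ∃ y, y = min (1 / 8) (min (b * η / 4) (η2 / (a * b ^ 2 * z0 ^ 2))) := ◇
  have e0 : 0 < e := by rw [he]; exact lt_min ♩ (lt_min ♭ ♭)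
  have e1 : e ≤ b * η / 4 := by rw [he]; exact ◨.trans ◧
  have e2 : e * (a * b ^ 2 * z0 ^ 2) ≤ η2 := (le_div_iff₀ ♭).1 (by rw [he]; exact ◨.trans ◨)
  obtain ⟨Tb, hTb⟩ : ∃ y, y = a ^ (-(2 * p - 2)) / ((2 * p - 2) * (2 * e)) := ◇
  have Tb0 : 0 < Tb := by rw [hTb]; exact div_pos (rpow_pos_of_pos ha _) (mul_pos ♮ ♮)
  refine ⟨ε, 1 + Tb, ε0, ♮, fun s u q r h hs hu => ?_⟩
  have hs' := hs
  have bb : b * (1 / b) = 1 := by field_simp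
  have key : ∀ x ∈ Icc 0 z0, 2 * η2 ≤ u 1 x - (a - ε - (a * b + ε) * x) + (1 + P) * ε * exp (μ ^ 2 * 1 - μ * x) := fun x1 hx1 => by
    have := KEY1 hp ha hη hb b0 apb hz0 hρ hη1 hP P0 hμ ε0 rfl rfl ♮ h (by rw [hb]; exact hs) hu hx1
    have h2 : 2 * η2 = η1 * exp (-κ * 1) := by rw [hη2]; ring
    rw [h2, hκ]; exact this
  have h1 := h.shift (a := 1) ♩ ♮
  rw [show 1 + Tb - 1 = Tb by ring] at h1
  have hez : (1 + 2 * e) / b ≤ z0 := by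
    rw [div_le_iff₀ b0]
    have : z0 * b = 1 + b * η / 2 := by rw [hz0]; linear_combination bb
    linarith
  have := BL hp h1 (e := e) (A := a) e0 (by rw [he]; exact min_le_left _ _) ha (by
    rw [← hb]; rw [← hb] at hs
    refine hez.trans ?_
    have := hs.trans (h.sm le_rfl ⟨le_rfl, ♮⟩ (⟨by norm_num, ♮⟩ : (0 + 1 : ℝ) ∈ Icc 0 (1 + Tb)) ♩)
    refine le_trans ?_ this
    rw [hz0]; linarith) (fun x hx => by
      rw [← hb] at hx ⊢
      have hx' : x ∈ Icc 0 z0 := ⟨hx.1, hx.2.trans hez⟩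
      have k := key x hx'
      have e3 : exp (μ ^ 2 * 1 - μ * x) ≤ exp (μ ^ 2) := exp_le_exp.2 (by nlinarith [mul_nonneg μ0.le hx.1])
      have e4 : (1 + P) * ε * exp (μ ^ 2 * 1 - μ * x) ≤ ε * ((1 + P) * exp (μ ^ 2)) := by
        calc _ ≤ (1 + P) * ε * exp (μ ^ 2) := mul_le_mul_of_nonneg_left e3 ♭
          _ = _ := by ring
      have e5 : ε * x ≤ ε * z0 := mul_le_mul_of_nonneg_left hx'.2 ε0.le
      have e6 : e * (a * b ^ 2 * x ^ 2) ≤ e * (a * b ^ 2 * z0 ^ 2) :=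
        mul_le_mul_of_nonneg_left (mul_le_mul_of_nonneg_left (pow_le_pow_left₀ hx.1 hx'.2 2) ♭) e0.le
      have e7 : ε * (1 + z0 + (1 + P) * exp (μ ^ 2)) = η2 := by rw [← hD]; exact εD
      rw [zero_add]
      linarith)
  rw [← hTb] at this; exact lt_irrefl _ this

lemma BIG {z0 ρ R : ℝ} (hp : 1 < p) (hz : 0 < z0) (hρ : 0 < ρ) (hR : z0 + ρ ≤ R) : ∃ B T0, 0 < B ∧ 0 < T0 ∧ ∀ s u q r, Sl 0 p T0 s u q r →
    R ≤ s 0 → ¬ ∀ x ∈ Icc 0 R, x ∈ Icc (z0 - ρ) (z0 + ρ) → B ≤ u 0 x := by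
  set κ := (6 * ρ * z0 / 1 + 30) ^ 2 / (96 * ρ ^ 2) with hκ
  set A := (5 / (4 * z0)) ^ (1 / (p - 1)) with hA
  have A0 : 0 < A := rpow_pos_of_pos ♭ _
  have Ap : A ^ (p - 1) = 5 / (4 * z0) := by
    rw [hA, ← rpow_mul ♭, one_div_mul_cancel ♮, rpow_one]
  set Tb := A ^ (-(2 * p - 2)) / ((2 * p - 2) * (2 * (1 / 8))) with hTb
  have Tb0 : 0 < Tb := div_pos (rpow_pos_of_pos A0 _) (mul_pos ♮ ♩)
  refine ⟨A * exp κ, 1 + Tb, ♭, ♮, fun s u q r h hs hu => ?_⟩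
  have Rs : ∀ t ∈ Icc 0 (1 + Tb), R ≤ s t := fun t ht => hs.trans (h.sm le_rfl ⟨le_rfl, ♮⟩ ht ht.1)
  have tT : ∀ t ∈ Ioc ⓪ 1, t ∈ Ioc 0 (1 + Tb) := fun t ht => ⟨ht.1, by linarith [ht.2]⟩
  have tx : ∀ t ∈ Ioc ⓪ 1, ∀ x ∈ Ioo 0 R, x ∈ Ioo 0 (s t) := fun t ht x hx => ⟨hx.1, hx.2.trans_le (Rs t (Ioc_Icc (tT t ht)))⟩
  have key : ∀ x ∈ Icc 0 z0, A ≤ u 1 x := fun x1 hx1 => by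
    have := BUMP (t1 := 1) (R := R) (C := 0) (η := A * exp κ) (z0 := z0) (ρ := ρ) (x1 := x1) (z := u) (zt := r) (zx := q) (zxx := r)
      (z0' := fun t => -(u t 0) ^ p)
      one_pos le_rfl ♭ ♭ hR hx1
      (h.uc.mono (Sl.Reg_sub le_rfl ♮ (fun _ _ => le_rfl) fun t ht => Rs t ⟨ht.1, by linarith [ht.2]⟩))
      (fun t ht x hx => h.ut t (tT t ht) x (tx t ht x hx))
      (fun t ht x hx => h.ux t (tT t ht) x (tx t ht x hx))
      (fun t ht x hx => h.uxx t (tT t ht) x (tx t ht x hx))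
      (fun t ht x hx => le_rfl)
      (fun t ht => ⟨h.d0 (tT t ht), by
        have := rpow_nonneg (h.u0 t (Ioc_Icc (tT t ht)) 0 ⟨le_rfl, (h.sp t (Ioc_Icc (tT t ht))).le⟩) p
        simpa using this⟩)
      (fun t ht => h.u0 t (Ioc_Icc (tT t ht)) R ⟨♮, Rs t (Ioc_Icc (tT t ht))⟩)
      (fun x hx => h.u0 0 ⟨le_rfl, ♮⟩ x ⟨hx.1, hx.2.trans hs⟩) hu
    rw [← hκ, mul_assoc, ← exp_add] at this
    simpa using this
  have h1 := h.shift (a := 1) ♩ ♮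
  rw [show 1 + Tb - 1 = Tb by ring] at h1
  have hez : (1 + 2 * (1 / 8)) / A ^ (p - 1) = z0 := by rw [Ap]; field_simp; norm_num
  have := BL hp h1 (e := 1 / 8) (A := A) ♩ le_rfl A0 (by
    rw [hez]
    exact le_trans ♮ (Rs (0 + 1) ⟨by norm_num, ♮⟩)) (fun x hx => by
      rw [hez] at hx
      have k := key x hx
      rw [zero_add]
      refine le_trans ?_ k
      rw [Ap]
      have h5 : 5 / (4 * z0) * x ≤ 5 / 4 := by
        calc _ ≤ 5 / (4 * z0) * z0 := mul_le_mul_of_nonneg_left hx.2 ♭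
          _ = 5 / 4 := by field_simp
      have h6 : 0 ≤ 5 / (4 * z0) * x := mul_nonneg ♭ hx.1
      set y := 5 / (4 * z0) * x
      have : 1 - y + 1 / 8 * y ^ 2 ≤ 1 := by nlinarith
      nlinarith)
  exact lt_irrefl _ this
end

section
variable {ε p T : ℝ} {s : ℝ → ℝ} {u q r : ℝ → ℝ → ℝ}

lemma GRADc (sc : ContinuousOn s (Icc 0 T)) (R : ℝ) :
    IsCompact {z : ℝ × ℝ² | z.1 ∈ Icc 0 T ∧ 0 ≤ z.2.1 ∧ z.2.1 ≤ z.2.2 ∧ z.2.2 ≤ s z.1 ∧ z.2.2 - z.2.1 ≤ R} := by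
  obtain ⟨A, hA⟩ := isCompact_Icc.bddAbove_image sc
  refine IsCompact.of_isClosed_subset ((isCompact_Icc (a := ⓪) (b := T)).prod ((isCompact_Icc (a := ⓪) (b := A)).prod (isCompact_Icc (a := ⓪) (b := A)))) ?_ ?_
  · have c1 : ContinuousOn (fun z : ℝ × ℝ² => (z.2.1, z.2.2 - z.2.1, s z.1 - z.2.2, R - (z.2.2 - z.2.1))) (Icc 0 T ×ˢ univ) := by
      have : ContinuousOn (fun z : ℝ × ℝ² => s z.1) (Icc 0 T ×ˢ univ) := sc.comp continuousOn_fst fun z hz => hz.1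
      exact continuousOn_snd.fst.prodMk (.prodMk (Continuous.continuousOn ♯) (.prodMk (this.sub continuousOn_snd.snd) (Continuous.continuousOn ♯)))
    have := c1.preimage_isClosed_of_isClosed (isClosed_Icc.prod isClosed_univ) (t := Ici 0 ×ˢ Ici 0 ×ˢ Ici 0 ×ˢ Ici 0)
      (isClosed_Ici.prod (isClosed_Ici.prod (isClosed_Ici.prod isClosed_Ici)))
    convert this using 1
    ext z; simp [mem_prod]
  · rintro ⟨t, x, y⟩ ⟨h1, h2, h3, h4, -⟩
    have := hA ⟨t, h1, rfl⟩
    simp only at *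
    exact ⟨h1, ⟨h2, ♮⟩, ⟨♮, ♮⟩⟩

lemma GRAD (h : Sl ε p T s u q r) (σ : ℝ) {K B R κ : ℝ} (hB : 0 ≤ B) (hκ : 0 ≤ κ) (hκR : κ * R ≤ π / 2)
    (hi : ∀ x y, 0 ≤ x → x ≤ y → y ≤ s 0 → y - x ≤ R → σ * u 0 x - σ * u 0 y ≤ K * (y - x) + B * sin (κ * (y - x)))
    (hR : ∀ t ∈ Ioc 0 T, ∀ x, 0 ≤ x → x + R ≤ s t → σ * u t x - σ * u t (x + R) ≤ K * R)
    (hs : ∀ t ∈ Ioc 0 T, ∀ x, 0 ≤ x → x ≤ s t → s t - x ≤ R → σ * u t x ≤ K * (s t - x) + B * exp (-κ ^ 2 * t) * sin (κ * (s t - x)))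
    (h0 : ∀ t ∈ Ioc 0 T, -K ≤ σ * q t 0) :
    ∀ t ∈ Icc 0 T, ∀ x y, 0 ≤ x → x ≤ y → y ≤ s t → y - x ≤ R →
      σ * u t x - σ * u t y ≤ K * (y - x) + B * exp (-κ ^ 2 * t) * sin (κ * (y - x)) := by
  intro t1 ht1 x1 y1 hx1 hxy1 hy1 hd1
  by_contra hcon
  push Not at hcon
  obtain ⟨gap, hgap⟩ : ∃ g, g = σ * u t1 x1 - σ * u t1 y1 - (K * (y1 - x1) + B * exp (-κ ^ 2 * t1) * sin (κ * (y1 - x1))) := ◇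
  have gap0 : 0 < gap := ♮
  obtain ⟨δ, hδ⟩ : ∃ d, d = gap / (2 * ((y1 - x1) + t1 + 1)) := ◇
  have den : 0 < (y1 - x1) + t1 + 1 := by linarith [ht1.1]
  have δ0 : 0 < δ := by rw [hδ]; positivity
  have δg : δ * ((y1 - x1) + t1 + 1) = gap / 2 := by rw [hδ]; field_simp
  obtain ⟨w, hw⟩ : ∃ w : ℝ → ℝ → ℝ → ℝ, w = fun t x y => σ * u t x - σ * u t y - (K * (y - x) + B * exp (-κ ^ 2 * t) * sin (κ * (y - x))) - δ * (y - x) - δ * t := ◇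
  have hwv : ∀ t x y, w t x y = σ * u t x - σ * u t y - (K * (y - x) + B * exp (-κ ^ 2 * t) * sin (κ * (y - x))) - δ * (y - x) - δ * t := fun t x y => by rw [hw]
  have hK := GRADc h.sc R
  have wc : ContinuousOn (fun z : ℝ × ℝ² => w z.1 z.2.1 z.2.2) {z : ℝ × ℝ² | z.1 ∈ Icc 0 T ∧ 0 ≤ z.2.1 ∧ z.2.1 ≤ z.2.2 ∧ z.2.2 ≤ s z.1 ∧ z.2.2 - z.2.1 ≤ R} := by
    have c1 := h.uc.comp (f := fun z : ℝ × ℝ² => (z.1, z.2.1)) (s := {z : ℝ × ℝ² | z.1 ∈ Icc 0 T ∧ 0 ≤ z.2.1 ∧ z.2.1 ≤ z.2.2 ∧ z.2.2 ≤ s z.1 ∧ z.2.2 - z.2.1 ≤ R})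
      ♯ (fun z hz => ⟨hz.1, hz.2.1, hz.2.2.1.trans hz.2.2.2.1⟩)
    have c2 := h.uc.comp (f := fun z : ℝ × ℝ² => (z.1, z.2.2)) (s := {z : ℝ × ℝ² | z.1 ∈ Icc 0 T ∧ 0 ≤ z.2.1 ∧ z.2.1 ≤ z.2.2 ∧ z.2.2 ≤ s z.1 ∧ z.2.2 - z.2.1 ≤ R})
      ♯ (fun z hz => ⟨hz.1, hz.2.1.trans hz.2.2.1, hz.2.2.2.1⟩)
    simp only [Function.comp_def] at c1 c2
    simp only [hwv]
    exact ((((c1.const_smul σ).sub (c2.const_smul σ)).sub (Continuous.continuousOn ♯)).sub (Continuous.continuousOn ♯)).sub (Continuous.continuousOn ♯)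
  obtain ⟨⟨t, x, y⟩, ⟨ht, hx, hxy, hy, hd⟩, hmax⟩ := hK.exists_isMaxOn ⟨(t1, x1, y1), ht1, hx1, hxy1, hy1, hd1⟩ wc
  simp only at ht hx hxy hy hd
  have hm : ∀ t' x' y', t' ∈ Icc 0 T → 0 ≤ x' → x' ≤ y' → y' ≤ s t' → y' - x' ≤ R → w t' x' y' ≤ w t x y :=
    fun t' x' y' a b c d e => hmax (show (t', x', y') ∈ _ from ⟨a, b, c, d, e⟩)
  have wp : 0 < w t x y := by
    have := hm t1 x1 y1 ht1 hx1 hxy1 hy1 hd1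
    rw [hwv t1] at this
    nlinarith
  have sinn : 0 ≤ sin (κ * (y - x)) := sin_nonneg_of_nonneg_of_le_pi (mul_nonneg hκ ♮) (by
    have := mul_le_mul_of_nonneg_left hd hκ; linarith [pi_pos])
  have cosn : 0 ≤ cos (κ * (y - x)) := cos_nonneg_of_neg_pi_div_two_le_of_le (by have := mul_nonneg hκ (sub_nonneg.2 hxy); linarith [pi_pos]) (by
    have := mul_le_mul_of_nonneg_left hd hκ; linarith [pi_pos])
  have e0 : 0 ≤ B * exp (-κ ^ 2 * t) := ♭
  have tpos : 0 < t := by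
    rcases ht.1.eq_or_lt with h' | h'
    · exfalso
      rw [hwv, ← h'] at wp
      rw [← h'] at hy
      have := hi x y hx hxy hy hd
      have h3 : 0 ≤ δ * (y - x) := mul_nonneg δ0.le ♮
      simp at wp; linarith
    · exact h'
  have δt : 0 < δ * t := mul_pos δ0 tpos
  have ht' : t ∈ Ioc 0 T := ⟨tpos, ht.2⟩
  rw [hwv] at wp
  have h3 : 0 ≤ δ * (y - x) := mul_nonneg δ0.le ♮
  have h4 : 0 ≤ B * exp (-κ ^ 2 * t) * sin (κ * (y - x)) := mul_nonneg e0 sinn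
  have hxy' : x < y := by
    rcases hxy.eq_or_lt with h' | h'
    · rw [h'] at wp; simp at wp; linarith
    · exact h'
  have hd' : y - x < R := by
    rcases hd.eq_or_lt with h' | h'
    · have := hR t ht' x hx ♮
      rw [show x + R = y by linarith] at this
      rw [← h'] at this; linarith
    · exact h'
  have hy' : y < s t := by
    rcases hy.eq_or_lt with h' | h'
    · have h5 := hs t ht' x hx ♮ ♮
      rw [← h'] at h5
      have := h.bs t ht
      rw [← h'] at this; rw [this] at wp; linarith
    · exact h'
  have dsin : ∀ a b d : ℝ, HasDerivAt (fun v => B * exp (-κ ^ 2 * t) * sin (κ * (a + b * v))) (B * exp (-κ ^ 2 * t) * (cos (κ * (a + b * d)) * (κ * b))) d := fun a b d => by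
    refine ((((((hasDerivAt_id d).const_mul b).const_add a).const_mul κ).sin).const_mul _).congr_deriv ?_; simp
  have hx' : 0 < x := by
    rcases hx.eq_or_lt with h' | h'
    · exfalso
      have e1 : (fun v => w t v y) = fun v => σ * u t v - σ * u t y - (K * (y - v) + B * exp (-κ ^ 2 * t) * sin (κ * (y + (-1) * v))) - δ * (y - v) - δ * t := by
        funext v; rw [hwv, show y + (-1) * v = y - v by ring]
      have d1 : HasDerivWithinAt (fun v => w t v y) (σ * (-(u t 0) ^ p) - (K * (-1) + B * exp (-κ ^ 2 * t) * (cos (κ * (y + (-1) * 0)) * (κ * (-1)))) - δ * (-1)) (Ici 0) 0 := by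
        rw [e1]
        exact (((((h.d0 ht').const_mul σ).sub_const _).sub ((((hasDerivAt_id ⓪).const_sub y).const_mul K).add (dsin y (-1) 0)).hasDerivWithinAt).sub
          (((hasDerivAt_id ⓪).const_sub y).const_mul δ).hasDerivWithinAt).sub_const _
      have := rdt d1 (by
        filter_upwards [Ioo_mem_nhdsGT (show 0 < y by linarith)] with v hv
        rw [h']
        exact hm t v y ht hv.1.le hv.2.le hy (by rw [← h'] at hd; linarith [hv.1]))
      have h6 := h0 t ht'
      rw [h.b0 t ht'] at h6
      rw [← h'] at cosn
      have h7 : 0 ≤ B * exp (-κ ^ 2 * t) * (cos (κ * (y - 0)) * κ) := mul_nonneg e0 (mul_nonneg cosn hκ)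
      simp at this h7
      linarith
    · exact h'
  have hxs : x ∈ Ioo 0 (s t) := ⟨hx', ♮⟩
  have hys : y ∈ Ioo 0 (s t) := ⟨♮, hy'⟩
  have T1 : HasDerivAt (fun τ => w τ x y) (σ * r t x - σ * r t y - (B * (exp (-κ ^ 2 * t) * (-κ ^ 2)) * sin (κ * (y - x))) - δ) t := by
    simp only [hwv]
    have := (((((h.ut t ht' x hxs).const_mul σ).sub ((h.ut t ht' y hys).const_mul σ)).sub
      (((((((hasDerivAt_id t).const_mul (-κ ^ 2)).exp).const_mul B).mul_const (sin (κ * (y - x)))).const_add (K * (y - x))))).sub_const (δ * (y - x))).sub ((hasDerivAt_id t).const_mul δ)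
    refine this.congr_deriv ?_; simp
  have T2 := ldt T1 (by
    have c := (h.sd t ht').continuousAt
    filter_upwards [Ioo_mem_nhdsLT tpos, nhdsWithin_le_nhds (c.eventually (lt_mem_nhds hy'))] with τ hτ hsτ
    exact hm τ x y ⟨hτ.1.le, by linarith [hτ.2, ht.2]⟩ hx hxy hsτ.le hd)
  obtain ⟨ρ, hρ⟩ : ∃ g, g = min (min x (s t - y)) (min ((y - x) / 2) ((R - (y - x)) / 2)) := ◇
  have ρ0 : 0 < ρ := by rw [hρ]; exact lt_min (lt_min hx' ♮) (lt_min ♮ ♮)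
  have r1 : ρ ≤ x := by rw [hρ]; exact ◧.trans ◧
  have r2 : ρ ≤ s t - y := by rw [hρ]; exact ◧.trans ◨
  have r3 : ρ ≤ (y - x) / 2 := by rw [hρ]; exact ◨.trans ◧
  have r4 : ρ ≤ (R - (y - x)) / 2 := by rw [hρ]; exact ◨.trans ◨
  have X := sdt (f := fun v => w t (x + v) (y - v)) (x := 0)
    (f' := fun v => σ * q t (x + v) + σ * q t (y - v) - (K * (-2) + B * exp (-κ ^ 2 * t) * (cos (κ * ((y - x) + (-2) * v)) * (κ * (-2)))) + 2 * δ)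
    (c := σ * r t x - σ * r t y - (B * exp (-κ ^ 2 * t) * (-sin (κ * (y - x)) * (κ * (-2)) * (κ * (-2)))))
    (by
      filter_upwards [Ioo_mem_nhds (neg_lt_zero.2 ρ0) ρ0] with v hv
      simp only [add_zero, sub_zero]
      exact hm t (x + v) (y - v) ht (by linarith [hv.1]) (by linarith [hv.2]) (by linarith [hv.1]) (by linarith [hv.1]))
    (by
      filter_upwards [Ioo_mem_nhds (neg_lt_zero.2 ρ0) ρ0] with v hv
      have a1 := (h.ux t ht' (x + v) ⟨by linarith [hv.1], by linarith [hv.2]⟩).comp_const_add x v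
      have a2 := (h.ux t ht' (y - v) ⟨by linarith [hv.2], by linarith [hv.1]⟩).comp_const_sub y v
      have a3 : HasDerivAt (fun v : ℝ => (y - v) - (x + v)) (-2) v := by
        refine (((hasDerivAt_id v).const_sub y).sub ((hasDerivAt_id v).const_add x)).congr_deriv ?_; norm_num
      have e1 : (fun v => w t (x + v) (y - v)) = fun v => σ * u t (x + v) - σ * u t (y - v) - (K * ((y - v) - (x + v)) + B * exp (-κ ^ 2 * t) * sin (κ * ((y - x) + (-2) * v))) - δ * ((y - v) - (x + v)) - δ * t := by
        funext v; rw [hwv, show (y - x) + (-2) * v = (y - v) - (x + v) by ring]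
      rw [e1]
      refine (((((a1.const_mul σ).sub (a2.const_mul σ)).sub ((a3.const_mul K).add (dsin (y - x) (-2) v))).sub (a3.const_mul δ)).sub_const _).congr_deriv ?_
      ring)
    (by
      have a1 := (h.uxx t ht' (x + 0) (by simpa using hxs)).comp_const_add x 0
      have a2 := (h.uxx t ht' (y - 0) (by simpa using hys)).comp_const_sub y 0
      have a3 : HasDerivAt (fun v => B * exp (-κ ^ 2 * t) * (cos (κ * ((y - x) + (-2) * v)) * (κ * (-2)))) (B * exp (-κ ^ 2 * t) * (-sin (κ * (y - x)) * (κ * (-2)) * (κ * (-2)))) 0 := by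
        refine ((((((((hasDerivAt_id ⓪).const_mul (-2)).const_add (y - x)).const_mul κ).cos).mul_const (κ * (-2)))).const_mul _).congr_deriv ?_; simp
      refine ((((a1.const_mul σ).add (a2.const_mul σ)).sub (a3.const_add _)).add_const _).congr_deriv ?_
      simp; ring)
  have h8 : 0 ≤ B * exp (-κ ^ 2 * t) * sin (κ * (y - x)) * κ ^ 2 := ♭
  nlinarith [X.2, T2, h8]

end

section
variable {ε p T : ℝ} {s : ℝ → ℝ} {u q r : ℝ → ℝ → ℝ}

lemma GRADu (h : Sl ε p T s u q r) (hε : 0 ≤ ε) {K B R κ : ℝ} (hK : 0 ≤ K) (hB : 0 ≤ B) (hκ : 0 ≤ κ) (hκR : κ * R ≤ π / 2) (hR0 : 0 < R)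
    (h0 : ∀ t ∈ Ioc 0 T, u t 0 ^ p ≤ K) (hKR : ∀ t ∈ Ioc 0 T, ∀ x ∈ Icc 0 (s t), R ≤ s t → u t x ≤ K * R)
    (hi : ∀ x y, 0 ≤ x → x ≤ y → y ≤ s 0 → y - x ≤ R → u 0 x - u 0 y ≤ K * (y - x) + B * sin (κ * (y - x))) :
    ∀ t ∈ Icc 0 T, ∀ x y, 0 ≤ x → x ≤ y → y ≤ s t → y - x ≤ R →
      u t x - u t y ≤ K * (y - x) + B * exp (-κ ^ 2 * t) * sin (κ * (y - x)) := by
  have Zs : ∀ d, 0 ≤ d → d ≤ R → 0 ≤ sin (κ * d) := fun d h1 h2 =>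
    sin_nonneg_of_nonneg_of_le_pi (mul_nonneg hκ h1) (by have := mul_le_mul_of_nonneg_left h2 hκ; linarith [pi_pos])
  have Zc : ∀ d, 0 ≤ d → d ≤ R → 0 ≤ cos (κ * d) := fun d h1 h2 =>
    cos_nonneg_of_neg_pi_div_two_le_of_le (by have := mul_nonneg hκ h1; linarith [pi_pos]) (by
    have := mul_le_mul_of_nonneg_left h2 hκ; linarith [pi_pos])
  have face : ∀ t ∈ Icc 0 T, ∀ x ∈ Icc (max 0 (s t - R)) (s t), u t x - (K * (s t - x) + B * exp (-κ ^ 2 * t) * sin (κ * (s t - x))) ≤ 0 := by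
    have dsn : ∀ t x, HasDerivAt (fun x => B * exp (-κ ^ 2 * t) * sin (κ * (s t - x))) (B * exp (-κ ^ 2 * t) * (cos (κ * (s t - x)) * (κ * (-1)))) x := fun t x => by
      refine (((((hasDerivAt_id x).const_sub (s t)).const_mul κ).sin).const_mul _).congr_deriv ?_; simp
    have dcs : ∀ t x, HasDerivAt (fun x => B * exp (-κ ^ 2 * t) * (cos (κ * (s t - x)) * (κ * (-1)))) (B * exp (-κ ^ 2 * t) * (-sin (κ * (s t - x)) * (κ * (-1)) * (κ * (-1)))) x := fun t x => by
      refine ((((((hasDerivAt_id x).const_sub (s t)).const_mul κ).cos).mul_const (κ * (-1))).const_mul _).congr_deriv ?_; simp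
    have dK : ∀ t x, HasDerivAt (fun x => K * (s t - x)) (K * (-1)) x := fun t x => ((hasDerivAt_id x).const_sub (s t)).const_mul K
    refine MPL (C := 0) (t0 := 0) (t1 := T) (l := fun t => max 0 (s t - R)) (r := s)
      (w := fun t x => u t x - (K * (s t - x) + B * exp (-κ ^ 2 * t) * sin (κ * (s t - x)))) ?_ h.sc ?_ ?_ ?_ ?_ ?_
    · exact ContinuousOn.sup continuousOn_const (h.sc.sub continuousOn_const)
    · have c1 : ContinuousOn (fun z : ℝ² => s z.1 - z.2) (Reg 0 T (fun t => max 0 (s t - R)) s) := (h.sc.comp continuousOn_fst fun z hz => hz.1).sub continuousOn_snd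
      have c2 := h.uc.mono (Sl.Reg_sub (t0 := 0) (t1 := T) (l := fun t => max 0 (s t - R)) (r' := s) le_rfl le_rfl (fun t _ => le_max_left _ _) fun t _ => le_rfl)
      exact c2.sub ((continuousOn_const.mul c1).add ((Continuous.continuousOn ♯).mul (continuous_sin.comp_continuousOn (continuousOn_const.mul c1))))
    · intro x hx
      have m1 := le_max_left 0 (s 0 - R)
      have m2 := le_max_right 0 (s 0 - R)
      have := hi x (s 0) (m1.trans hx.1) hx.2 le_rfl (by linarith [hx.1])
      rw [h.bs 0 ⟨le_rfl, h.T0.le⟩] at this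
      simp; linarith
    · intro t ht x hx _
      have m1 := le_max_left 0 (s t - R)
      have m2 := le_max_right 0 (s t - R)
      have hx' : x ∈ Ioo 0 (s t) := ⟨by linarith [hx.1], hx.2⟩
      refine ⟨r t x - (K * (-q t (s t) + ε) + (B * (exp (-κ ^ 2 * t) * (-κ ^ 2)) * sin (κ * (s t - x)) + B * exp (-κ ^ 2 * t) * (cos (κ * (s t - x)) * (κ * (-q t (s t) + ε))))), _, fun y => q t y - (K * (-1) + B * exp (-κ ^ 2 * t) * (cos (κ * (s t - y)) * (κ * (-1)))), ?_, ?_, (h.uxx t ht x hx').sub ((dcs t x).const_add _), ?_⟩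
      · have e1 := (h.sd t ht).sub_const x
        have e2 : HasDerivAt (fun t => B * exp (-κ ^ 2 * t)) (B * (exp (-κ ^ 2 * t) * (-κ ^ 2))) t := by
          refine ((((hasDerivAt_id t).const_mul (-κ ^ 2)).exp).const_mul B).congr_deriv ?_; simp
        exact (h.ut t ht x hx').sub ((e1.const_mul K).add (e2.mul ((e1.const_mul κ).sin)))
      · filter_upwards [h.uev ht hx'] with y hy using hy.sub ((dK t y).add (dsn t y))
      · have h1 := h.qs ht
        have h2 := Zc (s t - x) (by linarith [hx.2]) (by linarith [hx.1])
        have h3 : 0 ≤ K * (-q t (s t) + ε) := mul_nonneg hK ♮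
        have h4 : 0 ≤ B * exp (-κ ^ 2 * t) * (cos (κ * (s t - x)) * (κ * (-q t (s t) + ε))) :=
          mul_nonneg ♭ (mul_nonneg h2 (mul_nonneg hκ ♮))
        nlinarith
    · intro t ht hlt hpos
      have hl0 := h.sp t (Ioc_Icc ht)
      rcases le_total R (s t) with h' | h'
      · exfalso
        have e : max 0 (s t - R) = s t - R := max_eq_right ♮
        rw [e] at hpos
        have h1 := hKR t ht (s t - R) ⟨♮, ♮⟩ h'
        have h2 := mul_nonneg (show 0 ≤ B * exp (-κ ^ 2 * t) by positivity) (Zs R hR0.le le_rfl)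
        simp only [sub_sub_cancel] at hpos
        linarith
      · have e : max 0 (s t - R) = 0 := max_eq_left ♮
        rw [e]
        refine ⟨_, (h.d0 ht).sub ((dK t 0).add (dsn t 0)).hasDerivWithinAt, ?_⟩
        have h2 := mul_nonneg (show 0 ≤ B * exp (-κ ^ 2 * t) by positivity) (mul_nonneg (Zc (s t - 0) ♮ ♮) hκ)
        have h3 := h0 t ht
        nlinarith
    · intro t ht _
      simp [h.bs t (Ioc_Icc ht)]
  have := GRAD h 1 (K := K) (B := B) (R := R) (κ := κ) hB hκ hκR (by simpa using hi)
    (fun t ht x h1 h2 => by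
      have := hKR t ht x ⟨h1, ♮⟩ ♮
      have := h.u0 t (Ioc_Icc ht) (x + R) ⟨♮, h2⟩
      linarith)
    (fun t ht x h1 h2 h3 => by
      have := face t (Ioc_Icc ht) x ⟨max_le h1 ♮, h2⟩
      linarith)
    (fun t ht => by rw [h.b0 t ht]; linarith [h0 t ht])
  simpa using this

lemma LIP (h : Sl ε p T s u q r) (hε : 0 ≤ ε) {K : ℝ} (hK : 0 ≤ K) (h0 : ∀ t ∈ Ioc 0 T, u t 0 ^ p ≤ K)
    (hi : ∀ x ∈ Icc 0 (s 0), ∀ y ∈ Icc 0 (s 0), |u 0 x - u 0 y| ≤ K * |x - y|) :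
    ∀ t ∈ Icc 0 T, ∀ x ∈ Icc 0 (s t), ∀ y ∈ Icc 0 (s t), |u t x - u t y| ≤ K * |x - y| := by
  have mT : ∀ t ∈ Icc 0 T, s t ≤ s T := fun t ht => h.sm hε ht ⟨h.T0.le, le_rfl⟩ ht.2
  have sT := h.sp T ⟨h.T0.le, le_rfl⟩
  have A := GRADu h hε (K := K) (B := 0) (R := s T + 1) (κ := 0) hK le_rfl le_rfl (by simp; positivity) ♮ h0
    (fun t ht x hx hh => absurd (mT t (Ioc_Icc ht)) ♮) (fun x y h1 h2 h3 h4 => by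
      have := (abs_le.1 (hi x ⟨h1, h2.trans h3⟩ y ⟨h1.trans h2, h3⟩)).2
      rw [abs_sub_comm, abs_of_nonneg (sub_nonneg.2 h2)] at this; simpa using this)
  have B := GRAD h (-1) (K := K) (B := 0) (R := s T + 1) (κ := 0) le_rfl le_rfl (by simp; positivity) (fun x y h1 h2 h3 h4 => by
      have := (abs_le.1 (hi x ⟨h1, h2.trans h3⟩ y ⟨h1.trans h2, h3⟩)).1
      rw [abs_sub_comm, abs_of_nonneg (sub_nonneg.2 h2)] at this; simp; linarith)
    (fun t ht x h1 h2 => absurd (mT t (Ioc_Icc ht)) ♮)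
    (fun t ht x h1 h2 h3 => by
      have := h.u0 t (Ioc_Icc ht) x ⟨h1, h2⟩
      have := mul_nonneg hK (sub_nonneg.2 h2)
      simp; linarith)
    (fun t ht => by
      rw [h.b0 t ht]
      have := rpow_nonneg (h.u0 t (Ioc_Icc ht) 0 ⟨le_rfl, (h.sp t (Ioc_Icc ht)).le⟩) p
      linarith)
  have C : ∀ t ∈ Icc 0 T, ∀ x y, 0 ≤ x → x ≤ y → y ≤ s t → |u t x - u t y| ≤ K * |x - y| := fun t ht x y h1 h2 h3 => by
    have a := A t ht x y h1 h2 h3 (by linarith [mT t ht])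
    have b := B t ht x y h1 h2 h3 (by linarith [mT t ht])
    rw [abs_sub_comm x, abs_of_nonneg (sub_nonneg.2 h2), abs_le]
    simp at a b
    constructor <;> linarith
  intro t ht x hx y hy
  rcases le_total x y with h' | h'
  · exact C t ht x y hx.1 h' hy.2
  · rw [abs_sub_comm (u t x), abs_sub_comm x]; exact C t ht y x hy.1 h' hx.2

end

section
variable {ε p T : ℝ} {s : ℝ → ℝ} {u q r : ℝ → ℝ → ℝ}

lemma UB (hp : 1 < p) (hg : ∀ T, 0 < T → Sl 0 p T s u q r) {K : ℝ} (hK : 0 ≤ K)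
    (hi : ∀ x ∈ Icc 0 (s 0), ∀ y ∈ Icc 0 (s 0), |u 0 x - u 0 y| ≤ K * |x - y|) :
    ∀ t, 0 ≤ t → u t 0 ≤ max (K ^ (1 / p)) ((2 / s 0) ^ (1 / (p - 1))) := by
  have s0 := (hg 1 one_pos).sp 0 ⟨le_rfl, by norm_num⟩
  by_contra hcon
  push Not at hcon
  obtain ⟨t1, ht1, hu1⟩ := hcon
  obtain ⟨t, ht, hm⟩ := (isCompact_Icc (a := 0) (b := t1)).exists_isMaxOn ⟨0, le_rfl, ht1⟩
    (((hg (t1 + 1) ♮).c0).mono (Icc_subset_Icc le_rfl ♮))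
  obtain ⟨N, hN⟩ : ∃ N, N = u t 0 := ◇
  have h1 : max (K ^ (1 / p)) ((2 / s 0) ^ (1 / (p - 1))) < N := hN ▸ hu1.trans_le (hm ⟨ht1, le_rfl⟩)
  have hN1 : K ^ (1 / p) < N := (le_max_left _ _).trans_lt h1
  have hN2 : (2 / s 0) ^ (1 / (p - 1)) < N := (le_max_right _ _).trans_lt h1
  have N0 : 0 < N := lt_of_le_of_lt ♭ hN1
  have hp1 : 0 < p - 1 := ♮
  have hN3 : K ≤ N ^ p := by
    have := rpow_le_rpow ♭ hN1.le (show 0 ≤ p by linarith)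
    rwa [← rpow_mul hK, one_div_mul_cancel ♮, rpow_one] at this
  have hN4 : 2 / s 0 ≤ N ^ (p - 1) := by
    have := rpow_le_rpow ♭ hN2.le hp1.le
    rwa [← rpow_mul ♭, one_div_mul_cancel hp1.ne', rpow_one] at this
  obtain ⟨ε, T0, ε0, hT0, H⟩ := KEY (a := N) (η := s 0 / 2) hp N0 ♮
  have hs := (hg (t + T0) (by linarith [ht.1])).shift (a := t) ht.1 ♮
  rw [add_sub_cancel_left] at hs
  have hL : ∀ x ∈ Icc 0 (s t), N - N ^ p * x ≤ u t x := by
    intro x hx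
    have hst := (hg (t + T0) (by linarith [ht.1])).sp t ⟨ht.1, ♮⟩
    rcases ht.1.eq_or_lt with h' | h'
    · rw [← h'] at hN hx hst ⊢
      have := (abs_le.1 (hi 0 ⟨le_rfl, hst.le⟩ x hx)).2
      rw [← hN, abs_sub_comm, abs_of_nonneg (by linarith [hx.1])] at this
      have := mul_le_mul_of_nonneg_right hN3 hx.1
      linarith
    · have := (abs_le.1 (LIP (hg t h') le_rfl (K := N ^ p) ♭ (fun τ hτ => rpow_le_rpow
        ((hg t h').u0 τ (Ioc_Icc hτ) 0 ⟨le_rfl, ((hg t h').sp τ (Ioc_Icc hτ)).le⟩) (hN ▸ hm ⟨hτ.1.le, hτ.2.trans ht.2⟩) ♮)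
        (fun x hx y hy => (hi x hx y hy).trans (mul_le_mul_of_nonneg_right hN3 ◉)) t ⟨h'.le, le_rfl⟩ 0 ⟨le_rfl, hst.le⟩ x hx)).2
      rw [← hN, abs_sub_comm, abs_of_nonneg (by linarith [hx.1])] at this
      linarith
  refine H _ _ _ _ hs ?_ fun x hx => ?_
  · have m := (hg (t + T0) (by linarith [ht.1])).sm le_rfl ⟨le_rfl, by linarith [ht.1]⟩ (⟨ht.1, ♮⟩ : t ∈ Icc 0 (t + T0)) ht.1
    have : 1 / N ^ (p - 1) ≤ s 0 / 2 := by
      calc _ ≤ 1 / (2 / s 0) := one_div_le_one_div_of_le ♭ hN4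
        _ = _ := by field_simp
    rw [zero_add]; linarith
  · rw [zero_add] at hx ⊢
    have := hL x hx
    have := mul_nonneg ε0.le hx.1
    linarith

end

def cl (a b x : ℝ) : ℝ := max a (min x b)
lemma cl_mem {a b : ℝ} (h : a ≤ b) (x : ℝ) : cl a b x ∈ Icc a b := ⟨le_max_left _ _, max_le h ◨⟩
lemma cl_id {a b x : ℝ} (h : x ∈ Icc a b) : cl a b x = x := by unfold cl; rw [min_eq_left h.2, max_eq_right h.1]
lemma cl_cont (a b : ℝ) : Continuous (cl a b) := by unfold cl; fun_prop
lemma cl2 {G : ℝ → ℝ → ℝ} {a b c d : ℝ} (hab : a ≤ b) (hcd : c ≤ d) (h : ContinuousOn (fun z : ℝ² => G z.1 z.2) (Icc a b ×ˢ Icc c d)) :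
    Continuous (fun z : ℝ² => G (cl a b z.1) (cl c d z.2)) :=
  h.comp_continuous (f := fun z : ℝ² => (cl a b z.1, cl c d z.2)) (((cl_cont a b).comp continuous_fst).prodMk ((cl_cont c d).comp continuous_snd))
    fun z => ⟨cl_mem hab _, cl_mem hcd _⟩

lemma parC {G : ℝ → ℝ → ℝ} {a b c d : ℝ} (hab : a ≤ b) (hcd : c ≤ d) (h : ContinuousOn (fun z : ℝ² => G z.1 z.2) (Icc a b ×ˢ Icc c d)) :
    ContinuousOn (fun t => ∫ y in c..d, G t y) (Icc a b) := by
  have := intervalIntegral.continuous_parametric_intervalIntegral_of_continuous' (μ := volume) (f := fun t y => G (cl a b t) (cl c d y)) (cl2 hab hcd h) c d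
  refine this.continuousOn.congr fun t ht => intervalIntegral.integral_congr fun y hy => ?_
  rw [uIcc_of_le hcd] at hy
  simp only [cl_id ht, cl_id hy]

lemma parC2 {G : ℝ → ℝ → ℝ} {a b c d : ℝ} (hab : a ≤ b) (hcd : c ≤ d) (h : ContinuousOn (fun z : ℝ² => G z.1 z.2) (Icc a b ×ˢ Icc c d)) :
    ContinuousOn (fun y => ∫ t in a..b, G t y) (Icc c d) :=
  parC (G := fun y t => G t y) hcd hab (h.comp (f := fun z : ℝ² => (z.2, z.1)) ♯ fun z hz => ⟨hz.2, hz.1⟩)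

lemma swp {G : ℝ → ℝ → ℝ} {a b c d : ℝ} (hab : a ≤ b) (hcd : c ≤ d) (h : ContinuousOn (fun z : ℝ² => G z.1 z.2) (Icc a b ×ˢ Icc c d)) :
    ∫ t in a..b, ∫ y in c..d, G t y = ∫ y in c..d, ∫ t in a..b, G t y := by
  refine intervalIntegral_intervalIntegral_swap ?_
  rw [uIoc_of_le hab, uIoc_of_le hcd]
  exact (h.integrableOn_compact (isCompact_Icc.prod isCompact_Icc)).mono_set (prod_mono Ioc_subset_Icc_self Ioc_subset_Icc_self)

lemma GRN {G H Q Gt : ℝ → ℝ → ℝ} {t1 t2 : ℝ} (ht : t1 ≤ t2)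
    (Gc : ContinuousOn (fun z : ℝ² => G z.1 z.2) (Icc t1 t2 ×ˢ Icc 0 1))
    (Hc : ContinuousOn (fun z : ℝ² => H z.1 z.2) (Icc t1 t2 ×ˢ Icc 0 1))
    (Qc : ContinuousOn (fun z : ℝ² => Q z.1 z.2) (Icc t1 t2 ×ˢ Icc 0 1))
    (Tc : ContinuousOn (fun z : ℝ² => Gt z.1 z.2) (Icc t1 t2 ×ˢ Ioo 0 1))
    (hG : ∀ t ∈ Icc t1 t2, ∀ y ∈ Ioo ⓪ 1, HasDerivAt (fun τ => G τ y) (Gt t y) t)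
    (hH : ∀ t ∈ Icc t1 t2, ∀ y ∈ Ioo ⓪ 1, HasDerivAt (H t) (Gt t y - Q t y) y) :
    (∫ y in ⓪..1, G t2 y) - ∫ y in ⓪..1, G t1 y = ∫ t in t1..t2, (H t 1 - H t 0 + ∫ y in ⓪..1, Q t y) := by
  have sl : ∀ {f : ℝ → ℝ → ℝ} {A : Set ℝ} {y : ℝ}, ContinuousOn (fun z : ℝ² => f z.1 z.2) (Icc t1 t2 ×ˢ A) → y ∈ A →
      ContinuousOn (fun t => f t y) (Icc t1 t2) := fun hf hy =>
    hf.comp (f := fun t : ℝ => (t, _)) ♯ fun t ht => ⟨ht, hy⟩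
  have sl2 : ∀ {f : ℝ → ℝ → ℝ} {t : ℝ}, ContinuousOn (fun z : ℝ² => f z.1 z.2) (Icc t1 t2 ×ˢ Icc 0 1) → t ∈ Icc t1 t2 →
      IntervalIntegrable (f t) volume 0 1 := fun hf hy =>
    ContinuousOn.intervalIntegrable (by rw [uIcc_of_le zero_le_one]; exact hf.comp (f := fun y : ℝ => (_, y)) ♯ fun t ht => ⟨hy, ht⟩)
  have ii : ∀ {f : ℝ → ℝ}, ContinuousOn f (Icc t1 t2) → IntervalIntegrable f volume t1 t2 := fun hf =>
    ContinuousOn.intervalIntegrable (by rwa [uIcc_of_le ht])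
  have main : ∫ y in ⓪..1, (G t2 y - G t1 y - ∫ t in t1..t2, Q t y) = (∫ t in t1..t2, H t 1) - ∫ t in t1..t2, H t 0 := by
    refine intervalIntegral.integral_eq_sub_of_hasDerivAt_of_le (f := fun y => ∫ t in t1..t2, H t y) zero_le_one (parC2 ht zero_le_one Hc) (fun y hy => ?_) ?_
    · obtain ⟨δ, δ0, hδ⟩ : ∃ δ > 0, Icc (y - δ) (y + δ) ⊆ Ioo 0 1 := by
        refine ⟨min y (1 - y) / 2, by have := lt_min hy.1 (sub_pos.2 hy.2); positivity, fun z hz => ?_⟩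
        have a1 := min_le_left y (1 - y)
        have a2 := min_le_right y (1 - y)
        have a3 := lt_min hy.1 (sub_pos.2 hy.2)
        exact ⟨by linarith [hz.1], by linarith [hz.2]⟩
      obtain ⟨M, hM⟩ := (((isCompact_Icc (a := t1) (b := t2)).prod (isCompact_Icc (a := y - δ) (b := y + δ))).bddAbove_image
        (f := fun z : ℝ² => ‖Gt z.1 z.2 - Q z.1 z.2‖) ((Tc.mono (prod_mono le_rfl hδ)).sub (Qc.mono (prod_mono le_rfl (hδ.trans Ioo_subset_Icc_self)))).norm)
      have D := (intervalIntegral.hasDerivAt_integral_of_dominated_loc_of_deriv_le (μ := volume) (a := t1) (b := t2) (x₀ := y) (s := Ioo (y - δ) (y + δ))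
        (F := fun y t => H t y) (F' := fun y t => Gt t y - Q t y) (bound := fun _ => M) (Ioo_mem_nhds ♮ ♮)
        (by
          filter_upwards [Ioo_mem_nhds (show y - δ < y by linarith) (show y < y + δ by linarith)] with z hz
          have := (ii (sl Hc (Ioo_subset_Icc_self (hδ (Ioo_subset_Icc_self hz))))).aestronglyMeasurable
          rwa [uIoc_of_le ht]) (ii (sl Hc (Ioo_subset_Icc_self hy)))
        (by
          have := (ii ((sl Tc hy).sub (sl Qc (Ioo_subset_Icc_self hy)))).aestronglyMeasurable
          rwa [uIoc_of_le ht])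
        (.of_forall fun t hh z hz => by
          rw [uIoc_of_le ht] at hh
          exact hM ⟨(t, z), ⟨Ioc_subset_Icc_self hh, Ioo_subset_Icc_self hz⟩, rfl⟩)
        intervalIntegrable_const
        (.of_forall fun t hh z hz => by
          rw [uIoc_of_le ht] at hh
          exact hH t (Ioc_subset_Icc_self hh) z (hδ (Ioo_subset_Icc_self hz)))).2
      refine D.congr_deriv ?_
      rw [intervalIntegral.integral_sub (ii (sl Tc hy)) (ii (sl Qc (Ioo_subset_Icc_self hy)))]
      congr 1
      exact intervalIntegral.integral_eq_sub_of_hasDerivAt_of_le ht (sl Gc (Ioo_subset_Icc_self hy)) (fun t h' => hG t (Ioo_subset_Icc_self h') y hy) (ii (sl Tc hy))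
    · refine ((sl2 Gc (right_mem_Icc.2 ht)).sub (sl2 Gc (left_mem_Icc.2 ht))).sub (ContinuousOn.intervalIntegrable ?_)
      rw [uIcc_of_le zero_le_one]; exact parC2 ht zero_le_one Qc
  have i1 := sl2 Gc (right_mem_Icc.2 ht)
  have i2 := sl2 Gc (left_mem_Icc.2 ht)
  have i3 : IntervalIntegrable (fun y => ∫ t in t1..t2, Q t y) volume 0 1 := ContinuousOn.intervalIntegrable (by
    rw [uIcc_of_le zero_le_one]; exact parC2 ht zero_le_one Qc)
  have h1 := ii (sl Hc (right_mem_Icc.2 zero_le_one))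
  have h0 := ii (sl Hc (left_mem_Icc.2 zero_le_one))
  rw [intervalIntegral.integral_sub (i1.sub i2) i3, intervalIntegral.integral_sub i1 i2, ← swp ht zero_le_one Qc] at main
  rw [intervalIntegral.integral_add (h1.sub h0) (ii (parC ht zero_le_one Qc)), intervalIntegral.integral_sub h1 h0]
  linarith

section
variable {ε p T : ℝ} {s : ℝ → ℝ} {u q r : ℝ → ℝ → ℝ}

lemma Sl.joint (h : Sl ε p T s u q r) {t y : ℝ} (ht : t ∈ Ioo 0 T) (hy : y ∈ Ioo ⓪ 1) :
    HasDerivAt (fun τ => u τ (y * s τ)) (r t (y * s t) + q t (y * s t) * (y * (-q t (s t) + ε))) t := by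
  have hs := h.sp t ⟨ht.1.le, ht.2.le⟩
  have hd : HasDerivAt s (-q t (s t) + ε) t := h.sd t ⟨ht.1, ht.2.le⟩
  have hx : y * s t ∈ Ioo 0 (s t) := ⟨mul_pos hy.1 hs, by nlinarith [hy.2]⟩
  have ev : ∀ᶠ z : ℝ² in 𝓝 (t, y * s t), z.1 ∈ Ioo 0 T ∧ z.2 ∈ Ioo 0 (s z.1) := by
    have c1 : ContinuousAt (fun z : ℝ² => s z.1 - z.2) (t, y * s t) :=
      (hd.continuousAt.comp' (f := fun z : ℝ² => z.1) continuousAt_fst).sub continuousAt_snd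
    have e1 := c1.eventually (lt_mem_nhds (show ⓪ < s t - y * s t by linarith [hx.2]))
    have e2 := (continuousAt_fst (p := (t, y * s t))).eventually (Ioo_mem_nhds ht.1 ht.2)
    have e3 := (continuousAt_snd (p := (t, y * s t))).eventually (lt_mem_nhds hx.1)
    filter_upwards [e1, e2, e3] with z h1 h2 h3 using ⟨h2, h3, ♮⟩
  have rcA : ContinuousAt (fun z : ℝ² => r z.1 z.2) (t, y * s t) := h.rc.continuousAt (by
    filter_upwards [ev] with z hz using ⟨⟨hz.1.1, hz.1.2.le⟩, hz.2⟩)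
  have qcA : ContinuousAt (fun z : ℝ² => q z.1 z.2) (t, y * s t) := h.qc.continuousAt (by
    filter_upwards [ev] with z hz using ⟨⟨hz.1.1, hz.1.2.le⟩, hz.2.1.le, hz.2.2.le⟩)
  have J := hasStrictFDerivAt_uncurry_coprod (𝕜 := ℝ) (u := (t, y * s t)) (f := u)
    (f₁ := fun t x => ContinuousLinearMap.toSpanSingleton ℝ (r t x))
    (f₂ := fun t x => ContinuousLinearMap.toSpanSingleton ℝ (q t x))
    (by filter_upwards [ev] with z hz using (h.ut z.1 ⟨hz.1.1, hz.1.2.le⟩ z.2 hz.2).hasFDerivAt)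
    (by filter_upwards [ev] with z hz using (h.ux z.1 ⟨hz.1.1, hz.1.2.le⟩ z.2 hz.2).hasFDerivAt)
    ((ContinuousLinearMap.toSpanSingletonCLE (𝕜 := ℝ) (E := ℝ)).continuous.continuousAt.comp rcA)
    ((ContinuousLinearMap.toSpanSingletonCLE (𝕜 := ℝ) (E := ℝ)).continuous.continuousAt.comp qcA)
  have := J.hasFDerivAt.comp_hasDerivAt t ((hasDerivAt_id t).prodMk (hd.const_mul y))
  refine this.congr_deriv ?_
  simp [Function.HasUncurry.uncurry]; ring

variable {ψ ψ1 ψ2 Ψ : ℝ → ℝ}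

lemma Sl.scC (h : Sl ε p T s u q r) {t1 t2 : ℝ} (h1 : 0 ≤ t1) (h2 : t2 ≤ T) {f : ℝ → ℝ} (hf : Continuous f) :
    ContinuousOn (fun z : ℝ² => f (z.2 * s z.1)) (Icc t1 t2 ×ˢ univ) :=
  hf.comp_continuousOn (continuousOn_snd.mul (h.sc.comp continuousOn_fst fun z hz => ⟨h1.trans hz.1.1, hz.1.2.trans h2⟩))

lemma Sl.mapC (h : Sl ε p T s u q r) {t1 t2 : ℝ} (h1 : 0 ≤ t1) (h2 : t2 ≤ T) :
    ContinuousOn (fun z : ℝ² => (z.1, z.2 * s z.1)) (Icc t1 t2 ×ˢ univ) :=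
  continuousOn_fst.prodMk (h.scC h1 h2 continuous_id)

lemma Sl.ysm (h : Sl ε p T s u q r) {t y : ℝ} (ht : t ∈ Icc 0 T) (hy : y ∈ Icc ⓪ 1) : y * s t ∈ Icc 0 (s t) := by
  have := h.sp t ht
  exact ⟨mul_nonneg hy.1 this.le, by nlinarith [hy.2]⟩

lemma Sl.uyC (h : Sl ε p T s u q r) {t1 t2 : ℝ} (h1 : 0 ≤ t1) (h2 : t2 ≤ T) :
    ContinuousOn (fun z : ℝ² => u z.1 (z.2 * s z.1)) (Icc t1 t2 ×ˢ Icc 0 1) :=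
  h.uc.comp ((h.mapC h1 h2).mono (prod_mono le_rfl (subset_univ _))) fun z hz =>
    ⟨⟨h1.trans hz.1.1, hz.1.2.trans h2⟩, h.ysm ⟨h1.trans hz.1.1, hz.1.2.trans h2⟩ hz.2⟩

lemma Sl.ID0 (h : Sl ε p T s u q r) (d0 : ∀ x, HasDerivAt ψ (ψ1 x) x) (d1 : ∀ x, HasDerivAt ψ1 (ψ2 x) x) (c2 : Continuous ψ2)
    {t1 t2 : ℝ} (h1 : 0 < t1) (h12 : t1 ≤ t2) (h2 : t2 < T) :
    (∫ y in ⓪..1, s t2 * (ψ (y * s t2) * u t2 (y * s t2))) - ∫ y in ⓪..1, s t1 * (ψ (y * s t1) * u t1 (y * s t1)) =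
    ∫ t in t1..t2, (ψ (s t) * q t (s t) + ψ 0 * u t 0 ^ p + ψ1 0 * u t 0 + ∫ y in ⓪..1, s t * (ψ2 (y * s t) * u t (y * s t))) := by
  have cψ : Continuous ψ := continuous_iff_continuousAt.2 fun x => (d0 x).continuousAt
  have cψ1 : Continuous ψ1 := continuous_iff_continuousAt.2 fun x => (d1 x).continuousAt
  have tI : ∀ t ∈ Icc t1 t2, t ∈ Ioo 0 T := fun t ht => ⟨h1.trans_le ht.1, ht.2.trans_lt h2⟩
  have uC := h.uyC h1.le h2.le
  have sC : ContinuousOn (fun z : ℝ² => s z.1) (Icc t1 t2 ×ˢ Icc 0 1) := h.sc.comp continuousOn_fst fun z hz => ⟨(tI _ hz.1).1.le, (tI _ hz.1).2.le⟩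
  have fC : ∀ {f : ℝ → ℝ}, Continuous f → ContinuousOn (fun z : ℝ² => f (z.2 * s z.1)) (Icc t1 t2 ×ˢ Icc 0 1) := fun hf =>
    (h.scC h1.le h2.le hf).mono (prod_mono le_rfl (subset_univ _))
  have qC : ContinuousOn (fun z : ℝ² => q z.1 (z.2 * s z.1)) (Icc t1 t2 ×ˢ Icc 0 1) :=
    h.qc.comp ((h.mapC h1.le h2.le).mono (prod_mono le_rfl (subset_univ _))) fun z hz =>
      ⟨⟨(tI _ hz.1).1, (tI _ hz.1).2.le⟩, h.ysm ⟨(tI _ hz.1).1.le, (tI _ hz.1).2.le⟩ hz.2⟩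
  have sdC : ContinuousOn (fun z : ℝ² => -q z.1 (s z.1) + ε) (Icc t1 t2 ×ˢ Icc 0 1) := by
    have : ContinuousOn (fun z : ℝ² => q z.1 (s z.1)) (Icc t1 t2 ×ˢ Icc 0 1) := h.qc.comp (continuousOn_fst.prodMk sC) fun z hz =>
      ⟨⟨(tI _ hz.1).1, (tI _ hz.1).2.le⟩, (h.sp _ ⟨(tI _ hz.1).1.le, (tI _ hz.1).2.le⟩).le, le_rfl⟩
    exact this.neg.add continuousOn_const
  have io : Icc t1 t2 ×ˢ Ioo ⓪ 1 ⊆ Icc t1 t2 ×ˢ Icc 0 1 := prod_mono le_rfl Ioo_subset_Icc_self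
  have rC : ContinuousOn (fun z : ℝ² => r z.1 (z.2 * s z.1)) (Icc t1 t2 ×ˢ Ioo 0 1) :=
    h.rc.comp ((h.mapC h1.le h2.le).mono (prod_mono le_rfl (subset_univ _))) fun z hz => by
      have hs := h.sp _ ⟨(tI _ hz.1).1.le, (tI _ hz.1).2.le⟩
      exact ⟨⟨(tI _ hz.1).1, (tI _ hz.1).2.le⟩, mul_pos hz.2.1 hs, by nlinarith [hz.2.2]⟩
  have := GRN (G := fun t y => s t * (ψ (y * s t) * u t (y * s t)))
    (H := fun t y => y * (-q t (s t) + ε) * (ψ (y * s t) * u t (y * s t)) + ψ (y * s t) * q t (y * s t) - ψ1 (y * s t) * u t (y * s t))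
    (Q := fun t y => s t * (ψ2 (y * s t) * u t (y * s t)))
    (Gt := fun t y => (-q t (s t) + ε) * (ψ (y * s t) * u t (y * s t)) + s t * ((ψ1 (y * s t) * (y * (-q t (s t) + ε))) * u t (y * s t)
      + ψ (y * s t) * (r t (y * s t) + q t (y * s t) * (y * (-q t (s t) + ε)))))
    h12 (sC.mul ((fC cψ).mul uC)) ((((continuousOn_snd.mul sdC).mul ((fC cψ).mul uC)).add ((fC cψ).mul qC)).sub ((fC cψ1).mul uC))
    (sC.mul ((fC c2).mul uC))
    (((sdC.mono io).mul (((fC cψ).mono io).mul (uC.mono io))).add ((sC.mono io).mul (((((fC cψ1).mono io).mul (continuousOn_snd.mul (sdC.mono io))).mul (uC.mono io)).add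
      (((fC cψ).mono io).mul (rC.add ((qC.mono io).mul (continuousOn_snd.mul (sdC.mono io))))))))
    (fun t ht y hy => by
      have hd : HasDerivAt s (-q t (s t) + ε) t := h.sd t ⟨(tI t ht).1, (tI t ht).2.le⟩
      exact hd.mul (((d0 _).comp t (hd.const_mul y)).mul (h.joint (tI t ht) hy)))
    (fun t ht y hy => by
      have ht' : t ∈ Ioc 0 T := ⟨(tI t ht).1, (tI t ht).2.le⟩
      have hs := h.sp t (Ioc_Icc ht')
      have hx : y * s t ∈ Ioo 0 (s t) := ⟨mul_pos hy.1 hs, by nlinarith [hy.2]⟩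
      have hl : HasDerivAt (fun y => y * s t) (1 * s t) y := (hasDerivAt_id y).mul_const (s t)
      have a0 := (d0 (y * s t)).comp y hl
      have a1 := (d1 (y * s t)).comp y hl
      have a2 := (h.ux t ht' _ hx).comp y hl
      have a3 := (h.uxx t ht' _ hx).comp y hl
      refine ((((hasDerivAt_id y).mul_const (-q t (s t) + ε)).mul (a0.mul a2)).add (a0.mul a3)|>.sub (a1.mul a2)).congr_deriv ?_
      simp only [Pi.mul_apply, Function.comp_apply, id]
      ring)
  rw [this]
  refine intervalIntegral.integral_congr fun t ht => ?_
  rw [uIcc_of_le h12] at ht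
  simp only [one_mul, zero_mul, h.bs t ⟨(tI t ht).1.le, (tI t ht).2.le⟩, h.b0 t ⟨(tI t ht).1, (tI t ht).2.le⟩]
  ring

lemma Sl.scl (h : Sl ε p T s u q r) {t : ℝ} (f : ℝ → ℝ) :
    ∫ y in ⓪..1, s t * (f (y * s t) * u t (y * s t)) = ∫ x in ⓪..(s t), f x * u t x := by
  rw [intervalIntegral.integral_const_mul]
  have := intervalIntegral.mul_integral_comp_mul_right (f := fun x => f x * u t x) (a := 0) (b := 1) (s t)
  simpa using this

lemma Sl.intC (h : Sl ε p T s u q r) {f : ℝ → ℝ} (hf : Continuous f) : ContinuousOn (fun t => ∫ x in ⓪..(s t), f x * u t x) (Icc 0 T) := by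
  have := parC (G := fun t y => s t * (f (y * s t) * u t (y * s t))) h.T0.le zero_le_one
    ((h.sc.comp continuousOn_fst fun z hz => hz.1).mul (((h.scC le_rfl le_rfl hf).mono (prod_mono le_rfl (subset_univ _))).mul (h.uyC le_rfl le_rfl)))
  exact this.congr fun t _ => (h.scl f).symm

lemma ftc_ext {A B : ℝ → ℝ} {T : ℝ} (hA : ContinuousOn A (Icc 0 T)) (hB : ContinuousOn B (Icc 0 T))
    (h : ∀ t1 t2, 0 < t1 → t1 ≤ t2 → t2 < T → A t2 - A t1 = ∫ t in t1..t2, B t) {t1 t2 : ℝ} (h1 : 0 ≤ t1) (h12 : t1 ≤ t2) (h2 : t2 ≤ T) :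
    A t2 - A t1 = ∫ t in t1..t2, B t := by
  have ss : Icc t1 t2 ⊆ Icc 0 T := Icc_subset_Icc h1 h2
  symm
  refine intervalIntegral.integral_eq_sub_of_hasDerivAt_of_le h12 (hA.mono ss) (fun t ht => ?_) (ContinuousOn.intervalIntegrable (by rw [uIcc_of_le h12]; exact hB.mono ss))
  have t0 : 0 < t := h1.trans_lt ht.1
  have tT : t < T := ht.2.trans_le h2
  have D : HasDerivAt (fun v => ∫ τ in (t / 2)..v, B τ) (B t) t := by
    refine intervalIntegral.integral_hasDerivAt_right (ContinuousOn.intervalIntegrable (hB.mono ?_)) ?_ (hB.continuousAt (Icc_mem_nhds t0 tT))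
    · rw [uIcc_of_le ♮]; exact Icc_subset_Icc ♮ ♮
    · exact ContinuousOn.stronglyMeasurableAtFilter_nhdsWithin (s := Ioo 0 T) (hB.mono Ioo_subset_Icc_self) measurableSet_Ioo t |>.filter_mono (by
        rw [isOpen_Ioo.nhdsWithin_eq ⟨t0, tT⟩])
  refine (D.const_add (A (t / 2))).congr_of_eventuallyEq ?_
  filter_upwards [Ioo_mem_nhds (show t / 2 < t by linarith) tT] with v hv
  linarith [h (t / 2) v ♮ hv.1.le hv.2]

lemma Sl.ID (h : Sl ε p T s u q r) (hp : 1 < p) (dΨ : ∀ x, HasDerivAt Ψ (ψ x) x) (d0 : ∀ x, HasDerivAt ψ (ψ1 x) x) (d1 : ∀ x, HasDerivAt ψ1 (ψ2 x) x) (c2 : Continuous ψ2)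
    {t1 t2 : ℝ} (h1 : 0 ≤ t1) (h12 : t1 ≤ t2) (h2 : t2 ≤ T) :
    ((∫ x in ⓪..(s t2), ψ x * u t2 x) + Ψ (s t2)) - ((∫ x in ⓪..(s t1), ψ x * u t1 x) + Ψ (s t1)) =
    ∫ t in t1..t2, (ψ 0 * u t 0 ^ p + ψ1 0 * u t 0 + (∫ x in ⓪..(s t), ψ2 x * u t x) + ε * ψ (s t)) := by
  have cψ : Continuous ψ := continuous_iff_continuousAt.2 fun x => (d0 x).continuousAt
  have cΨ : Continuous Ψ := continuous_iff_continuousAt.2 fun x => (dΨ x).continuousAt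
  have c0p : ContinuousOn (fun t => u t 0 ^ p) (Icc 0 T) := h.c0.rpow_const fun t _ => Or.inr ♮
  refine ftc_ext (A := fun t => (∫ x in ⓪..(s t), ψ x * u t x) + Ψ (s t)) ((h.intC cψ).add (cΨ.comp_continuousOn h.sc))
    ((((continuousOn_const.mul c0p).add (continuousOn_const.mul h.c0)).add (h.intC c2)).add (continuousOn_const.mul (cψ.comp_continuousOn h.sc))) ?_ h1 h12 h2
  intro t1 t2 h1 h12 h2
  have I := h.ID0 d0 d1 c2 h1 h12 h2
  simp only [h.scl] at I
  have ss : Icc t1 t2 ⊆ Ioc 0 T := fun t ht => ⟨h1.trans_le ht.1, ht.2.trans h2.le⟩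
  have qC : ContinuousOn (fun t => q t (s t)) (Icc t1 t2) := h.qc.comp (f := fun t => (t, s t)) (continuousOn_id.prodMk (h.sc.mono (ss.trans Ioc_subset_Icc_self)))
    fun t ht => ⟨ss ht, (h.sp t (Ioc_Icc (ss ht))).le, le_rfl⟩
  have m := fun {f : ℝ → ℝ} (hf : ContinuousOn f (Icc 0 T)) => hf.mono (ss.trans Ioc_subset_Icc_self)
  have J : ∫ t in t1..t2, ψ (s t) * (-q t (s t) + ε) = Ψ (s t2) - Ψ (s t1) := by
    refine intervalIntegral.integral_eq_sub_of_hasDerivAt_of_le (f := fun t => Ψ (s t)) h12 (m (cΨ.comp_continuousOn h.sc)) (fun t ht => (dΨ _).comp t (h.sd t (ss (Ioo_subset_Icc_self ht)))) ?_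
    refine ContinuousOn.intervalIntegrable ?_
    rw [uIcc_of_le h12]
    exact (m (cψ.comp_continuousOn h.sc)).mul (qC.neg.add continuousOn_const)
  have K := intervalIntegral.integral_add (μ := volume) (a := t1) (b := t2) (f := fun t => ψ (s t) * q t (s t) + ψ 0 * u t 0 ^ p + ψ1 0 * u t 0 + ∫ x in ⓪..(s t), ψ2 x * u t x)
    (g := fun t => ψ (s t) * (-q t (s t) + ε))
    (ContinuousOn.intervalIntegrable (by
      rw [uIcc_of_le h12]
      exact ((((m (cψ.comp_continuousOn h.sc)).mul qC).add (continuousOn_const.mul (m c0p))).add (continuousOn_const.mul (m h.c0))).add (m (h.intC c2))))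
    (ContinuousOn.intervalIntegrable (by
      rw [uIcc_of_le h12]
      exact (m (cψ.comp_continuousOn h.sc)).mul (qC.neg.add continuousOn_const)))
  rw [← I, J] at K
  have E : ∀ t, ψ (s t) * q t (s t) + ψ 0 * u t 0 ^ p + ψ1 0 * u t 0 + (∫ x in ⓪..(s t), ψ2 x * u t x) + ψ (s t) * (-q t (s t) + ε)
    = ψ 0 * u t 0 ^ p + ψ1 0 * u t 0 + (∫ x in ⓪..(s t), ψ2 x * u t x) + ε * ψ (s t) := fun t => by ring
  simp only [E] at K
  simp only [Pi.add_apply, Pi.mul_apply, Function.comp_apply]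
  rw [K]; ring

end

lemma gron {D : ℝ → ℝ} {T C ε : ℝ} (hε : 0 ≤ ε) (hD : ContinuousOn D (Icc 0 T))
    (h : ∀ t ∈ Icc 0 T, D t - D 0 ≤ ∫ τ in ⓪..t, (C ^ 2 * D τ + ε)) : ∀ t ∈ Icc 0 T, D t ≤ exp (C ^ 2 * t) * (D 0 + ε * t) := by
  intro t ht
  have hT : 0 ≤ T := ht.1.trans ht.2
  have cg : ContinuousOn (fun τ => C ^ 2 * D τ + ε) (Icc 0 T) := (continuousOn_const.mul hD).add continuousOn_const
  obtain ⟨F, hF⟩ : ∃ F : ℝ → ℝ, F = fun t => D 0 + ∫ τ in ⓪..t, (C ^ 2 * D τ + ε) := ◇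
  have hF0 : F 0 = D 0 := by simp [hF]
  have hDF : ∀ t ∈ Icc 0 T, D t ≤ F t := fun t ht => by rw [hF]; linarith [h t ht]
  have cF : ContinuousOn F (Icc 0 T) := by
    rw [hF]
    have := intervalIntegral.continuousOn_primitive_interval (f := fun τ => C ^ 2 * D τ + ε) (μ := volume) (a := 0) (b := T)
      (by rw [uIcc_of_le hT]; exact cg.integrableOn_Icc)
    rw [uIcc_of_le hT] at this
    exact continuousOn_const.add this
  have dF : ∀ t ∈ Ioo 0 T, HasDerivAt F (C ^ 2 * D t + ε) t := fun t ht => by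
    rw [hF]
    refine HasDerivAt.const_add _ (intervalIntegral.integral_hasDerivAt_right ?_ ?_ ?_)
    · exact (cg.mono (Icc_subset_Icc le_rfl ht.2.le)).intervalIntegrable_of_Icc ht.1.le
    · exact (cg.mono Ioo_subset_Icc_self).stronglyMeasurableAtFilter isOpen_Ioo t ht
    · exact cg.continuousAt (Icc_mem_nhds ht.1 ht.2)
  have dG : ∀ t ∈ Ioo 0 T, HasDerivAt (fun t => exp (-(C ^ 2 * t)) * F t - ε * t)
      (exp (-(C ^ 2 * t)) * (-(C ^ 2)) * F t + exp (-(C ^ 2 * t)) * (C ^ 2 * D t + ε) - ε) t := fun t ht => by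
    have e := (((hasDerivAt_id t).const_mul (C ^ 2)).neg).exp
    refine ((e.mul (dF t ht)).sub ((hasDerivAt_id t).const_mul ε)).congr_deriv ?_
    simp
  have anti := antitoneOn_of_deriv_nonpos (f := fun t => exp (-(C ^ 2 * t)) * F t - ε * t) (convex_Icc 0 T)
    (((Continuous.continuousOn ♯).mul cF).sub (Continuous.continuousOn ♯))
    (fun t ht => by rw [interior_Icc] at ht; exact (dG t ht).differentiableAt.differentiableWithinAt)
    (fun t ht => by
      rw [interior_Icc] at ht
      rw [(dG t ht).deriv]
      have e1 : exp (-(C ^ 2 * t)) ≤ 1 := exp_le_one_iff.2 (by have := ht.1; have := mul_nonneg (sq_nonneg C) this.le; linarith)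
      have e0 := exp_pos (-(C ^ 2 * t))
      have a1 := hDF t ⟨ht.1.le, ht.2.le⟩
      have : 0 ≤ exp (-(C ^ 2 * t)) * C ^ 2 * (F t - D t) := by have := sub_nonneg.2 a1; positivity
      nlinarith [mul_nonneg hε (sub_nonneg.2 e1)])
  have := anti ⟨le_rfl, hT⟩ ht ht.1
  simp [hF0] at this
  have e : exp (C ^ 2 * t) * exp (-(C ^ 2 * t)) = 1 := by rw [← exp_add]; simp
  calc D t ≤ F t := hDF t ht
    _ = exp (C ^ 2 * t) * (exp (-(C ^ 2 * t)) * F t) := by rw [← mul_assoc, e, one_mul]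
    _ ≤ _ := mul_le_mul_of_nonneg_left ♮ (exp_pos _).le

lemma WM {a b : ℝ} {f g w1 w2 : ℝ → ℝ} (ha : 0 ≤ a) (hab : a ≤ b) (cf : ContinuousOn f (Icc 0 a)) (cg : ContinuousOn g (Icc 0 b))
    (c1 : Continuous w1) (c2 : Continuous w2) (hfg : ∀ x ∈ Icc 0 a, f x ≤ g x) (hg : ∀ x ∈ Icc 0 b, 0 ≤ g x) (hw : ∀ x ∈ Icc 0 b, w1 x ≤ w2 x) :
    (∫ x in ⓪..b, w1 x * g x) - (∫ x in ⓪..a, w1 x * f x) ≤ (∫ x in ⓪..b, w2 x * g x) - ∫ x in ⓪..a, w2 x * f x := by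
  have iw : ∀ w : ℝ → ℝ, Continuous w → (∫ x in ⓪..b, w x * g x) - (∫ x in ⓪..a, w x * f x) =
      (∫ x in ⓪..a, w x * (g x - f x)) + ∫ x in a..b, w x * g x := fun w cw => by
    have i1 : IntervalIntegrable (fun x => w x * g x) volume 0 a :=
      (cw.continuousOn.mul (cg.mono (Icc_subset_Icc le_rfl hab))).intervalIntegrable_of_Icc ha
    have i2 : IntervalIntegrable (fun x => w x * g x) volume a b :=
      (cw.continuousOn.mul (cg.mono (Icc_subset_Icc ha le_rfl))).intervalIntegrable_of_Icc hab
    have i3 : IntervalIntegrable (fun x => w x * f x) volume 0 a := (cw.continuousOn.mul cf).intervalIntegrable_of_Icc ha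
    rw [← intervalIntegral.integral_add_adjacent_intervals i1 i2]
    simp only [mul_sub]
    rw [intervalIntegral.integral_sub i1 i3]; ring
  rw [iw _ c1, iw _ c2]
  refine add_le_add (intervalIntegral.integral_mono_on ha ?_ ?_ fun x hx => ?_) (intervalIntegral.integral_mono_on hab ?_ ?_ fun x hx => ?_)
  · exact (c1.continuousOn.mul ((cg.mono (Icc_subset_Icc le_rfl hab)).sub cf)).intervalIntegrable_of_Icc ha
  · exact (c2.continuousOn.mul ((cg.mono (Icc_subset_Icc le_rfl hab)).sub cf)).intervalIntegrable_of_Icc ha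
  · exact mul_le_mul_of_nonneg_right (hw x ⟨hx.1, hx.2.trans hab⟩) (sub_nonneg.2 (hfg x hx))
  · exact (c1.continuousOn.mul (cg.mono (Icc_subset_Icc ha le_rfl))).intervalIntegrable_of_Icc hab
  · exact (c2.continuousOn.mul (cg.mono (Icc_subset_Icc ha le_rfl))).intervalIntegrable_of_Icc hab
  · exact mul_le_mul_of_nonneg_right (hw x ⟨ha.trans hx.1, hx.2⟩) (hg x ⟨ha.trans hx.1, hx.2⟩)

lemma expd (C x : ℝ) : HasDerivAt (fun x => exp (-(C * x))) (-C * exp (-(C * x))) x := by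
  refine (((hasDerivAt_id x).const_mul C).neg.exp).congr_deriv ?_; simp; ring

section
variable {ε p T N : ℝ} {s1 s2 : ℝ → ℝ} {u1 q1 r1 u2 q2 r2 : ℝ → ℝ → ℝ}

lemma DEP (hp : 1 < p) (h1 : Sl 0 p T s1 u1 q1 r1) (h2 : Sl ε p T s2 u2 q2 r2) (hε : 0 ≤ ε) (hN : 0 < N)
    (os : ∀ t ∈ Icc 0 T, s1 t ≤ s2 t) (ou : ∀ t ∈ Icc 0 T, ∀ x ∈ Icc 0 (s1 t), u1 t x ≤ u2 t x) (hu : ∀ t ∈ Icc 0 T, u2 t 0 ≤ N) :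
    ∀ t ∈ Icc 0 T, ((∫ x in ⓪..(s2 t), u2 t x) - ∫ x in ⓪..(s1 t), u1 t x) + (s2 t - s1 t) ≤
      exp (p * N ^ (p - 1) * s2 t) * (exp ((p * N ^ (p - 1)) ^ 2 * t) *
      (((∫ x in ⓪..(s2 0), u2 0 x) - ∫ x in ⓪..(s1 0), u1 0 x) + (s2 0 - s1 0) + ε * t)) := by
  obtain ⟨C, hC⟩ : ∃ C, C = p * N ^ (p - 1) := ◇
  have C0 : 0 < C := by rw [hC]; have := rpow_pos_of_pos hN (p - 1); positivity
  rw [← hC]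
  obtain ⟨ψ, hψ⟩ : ∃ ψ : ℝ → ℝ, ψ = fun x => exp (-(C * x)) := ◇
  obtain ⟨Ψ, hΨ⟩ : ∃ Ψ : ℝ → ℝ, Ψ = fun x => -(1 / C) * exp (-(C * x)) := ◇
  have dψ : ∀ x, HasDerivAt ψ (-C * ψ x) x := fun x => by rw [hψ]; exact expd C x
  have dΨ : ∀ x, HasDerivAt Ψ (ψ x) x := fun x => by
    rw [hΨ, hψ]; refine ((expd C x).const_mul _).congr_deriv ?_; field_simp
  have cψ : Continuous ψ := by rw [hψ]; fun_prop
  have d1 : ∀ x, HasDerivAt (fun x => -C * ψ x) (C ^ 2 * ψ x) x := fun x => ((dψ x).const_mul (-C)).congr_deriv (by ring)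
  have ψ1 : ∀ x, 0 ≤ x → ψ x ≤ 1 := fun x hx => by rw [hψ]; exact exp_le_one_iff.2 (by have := mul_nonneg C0.le hx; linarith)
  have ψ0 : ∀ x, 0 < ψ x := fun x => by rw [hψ]; exact exp_pos _
  have ψa : Antitone ψ := fun x y hxy => by rw [hψ]; exact exp_le_exp.2 (by have := mul_le_mul_of_nonneg_left hxy C0.le; linarith)
  have mv : ∀ a b, 0 ≤ a → a ≤ b → ψ b * (b - a) ≤ Ψ b - Ψ a ∧ Ψ b - Ψ a ≤ b - a := fun a b ha hab => by
    rcases hab.eq_or_lt with rfl | hab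
    · simp
    obtain ⟨c, hc, e⟩ := exists_hasDerivAt_eq_slope Ψ ψ hab (fun x _ => (dΨ x).continuousAt.continuousWithinAt) fun x _ => dΨ x
    have hb : 0 < b - a := ♮
    have e2 : Ψ b - Ψ a = ψ c * (b - a) := by rw [e]; field_simp
    rw [e2]
    exact ⟨mul_le_mul_of_nonneg_right (ψa hc.2.le) hb.le, by nlinarith [ψ1 c (ha.trans hc.1.le)]⟩
  obtain ⟨D, hD⟩ : ∃ D : ℝ → ℝ, D = fun t => ((∫ x in ⓪..(s2 t), ψ x * u2 t x) + Ψ (s2 t)) - ((∫ x in ⓪..(s1 t), ψ x * u1 t x) + Ψ (s1 t)) := ◇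
  have cΨ : Continuous Ψ := by rw [hΨ]; fun_prop
  have cD : ContinuousOn D (Icc 0 T) := by
    rw [hD]
    exact ((h2.intC cψ).add (cΨ.comp_continuousOn h2.sc)).sub ((h1.intC cψ).add (cΨ.comp_continuousOn h1.sc))
  have cB : ∀ {ε s u q r}, Sl ε p T s u q r → ContinuousOn (fun t => ψ 0 * u t 0 ^ p + -C * ψ 0 * u t 0 + (∫ x in ⓪..(s t), C ^ 2 * ψ x * u t x) + ε * ψ (s t)) (Icc 0 T) :=
    fun h => (((continuousOn_const.mul (h.c0.rpow_const fun x _ => Or.inr ♮)).add (continuousOn_const.mul h.c0)).add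
      (h.intC (f := fun x => C ^ 2 * ψ x) ♯)).add (continuousOn_const.mul (cψ.comp_continuousOn h.sc))
  have e0 : ψ 0 = 1 := by simp [hψ]
  have key : ∀ t ∈ Icc 0 T, D t - D 0 ≤ ∫ τ in ⓪..t, (C ^ 2 * D τ + ε) := fun t ht => by
    have ss : Icc 0 t ⊆ Icc 0 T := Icc_subset_Icc le_rfl ht.2
    have i1 := h1.ID hp dΨ dψ d1 ♯ le_rfl ht.1 ht.2
    have i2 := h2.ID hp dΨ dψ d1 ♯ le_rfl ht.1 ht.2
    simp only [hD]
    rw [sub_sub_sub_comm, i2, i1, ← intervalIntegral.integral_sub (((cB h2).mono ss).intervalIntegrable_of_Icc ht.1) (((cB h1).mono ss).intervalIntegrable_of_Icc ht.1)]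
    simp only [hD] at cD
    refine intervalIntegral.integral_mono_on ht.1 ((((cB h2).sub (cB h1)).mono ss).intervalIntegrable_of_Icc ht.1)
      ((((continuousOn_const.mul cD).add continuousOn_const).mono ss).intervalIntegrable_of_Icc ht.1) fun τ hτ => ?_
    have hτ := ss hτ
    have p1 := h1.sp τ hτ
    have p2 := h2.sp τ hτ
    have rl := rpow_lip hp (h1.u0 τ hτ 0 ⟨le_rfl, p1.le⟩) (ou τ hτ 0 ⟨le_rfl, p1.le⟩) (hu τ hτ)
    rw [← hC] at rl
    have m := (mv _ _ p1.le (os τ hτ)).1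
    have m2 : 0 ≤ ψ (s2 τ) * (s2 τ - s1 τ) := mul_nonneg (ψ0 _).le (sub_nonneg.2 (os τ hτ))
    have ep : ε * ψ (s2 τ) ≤ ε := mul_le_of_le_one_right hε (ψ1 _ p2.le)
    simp only [e0, mul_assoc, intervalIntegral.integral_const_mul, hD]
    nlinarith [mul_le_mul_of_nonneg_left (m2.trans m) (sq_nonneg C)]
  intro t ht
  have g := gron hε cD key t ht
  have T0 : ⓪ ∈ Icc 0 T := ⟨le_rfl, h1.T0.le⟩
  have lo : ψ (s2 t) * (((∫ x in ⓪..(s2 t), u2 t x) - ∫ x in ⓪..(s1 t), u1 t x) + (s2 t - s1 t)) ≤ D t := by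
    have := WM (w1 := fun _ => ψ (s2 t)) (h1.sp t ht).le (os t ht) (h1.cu ht) (h2.cu ht) continuous_const cψ (ou t ht) (h2.u0 t ht) (fun x hx => ψa hx.2)
    simp only [intervalIntegral.integral_const_mul] at this
    rw [hD]
    linarith [(mv _ _ (h1.sp t ht).le (os t ht)).1]
  have up : D 0 ≤ ((∫ x in ⓪..(s2 0), u2 0 x) - ∫ x in ⓪..(s1 0), u1 0 x) + (s2 0 - s1 0) := by
    have := WM (w2 := fun _ => 1) (h1.sp 0 T0).le (os 0 T0) (h1.cu T0) (h2.cu T0) cψ continuous_const (ou 0 T0) (h2.u0 0 T0) (fun x hx => ψ1 x hx.1)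
    simp only [one_mul] at this
    rw [hD]
    linarith [(mv _ _ (h1.sp 0 T0).le (os 0 T0)).2]
  have e : exp (C * s2 t) * ψ (s2 t) = 1 := by rw [hψ]; simp only []; rw [← exp_add]; simp
  calc _ = exp (C * s2 t) * (ψ (s2 t) * (((∫ x in ⓪..(s2 t), u2 t x) - ∫ x in ⓪..(s1 t), u1 t x) + (s2 t - s1 t))) := by
        rw [← mul_assoc, e, one_mul]
    _ ≤ _ := mul_le_mul_of_nonneg_left (lo.trans (g.trans (mul_le_mul_of_nonneg_left ♮ (exp_pos _).le))) (exp_pos _).le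
end

lemma Sl.bdd {ε p T : ℝ} {s : ℝ → ℝ} {u q r : ℝ → ℝ → ℝ} (h : Sl ε p T s u q r) : ∃ M, 0 < M ∧ ∀ t ∈ Icc 0 T, ∀ x ∈ Icc 0 (s t), u t x ≤ M := by
  obtain ⟨M, hM⟩ := (Reg_compact (t0 := 0) (t1 := T) (l := fun _ => 0) continuousOn_const h.sc).bddAbove_image (f := fun z : ℝ² => u z.1 z.2) h.uc
  exact ⟨max M 1, ♭, fun t ht x hx => (hM (mem_image_of_mem _ (show (t, x) ∈ Reg 0 T ◈ s from ⟨ht, hx⟩))).trans (le_max_left _ _)⟩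

section
variable {ε ε1 ε2 p T N : ℝ} {s s1 s2 : ℝ → ℝ} {u q r u1 q1 r1 u2 q2 r2 : ℝ → ℝ → ℝ}

lemma CMP (hp : 1 < p) (h1 : Sl ε1 p T s1 u1 q1 r1) (h2 : Sl ε2 p T s2 u2 q2 r2) (os : ∀ t ∈ Icc 0 T, s1 t ≤ s2 t)
    (oi : ∀ x ∈ Icc 0 (s1 0), u1 0 x ≤ u2 0 x) : ∀ t ∈ Icc 0 T, ∀ x ∈ Icc 0 (s1 t), u1 t x ≤ u2 t x := by
  obtain ⟨N, hN, hu⟩ := h1.bdd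
  have := MPL (t0 := 0) (t1 := T) (C := p * N ^ (p - 1)) (l := fun _ => 0) (r := s1) (w := fun t x => u1 t x - u2 t x) continuousOn_const h1.sc
    (h1.uc.sub (h2.uc.mono fun z hz => ⟨hz.1, hz.2.1, hz.2.2.trans (os _ hz.1)⟩)) (fun x hx => by linarith [oi x hx])
    (fun t ht x hx hw => by
      have hx2 : x ∈ Ioo 0 (s2 t) := ⟨hx.1, hx.2.trans_le (os t (Ioc_Icc ht))⟩
      refine ⟨r1 t x - r2 t x, r1 t x - r2 t x, fun y => q1 t y - q2 t y, (h1.ut t ht x hx).sub (h2.ut t ht x hx2),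
        by filter_upwards [h1.uev ht hx, h2.uev ht hx2] with y hy hy2 using hy.sub hy2, (h1.uxx t ht x hx).sub (h2.uxx t ht x hx2), ?_⟩
      have : 0 ≤ p * N ^ (p - 1) * (u1 t x - u2 t x) := by have := rpow_pos_of_pos hN (p - 1); positivity
      linarith)
    (fun t ht _ hw => ⟨_, (h1.d0 ht).sub (h2.d0 ht), by
      have p1 := h1.sp t (Ioc_Icc ht)
      have := rpow_lip hp (h2.u0 t (Ioc_Icc ht) 0 ⟨le_rfl, (h2.sp t (Ioc_Icc ht)).le⟩) (sub_pos.1 hw).le (hu t (Ioc_Icc ht) 0 ⟨le_rfl, p1.le⟩)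
      linarith⟩)
    (fun t ht _ => by
      have p1 := h1.sp t (Ioc_Icc ht)
      rw [h1.bs t (Ioc_Icc ht)]; linarith [h2.u0 t (Ioc_Icc ht) (s1 t) ⟨p1.le, os t (Ioc_Icc ht)⟩])
  intro t ht x hx
  linarith [this t ht x hx]

lemma SO (hp : 1 < p) (h1 : Sl 0 p T s1 u1 q1 r1) (h2 : Sl ε p T s2 u2 q2 r2) (hε : 0 < ε) (o0 : s1 0 < s2 0)
    (oi : ∀ x ∈ Icc 0 (s1 0), u1 0 x ≤ u2 0 x) : ∀ t ∈ Icc 0 T, s1 t < s2 t := by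
  by_contra! hcon
  obtain ⟨t', ht', hc'⟩ := hcon
  obtain ⟨τ, hτ, hl⟩ := (IsCompact.of_isClosed_subset (isCompact_Icc (a := 0) (b := T))
    (isClosed_Icc.isClosed_le h2.sc h1.sc) (fun x hx => hx.1)).exists_isLeast ⟨t', ht', hc'⟩
  have lt : ∀ t, 0 ≤ t → t < τ → s1 t < s2 t := fun t h0 hlt => by
    by_contra! hh
    exact absurd (hl ⟨⟨h0, hlt.le.trans hτ.1.2⟩, hh⟩) (not_le.2 hlt)
  have τ0 : 0 < τ := by
    rcases hτ.1.1.eq_or_lt with h | h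
    · rw [← h] at hτ; exact absurd hτ.2 (not_le.2 o0)
    · exact h
  have hτm : τ ∈ Ioc 0 T := ⟨τ0, hτ.1.2⟩
  have le : s1 τ ≤ s2 τ := by
    refine le_of_tendsto_of_tendsto ((h1.sd τ hτm).continuousAt.continuousWithinAt (s := Iio τ)) ((h2.sd τ hτm).continuousAt.continuousWithinAt) ?_
    filter_upwards [Ioo_mem_nhdsLT τ0] with t ht using (lt t ht.1.le ht.2).le
  have eq : s2 τ = s1 τ := le_antisymm hτ.2 le
  have ou := CMP hp (h1.mono τ0 hτ.1.2) (h2.mono τ0 hτ.1.2) (fun t ht => by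
    rcases ht.2.eq_or_lt with h | h
    · rw [h]; exact le
    · exact (lt t ht.1 h).le) oi τ ⟨τ0.le, le_rfl⟩
  have p1 := h1.sp τ hτ.1
  have d2 := h2.ds hτm
  rw [eq] at d2
  have k1 := ldtw (d2.sub (h1.ds hτm)) (by
    filter_upwards [Ioo_mem_nhdsLT p1] with x hx
    have b2 := h2.bs τ hτ.1
    rw [eq] at b2
    simp only [Pi.sub_apply]
    rw [h1.bs τ hτ.1, b2]; linarith [ou x ⟨hx.1.le, hx.2.le⟩])
  have k2 := ldtw ((h2.sd τ hτm).sub (h1.sd τ hτm)).hasDerivWithinAt (by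
    filter_upwards [Ioo_mem_nhdsLT τ0] with t ht
    simp only [Pi.sub_apply]
    linarith [lt t ht.1.le ht.2])
  rw [eq] at k2
  linarith

lemma Sl.mass (h : Sl ε p T s u q r) (hp : 1 < p) {t1 t2 : ℝ} (h1 : 0 ≤ t1) (h12 : t1 ≤ t2) (h2 : t2 ≤ T) :
    ((∫ x in ⓪..(s t2), u t2 x) + s t2) - ((∫ x in ⓪..(s t1), u t1 x) + s t1) = (∫ t in t1..t2, u t 0 ^ p) + ε * (t2 - t1) := by
  have := h.ID (ψ := fun _ => 1) (ψ1 := fun _ => 0) (ψ2 := fun _ => 0) (Ψ := fun x => x) hp (fun x => hasDerivAt_id x) (fun x => hasDerivAt_const _ _) (fun x => hasDerivAt_const _ _) continuous_const h1 h12 h2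
  simp only [one_mul, zero_mul, intervalIntegral.integral_zero, add_zero, mul_one] at this
  rw [this, intervalIntegral.integral_add (((h.c0.rpow_const fun x _ => Or.inr ♮).mono (Icc_subset_Icc h1 h2)).intervalIntegrable_of_Icc h12) (by simp)]
  simp; ring

lemma Sl.int0 (h : Sl ε p T s u q r) {t : ℝ} (ht : t ∈ Icc 0 T) : 0 ≤ ∫ x in ⓪..(s t), u t x :=
  intervalIntegral.integral_nonneg (h.sp t ht).le (h.u0 t ht)

lemma Sl.intM (h : Sl ε p T s u q r) {t M : ℝ} (ht : t ∈ Icc 0 T) (hM : ∀ x ∈ Icc 0 (s t), u t x ≤ M) : ∫ x in ⓪..(s t), u t x ≤ M * s t := by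
  have := intervalIntegral.integral_mono_on (h.sp t ht).le ((h.cu ht).intervalIntegrable_of_Icc (h.sp t ht).le) (g := fun _ => M) (μ := volume) intervalIntegrable_const hM
  simpa [mul_comm] using this

/-- a-priori bound for the free boundary -/
lemma Sl.sle (h : Sl ε p T s u q r) (hp : 1 < p) {t M : ℝ} (ht : t ∈ Icc 0 T) (hM : ∀ x ∈ Icc 0 (s 0), u 0 x ≤ M) (hN : ∀ t ∈ Icc 0 T, u t 0 ≤ N) :
    s t ≤ M * s 0 + s 0 + N ^ p * t + ε * t := by
  have m := h.mass hp le_rfl ht.1 ht.2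
  have i1 := h.int0 ht
  have T0 : ⓪ ∈ Icc 0 T := ⟨le_rfl, h.T0.le⟩
  have i2 := h.intM T0 hM
  have i3 := intervalIntegral.integral_mono_on ht.1 (((h.c0.rpow_const fun x _ => Or.inr ♮).mono (Icc_subset_Icc le_rfl ht.2)).intervalIntegrable_of_Icc ht.1) (g := fun _ => N ^ p) (μ := volume) intervalIntegrable_const
    (fun τ hτ => rpow_le_rpow (h.u0 τ ⟨hτ.1, hτ.2.trans ht.2⟩ 0 ⟨le_rfl, (h.sp τ ⟨hτ.1, hτ.2.trans ht.2⟩).le⟩) (hN τ ⟨hτ.1, hτ.2.trans ht.2⟩) ♮)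
  simp at i3
  linarith

lemma eps0 {A B : ℝ} (h : ∀ ε, 0 < ε → ε ≤ 1 → A ≤ ε * B) : A ≤ 0 := by
  have : Tendsto (fun ε : ℝ => ε * B) (𝓝[>] 0) (𝓝 (0 * B)) := ((continuous_id.mul continuous_const).tendsto 0).mono_left nhdsWithin_le_nhds
  rw [zero_mul] at this
  refine ge_of_tendsto this ?_
  filter_upwards [Ioo_mem_nhdsGT one_pos] with ε hε using h ε hε.1 hε.2.le

lemma STEP {K M b τ N : ℝ} (hp : 1 < p) (hN : 0 < N)
    (ex : ∀ S, b ≤ S → ∀ ψ : ℝ → ℝ, (∀ x ∈ Icc 0 S, ∀ y ∈ Icc 0 S, |ψ x - ψ y| ≤ K * |x - y|) → (∀ x ∈ Icc 0 S, 0 ≤ ψ x ∧ ψ x ≤ M) → ψ S = 0 → ∀ ε, 0 ≤ ε → ε ≤ 1 →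
      ∃ s u q r, Sl ε p τ s u q r ∧ s 0 = S ∧ (∀ x ∈ Icc 0 S, u 0 x = ψ x) ∧ ∀ t ∈ Icc 0 τ, ∀ x ∈ Icc 0 (s t), u t x ≤ N)
    (hK : 0 ≤ K) (hT : T ≤ τ) (h1 : Sl 0 p T s1 u1 q1 r1) (h2 : Sl 0 p T s2 u2 q2 r2) (hb : b ≤ s2 0) (o0 : s1 0 ≤ s2 0)
    (oi : ∀ x ∈ Icc 0 (s1 0), u1 0 x ≤ u2 0 x) (hl : ∀ x ∈ Icc 0 (s2 0), ∀ y ∈ Icc 0 (s2 0), |u2 0 x - u2 0 y| ≤ K * |x - y|)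
    (hM : ∀ x ∈ Icc 0 (s2 0), u2 0 x ≤ M) : ∀ t ∈ Icc 0 T, s1 t ≤ s2 t := by
  intro t ht
  have T0 : ⓪ ∈ Icc 0 T := ⟨le_rfl, h1.T0.le⟩
  have p2 := h2.sp 0 T0
  obtain ⟨C, hC⟩ : ∃ C, C = p * N ^ (p - 1) := ◇
  have C0 : 0 < C := by rw [hC]; have := rpow_pos_of_pos hN (p - 1); positivity
  have M0 : 0 ≤ M := (h2.u0 0 T0 0 ⟨le_rfl, p2.le⟩).trans (hM 0 ⟨le_rfl, p2.le⟩)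
  refine sub_nonpos.1 (eps0 (B := exp (C * (M * (s2 0 + 1) + (s2 0 + 1) + N ^ p * t + 1 * t)) * (exp (C ^ 2 * t) * (1 + t))) fun ε e0 e1 => ?_)
  have mm : ∀ x, 0 ≤ x → min x (s2 0) ∈ Icc 0 (s2 0) := fun x hx => ⟨le_min hx p2.le, min_le_right _ _⟩
  obtain ⟨s, u, q, r, h, hs, hi, hu⟩ := ex (s2 0 + ε) ♮ (fun x => u2 0 (min x (s2 0)))
    (fun x hx y hy => (hl _ (mm x hx.1) _ (mm y hy.1)).trans (mul_le_mul_of_nonneg_left (by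
      have := abs_min_sub_min_le_max x (s2 0) y (s2 0)
      simpa using this) hK))
    (fun x hx => ⟨h2.u0 0 T0 _ (mm x hx.1), hM _ (mm x hx.1)⟩) (by rw [min_eq_right ♮]; exact h2.bs 0 T0) ε e0.le e1
  have h := h.mono h1.T0 hT
  have ii : ∀ x ∈ Icc 0 (s2 0), u 0 x = u2 0 x := fun x hx => by rw [hi x ⟨hx.1, by linarith [hx.2]⟩, min_eq_left hx.2]
  have hu : ∀ t ∈ Icc 0 T, u t 0 ≤ N := fun t ht => hu t ⟨ht.1, ht.2.trans hT⟩ 0 ⟨le_rfl, (h.sp t ht).le⟩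
  have g1 := SO hp h1 h e0 ♮ (fun x hx => by rw [ii x ⟨hx.1, hx.2.trans o0⟩]; exact oi x hx) t ht
  have o2 := fun t ht => (SO hp h2 h e0 ♮ (fun x hx => (ii x hx).ge) t ht).le
  have ou := CMP hp h2 h o2 (fun x hx => (ii x hx).ge)
  have d := DEP hp h2 h e0.le hN o2 ou hu t ht
  rw [← hC] at d
  have z1 : (∫ x in ⓪..(s 0), u 0 x) = ∫ x in ⓪..(s2 0), u2 0 x := by
    have j : ∀ a b, 0 ≤ a → a ≤ b → b ≤ s 0 → IntervalIntegrable (u 0) volume a b := fun a b ha hab hb =>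
      ((h.cu T0).mono (Icc_subset_Icc ha hb)).intervalIntegrable_of_Icc hab
    rw [← intervalIntegral.integral_add_adjacent_intervals (j 0 (s2 0) le_rfl p2.le (o2 0 T0)) (j (s2 0) (s 0) p2.le (o2 0 T0) le_rfl)]
    rw [intervalIntegral.integral_congr (g := u2 0) (fun x hx => by rw [uIcc_of_le p2.le] at hx; exact ii x hx),
      intervalIntegral.integral_congr (g := fun _ => 0) (a := s2 0) (fun x hx => by
        rw [uIcc_of_le (o2 0 T0)] at hx
        show u 0 x = 0
        rw [hi x ⟨p2.le.trans hx.1, hs ▸ hx.2⟩, min_eq_right hx.1, h2.bs 0 T0])]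
    simp
  have z2 : 0 ≤ (∫ x in ⓪..(s t), u t x) - ∫ x in ⓪..(s2 t), u2 t x := by
    have := WM (w1 := fun _ => 0) (w2 := fun _ => 1) (h2.sp t ht).le (o2 t ht) (h2.cu ht) (h.cu ht) continuous_const continuous_const (ou t ht) (h.u0 t ht) (fun x hx => zero_le_one)
    simpa using this
  have sl := h.sle hp ht (M := M) (fun x hx => by rw [hs] at hx; rw [hi x hx]; exact hM _ (mm x hx.1)) hu
  rw [hs] at sl
  rw [z1, hs] at d
  have t0 := ht.1
  have e2 : exp (C * s t) ≤ exp (C * (M * (s2 0 + 1) + (s2 0 + 1) + N ^ p * t + 1 * t)) := by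
    refine exp_le_exp.2 (mul_le_mul_of_nonneg_left (sl.trans ?_) C0.le)
    have := mul_le_mul_of_nonneg_left (show s2 0 + ε ≤ s2 0 + 1 by linarith) M0
    have := mul_le_mul_of_nonneg_right e1 t0
    linarith
  have : exp (C * s t) * (exp (C ^ 2 * t) * (ε + ε * t)) ≤ exp (C * (M * (s2 0 + 1) + (s2 0 + 1) + N ^ p * t + 1 * t)) * (exp (C ^ 2 * t) * (ε + ε * t)) :=
    mul_le_mul_of_nonneg_right e2 ♭
  have e3 : ∀ X Y : ℝ, ε * (X * (Y * (1 + t))) = X * (Y * (ε + ε * t)) := fun X Y => by ring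
  rw [e3]
  ring_nf at d this ⊢
  linarith

lemma ORD {K : ℝ} (hp : 1 < p) (h1 : Sl 0 p T s1 u1 q1 r1) (h2 : Sl 0 p T s2 u2 q2 r2) (o0 : s1 0 ≤ s2 0) (hK : 0 ≤ K)
    (oi : ∀ x ∈ Icc 0 (s1 0), u1 0 x ≤ u2 0 x) (hl : ∀ x ∈ Icc 0 (s2 0), ∀ y ∈ Icc 0 (s2 0), |u2 0 x - u2 0 y| ≤ K * |x - y|) :
    ∀ t ∈ Icc 0 T, s1 t ≤ s2 t ∧ ∀ x ∈ Icc 0 (s1 t), u1 t x ≤ u2 t x := by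
  have T0 : ⓪ ∈ Icc 0 T := ⟨le_rfl, h1.T0.le⟩
  obtain ⟨M, M0, hM⟩ := h2.bdd
  have hlip := LIP h2 le_rfl (K := max K (M ^ p)) (le_max_of_le_left hK) (fun t ht => (rpow_le_rpow (h2.u0 t (Ioc_Icc ht) 0 ⟨le_rfl, (h2.sp t (Ioc_Icc ht)).le⟩)
    (hM t (Ioc_Icc ht) 0 ⟨le_rfl, (h2.sp t (Ioc_Icc ht)).le⟩) ♮).trans (le_max_right _ _))
    (fun x hx y hy => (hl x hx y hy).trans (mul_le_mul_of_nonneg_right (le_max_left _ _) ◉))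
  have K0 : 0 ≤ max K (M ^ p) := le_max_of_le_left hK
  obtain ⟨τ, N, τ0, ex⟩ := EX p _ M _ hp K0 M0.le (h2.sp 0 T0)
  have ex2 : ∀ S, s2 0 ≤ S → ∀ ψ : ℝ → ℝ, (∀ x ∈ Icc 0 S, ∀ y ∈ Icc 0 S, |ψ x - ψ y| ≤ max K (M ^ p) * |x - y|) → (∀ x ∈ Icc 0 S, 0 ≤ ψ x ∧ ψ x ≤ M) → ψ S = 0 → ∀ ε, 0 ≤ ε → ε ≤ 1 →
      ∃ s u q r, Sl ε p τ s u q r ∧ s 0 = S ∧ (∀ x ∈ Icc 0 S, u 0 x = ψ x) ∧ ∀ t ∈ Icc 0 τ, ∀ x ∈ Icc 0 (s t), u t x ≤ max N 1 := fun S hS ψ a b c ε e1 e2 => by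
    obtain ⟨s, u, q, r, h, hs, hi, hu⟩ := ex S hS ψ a b c ε e1 e2
    exact ⟨s, u, q, r, h, hs, hi, fun t ht x hx => (hu t ht x hx).trans (le_max_left _ _)⟩
  have ind : ∀ n : ℕ, ∀ t ∈ Icc 0 T, t ≤ n * τ → s1 t ≤ s2 t ∧ ∀ x ∈ Icc 0 (s1 t), u1 t x ≤ u2 t x := by
    intro n
    induction n with
    | zero =>
      intro t ht h0
      have : t = 0 := le_antisymm (by simpa using h0) ht.1
      rw [this]; exact ⟨o0, oi⟩
    | succ n ih =>
      intro t ht hle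
      rcases le_or_gt t (n * τ) with h | h
      · exact ih t ht h
      have a0 : 0 ≤ n * τ := ♭
      have aT : n * τ < T := h.trans_le ht.2
      have am : n * τ ∈ Icc 0 T := ⟨a0, aT.le⟩
      obtain ⟨is, iu⟩ := ih _ am le_rfl
      push_cast at hle
      have g1 := (h1.shift a0 aT).mono (T' := t - n * τ) ♮ (by linarith [ht.2])
      have g2 := (h2.shift a0 aT).mono (T' := t - n * τ) ♮ (by linarith [ht.2])
      have S := STEP hp ♭ ex2 K0 ♮ g1 g2 (by simpa using h2.sm le_rfl T0 am a0) (by simpa using is) (by simpa using iu)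
        (by simpa using hlip _ am) (by simpa using hM _ am)
      have tm : t - n * τ ∈ Icc 0 (t - n * τ) := ⟨♮, le_rfl⟩
      have R := CMP hp g1 g2 S (by simpa using iu) _ tm
      have S := S _ tm
      simp only [sub_add_cancel] at R S
      exact ⟨S, R⟩
  intro t ht
  obtain ⟨n, hn⟩ := exists_nat_ge (t / τ)
  exact ind n t ht ((div_le_iff₀ τ0).1 hn)

lemma UNI {K : ℝ} (hp : 1 < p) (h1 : Sl 0 p T s1 u1 q1 r1) (h2 : Sl 0 p T s2 u2 q2 r2) (o0 : s1 0 = s2 0) (hK : 0 ≤ K)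
    (oi : ∀ x ∈ Icc 0 (s2 0), u1 0 x = u2 0 x) (hl : ∀ x ∈ Icc 0 (s2 0), ∀ y ∈ Icc 0 (s2 0), |u2 0 x - u2 0 y| ≤ K * |x - y|) :
    ∀ t ∈ Icc 0 T, s1 t = s2 t ∧ ∀ x ∈ Icc 0 (s2 t), u1 t x = u2 t x := by
  have a := ORD hp h1 h2 o0.le hK (fun x hx => (oi x (o0 ▸ hx)).le) hl
  have b := ORD hp h2 h1 o0.ge hK (fun x hx => (oi x hx).ge) (fun x hx y hy => by rw [o0] at hx hy; rw [oi x hx, oi y hy]; exact hl x hx y hy)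
  intro t ht
  have e := le_antisymm (a t ht).1 (b t ht).1
  exact ⟨e, fun x hx => le_antisymm ((a t ht).2 x (e ▸ hx)) ((b t ht).2 x hx)⟩
end

section
variable {p T T1 T2 t0 m s₀ : ℝ} {φ s s1 s2 : ℝ → ℝ} {u q r u1 q1 r1 u2 q2 r2 : ℝ → ℝ → ℝ}

lemma toSl (h : IsSolOn p s₀ φ T s u) (h0 : φ s₀ = 0) (hs : 0 ≤ s₀) : Sl 0 p T s u (fun t => deriv (u t)) (fun t => deriv (deriv (u t))) where
  T0 := h.T_pos
  sc := h.s_cont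
  sp := h.s_pos
  sd t ht := (h.s_diff t ht).hasDerivAt.congr_deriv (by rw [h.stefan t ht]; simp)
  ut t ht x hx := (h.ut_diff t ht x hx).hasDerivAt.congr_deriv (h.heat t ht x hx)
  ux t ht x hx := (h.ux_diff t ht x hx).hasDerivAt
  uxx t ht x hx := (h.uxx_diff t ht x hx).hasDerivAt
  rc := h.uxx_cont
  qc := h.ux_cont
  uc := h.u_cont
  u0 := h.u_nonneg
  b0 t ht := by linarith [h.bc_zero t ht]
  bs t ht := by
    rcases ht.1.eq_or_lt with e | e
    · rw [← e, h.init_s, h.init s₀ ⟨hs, le_rfl⟩, h0]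
    · exact h.bc_free t ⟨e, ht.2⟩

lemma ofSl (h : Sl 0 p T s u q r) (h0 : s 0 = s₀) (hi : ∀ x ∈ Icc 0 s₀, u 0 x = φ x) : ∃ v, IsSolOn p s₀ φ T s v := by
  obtain ⟨v, hv⟩ : ∃ v : ℝ → ℝ → ℝ, v = fun t x => if x < 0 then u t 0 + q t 0 * x else if x ≤ s t then u t x else q t (s t) * (x - s t) := ◇
  have ev : ∀ t x, 0 ≤ x → x ≤ s t → v t x = u t x := fun t x a b => by rw [hv]; simp [not_lt.2 a, b]
  have evx : ∀ t ∈ Ioc 0 T, ∀ x ∈ Ioo 0 (s t), v t =ᶠ[𝓝 x] u t := fun t ht x hx => by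
    filter_upwards [Ioo_mem_nhds hx.1 hx.2] with y hy using ev t y hy.1.le hy.2.le
  have dv : ∀ t ∈ Ioc 0 T, ∀ x ∈ Icc 0 (s t), HasDerivAt (v t) (q t x) x := fun t ht x hx => by
    have sp := h.sp t (Ioc_Icc ht)
    have lin : ∀ a b c y : ℝ, HasDerivAt (fun y => a + b * (y - c)) b y := fun a b c y =>
      ((((hasDerivAt_id y).sub_const c).const_mul b).const_add a).congr_deriv (by simp)
    rcases hx.1.eq_or_lt with e | e
    · subst e
      have d1 := (h.b0 t ht ▸ h.d0 ht : HasDerivWithinAt (u t) (q t 0) (Ici 0) 0)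
      have d1 : HasDerivWithinAt (v t) (q t 0) (Ici 0) 0 := d1.congr_of_eventuallyEq_of_mem (by
        filter_upwards [inter_mem_nhdsWithin _ (Iio_mem_nhds sp)] with y hy using ev t y hy.1 (mem_Iio.1 hy.2).le) self_mem_Ici
      have d2 : HasDerivWithinAt (v t) (q t 0) (Iic 0) 0 := (lin (u t 0) (q t 0) 0 0).hasDerivWithinAt.congr_of_eventuallyEq_of_mem (by
        filter_upwards [self_mem_nhdsWithin] with y hy
        rcases (mem_Iic.1 hy).eq_or_lt with k | k
        · rw [k, ev t 0 le_rfl sp.le]; simp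
        · rw [hv]; simp [k]) self_mem_Iic
      have := d2.union d1
      rwa [Iic_union_Ici, hasDerivWithinAt_univ] at this
    rcases hx.2.eq_or_lt with e2 | e2
    · rw [e2]
      have d1 : HasDerivWithinAt (v t) (q t (s t)) (Iic (s t)) (s t) := (h.ds ht).congr_of_eventuallyEq_of_mem (by
        filter_upwards [inter_mem_nhdsWithin _ (Ioi_mem_nhds sp)] with y hy using ev t y (mem_Ioi.1 hy.2).le hy.1) self_mem_Iic
      have d2 : HasDerivWithinAt (v t) (q t (s t)) (Ici (s t)) (s t) := (lin 0 (q t (s t)) (s t) (s t)).hasDerivWithinAt.congr_of_eventuallyEq_of_mem (by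
        filter_upwards [self_mem_nhdsWithin] with y hy
        rcases (mem_Ici.1 hy).eq_or_lt with k | k
        · rw [← k, ev t _ sp.le le_rfl, h.bs t (Ioc_Icc ht)]; simp
        · rw [hv]; simp [not_lt.2 (sp.le.trans k.le), k]) self_mem_Ici
      have := d1.union d2
      rwa [Iic_union_Ici, hasDerivWithinAt_univ] at this
    · exact (h.ux t ht x ⟨e, e2⟩).congr_of_eventuallyEq (evx t ht x ⟨e, e2⟩)
  have dvv : ∀ t ∈ Ioc 0 T, ∀ x ∈ Ioo 0 (s t), HasDerivAt (deriv (v t)) (r t x) x := fun t ht x hx =>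
    (h.uxx t ht x hx).congr_of_eventuallyEq (by filter_upwards [Ioo_mem_nhds hx.1 hx.2] with y hy using (dv t ht y ⟨hy.1.le, hy.2.le⟩).deriv)
  have dvt : ∀ t ∈ Ioc 0 T, ∀ x ∈ Ioo 0 (s t), HasDerivAt (fun τ => v τ x) (r t x) t := fun t ht x hx =>
    (h.ut t ht x hx).congr_of_eventuallyEq (by
      filter_upwards [(h.sd t ht).continuousAt.eventually (Ioi_mem_nhds hx.2)] with τ hτ using ev τ x hx.1.le (mem_Ioi.1 hτ).le)
  have ds : ∀ t ∈ Ioc 0 T, deriv s t = -q t (s t) := fun t ht => by rw [(h.sd t ht).deriv, add_zero]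
  exact ⟨v, {
    T_pos := h.T0
    s_cont := h.sc
    s_diff := fun t ht => (h.sd t ht).differentiableAt
    s_deriv_cont := ((h.qc.comp (f := fun t => (t, s t)) (continuousOn_id.prodMk (h.sc.mono Ioc_subset_Icc_self))
      fun t ht => ⟨ht, (h.sp t (Ioc_Icc ht)).le, le_rfl⟩).neg).congr ds
    s_pos := h.sp
    ut_diff := fun t ht x hx => (dvt t ht x hx).differentiableAt
    ux_diff := fun t ht x hx => (dv t ht x ⟨hx.1.le, hx.2.le⟩).differentiableAt
    uxx_diff := fun t ht x hx => (dvv t ht x hx).differentiableAt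
    ut_cont := h.rc.congr fun z hz => (dvt _ hz.1 _ hz.2).deriv
    uxx_cont := h.rc.congr fun z hz => (dvv _ hz.1 _ hz.2).deriv
    ux_cont := h.qc.congr fun z hz => (dv _ hz.1 _ hz.2).deriv
    u_cont := h.uc.congr fun z hz => ev _ _ hz.2.1 hz.2.2
    u_nonneg := fun t ht x hx => by rw [ev t x hx.1 hx.2]; exact h.u0 t ht x hx
    heat := fun t ht x hx => by rw [(dvt t ht x hx).deriv, (dvv t ht x hx).deriv]
    bc_zero := fun t ht => by
      have sp := h.sp t (Ioc_Icc ht)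
      rw [(dv t ht 0 ⟨le_rfl, sp.le⟩).deriv, h.b0 t ht, neg_neg, ev t 0 le_rfl sp.le]
    bc_free := fun t ht => by
      have sp := h.sp t (Ioc_Icc ht)
      rw [ev t _ sp.le le_rfl, h.bs t (Ioc_Icc ht)]
    stefan := fun t ht => by
      have sp := h.sp t (Ioc_Icc ht)
      rw [(dv t ht (s t) ⟨sp.le, le_rfl⟩).deriv, ds t ht]
    init := fun x hx => by rw [ev 0 x hx.1 (h0 ▸ hx.2)]; exact hi x hx
    init_s := h0 }⟩

lemma glueC {A : Set (ℝ²)} {F F1 F2 : ℝ² → ℝ} (hm : m < T1) (c1 : ContinuousOn F1 (A ∩ {z | z.1 < T1})) (c2 : ContinuousOn F2 (A ∩ {z | m < z.1}))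
    (e1 : ∀ z ∈ A, z.1 < T1 → F z = F1 z) (e2 : ∀ z ∈ A, m < z.1 → F z = F2 z) : ContinuousOn F A := by
  intro z hz
  rcases lt_or_ge z.1 T1 with h | h
  · have : ContinuousWithinAt F (A ∩ {z | z.1 < T1}) z := (c1.congr fun w hw => e1 w hw.1 hw.2) z ⟨hz, h⟩
    exact (continuousWithinAt_inter ((isOpen_lt continuous_fst continuous_const).mem_nhds h)).1 this
  · have h := hm.trans_le h
    have : ContinuousWithinAt F (A ∩ {z | m < z.1}) z := (c2.congr fun w hw => e2 w hw.1 hw.2) z ⟨hz, h⟩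
    exact (continuousWithinAt_inter ((isOpen_lt continuous_const continuous_fst).mem_nhds h)).1 this

lemma GLUE (h1 : Sl 0 p T1 s1 u1 q1 r1) (h2 : Sl 0 p T2 s2 u2 q2 r2) (a0 : 0 < t0) (a1 : t0 < T1) (a2 : T1 ≤ t0 + T2)
    (es : ∀ t ∈ Icc t0 T1, s2 (t - t0) = s1 t) (eu : ∀ t ∈ Icc t0 T1, ∀ x ∈ Icc 0 (s1 t), u2 (t - t0) x = u1 t x) :
    ∃ s u q r, Sl 0 p (t0 + T2) s u q r ∧ s 0 = s1 0 ∧ ∀ x, u 0 x = u1 0 x := by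
  obtain ⟨m, hm⟩ : ∃ m, m = (t0 + T1) / 2 := ◇
  have m1 : t0 < m := ♮
  have m2 : m < T1 := ♮
  obtain ⟨S, hS⟩ : ∃ S : ℝ → ℝ, S = fun t => if t < m then s1 t else s2 (t - t0) := ◇
  obtain ⟨V, hV⟩ : ∃ S : ℝ → ℝ → ℝ, S = fun t => if t < m then u1 t else u2 (t - t0) := ◇
  obtain ⟨Q, hQ⟩ : ∃ S : ℝ → ℝ → ℝ, S = fun t => if t < m then q1 t else q2 (t - t0) := ◇
  obtain ⟨R, hR⟩ : ∃ S : ℝ → ℝ → ℝ, S = fun t => if t < m then r1 t else r2 (t - t0) := ◇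
  have L : ∀ t, t < m → S t = s1 t ∧ V t = u1 t ∧ Q t = q1 t ∧ R t = r1 t := fun t ht => by simp [hS, hV, hQ, hR, ht]
  have G : ∀ t, m ≤ t → S t = s2 (t - t0) ∧ V t = u2 (t - t0) ∧ Q t = q2 (t - t0) ∧ R t = r2 (t - t0) := fun t ht => by
    simp [hS, hV, hQ, hR, not_lt.2 ht]
  have i2 : ∀ t, t0 < t → t ≤ t0 + T2 → t - t0 ∈ Ioc 0 T2 := fun t a b => ⟨♮, ♮⟩
  have A : ∀ t, t < T1 → S t = s1 t ∧ (∀ x ∈ Icc 0 (s1 t), V t x = u1 t x) := fun t ht => by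
    rcases lt_or_ge t m with h | h
    · obtain ⟨a, b, -⟩ := L t h; exact ⟨a, fun x _ => by rw [b]⟩
    · obtain ⟨a, b, -⟩ := G t h
      have : t ∈ Icc t0 T1 := ⟨♮, ht.le⟩
      exact ⟨a.trans (es t this), fun x hx => by rw [b, eu t this x hx]⟩
  have A2 : ∀ t, 0 < t → t < T1 → (∀ x ∈ Ioo 0 (s1 t), R t x = r1 t x) ∧ (∀ x ∈ Icc 0 (s1 t), Q t x = q1 t x) := fun t t0' ht => by
    rcases lt_or_ge t m with h | h
    · obtain ⟨-, -, a, b⟩ := L t h; exact ⟨fun x _ => by rw [b], fun x _ => by rw [a]⟩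
    obtain ⟨-, -, a, b⟩ := G t h
    have ht0 : t0 < t := ♮
    have t2 := i2 t ht0 ♮
    have t1 : t ∈ Ioc 0 T1 := ⟨t0', ht.le⟩
    have e := es t ⟨♮, ht.le⟩
    have sp := h1.sp t (Ioc_Icc t1)
    refine ⟨fun x hx => ?_, fun x hx => ?_⟩
    · rw [b]
      have d2 := (h2.ut _ t2 x (e.symm ▸ hx)).comp_sub_const t t0
      refine d2.unique ((h1.ut t t1 x hx).congr_of_eventuallyEq ?_)
      filter_upwards [Ioo_mem_nhds ht0 ht, (h1.sd t t1).continuousAt.eventually (Ioi_mem_nhds hx.2)] with τ hτ hτ2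
      exact eu τ ⟨hτ.1.le, hτ.2.le⟩ x ⟨hx.1.le, (mem_Ioi.1 hτ2).le⟩
    · rw [a]
      rcases hx.1.eq_or_lt with k | k
      · rw [← k, h1.b0 t t1, h2.b0 _ t2, eu t ⟨♮, ht.le⟩ 0 ⟨le_rfl, sp.le⟩]
      rcases hx.2.eq_or_lt with k2 | k2
      · have d2 := ((h2.sd _ t2).comp_sub_const t t0).unique ((h1.sd t t1).congr_of_eventuallyEq (by
          filter_upwards [Ioo_mem_nhds ht0 ht] with τ hτ using es τ ⟨hτ.1.le, hτ.2.le⟩))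
        rw [e] at d2
        rw [k2]; linarith
      · refine (h2.ux _ t2 x ⟨k, e.symm ▸ k2⟩).unique ((h1.ux t t1 x ⟨k, k2⟩).congr_of_eventuallyEq ?_)
        filter_upwards [Ioo_mem_nhds k k2] with y hy using eu t ⟨♮, ht.le⟩ y ⟨hy.1.le, hy.2.le⟩
  have cs : Continuous (fun z : ℝ² => (z.1 - t0, z.2)) := by fun_prop
  refine ⟨S, V, Q, R, ?_, (L 0 ♮).1, fun x => by rw [(L 0 ♮).2.1]⟩
  refine ⟨♮, ?_, ?_, ?_, ?_, ?_, ?_, ?_, ?_, ?_, ?_, ?_, ?_⟩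
  · have := glueC (A := Icc 0 (t0 + T2) ×ˢ univ) (F := fun z => S z.1) (F1 := fun z => s1 z.1) (F2 := fun z => s2 (z.1 - t0)) m2
      (h1.sc.comp continuousOn_fst fun z hz => ⟨hz.1.1.1, (mem_ofPred.1 hz.2).le⟩)
      (h2.sc.comp (f := fun z : ℝ² => z.1 - t0) (Continuous.continuousOn ♯) fun z hz => ⟨by linarith [mem_ofPred.1 hz.2], by linarith [hz.1.1.2]⟩)
      (fun z hz hl => (A _ hl).1) (fun z hz hl => (G _ (le_of_lt hl)).1)
    exact this.comp (f := fun t : ℝ => (t, ⓪)) ♯ fun t ht => ⟨ht, trivial⟩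
  · intro t ht
    rcases lt_or_ge t m with h | h
    · rw [(L t h).1]; exact h1.sp t ⟨ht.1, ♮⟩
    · rw [(G t h).1]; exact h2.sp _ (Ioc_Icc (i2 t ♮ ht.2))
  · intro t ht
    rcases lt_or_ge t T1 with h | h
    · have e := (A t h).1
      rw [e, (A2 t ht.1 h).2 _ ⟨(h1.sp t ⟨ht.1.le, h.le⟩).le, le_rfl⟩]
      exact (h1.sd t ⟨ht.1, h.le⟩).congr_of_eventuallyEq (by filter_upwards [Iio_mem_nhds h] with τ hτ using (A τ hτ).1)
    · have h : m < t := ♮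
      obtain ⟨a, -, b, -⟩ := G t h.le
      rw [a, b]
      exact ((h2.sd _ (i2 t ♮ ht.2)).comp_sub_const t t0).congr_of_eventuallyEq (by
        filter_upwards [Ioi_mem_nhds h] with τ hτ using (G τ (mem_Ioi.1 hτ).le).1)
  · intro t ht x hx
    rcases lt_or_ge t T1 with h | h
    · have e := (A t h).1
      rw [e] at hx
      have t1 : t ∈ Ioc 0 T1 := ⟨ht.1, h.le⟩
      rw [(A2 t ht.1 h).1 x hx]
      refine (h1.ut t t1 x hx).congr_of_eventuallyEq ?_
      filter_upwards [Iio_mem_nhds h, (h1.sd t t1).continuousAt.eventually (Ioi_mem_nhds hx.2)] with τ hτ hτ2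
      exact (A τ hτ).2 x ⟨hx.1.le, (mem_Ioi.1 hτ2).le⟩
    · have h : m < t := ♮
      obtain ⟨a, -, -, b⟩ := G t h.le
      rw [a] at hx; rw [b]
      exact ((h2.ut _ (i2 t ♮ ht.2) x hx).comp_sub_const t t0).congr_of_eventuallyEq (by
        filter_upwards [Ioi_mem_nhds h] with τ hτ; rw [(G τ (mem_Ioi.1 hτ).le).2.1])
  · intro t ht x hx
    rcases lt_or_ge t m with h | h
    · obtain ⟨a, b, c, d⟩ := L t h
      rw [a] at hx; rw [b, c]; exact h1.ux t ⟨ht.1, ♮⟩ x hx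
    · obtain ⟨a, b, c, d⟩ := G t h
      rw [a] at hx; rw [b, c]; exact h2.ux _ (i2 t ♮ ht.2) x hx
  · intro t ht x hx
    rcases lt_or_ge t m with h | h
    · obtain ⟨a, b, c, d⟩ := L t h
      rw [a] at hx; rw [d, c]; exact h1.uxx t ⟨ht.1, ♮⟩ x hx
    · obtain ⟨a, b, c, d⟩ := G t h
      rw [a] at hx; rw [d, c]; exact h2.uxx _ (i2 t ♮ ht.2) x hx
  · exact glueC m2 (h1.rc.mono fun z hz => ⟨⟨hz.1.1.1, (mem_ofPred.1 hz.2).le⟩, (A _ hz.2).1 ▸ hz.1.2⟩)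
      (h2.rc.comp cs.continuousOn fun z hz => ⟨i2 _ (m1.trans hz.2) hz.1.1.2, (G _ (le_of_lt hz.2)).1 ▸ hz.1.2⟩)
      (fun z hz hl => (A2 _ hz.1.1 hl).1 _ ((A _ hl).1 ▸ hz.2)) (fun z hz hl => by rw [(G _ (le_of_lt hl)).2.2.2]; rfl)
  · exact glueC m2 (h1.qc.mono fun z hz => ⟨⟨hz.1.1.1, (mem_ofPred.1 hz.2).le⟩, (A _ hz.2).1 ▸ hz.1.2⟩)
      (h2.qc.comp cs.continuousOn fun z hz => ⟨i2 _ (m1.trans hz.2) hz.1.1.2, (G _ (le_of_lt hz.2)).1 ▸ hz.1.2⟩)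
      (fun z hz hl => (A2 _ hz.1.1 hl).2 _ ((A _ hl).1 ▸ hz.2)) (fun z hz hl => by rw [(G _ (le_of_lt hl)).2.2.1]; rfl)
  · exact glueC m2 (h1.uc.mono fun z hz => ⟨⟨hz.1.1.1, (mem_ofPred.1 hz.2).le⟩, (A _ hz.2).1 ▸ hz.1.2⟩)
      (h2.uc.comp cs.continuousOn fun z hz => ⟨Ioc_Icc (i2 _ (m1.trans hz.2) hz.1.1.2), (G _ (le_of_lt hz.2)).1 ▸ hz.1.2⟩)
      (fun z hz hl => (A _ hl).2 _ ((A _ hl).1 ▸ hz.2)) (fun z hz hl => by rw [(G _ (le_of_lt hl)).2.1]; rfl)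
  · intro t ht x hx
    rcases lt_or_ge t m with h | h
    · obtain ⟨a, b, c, d⟩ := L t h
      rw [a] at hx; rw [b]; exact h1.u0 t ⟨ht.1, ♮⟩ x hx
    · obtain ⟨a, b, c, d⟩ := G t h
      rw [a] at hx; rw [b]; exact h2.u0 _ (Ioc_Icc (i2 t ♮ ht.2)) x hx
  · intro t ht
    rcases lt_or_ge t m with h | h
    · obtain ⟨a, b, c, d⟩ := L t h
      rw [b, c]; exact h1.b0 t ⟨ht.1, ♮⟩
    · obtain ⟨a, b, c, d⟩ := G t h
      rw [b, c]; exact h2.b0 _ (i2 t ♮ ht.2)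
  · intro t ht
    rcases lt_or_ge t m with h | h
    · obtain ⟨a, b, c, d⟩ := L t h
      rw [a, b]; exact h1.bs t ⟨ht.1, ♮⟩
    · obtain ⟨a, b, c, d⟩ := G t h
      rw [a, b]; exact h2.bs _ (Ioc_Icc (i2 t ♮ ht.2))
end

structure MX (p s₀ K : ℝ) (φ : ℝ → ℝ) (Tm : ℝ≥0∞) (s : ℝ → ℝ) (u : ℝ → ℝ → ℝ) : Prop where
  hp : 1 < p
  s0 : 0 < s₀
  K0 : 0 ≤ K
  l : ∀ x ∈ Icc 0 s₀, ∀ y ∈ Icc 0 s₀, |φ x - φ y| ≤ K * |x - y|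
  n : ∀ x ∈ Icc 0 s₀, 0 ≤ φ x
  z : φ s₀ = 0
  m : IsMaxSol p s₀ φ Tm s u

section
variable {p s₀ K T N : ℝ} {φ s : ℝ → ℝ} {Tm : ℝ≥0∞} {u : ℝ → ℝ → ℝ}

lemma MX.sl (h : MX p s₀ K φ Tm s u) (hT : 0 < T) (hm : ENNReal.ofReal T < Tm) :
    Sl 0 p T s u (fun t => deriv (u t)) (fun t => deriv (deriv (u t))) := toSl (h.m.2.1 T hT hm) h.z h.s0.le

lemma MX.init (h : MX p s₀ K φ Tm s u) : s 0 = s₀ ∧ ∀ x ∈ Icc 0 s₀, u 0 x = φ x := by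
  obtain ⟨T, a, b⟩ := ENNReal.lt_iff_exists_nnreal_btwn.1 h.m.1
  have := h.m.2.1 T (by exact_mod_cast a) (by simpa using b)
  exact ⟨this.init_s, this.init⟩

lemma MX.phi (h : MX p s₀ K φ Tm s u) : ∀ x ∈ Icc 0 s₀, φ x ≤ K * s₀ := fun x hx => by
  have := h.l x hx s₀ ⟨h.s0.le, le_rfl⟩
  rw [h.z, sub_zero] at this
  refine (le_abs_self _).trans (this.trans (mul_le_mul_of_nonneg_left ?_ h.K0))
  rw [abs_sub_comm, abs_of_nonneg (by linarith [hx.2])]; linarith [hx.1]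

lemma Sl.lipN {ε : ℝ} {q r : ℝ → ℝ → ℝ} (h : Sl ε p T s u q r) (hp : 1 < p) (hε : 0 ≤ ε) (hK : 0 ≤ K) (hN : ∀ t ∈ Icc 0 T, u t 0 ≤ N)
    (hi : ∀ x ∈ Icc 0 (s 0), ∀ y ∈ Icc 0 (s 0), |u 0 x - u 0 y| ≤ K * |x - y|) :
    ∀ t ∈ Icc 0 T, ∀ x ∈ Icc 0 (s t), ∀ y ∈ Icc 0 (s t), |u t x - u t y| ≤ max K (N ^ p) * |x - y| :=
  LIP h hε (le_max_of_le_left hK) (fun t ht => (rpow_le_rpow (h.u0 t (Ioc_Icc ht) 0 ⟨le_rfl, (h.sp t (Ioc_Icc ht)).le⟩)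
    (hN t (Ioc_Icc ht)) ♮).trans (le_max_right _ _))
    (fun x hx y hy => (hi x hx y hy).trans (mul_le_mul_of_nonneg_right (le_max_left _ _) ◉))

lemma MX.hl (h : MX p s₀ K φ Tm s u) : ∀ x ∈ Icc 0 (s 0), ∀ y ∈ Icc 0 (s 0), |u 0 x - u 0 y| ≤ K * |x - y| := by
  obtain ⟨a, b⟩ := h.init
  rw [a]; intro x hx y hy; rw [b x hx, b y hy]; exact h.l x hx y hy

lemma MX.b0 (h : MX p s₀ K φ Tm s u) (hN : ∀ t, 0 < t → t ≤ T → u t 0 ≤ N) : ∀ t ∈ Icc 0 T, u t 0 ≤ max N (K * s₀) := fun t ht => by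
  rcases ht.1.eq_or_lt with e | e
  · rw [← e, h.init.2 0 ⟨le_rfl, h.s0.le⟩]; exact (h.phi 0 ⟨le_rfl, h.s0.le⟩).trans (le_max_right _ _)
  · exact (hN t e ht.2).trans (le_max_left _ _)

/-- continuation criterion -/
lemma CONT (h : MX p s₀ K φ Tm s u) (hN : ∀ t, 0 < t → ENNReal.ofReal t < Tm → u t 0 ≤ N) : Tm = ⊤ := by
  by_contra htop
  obtain ⟨Ts, hTs⟩ : ∃ Ts, Ts = Tm.toReal := ◇
  have Ts0 : 0 < Ts := hTs ▸ ENNReal.toReal_pos h.m.1.ne' htop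
  have lt : ∀ t, 0 ≤ t → t < Ts → ENNReal.ofReal t < Tm := fun t h0 ht => (ENNReal.ofReal_lt_iff_lt_toReal h0 htop).2 (hTs ▸ ht)
  have KS : 0 ≤ K * s₀ := mul_nonneg h.K0 h.s0.le
  obtain ⟨M, hM⟩ : ∃ M, M = max N (K * s₀) := ◇
  have M0 : 0 ≤ M := hM ▸ le_max_of_le_right KS
  obtain ⟨τ, N', hτ, H⟩ := EX p (max K (M ^ p)) M s₀ h.hp (le_max_of_le_left h.K0) M0 h.s0
  obtain ⟨t0, e0⟩ : ∃ t0, t0 = max (Ts / 2) (Ts - τ / 2) := ◇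
  have a1 : Ts / 2 ≤ t0 := e0 ▸ le_max_left _ _
  have a2 : Ts - τ / 2 ≤ t0 := e0 ▸ le_max_right _ _
  have a3 : t0 < Ts := e0 ▸ max_lt ♮ ♮
  obtain ⟨T1, e1⟩ : ∃ T1, T1 = (t0 + Ts) / 2 := ◇
  have h1 := h.sl (T := T1) ♮ (lt T1 ♮ ♮)
  have b := h.b0 (T := T1) (N := N) fun t t1 t2 => hN t t1 (lt t t1.le ♮)
  rw [← hM] at b
  have i0 : t0 ∈ Icc 0 T1 := ⟨♮, ♮⟩
  have ub := h1.sup M0 (fun x hx => by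
    rw [h.init.1] at hx; rw [h.init.2 x hx]; exact (h.phi x hx).trans (hM ▸ le_max_right _ _)) b
  have ll := h1.lipN h.hp le_rfl h.K0 b h.hl
  obtain ⟨s2, u2, q2, r2, h2, c1, c2, -⟩ := H (s t0) (h.init.1 ▸ h1.sm le_rfl ⟨le_rfl, h1.T0.le⟩ i0 i0.1) (u t0) (ll t0 i0)
    (fun x hx => ⟨h1.u0 t0 i0 x hx, ub t0 i0 x hx⟩) (h1.bs t0 i0) 0 le_rfl zero_le_one
  have h1' := h1.shift (a := t0) i0.1 ♮
  have uu := UNI h.hp h1' (h2.mono h1'.T0 ♮) (by simp [c1]) (le_max_of_le_left h.K0 : 0 ≤ max K (M ^ p))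
    (fun x hx => by rw [c1] at hx; simp [c2 x hx]) (fun x hx y hy => by
      rw [c1] at hx hy; rw [c2 x hx, c2 y hy]; exact ll t0 i0 x hx y hy)
  have uu' : ∀ t ∈ Icc t0 T1, s2 (t - t0) = s t ∧ ∀ x ∈ Icc 0 (s2 (t - t0)), u t x = u2 (t - t0) x := fun t ht => by
    have := uu (t - t0) ⟨by linarith [ht.1], by linarith [ht.2]⟩
    simp only [sub_add_cancel] at this
    exact ⟨this.1.symm, this.2⟩
  obtain ⟨s3, u3, q3, r3, h3, d1, d2⟩ := GLUE h1 h2 ♮ ♮ ♮ (fun t ht => (uu' t ht).1)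
    (fun t ht x hx => ((uu' t ht).2 x ((uu' t ht).1 ▸ hx)).symm)
  obtain ⟨v, hv⟩ := ofSl h3 (d1.trans h.init.1) (fun x hx => (d2 x).trans (h.init.2 x hx))
  exact h.m.2.2 (t0 + τ) ((ENNReal.lt_ofReal_iff_toReal_lt htop).2 (by rw [← hTs]; linarith)) ⟨s3, v, hv⟩
end

section
variable {p T η M : ℝ} {s : ℝ → ℝ} {u q r : ℝ → ℝ → ℝ}

lemma CRIT1 (hp : 1 < p) (h : Sl 0 p T s u q r) (hη : 0 < η) (hη8 : η ≤ 1 / 8) (hηp : η ^ (p - 1) ≤ 1 / (8 * s 0))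
    (hi : ∀ x ∈ Icc 0 (s 0), u 0 x ≤ η / 2) (hs : s T ≤ 2 * s 0) :
    s T < 2 * s 0 ∧ ∀ t ∈ Icc 0 T, ∀ x ∈ Icc 0 (s t), u t x ≤ η * exp (-(1 / (16 * s 0 ^ 2)) * t) := by
  have z0 : ⓪ ∈ Icc 0 T := ⟨le_rfl, h.T0.le⟩
  have hs0 := h.sp 0 z0
  obtain ⟨L, hL⟩ : ∃ L, L = 2 * s 0 := ◇
  have L0 : 0 < L := ♮
  obtain ⟨α, hα⟩ : ∃ α, α = 1 / (16 * s 0 ^ 2) := ◇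
  have α0 : 0 < α := by rw [hα]; positivity
  have αL : α = 1 / (4 * L ^ 2) := by rw [hα, hL]; ring
  rw [← hα]
  have mT : ∀ t ∈ Icc 0 T, s t ≤ L := fun t ht => (h.sm le_rfl ht ⟨h.T0.le, le_rfl⟩ ht.2).trans (hL ▸ hs)
  have gb : ∀ x, 0 ≤ x → x ≤ L → 1 / 2 ≤ 1 - (x + L) ^ 2 * (1 / (8 * L ^ 2)) ∧ 1 - (x + L) ^ 2 * (1 / (8 * L ^ 2)) ≤ 7 / 8 := fun x x0 x1 => by
    have e : L ^ 2 * (1 / (8 * L ^ 2)) = 1 / 8 := by field_simp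
    have c : 0 < 1 / (8 * L ^ 2) := ♭
    have a1 := mul_le_mul_of_nonneg_right (show (x + L) ^ 2 ≤ 4 * L ^ 2 by nlinarith) c.le
    have a2 := mul_le_mul_of_nonneg_right (show L ^ 2 ≤ (x + L) ^ 2 by nlinarith) c.le
    constructor <;> linarith
  obtain ⟨M, M0, hM⟩ := h.bdd
  have E1 : ∀ t, 0 ≤ t → exp (-α * t) ≤ 1 := fun t ht => exp_le_one_iff.2 (by nlinarith)
  have B : ∀ t ∈ Icc 0 T, ∀ x ∈ Icc 0 (s t), u t x ≤ η * exp (-α * t) * (1 - (x + L) ^ 2 * (1 / (8 * L ^ 2))) :=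
    h.upper (C := p * M ^ (p - 1)) (v := fun t x => η * exp (-α * t) * (1 - (x + L) ^ 2 * (1 / (8 * L ^ 2))))
      (vt := fun t x => η * (exp (-α * t) * (-α)) * (1 - (x + L) ^ 2 * (1 / (8 * L ^ 2))))
      (vx := fun t x => η * exp (-α * t) * (-(2 * (x + L) * (1 / (8 * L ^ 2)))))
      (vxx := fun t x => η * exp (-α * t) * (-(2 * (1 / (8 * L ^ 2)))))
      (Continuous.continuousOn ♯)
      (fun x hx => by
        have := (gb x hx.1 (hx.2.trans (mT 0 z0))).1
        simp only [mul_zero, exp_zero, mul_one]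
        nlinarith [hi x hx])
      (fun t ht x hx => by
        refine (((((hasDerivAt_id t).const_mul (-α)).exp).const_mul η).mul_const _).congr_deriv ?_
        simp)
      (fun t ht x => by
        refine (((((hasDerivAt_id x).add_const L).pow 2).mul_const (1 / (8 * L ^ 2))).const_sub 1 |>.const_mul (η * exp (-α * t))).congr_deriv ?_
        simp)
      (fun t ht x hx => by
        refine ((((((hasDerivAt_id x).add_const L).const_mul 2).mul_const (1 / (8 * L ^ 2))).neg).const_mul (η * exp (-α * t))).congr_deriv ?_
        simp)
      (fun t ht x hx hh => by
        have g := gb x hx.1.le (hx.2.le.trans (mT t (Ioc_Icc ht)))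
        have : 0 ≤ p * M ^ (p - 1) * (u t x - η * exp (-α * t) * (1 - (x + L) ^ 2 * (1 / (8 * L ^ 2)))) :=
          mul_nonneg ♭ ♮
        have e2 : 2 * (1 / (8 * L ^ 2)) = α := by rw [αL]; field_simp; norm_num
        rw [e2]
        have : 0 ≤ η * exp (-α * t) * α * (1 - (1 - (x + L) ^ 2 * (1 / (8 * L ^ 2)))) := mul_nonneg ♭ ♮
        linarith)
      (fun t ht hh => by
        have s1 := h.sp t (Ioc_Icc ht)
        have g := gb 0 le_rfl L0.le
        obtain ⟨w, hw⟩ : ∃ w, w = η * exp (-α * t) * (1 - (0 + L) ^ 2 * (1 / (8 * L ^ 2))) := ◇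
        rw [← hw] at hh ⊢
        have ep := exp_pos (-α * t)
        have w0 : 0 ≤ w := hw ▸ mul_nonneg ♭ ♮
        have w1 : w ≤ η * exp (-α * t) := hw ▸ mul_le_of_le_one_right ♭ ♮
        have a1 := rpow_lip hp w0 hh.le (hM t (Ioc_Icc ht) 0 ⟨le_rfl, s1.le⟩)
        have a2 : w ^ p ≤ η * exp (-α * t) * (1 / (8 * s 0)) := by
          refine (rpow_le_rpow w0 w1 ♮).trans ?_
          have : (η * exp (-α * t)) ^ p = η * exp (-α * t) * (η * exp (-α * t)) ^ (p - 1) := by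
            rw [← rpow_one_add' ♭ ♮]; congr 1; ring
          rw [this]
          refine mul_le_mul_of_nonneg_left ((rpow_le_rpow ♭ ?_ ♮).trans hηp) ♭
          exact mul_le_of_le_one_right hη.le (E1 t ht.1.le)
        have e : 2 * (0 + L) * (1 / (8 * L ^ 2)) = 1 / (8 * s 0) := by rw [hL]; field_simp; norm_num
        rw [e]
        linarith)
      (fun t ht => by
        have := gb (s t) (h.sp t (Ioc_Icc ht)).le (mT t (Ioc_Icc ht))
        exact mul_nonneg ♭ ♮)
  have B' : ∀ t ∈ Icc 0 T, ∀ x ∈ Icc 0 (s t), u t x ≤ η * exp (-α * t) := fun t ht x hx =>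
    (B t ht x hx).trans (mul_le_of_le_one_right ♭ (by linarith [(gb x hx.1 (hx.2.trans (mT t ht))).2]))
  refine ⟨?_, B'⟩
  have m := h.mass hp le_rfl h.T0.le le_rfl
  have i1 := h.int0 (t := T) ⟨h.T0.le, le_rfl⟩
  have i2 := h.intM z0 hi
  have hηp' : η ^ p ≤ η * (1 / (8 * s 0)) := by
    have : η ^ p = η * η ^ (p - 1) := by rw [← rpow_one_add' hη.le ♮]; congr 1; ring
    rw [this]; exact mul_le_mul_of_nonneg_left hηp hη.le
  have i3 : ∫ t in ⓪..T, u t 0 ^ p ≤ ∫ t in ⓪..T, η ^ p * exp (-α * t) := by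
    refine intervalIntegral.integral_mono_on h.T0.le ((h.c0.rpow_const fun t _ => Or.inr ♮).intervalIntegrable_of_Icc h.T0.le)
      (Continuous.intervalIntegrable ♯ _ _) fun t ht => ?_
    have s1 := h.sp t ht
    refine (rpow_le_rpow (h.u0 t ht 0 ⟨le_rfl, s1.le⟩) (B' t ht 0 ⟨le_rfl, s1.le⟩) ♮).trans ?_
    rw [mul_rpow hη.le (exp_pos _).le]
    refine mul_le_mul_of_nonneg_left ?_ ♭
    rw [← exp_mul]
    exact exp_le_exp.2 (by nlinarith [mul_nonneg α0.le ht.1])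
  have i4 : ∫ t in ⓪..T, η ^ p * exp (-α * t) = -(η ^ p / α) * exp (-α * T) - -(η ^ p / α) * exp (-α * 0) :=
    intervalIntegral.integral_eq_sub_of_hasDerivAt (f := fun t => -(η ^ p / α) * exp (-α * t)) (fun t _ => by
      refine ((((hasDerivAt_id t).const_mul (-α)).exp).const_mul _).congr_deriv ?_
      simp; field_simp) (Continuous.intervalIntegrable ♯ _ _)
  have i5 : η ^ p / α ≤ 2 * η * s 0 := by
    rw [div_le_iff₀ α0]
    refine hηp'.trans (le_of_eq ?_)
    rw [hα]; field_simp; norm_num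
  have : 0 ≤ η ^ p / α * exp (-α * T) := ♭
  simp only [mul_zero, exp_zero, mul_one] at i4
  nlinarith

lemma CRIT (hp : 1 < p) (h : Sl 0 p T s u q r) (hη : 0 < η) (hη8 : η ≤ 1 / 8) (hηp : η ^ (p - 1) ≤ 1 / (8 * s 0))
    (hi : ∀ x ∈ Icc 0 (s 0), u 0 x ≤ η / 2) :
    s T < 2 * s 0 ∧ ∀ t ∈ Icc 0 T, ∀ x ∈ Icc 0 (s t), u t x ≤ η * exp (-(1 / (16 * s 0 ^ 2)) * t) := by
  refine CRIT1 hp h hη hη8 hηp hi ?_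
  by_contra hc
  push Not at hc
  have hs0 := h.sp 0 ⟨le_rfl, h.T0.le⟩
  obtain ⟨t, ht, e⟩ := intermediate_value_Icc h.T0.le h.sc (show 2 * s 0 ∈ Icc (s 0) (s T) from ⟨♮, hc.le⟩)
  have t0 : 0 < t := by
    rcases ht.1.eq_or_lt with e' | e'
    · rw [← e'] at e; linarith
    · exact e'
  have := (CRIT1 hp (h.mono t0 ht.2) hη hη8 hηp hi e.le).1
  linarith
end

section
variable {p s₀ K T N m a b ϵ : ℝ} {φ s f g : ℝ → ℝ} {Tm : ℝ≥0∞} {u : ℝ → ℝ → ℝ}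

lemma L1SUP (hK : 0 ≤ K) (ha : 0 ≤ a) (hab : a ≤ b) (cf : ContinuousOn f (Icc 0 b)) (cg : ContinuousOn g (Icc 0 a))
    (hf : ∀ x ∈ Icc 0 b, ∀ y ∈ Icc 0 b, |f x - f y| ≤ K * |x - y|) (f0 : ∀ x ∈ Icc 0 b, 0 ≤ f x) (fb : f b = 0)
    (hgf : ∀ x ∈ Icc 0 a, g x ≤ f x) (hm : 0 ≤ m) (hg : ∀ x ∈ Icc 0 a, g x ≤ m) {x : ℝ} (hx : x ∈ Icc 0 b) (hϵ : 0 < ϵ) (hfx : m + ϵ ≤ f x) :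
    ϵ ^ 2 ≤ 4 * (K + 1) * ((∫ x in ⓪..b, f x) - ∫ x in ⓪..a, g x) := by
  have hb : 0 ≤ b := ha.trans hab
  obtain ⟨d, hd⟩ : ∃ d, d = ϵ / (2 * (K + 1)) := ◇
  have d0 : 0 < d := by rw [hd]; positivity
  have dK : (K + 1) * d = ϵ / 2 := by rw [hd]; field_simp
  have lo : ∀ y ∈ Icc x b, f x ≤ f y + (K + 1) * (y - x) := fun y hy => by
    have := (le_abs_self _).trans (hf x hx y ⟨hx.1.trans hy.1, hy.2⟩)
    rw [abs_sub_comm, abs_of_nonneg (by linarith [hy.1])] at this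
    nlinarith [hy.1]
  have xd : x + d ≤ b := by
    have := lo b ⟨hx.2, le_rfl⟩
    by_contra hc
    push Not at hc
    nlinarith
  have cG : ContinuousOn (fun x => min (f x) m) (Icc 0 b) := cf.inf continuousOn_const
  have ii : ∀ {h : ℝ → ℝ}, ContinuousOn h (Icc 0 b) → ∀ y ∈ Icc 0 b, ∀ z ∈ Icc 0 b, y ≤ z → IntervalIntegrable h volume y z :=
    fun ch y hy z hz hyz => (ch.mono (Icc_subset_Icc hy.1 hz.2)).intervalIntegrable_of_Icc hyz
  have z0 : ⓪ ∈ Icc 0 b := ⟨le_rfl, hb⟩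
  have zb : b ∈ Icc 0 b := ⟨hb, le_rfl⟩
  have zd : x + d ∈ Icc 0 b := ⟨by linarith [hx.1], xd⟩
  have za : a ∈ Icc 0 b := ⟨ha, hab⟩
  have i1 : ∫ x in ⓪..a, g x ≤ ∫ x in ⓪..a, min (f x) m :=
    intervalIntegral.integral_mono_on ha (cg.intervalIntegrable_of_Icc ha) (ii cG _ z0 _ za ha) fun y hy => le_min (hgf y hy) (hg y hy)
  have i2 : 0 ≤ ∫ x in a..b, min (f x) m := intervalIntegral.integral_nonneg hab fun y hy => le_min (f0 y ⟨ha.trans hy.1, hy.2⟩) hm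
  have i3 := intervalIntegral.integral_add_adjacent_intervals (ii cG _ z0 _ za ha) (ii cG _ za _ zb hab)
  have cD := cf.sub cG
  have i4 := intervalIntegral.integral_sub (ii cf _ z0 _ zb hb) (ii cG _ z0 _ zb hb)
  have i5 := intervalIntegral.integral_add_adjacent_intervals (ii cD _ z0 _ hx hx.1) (ii cD _ hx _ zd ♮)
  have i6 := intervalIntegral.integral_add_adjacent_intervals (ii cD _ z0 _ zd zd.1) (ii cD _ zd _ zb xd)
  have nn : ∀ y, 0 ≤ f y - min (f y) m := fun y => by linarith [min_le_left (f y) m]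
  have i7 : 0 ≤ ∫ y in ⓪..x, (f y - min (f y) m) := intervalIntegral.integral_nonneg hx.1 fun y _ => nn y
  have i8 : 0 ≤ ∫ y in (x + d)..b, (f y - min (f y) m) := intervalIntegral.integral_nonneg xd fun y _ => nn y
  have i9 : ∫ y in x..(x + d), ϵ / 2 ≤ ∫ y in x..(x + d), (f y - min (f y) m) :=
    intervalIntegral.integral_mono_on ♮ intervalIntegrable_const (ii cD _ hx _ zd ♮) fun y hy => by
      have := lo y ⟨hy.1, hy.2.trans xd⟩
      have := mul_le_mul_of_nonneg_left (show y - x ≤ d by linarith [hy.2]) (show 0 ≤ K + 1 by linarith)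
      linarith [min_le_right (f y) m]
  simp only [intervalIntegral.integral_const, add_sub_cancel_left, smul_eq_mul] at i9
  simp only [Pi.sub_apply] at i5 i6
  have j : d * (ϵ / 2) ≤ (∫ x in ⓪..b, f x) - ∫ x in ⓪..a, g x := ♮
  have := mul_le_mul_of_nonneg_left j (show 0 ≤ 4 * (K + 1) by linarith)
  refine le_trans (le_of_eq ?_) this
  rw [hd]; field_simp; norm_num

lemma DIFF (hp : 1 < p) (hK : 0 ≤ K) (hN : 0 < N) {M S0 T : ℝ} (hS : 0 < S0) (hM : 0 ≤ M) (hT : 0 ≤ T) : ∃ C, 0 < C ∧ ∀ T' s1 s2 u1 u2 q1 q2 r1 r2 δ,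
    T' ≤ T → 0 ≤ δ → Sl 0 p T' s1 u1 q1 r1 → Sl 0 p T' s2 u2 q2 r2 → s1 0 = S0 → s2 0 = S0 →
    (∀ x ∈ Icc 0 S0, u1 0 x ≤ u2 0 x ∧ u2 0 x ≤ u1 0 x + δ) → (∀ x ∈ Icc 0 S0, ∀ y ∈ Icc 0 S0, |u2 0 x - u2 0 y| ≤ K * |x - y|) →
    (∀ x ∈ Icc 0 S0, u2 0 x ≤ M) → (∀ t ∈ Icc 0 T', u2 t 0 ≤ N) → ∀ t ∈ Icc 0 T', s2 t ≤ s1 t + C * δ ∧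
    ∀ m, 0 ≤ m → (∀ x ∈ Icc 0 (s1 t), u1 t x ≤ m) → ∀ x ∈ Icc 0 (s2 t), ∀ ϵ, 0 < ϵ → m + ϵ ≤ u2 t x → ϵ ^ 2 ≤ C * δ := by
  obtain ⟨A, hA⟩ : ∃ A, A = exp (p * N ^ (p - 1) * (M * S0 + S0 + N ^ p * T)) * (exp ((p * N ^ (p - 1)) ^ 2 * T) * S0) := ◇
  have A0 : 0 < A := by rw [hA]; positivity
  have k0 : 0 ≤ max K (N ^ p) := le_max_of_le_left hK
  refine ⟨4 * (max K (N ^ p) + 1) * A, ♭, ?_⟩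
  intro T' s1 s2 u1 u2 q1 q2 r1 r2 δ hT' hδ h1 h2 e1 e2 hi hl hM' hN' t ht
  have o := ORD hp h1 h2 (e1.trans e2.symm).le hK (fun x hx => (hi x (e1 ▸ hx)).1) (by rwa [e2])
  have D := DEP hp h1 h2 le_rfl hN (fun t ht => (o t ht).1) (fun t ht => (o t ht).2) hN' t ht
  have z0 : ⓪ ∈ Icc 0 T' := ⟨le_rfl, h1.T0.le⟩
  have ii1 := (h1.cu z0).intervalIntegrable_of_Icc (μ := volume) (h1.sp 0 z0).le
  have ii2 := (h2.cu z0).intervalIntegrable_of_Icc (μ := volume) (h2.sp 0 z0).le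
  rw [e1] at ii1; rw [e2] at ii2
  have d0 : (∫ x in ⓪..S0, u2 0 x) - ∫ x in ⓪..S0, u1 0 x ≤ S0 * δ := by
    rw [← intervalIntegral.integral_sub ii2 ii1]
    have := intervalIntegral.integral_mono_on hS.le (ii2.sub ii1) (g := fun _ => δ) (μ := volume) intervalIntegrable_const (fun x hx => by
      have := (hi x hx).2; linarith)
    simpa using this
  have sl := h2.sle hp ht (by rwa [e2]) hN'
  rw [e2, zero_mul, add_zero] at sl
  have tT := mul_le_mul_of_nonneg_left (ht.2.trans hT') (rpow_nonneg hN.le p)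
  rw [e1, e2, sub_self, zero_mul, add_zero, add_zero] at D
  have k1 : 0 ≤ p * N ^ (p - 1) := ♭
  have D' : ((∫ x in ⓪..(s2 t), u2 t x) - ∫ x in ⓪..(s1 t), u1 t x) + (s2 t - s1 t) ≤ A * δ := by
    refine D.trans ?_
    rw [hA, show ∀ a b c d : ℝ, a * (b * c) * d = a * (b * (c * d)) from fun _ _ _ _ => by ring]
    refine mul_le_mul (exp_le_exp.2 (mul_le_mul_of_nonneg_left ♮ k1)) ?_ ?_ (exp_pos _).le
    · refine (mul_le_mul_of_nonneg_left d0 (exp_pos _).le).trans (mul_le_mul_of_nonneg_right (exp_le_exp.2 ?_) ♭)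
      exact mul_le_mul_of_nonneg_left (ht.2.trans hT') ♭
    · refine mul_nonneg (exp_pos _).le ?_
      rw [← intervalIntegral.integral_sub ii2 ii1]
      exact intervalIntegral.integral_nonneg hS.le fun x hx => by linarith [(hi x hx).1]
  have W := WM (h1.sp t ht).le (o t ht).1 (h1.cu ht) (h2.cu ht) (w1 := fun _ => 0) (w2 := fun _ => 1) continuous_const continuous_const (o t ht).2
    (h2.u0 t ht) (fun _ _ => zero_le_one)
  simp only [zero_mul, one_mul, intervalIntegral.integral_zero, sub_zero] at W
  have Aδ : 0 ≤ A * δ := ♭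
  refine ⟨?_, ?_⟩
  · nlinarith [mul_nonneg k0 Aδ]
  · intro m hm hu x hx ϵ hϵ hux
    have := L1SUP k0 (h1.sp t ht).le (o t ht).1 (h2.cu ht) (h1.cu ht) (h2.lipN hp le_rfl hK hN' (by rwa [e2]) t ht) (h2.u0 t ht) (h2.bs t ht)
      (o t ht).2 hm hu hx hϵ hux
    refine this.trans ?_
    rw [mul_assoc _ A]
    exact mul_le_mul_of_nonneg_left (by linarith [(o t ht).1]) ♭
end

section
variable {p s₀ K T N t0 η L : ℝ} {φ s : ℝ → ℝ} {Tm : ℝ≥0∞} {u : ℝ → ℝ → ℝ}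

lemma MX.gl (h : MX p s₀ K φ ⊤ s u) (hT : 0 < T) : Sl 0 p T s u (fun t => deriv (u t)) (fun t => deriv (deriv (u t))) :=
  h.sl hT ENNReal.ofReal_lt_top

def NB (p s₀ K : ℝ) : ℝ := max (max (K ^ (1 / p)) ((2 / s₀) ^ (1 / (p - 1)))) (K * s₀)

lemma MX.NB0 (h : MX p s₀ K φ Tm s u) : 0 < NB p s₀ K :=
  lt_max_of_lt_left (lt_max_of_lt_right (by have := h.s0; positivity))

lemma MX.iM (h : MX p s₀ K φ Tm s u) : ∀ x ∈ Icc 0 (s 0), u 0 x ≤ K * s₀ := fun x hx => by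
  rw [h.init.1] at hx; rw [h.init.2 x hx]; exact h.phi x hx

lemma MX.ub0 (h : MX p s₀ K φ ⊤ s u) {t : ℝ} (ht : 0 ≤ t) : u t 0 ≤ NB p s₀ K := by
  have := UB h.hp (fun T hT => h.gl hT) h.K0 h.hl t ht
  rw [h.init.1] at this
  exact this.trans (le_max_left _ _)

lemma MX.ub (h : MX p s₀ K φ ⊤ s u) {t : ℝ} (ht : 0 ≤ t) : ∀ x ∈ Icc 0 (s t), u t x ≤ NB p s₀ K :=
  (h.gl (T := t + 1) ♮).sup h.NB0.le (fun x hx => (h.iM x hx).trans (le_max_right _ _)) (fun τ hτ => h.ub0 hτ.1) t ⟨ht, ♮⟩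

lemma MX.sp (h : MX p s₀ K φ ⊤ s u) {t : ℝ} (ht : 0 ≤ t) : 0 < s t := (h.gl (T := t + 1) ♮).sp t ⟨ht, ♮⟩

lemma MX.sm (h : MX p s₀ K φ ⊤ s u) {t t' : ℝ} (ht : 0 ≤ t) (htt : t ≤ t') : s t ≤ s t' :=
  (h.gl (T := t' + 1) ♮).sm le_rfl ⟨ht, ♮⟩ ⟨♮, ♮⟩ htt

lemma MX.lip (h : MX p s₀ K φ ⊤ s u) {t : ℝ} (ht : 0 ≤ t) :
    ∀ x ∈ Icc 0 (s t), ∀ y ∈ Icc 0 (s t), |u t x - u t y| ≤ max K (NB p s₀ K ^ p) * |x - y| :=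
  (h.gl (T := t + 1) ♮).lipN h.hp le_rfl h.K0 (fun τ hτ => h.ub0 hτ.1) h.hl t ⟨ht, ♮⟩

lemma LIMG (h : MX p s₀ K φ Tm s u) (H : ∀ δ > 0, ∃ φ1 s1 u1, MX p s₀ K φ1 ⊤ s1 u1 ∧ ∀ x ∈ Icc 0 s₀, φ1 x ≤ φ x ∧ φ x ≤ φ1 x + δ) : Tm = ⊤ := by
  refine CONT h (N := NB p s₀ K) fun t t0 tm => ?_
  by_contra hc
  push Not at hc
  have h2 := h.sl t0 tm
  obtain ⟨M, M0, hM⟩ := h2.bdd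
  have KS : 0 ≤ K * s₀ := mul_nonneg h.K0 h.s0.le
  obtain ⟨C, C0, HC⟩ := DIFF h.hp h.K0 M0 h.s0 KS t0.le
  obtain ⟨ϵ, hϵ⟩ : ∃ ϵ, ϵ = u t 0 - NB p s₀ K := ◇
  have ϵ0 : 0 < ϵ := ♮
  obtain ⟨φ1, s1, u1, h1, hφ⟩ := H (ϵ ^ 2 / (2 * C)) ♭
  have tt : t ∈ Icc 0 t := ⟨t0.le, le_rfl⟩
  have := (HC t s1 s u1 u _ _ _ _ (ϵ ^ 2 / (2 * C)) le_rfl ♭ (h1.gl t0) h2 h1.init.1 h.init.1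
    (fun x hx => by rw [h1.init.2 x hx, h.init.2 x hx]; exact hφ x hx) (h.init.1 ▸ h.hl) (h.init.1 ▸ h.iM)
    (fun τ hτ => hM τ hτ 0 ⟨le_rfl, (h2.sp τ hτ).le⟩) t tt).2 _ h.NB0.le (h1.ub t0.le) 0 ⟨le_rfl, (h2.sp t tt).le⟩ ϵ ϵ0 ♮
  have e : C * (ϵ ^ 2 / (2 * C)) = ϵ ^ 2 / 2 := by field_simp
  rw [e] at this
  nlinarith [pow_pos ϵ0 2]

lemma STAY (h : MX p s₀ K φ Tm s u) (ht0 : 0 ≤ t0) (hm : ENNReal.ofReal t0 < Tm) (hη : 0 < η) (hη8 : η ≤ 1 / 8) (hηp : η ^ (p - 1) ≤ 1 / (8 * s t0))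
    (hi : ∀ x ∈ Icc 0 (s t0), u t0 x ≤ η / 2) :
    Tm = ⊤ ∧ (∀ t, t0 < t → s t ≤ 2 * s t0) ∧ ∀ t, t0 < t → ∀ x ∈ Icc 0 (s t), u t x ≤ η * exp (-(1 / (16 * s t0 ^ 2)) * (t - t0)) := by
  have A : ∀ t, t0 < t → ENNReal.ofReal t < Tm → s t ≤ 2 * s t0 ∧ ∀ x ∈ Icc 0 (s t), u t x ≤ η * exp (-(1 / (16 * s t0 ^ 2)) * (t - t0)) := fun t tt tm => by
    have := CRIT h.hp ((h.sl (ht0.trans_lt tt) tm).shift ht0 tt) hη hη8 (by simpa using hηp) (by simpa using hi)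
    simp only [zero_add, sub_add_cancel] at this
    refine ⟨this.1.le, fun x hx => ?_⟩
    have := this.2 (t - t0) ⟨♮, le_rfl⟩ x (by simpa using hx)
    simpa using this
  obtain ⟨T1, a, b⟩ := ENNReal.lt_iff_exists_nnreal_btwn.1 hm
  have a' : t0 < T1 := by rwa [← ENNReal.ofReal_coe_nnreal, ENNReal.ofReal_lt_ofReal_iff_of_nonneg ht0] at a
  have h1 := h.sl (T := T1) ♮ (by simpa using b)
  obtain ⟨M, M0, hM⟩ := h1.bdd
  have top : Tm = ⊤ := CONT h (N := max M η) fun t tp tm => by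
    by_cases hc : t ≤ T1
    · exact (hM t ⟨tp.le, hc⟩ 0 ⟨le_rfl, (h1.sp t ⟨tp.le, hc⟩).le⟩).trans (le_max_left _ _)
    · push Not at hc
      refine ((A t ♮ tm).2 0 ⟨le_rfl, ((h.sl tp tm).sp t ⟨tp.le, le_rfl⟩).le⟩).trans ((mul_le_of_le_one_right hη.le (exp_le_one_iff.2 ?_)).trans (le_max_right _ _))
      rw [neg_mul, Left.neg_nonpos_iff]
      exact mul_nonneg ♭ ♮
  subst top
  exact ⟨rfl, fun t tt => (A t tt ENNReal.ofReal_lt_top).1, fun t tt => (A t tt ENNReal.ofReal_lt_top).2⟩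

lemma F7 (h : MX p s₀ K φ ⊤ s u) (hL : ∀ t, 0 ≤ t → s t ≤ L) {ϵ : ℝ} (hϵ : 0 < ϵ) : ∃ t, 0 < t ∧ ∀ x ∈ Icc 0 (s t), u t x ≤ ϵ := by
  obtain ⟨k, hk⟩ : ∃ k, k = max K (NB p s₀ K ^ p) := ◇
  have k0 : 0 ≤ k := hk ▸ le_max_of_le_left h.K0
  obtain ⟨d, hd⟩ : ∃ d, d = ϵ ^ 2 / (4 * (k + 1)) := ◇
  have d0 : 0 < d := by rw [hd]; positivity
  have L0 : 0 < L := (h.sp le_rfl).trans_le (hL 0 le_rfl)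
  have N0 := h.NB0
  suffices H : ∃ t, 0 < t ∧ ∫ x in ⓪..(s t), u t x < d by
    obtain ⟨t, tp, ht⟩ := H
    refine ⟨t, tp, fun x hx => ?_⟩
    by_contra hc
    push Not at hc
    have g := h.gl (T := t) tp
    have tt : t ∈ Icc 0 t := ⟨tp.le, le_rfl⟩
    have := L1SUP (K := k) (a := 0) (g := fun _ => 0) (m := 0) k0 le_rfl (h.sp tp.le).le (g.cu tt) continuousOn_const (hk ▸ h.lip tp.le) (g.u0 t tt) (g.bs t tt)
      (fun x hx => g.u0 t tt x ⟨hx.1, hx.2.trans (h.sp tp.le).le⟩) le_rfl (fun _ _ => le_rfl) hx hϵ ♮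
    rw [intervalIntegral.integral_same, sub_zero] at this
    have h2 := mul_lt_mul_of_pos_left ht (show 0 < 4 * (k + 1) by linarith)
    have e : 4 * (k + 1) * d = ϵ ^ 2 := by rw [hd]; field_simp
    linarith
  by_contra hc
  push Not at hc
  obtain ⟨B, hB⟩ : ∃ B, B = L ^ 2 * (NB p s₀ K * L + L) + ((∫ x in ⓪..(s 0), (L ^ 2 - x ^ 2) * u 0 x) + (L ^ 2 * s 0 - s 0 ^ 3 / 3)) := ◇
  have key : ∀ t, 0 < t → 2 * (d * t) ≤ B := fun t tp => by
    have g := h.gl (T := t) tp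
    have tt : t ∈ Icc 0 t := ⟨tp.le, le_rfl⟩
    have z0 : ⓪ ∈ Icc 0 t := ⟨le_rfl, tp.le⟩
    have m := g.mass h.hp le_rfl tp.le le_rfl
    have id := g.ID (Ψ := fun x => L ^ 2 * x - x ^ 3 / 3) (ψ := fun x => L ^ 2 - x ^ 2) (ψ1 := fun x => -(2 * x)) (ψ2 := fun _ => -2) h.hp
      (fun x => (((hasDerivAt_id x).const_mul (L ^ 2)).sub (((hasDerivAt_id x).pow 3).div_const 3)).congr_deriv (by simp))
      (fun x => (((hasDerivAt_id x).pow 2).const_sub (L ^ 2)).congr_deriv (by simp))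
      (fun x => (((hasDerivAt_id x).const_mul 2).neg).congr_deriv (by simp)) continuous_const le_rfl tp.le le_rfl
    simp only [mul_zero, neg_zero, zero_mul, add_zero, intervalIntegral.integral_const_mul, zero_pow two_ne_zero, sub_zero] at id
    have c1 : IntervalIntegrable (fun τ => L ^ 2 * u τ 0 ^ p) volume 0 t :=
      (continuousOn_const.mul (g.c0.rpow_const fun t _ => Or.inr (by linarith [h.hp]))).intervalIntegrable_of_Icc tp.le
    have cI : ContinuousOn (fun τ => ∫ x in ⓪..(s τ), u τ x) (Icc 0 t) := by simpa using g.intC (f := fun _ => 1) continuous_const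
    have c2 : IntervalIntegrable (fun τ => ∫ x in ⓪..(s τ), u τ x) volume 0 t := cI.intervalIntegrable_of_Icc tp.le
    rw [intervalIntegral.integral_add c1 (c2.const_mul _), intervalIntegral.integral_const_mul, intervalIntegral.integral_const_mul] at id
    have lo : ∫ τ in ⓪..t, d ≤ ∫ τ in ⓪..t, ∫ x in ⓪..(s τ), u τ x := by
      refine intervalIntegral.integral_mono_on_of_le_Ioo tp.le intervalIntegrable_const c2 fun τ hτ => hc τ hτ.1
    simp only [intervalIntegral.integral_const, sub_zero, smul_eq_mul] at lo
    have up := g.intM tt (h.ub tp.le)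
    have sL := hL t tp.le
    have s1 := h.sp tp.le
    have i0 := g.int0 z0
    have s0 := h.sp (le_refl ⓪)
    have P : ∫ τ in ⓪..t, u τ 0 ^ p ≤ NB p s₀ K * L + L := by nlinarith
    have A1 : 0 ≤ ∫ x in ⓪..(s t), (L ^ 2 - x ^ 2) * u t x := intervalIntegral.integral_nonneg s1.le fun x hx =>
      mul_nonneg (by nlinarith [hx.1, hx.2]) (g.u0 t tt x hx)
    have A2 : 0 ≤ L ^ 2 * s t - s t ^ 3 / 3 := by nlinarith [mul_nonneg s1.le (show 0 ≤ L ^ 2 - s t ^ 2 by nlinarith), pow_pos s1 3]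
    have := mul_le_mul_of_nonneg_left P (sq_nonneg L)
    nlinarith
  have B0 := key 1 one_pos
  have := key (B / d) (div_pos ♮ d0)
  rw [mul_div_cancel₀ _ d0.ne'] at this
  linarith
end

section
variable {p s₀ K T N t0 η L : ℝ} {φ s : ℝ → ℝ} {u : ℝ → ℝ → ℝ}

lemma etaE (p S : ℝ) (hp : 1 < p) (hS : 0 < S) : ∃ η, 0 < η ∧ η ≤ 1 / 8 ∧ ∀ S', 0 < S' → S' ≤ S → η ^ (p - 1) ≤ 1 / (8 * S') := by
  refine ⟨min (1 / 8) ((1 / (8 * S)) ^ (1 / (p - 1))), ♭, min_le_left _ _, fun S' h0 h1 => ?_⟩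
  refine (rpow_le_rpow ♭ ◨ ♮).trans ?_
  rw [← rpow_mul ♭, one_div_mul_cancel ♮, rpow_one]
  exact one_div_le_one_div_of_le ♭ ♮

lemma OPEN (h : MX p s₀ K φ ⊤ s u) (hL : ∀ t, 0 ≤ t → s t ≤ L) : ∃ δ > 0, ∀ φ' Tm' s' u', MX p s₀ K φ' Tm' s' u' →
    (∀ x ∈ Icc 0 s₀, φ x ≤ φ' x ∧ φ' x ≤ φ x + δ) → Tm' = ⊤ ∧ ∃ L', ∀ t, 0 ≤ t → s' t ≤ L' := by
  have L0 : 0 < L := (h.sp le_rfl).trans_le (hL 0 le_rfl)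
  obtain ⟨η, η0, η8, ηp⟩ := etaE p (L + 1) h.hp ♮
  obtain ⟨t0, tp, hu⟩ := F7 h hL (show 0 < η / 4 by positivity)
  have N0 := h.NB0
  obtain ⟨C, C0, HC⟩ := DIFF (N := NB p s₀ K + 1) h.hp h.K0 ♮ h.s0 (mul_nonneg h.K0 h.s0.le) tp.le
  obtain ⟨δ, hδ⟩ : ∃ δ, δ = (η / 4) ^ 2 / (2 * C) := ◇
  have δ0 : 0 < δ := by rw [hδ]; positivity
  have Cδ : C * δ = (η / 4) ^ 2 / 2 := by rw [hδ]; field_simp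
  have Cδ1 : C * δ < 1 := by rw [Cδ]; nlinarith
  refine ⟨δ, δ0, fun φ' Tm' s' u' h' hφ => ?_⟩
  have D := fun T' (hT' : 0 < T') (a : T' ≤ t0) (b : ENNReal.ofReal T' < Tm') => HC T' s s' u u' _ _ _ _ δ a δ0.le (h.gl hT') (h'.sl hT' b) h.init.1 h'.init.1
    (fun x hx => by rw [h.init.2 x hx, h'.init.2 x hx]; exact hφ x hx) (h'.init.1 ▸ h'.hl) (h'.init.1 ▸ h'.iM)
  have i0 : u' 0 0 ≤ NB p s₀ K := (h'.iM 0 ⟨le_rfl, by rw [h'.init.1]; exact h.s0.le⟩).trans (le_max_right _ _)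
  have bd : ∀ t, 0 < t → t ≤ t0 → ENNReal.ofReal t < Tm' → u' t 0 ≤ NB p s₀ K + 1 := fun t t1 t2 t3 => by
    by_contra hc
    push Not at hc
    have g := h'.sl t1 t3
    have cl : IsClosed {τ | τ ∈ Icc 0 t ∧ NB p s₀ K + 1 ≤ u' τ 0} := isClosed_Icc.isClosed_le continuousOn_const g.c0
    obtain ⟨a, ⟨a1, a2⟩, a3⟩ := (isCompact_Icc.of_isClosed_subset cl fun _ hx => hx.1).exists_isLeast ⟨t, ⟨t1.le, le_rfl⟩, hc.le⟩
    have ap : 0 < a := by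
      rcases a1.1.eq_or_lt with e | e
      · rw [← e] at a2; linarith
      · exact e
    obtain ⟨b, b1, b2⟩ := intermediate_value_Icc a1.1 (g.c0.mono (Icc_subset_Icc le_rfl a1.2))
      (show NB p s₀ K + 1 ∈ Icc (u' 0 0) (u' a 0) from ⟨♮, a2⟩)
    have ab : a ≤ b := a3 ⟨⟨b1.1, b1.2.trans a1.2⟩, b2.ge⟩
    obtain rfl : a = b := le_antisymm ab b1.2
    have := (D a ap (a1.2.trans t2) ((ENNReal.ofReal_le_ofReal a1.2).trans_lt t3) (fun τ hτ => by
      by_contra hcc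
      push Not at hcc
      have := a3 ⟨⟨hτ.1, hτ.2.trans a1.2⟩, hcc.le⟩
      obtain rfl : a = τ := le_antisymm this hτ.2
      exact absurd b2 hcc.ne') a b1).2 (NB p s₀ K) N0.le (h.ub ap.le) 0 ⟨le_rfl, (g.sp a a1).le⟩ 1 one_pos b2.ge
    linarith
  have tm : ENNReal.ofReal t0 < Tm' := by
    by_contra hc
    push Not at hc
    have := CONT h' (N := NB p s₀ K + 1) fun t t1 t2 => bd t t1 ((ENNReal.ofReal_le_ofReal_iff tp.le).1 (t2.le.trans hc)) t2
    rw [this, top_le_iff] at hc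
    exact ENNReal.ofReal_ne_top hc
  have D0 := D t0 tp le_rfl tm (fun τ hτ => by
    rcases hτ.1.eq_or_lt with e | e
    · rw [← e]; linarith
    · exact bd τ e hτ.2 ((ENNReal.ofReal_le_ofReal hτ.2).trans_lt tm)) t0 ⟨tp.le, le_rfl⟩
  have g := h'.sl tp tm
  have := STAY h' tp.le tm η0 η8 (ηp _ (g.sp t0 ⟨tp.le, le_rfl⟩) (by linarith [hL t0 tp.le])) (fun x hx => by
    by_contra hc
    push Not at hc
    have := D0.2 (η / 4) ♭ hu x hx (η / 4) ♭ ♮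
    rw [Cδ] at this
    nlinarith [pow_pos η0 2])
  obtain ⟨rfl, a, -⟩ := this
  refine ⟨rfl, 2 * s' t0, fun t ht => ?_⟩
  rcases le_or_gt t t0 with c | c
  · linarith [h'.sm ht c, h'.sp tp.le]
  · exact a t c

lemma DOWN {φ' s' : ℝ → ℝ} {u' : ℝ → ℝ → ℝ} {Tm' : ℝ≥0∞} (h : MX p s₀ K φ ⊤ s u) (h' : MX p s₀ K φ' Tm' s' u') (hφ : ∀ x ∈ Icc 0 s₀, φ' x ≤ φ x) :
    Tm' = ⊤ ∧ ∀ t, 0 ≤ t → s' t ≤ s t := by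
  have A : ∀ t, 0 < t → ENNReal.ofReal t < Tm' → s' t ≤ s t ∧ u' t 0 ≤ u t 0 := fun t t1 t2 => by
    have g := h'.sl t1 t2
    have tt : t ∈ Icc 0 t := ⟨t1.le, le_rfl⟩
    have := ORD h.hp g (h.gl t1) (h'.init.1.trans h.init.1.symm).le h.K0 (fun x hx => by
      rw [h'.init.1] at hx; rw [h.init.2 x hx, h'.init.2 x hx]; exact hφ x hx) h.hl t tt
    exact ⟨this.1, this.2 0 ⟨le_rfl, (g.sp t tt).le⟩⟩
  obtain rfl : Tm' = ⊤ := CONT h' (N := NB p s₀ K) fun t t1 t2 => (A t t1 t2).2.trans (h.ub0 t1.le)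
  refine ⟨rfl, fun t ht => ?_⟩
  rcases ht.eq_or_lt with e | e
  · rw [← e, h.init.1, h'.init.1]
  · exact (A t e ENNReal.ofReal_lt_top).1

/-- the bounded case -/
lemma BDD1 (h : MX p s₀ K φ ⊤ s u) (hL : ∀ t, 0 ≤ t → s t ≤ L) : (∃ L : ℝ, Tendsto s atTop (𝓝 L)) ∧
    ∃ α : ℝ, 0 < α ∧ (fun t => supNorm s u t) =O[atTop] fun t => exp (-α * t) := by
  have L0 : 0 < L := (h.sp le_rfl).trans_le (hL 0 le_rfl)
  constructor
  · have mo : Monotone fun t => s (max t 0) := fun a b hab => h.sm (le_max_right _ _) (max_le_max hab le_rfl)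
    refine ⟨_, (tendsto_atTop_ciSup mo ⟨L, ?_⟩).congr' ?_⟩
    · rintro _ ⟨t, rfl⟩; exact hL _ (le_max_right _ _)
    · filter_upwards [eventually_ge_atTop 0] with t ht; simp [ht]
  · obtain ⟨η, η0, η8, ηp⟩ := etaE p L h.hp L0
    obtain ⟨t0, tp, hu⟩ := F7 h hL (show 0 < η / 2 by positivity)
    have := (STAY h tp.le ENNReal.ofReal_lt_top η0 η8 (ηp _ (h.sp tp.le) (hL t0 tp.le)) hu).2.2
    have s1 := h.sp tp.le
    refine ⟨1 / (16 * s t0 ^ 2), ♭, Asymptotics.IsBigO.of_bound (η * exp (1 / (16 * s t0 ^ 2) * t0)) ?_⟩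
    filter_upwards [eventually_gt_atTop t0] with t ht
    have g := h.gl (T := t) (tp.trans ht)
    have tt : t ∈ Icc 0 t := ⟨(tp.trans ht).le, le_rfl⟩
    have st := h.sp tt.1
    rw [norm_of_nonneg (exp_pos _).le, norm_of_nonneg, mul_assoc, ← exp_add]
    · refine csSup_le ((nonempty_Ioo.2 st).image _) ?_
      rintro _ ⟨x, hx, rfl⟩
      refine (this t ht x (Ioo_subset_Icc_self hx)).trans (le_of_eq ?_)
      congr 2; ring
    · refine Real.sSup_nonneg ?_
      rintro _ ⟨x, hx, rfl⟩
      exact g.u0 t tt x (Ioo_subset_Icc_self hx)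
end

section
variable {p s₀ K T N t0 η L : ℝ} {φ s : ℝ → ℝ} {u : ℝ → ℝ → ℝ}

lemma MX.n0 (h : MX p s₀ K φ ⊤ s u) {t x : ℝ} (ht : 0 ≤ t) (hx : x ∈ Icc 0 (s t)) : 0 ≤ u t x :=
  (h.gl (T := t + 1) ♮).u0 t ⟨ht, ♮⟩ x hx

lemma MX.n00 (h : MX p s₀ K φ ⊤ s u) {t : ℝ} (ht : 0 ≤ t) : 0 ≤ u t 0 := h.n0 ht ⟨le_rfl, (h.sp ht).le⟩

lemma MX.sht (h : MX p s₀ K φ ⊤ s u) {a : ℝ} (ha : 0 ≤ a) (hT : 0 < T) :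
    Sl 0 p T (fun t => s (t + a)) (fun t => u (t + a)) (fun t => deriv (u (t + a))) (fun t => deriv (deriv (u (t + a)))) := by
  have := (h.gl (T := T + a) ♮).shift ha ♮
  rwa [add_sub_cancel_right] at this

lemma sT (h : MX p s₀ K φ ⊤ s u) (hU : ¬ ∃ L, ∀ t, 0 ≤ t → s t ≤ L) : Tendsto s atTop atTop := by
  refine tendsto_atTop.2 fun b => ?_
  push Not at hU
  obtain ⟨t, t1, t2⟩ := hU b
  filter_upwards [eventually_ge_atTop t] with τ hτ using t2.le.trans (h.sm t1 hτ)

lemma DEC0 (h : MX p s₀ K φ ⊤ s u) (hs : Tendsto s atTop atTop) : Tendsto (fun t => u t 0) atTop (𝓝 0) := by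
  have bdA : IsBoundedUnder (· ≤ ·) atTop fun t => u t 0 := ⟨NB p s₀ K, by
    rw [eventually_map]; filter_upwards [eventually_ge_atTop 0] with t ht using h.ub0 ht⟩
  have bdB : IsBoundedUnder (· ≥ ·) atTop fun t => u t 0 := ⟨0, by
    rw [eventually_map]; filter_upwards [eventually_ge_atTop 0] with t ht using h.n00 ht⟩
  obtain ⟨a, ha⟩ : ∃ a, a = limsup (fun t => u t 0) atTop := ◇
  rcases le_or_gt a 0 with a0 | a0
  · refine (tendsto_order.2 ⟨fun b hb => ?_, fun b hb => eventually_lt_of_limsup_lt (by rw [← ha]; linarith) bdA⟩)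
    filter_upwards [eventually_ge_atTop 0] with t ht using hb.trans_le (h.n00 ht)
  exfalso
  have aN : a ≤ NB p s₀ K := by
    rw [ha]; refine limsup_le_of_le bdB.isCoboundedUnder_le ?_
    filter_upwards [eventually_ge_atTop 0] with t ht using h.ub0 ht
  obtain ⟨ε, T0, ε0, T00, HK⟩ := KEY h.hp a0 one_pos
  obtain ⟨ε', ε'0, ε'1, ε'2⟩ : ∃ ε', 0 < ε' ∧ ε' ≤ ε / 2 ∧ (a + ε') ^ p ≤ a ^ p + ε := by
    have c : Tendsto (fun e : ℝ => (a + e) ^ p) (𝓝[>] 0) (𝓝 ((a + 0) ^ p)) :=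
      ((continuous_rpow_const (by linarith [h.hp])).comp (continuous_const.add continuous_id)).continuousAt.mono_left nhdsWithin_le_nhds
    have e1 := c.eventually (eventually_le_nhds (show (a + 0) ^ p < a ^ p + ε by rw [add_zero]; linarith))
    obtain ⟨e, e1, e2⟩ := (e1.and (Ioc_mem_nhdsGT (show 0 < ε / 2 by positivity))).exists
    exact ⟨e, e2.1, e2.2, e1⟩
  have ev : ∀ᶠ t in atTop, u t 0 < a + ε' := eventually_lt_of_limsup_lt (by rw [← ha]; linarith) bdA
  have fr : ∃ᶠ t in atTop, a - ε' < u t 0 := frequently_lt_of_lt_limsup bdB.isCoboundedUnder_le (by rw [← ha]; linarith)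
  obtain ⟨t1, ht1⟩ := eventually_atTop.1 (ev.and (eventually_ge_atTop 0))
  have t10 := (ht1 t1 le_rfl).2
  obtain ⟨k, hk⟩ : ∃ k, k = (a + ε') ^ p := ◇
  have k0 : 0 < k := by rw [hk]; positivity
  have N0 := h.NB0
  obtain ⟨R, hR⟩ : ∃ R, R = NB p s₀ K / k := ◇
  have R0 : 0 < R := by rw [hR]; positivity
  have kR : k * R = NB p s₀ K := by rw [hR]; field_simp
  obtain ⟨κ, hκ⟩ : ∃ κ, κ = π / 2 / R := ◇
  have κ0 : 0 < κ := by rw [hκ]; positivity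
  have κR : κ * R = π / 2 := by rw [hκ]; field_simp
  obtain ⟨K0, hK0⟩ : ∃ K0, K0 = max K (NB p s₀ K ^ p) := ◇
  have K00 : 0 ≤ K0 := hK0 ▸ le_max_of_le_left h.K0
  have G := fun T (hT : 0 < T) => GRADu (h.sht t10 hT) le_rfl (K := k) (B := K0 * R) (R := R) (κ := κ) k0.le ♭ κ0.le κR.le R0
    (fun t ht => by rw [hk]; exact rpow_le_rpow (h.n00 (by linarith [ht.1])) (ht1 _ (by linarith [ht.1])).1.le (by linarith [h.hp]))
    (fun t ht x hx _ => by rw [kR]; exact h.ub (by linarith [ht.1]) x hx) (fun x y x0 xy ys yR => by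
      simp only [zero_add] at ys ⊢
      have l := (le_abs_self _).trans (h.lip t10 x ⟨x0, ♮⟩ y ⟨♮, ys⟩)
      rw [← hK0, abs_sub_comm, abs_of_nonneg ♮] at l
      have j := mul_le_sin (x := κ * (y - x)) (mul_nonneg κ0.le ♮) (by rw [← κR]; exact mul_le_mul_of_nonneg_left yR κ0.le)
      have e : 2 / π * (κ * (y - x)) * R = y - x := by
        have : 2 / π * (κ * (y - x)) * R = 2 / π * (κ * R) * (y - x) := by ring
        rw [this, κR]; field_simp
      have := mul_le_mul_of_nonneg_left j (mul_nonneg K00 R0.le)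
      have e2 : K0 * R * (2 / π * (κ * (y - x))) = K0 * (y - x) := by linear_combination K0 * e
      nlinarith [mul_nonneg k0.le (show 0 ≤ y - x by linarith)])
  have lim : Tendsto (fun t : ℝ => K0 * R * exp (-κ ^ 2 * (t - t1))) atTop (𝓝 (K0 * R * 0)) := by
    refine (tendsto_exp_atBot.comp ?_).const_mul _
    exact (tendsto_atTop_add_const_right _ (-t1) tendsto_id).const_mul_atTop_of_neg (show -κ ^ 2 < 0 by nlinarith [pow_pos κ0 2])
  rw [mul_zero] at lim
  obtain ⟨t, f1, f2, f3, f4⟩ := (fr.and_eventually ((lim.eventually (gt_mem_nhds (show ⓪ < ε / 2 by positivity))).and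
    ((eventually_gt_atTop t1).and (hs.eventually_ge_atTop (1 / a ^ (p - 1) + 1))))).exists
  refine HK _ _ _ _ (h.sht (a := t) ♮ T00) (by simpa using f4) fun x hx => ?_
  simp only [zero_add] at hx ⊢
  have n := h.n0 (show 0 ≤ t by linarith) hx
  rcases le_or_gt x R with c | c
  · have := G (t - t1) ♮ (t - t1) ⟨♮, le_rfl⟩ 0 x le_rfl hx.1 (by simpa using hx.2) ♮
    simp only [sub_add_cancel, sub_zero] at this
    have s1 : K0 * R * exp (-κ ^ 2 * (t - t1)) * sin (κ * x) ≤ K0 * R * exp (-κ ^ 2 * (t - t1)) := mul_le_of_le_one_right ♭ (sin_le_one _)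
    have := mul_le_mul_of_nonneg_right (hk ▸ ε'2) hx.1
    linarith
  · have := mul_le_mul (hk ▸ ε'2) c.le R0.le ♭
    linarith

lemma DECs (h : MX p s₀ K φ ⊤ s u) (hs : Tendsto s atTop atTop) {ε : ℝ} (hε : 0 < ε) : ∃ t1, 0 ≤ t1 ∧ ∀ t, t1 ≤ t → ∀ x ∈ Icc 0 (s t), u t x ≤ ε := by
  obtain ⟨t1, ht1⟩ := eventually_atTop.1 (((DEC0 h hs).eventually (gt_mem_nhds (show ⓪ < ε / 2 by positivity))).and (eventually_ge_atTop 0))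
  have t10 := (ht1 t1 le_rfl).2
  have N0 := h.NB0
  have Γp : ∀ t x : ℝ, 0 < t → 0 < Γ0 t x := fun t x ht => by
    have := k0_pos
    unfold Γ0 E; rw [if_pos ht]; positivity
  obtain ⟨y, hy, hmin⟩ := isCompact_Icc.exists_isMinOn (nonempty_Icc.2 (h.sp t10).le) (f := Γ0 1) (fun x _ => (Γ0_hx 1 x).continuousAt.continuousWithinAt)
  have y0 := Γp 1 y one_pos
  obtain ⟨A, hA⟩ : ∃ A, A = NB p s₀ K / Γ0 1 y := ◇
  have A0 : 0 < A := by rw [hA]; positivity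
  have Ay : A * Γ0 1 y = NB p s₀ K := by rw [hA]; field_simp
  have up := fun T (hT : 0 < T) => (h.sht t10 hT).upper (C := 0) (v := fun t x => ε / 2 + A * Γ0 (t + 1) x) (vt := fun t x => A * Γ2 (t + 1) x)
    (vx := fun t x => A * Γ1 (t + 1) x) (vxx := fun t x => A * Γ2 (t + 1) x)
    (fun z hz => by
      have := (Γ_cont (z.1 + 1) z.2 (Or.inl (by linarith [hz.1.1]))).1
      have : ContinuousAt (fun z : ℝ² => Γ0 (z.1 + 1) z.2) z := ContinuousAt.comp (f := fun z : ℝ² => (z.1 + 1, z.2)) this ♯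
      exact (continuousAt_const.add (continuousAt_const.mul this)).continuousWithinAt)
    (fun x hx => by
      simp only [zero_add] at hx ⊢
      have := mul_le_mul_of_nonneg_left (hmin hx) A0.le
      linarith [h.ub t10 x hx])
    (fun t ht x hx => ((((Γ0_ht (t + 1) x (Or.inl (by linarith [ht.1]))).comp_add_const t 1).const_mul A).const_add _))
    (fun t ht x => ((Γ0_hx (t + 1) x).const_mul A).const_add _)
    (fun t ht x hx => (Γ1_hx (t + 1) x).const_mul A)
    (fun t ht x hx _ => by simp)
    (fun t ht hh => by
      have := (ht1 (t + t1) (by linarith [ht.1])).1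
      have := mul_pos A0 (Γp (t + 1) 0 (by linarith [ht.1]))
      linarith)
    (fun t ht => by
      have := mul_pos A0 (Γp (t + 1) (s (t + t1)) (by linarith [ht.1]))
      linarith)
  obtain ⟨C, C0, hC⟩ := Γ_near
  have lim : Tendsto (fun t : ℝ => A * (C * (t - t1 + 1) ^ ⊟)) atTop (𝓝 (A * (C * 0))) := by
    refine (((tendsto_rpow_neg_atTop (show ⓪ < 1 / 2 by norm_num)).comp ?_).const_mul _).const_mul _
    exact tendsto_atTop_add_const_right _ _ (tendsto_atTop_add_const_right _ _ tendsto_id)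
  rw [mul_zero, mul_zero] at lim
  obtain ⟨t2, ht2⟩ := eventually_atTop.1 ((lim.eventually (gt_mem_nhds (show ⓪ < ε / 2 by positivity))).and (eventually_gt_atTop t1))
  have t20 := (ht2 t2 le_rfl).2
  refine ⟨t2, ♮, fun t ht x hx => ?_⟩
  have a := up (t - t1) ♮ (t - t1) ⟨♮, le_rfl⟩ x (by simpa using hx)
  simp only [sub_add_cancel] at a
  have b := (le_abs_self _).trans (hC (t - t1 + 1) x ♮).1
  have := mul_le_mul_of_nonneg_left b A0.le
  linarith [(ht2 t ht).1]
end

section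
variable {p s₀ K T N t0 η L : ℝ} {φ s : ℝ → ℝ} {u : ℝ → ℝ → ℝ}

lemma MX.SN (h : MX p s₀ K φ ⊤ s u) {t : ℝ} (ht : 0 ≤ t) : 0 ≤ supNorm s u t ∧ (∀ m, (∀ x ∈ Icc 0 (s t), u t x ≤ m) → supNorm s u t ≤ m) ∧
    ∀ x ∈ Icc 0 (s t), u t x ≤ supNorm s u t := by
  have st := h.sp ht
  refine ⟨Real.sSup_nonneg ?_, fun m hm => csSup_le ((nonempty_Ioo.2 st).image _) ?_, ?_⟩
  · rintro _ ⟨x, hx, rfl⟩; exact h.n0 ht (Ioo_subset_Icc_self hx)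
  · rintro _ ⟨x, hx, rfl⟩; exact hm x (Ioo_subset_Icc_self hx)
  · have cu := (h.gl (T := t + 1) ♮).cu ⟨ht, ♮⟩
    have cl : IsClosed {x | x ∈ Icc 0 (s t) ∧ u t x ≤ supNorm s u t} := isClosed_Icc.isClosed_le cu continuousOn_const
    have sub : Ioo 0 (s t) ⊆ {x | x ∈ Icc 0 (s t) ∧ u t x ≤ supNorm s u t} := fun x hx => ⟨Ioo_subset_Icc_self hx, le_csSup ⟨NB p s₀ K, by
      rintro _ ⟨x, hx, rfl⟩; exact h.ub ht x (Ioo_subset_Icc_self hx)⟩ (mem_image_of_mem _ hx)⟩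
    have := closure_minimal sub cl
    rw [closure_Ioo st.ne] at this
    exact fun x hx => (this hx).2

lemma F8 (h : MX p s₀ K φ ⊤ s u) (hU : ¬ ∃ L, ∀ t, 0 ≤ t → s t ≤ L) : Tendsto s atTop atTop ∧
        Tendsto (fun t => supNorm s u t) atTop (𝓝 0) ∧
        (∃ c : ℝ, 0 < c ∧ ∀ᶠ t in atTop, c ≤ s t ^ (1 / (p - 1)) * supNorm s u t) ∧
        ((fun t => s t - ∫ τ in ⓪..t, u τ 0 ^ p) =o[atTop] fun t => ∫ τ in ⓪..t, u τ 0 ^ p) ∧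
        ((fun t => s t) =o[atTop] fun t : ℝ => t ^ ((1:ℝ) / 2)) ∧
        Tendsto (fun t => t ^ (1 / (2 * (p - 1))) * supNorm s u t) atTop atTop := by
  have hs := sT h hU
  have hp := h.hp
  have p1 : 0 < p - 1 := ♮
  have ip : 0 < 1 / (p - 1) := ♭
  have e0 := eventually_ge_atTop ⓪
  have D : ∃ c : ℝ, 0 < c ∧ ∀ᶠ t in atTop, c ≤ s t ^ (1 / (p - 1)) * supNorm s u t := by
    refine ⟨(1 / 8) ^ (1 / (p - 1)) / 2, ♭, ?_⟩
    filter_upwards [e0, hs.eventually_ge_atTop (1 / (8 * (1 / 8) ^ (p - 1)))] with t ht hst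
    have st := h.sp ht
    obtain ⟨η, hη⟩ : ∃ η, η = (1 / (8 * s t)) ^ (1 / (p - 1)) := ◇
    have η0 : 0 < η := by rw [hη]; positivity
    have ηp : η ^ (p - 1) = 1 / (8 * s t) := by rw [hη, ← rpow_mul ♭, one_div_mul_cancel p1.ne', rpow_one]
    have q0 : ⓪ < (1 / 8) ^ (p - 1) := ♭
    have η8 : η ≤ 1 / 8 := by
      refine (rpow_le_rpow_iff η0.le ♩ p1).1 ?_
      rw [ηp, div_le_iff₀ ♭]
      rw [div_le_iff₀ ♭] at hst
      linarith
    have : η / 2 ≤ supNorm s u t := by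
      by_contra hc
      push Not at hc
      have := (STAY h ht ENNReal.ofReal_lt_top η0 η8 ηp.le (fun x hx => ((h.SN ht).2.2 x hx).trans hc.le)).2.1
      refine hU ⟨2 * s t, fun τ hτ => ?_⟩
      rcases le_or_gt τ t with c | c
      · linarith [h.sm hτ c]
      · exact this τ c
    refine le_trans (le_of_eq ?_) (mul_le_mul_of_nonneg_left this ♭)
    rw [hη, mul_div_assoc', ← mul_rpow st.le ♭]
    congr 2; field_simp
  have F : (fun t => s t) =o[atTop] fun t : ℝ => t ^ ((1:ℝ) / 2) := by
    refine Asymptotics.isLittleO_iff.2 fun c hc => ?_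
    obtain ⟨t1, t10, ht1⟩ := DECs h hs (show 0 < c ^ 2 / 4 by positivity)
    obtain ⟨B, hB⟩ : ∃ B, B = (∫ x in ⓪..(s 0), x * u 0 x) + s 0 ^ 2 / 2 := ◇
    filter_upwards [eventually_ge_atTop t1, eventually_gt_atTop 0, eventually_ge_atTop ((2 * B + 2 * (NB p s₀ K * t1)) / (c ^ 2 / 2))] with t tt1 tp tB
    rw [div_le_iff₀ ♭] at tB
    have g := h.gl (T := t) tp
    have st := h.sp tp.le
    have tt : t ∈ Icc 0 t := ⟨tp.le, le_rfl⟩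
    have id := g.ID (Ψ := fun x => x ^ 2 / 2) (ψ := fun x => x) (ψ1 := fun x => 1) (ψ2 := fun _ => 0) hp
      (fun x => (((hasDerivAt_id x).pow 2).div_const 2).congr_deriv (by simp)) (fun x => hasDerivAt_id x)
      (fun x => hasDerivAt_const _ _) continuous_const le_rfl tp.le le_rfl
    simp only [zero_mul, one_mul, zero_add, add_zero, intervalIntegral.integral_zero] at id
    rw [← hB] at id
    have A1 : 0 ≤ ∫ x in ⓪..(s t), x * u t x := intervalIntegral.integral_nonneg st.le fun x hx => mul_nonneg hx.1 (g.u0 t tt x hx)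
    have c1 : IntervalIntegrable (fun τ => u τ 0) volume 0 t1 := (g.c0.mono (Icc_subset_Icc le_rfl tt1)).intervalIntegrable_of_Icc t10
    have c2 : IntervalIntegrable (fun τ => u τ 0) volume t1 t := (g.c0.mono (Icc_subset_Icc t10 le_rfl)).intervalIntegrable_of_Icc tt1
    rw [← intervalIntegral.integral_add_adjacent_intervals c1 c2] at id
    have b1 := intervalIntegral.integral_mono_on t10 c1 (g := fun _ => NB p s₀ K) (μ := volume) intervalIntegrable_const fun τ hτ => h.ub0 hτ.1
    have b2 := intervalIntegral.integral_mono_on tt1 c2 (g := fun _ => c ^ 2 / 4) (μ := volume) intervalIntegrable_const fun τ hτ =>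
      ht1 τ hτ.1 0 ⟨le_rfl, (h.sp (t10.trans hτ.1)).le⟩
    simp only [intervalIntegral.integral_const, smul_eq_mul, sub_zero] at b1 b2
    rw [norm_of_nonneg st.le, norm_of_nonneg ♭, ← sqrt_eq_rpow]
    refine abs_le_of_sq_le_sq' ?_ ♭ |>.2
    rw [mul_pow, sq_sqrt tp.le]
    nlinarith [mul_nonneg t10 (sq_nonneg c)]
  refine ⟨hs, ?_, D, ?_, F, ?_⟩
  · refine tendsto_order.2 ⟨fun b hb => ?_, fun b hb => ?_⟩
    · filter_upwards [e0] with t ht using hb.trans_le (h.SN ht).1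
    · obtain ⟨t1, t10, ht1⟩ := DECs h hs (show 0 < b / 2 by positivity)
      filter_upwards [eventually_ge_atTop t1] with t ht
      have := (h.SN (t10.trans ht)).2.1 _ (ht1 t ht)
      linarith
  · refine Asymptotics.isLittleO_iff.2 fun c hc => ?_
    obtain ⟨ε, ε0, ε1, ε2⟩ : ∃ ε, 0 < ε ∧ ε ≤ 1 / 2 ∧ ε ≤ c / 4 := ⟨min (1 / 2) (c / 4), ♭, min_le_left _ _, min_le_right _ _⟩
    obtain ⟨t1, t10, ht1⟩ := DECs h hs ε0
    obtain ⟨A, hA⟩ : ∃ A, A = (∫ x in ⓪..(s 0), u 0 x) + s 0 := ◇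
    filter_upwards [eventually_ge_atTop t1, eventually_gt_atTop 0, hs.eventually_ge_atTop (A / ε)] with t tt1 tp sA
    rw [div_le_iff₀ ε0] at sA
    have g := h.gl (T := t) tp
    have tt : t ∈ Icc 0 t := ⟨tp.le, le_rfl⟩
    have m := g.mass hp le_rfl tp.le le_rfl
    rw [zero_mul, add_zero, ← hA] at m
    have i1 := g.int0 tt
    have i2 := g.intM tt (ht1 t tt1)
    have i3 := g.int0 (t := 0) ⟨le_rfl, tp.le⟩
    have s0 := h.sp (le_refl ⓪)
    have st := h.sp tp.le
    rw [← m, Real.norm_eq_abs, Real.norm_eq_abs]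
    have f : (1 - ε) * s t ≤ |(∫ x in ⓪..(s t), u t x) + s t - A| := le_trans ♮ (le_abs_self _)
    have f2 := mul_le_mul_of_nonneg_left f hc.le
    have f3 : 2 * ε * s t ≤ c * ((1 - ε) * s t) := by rw [← mul_assoc]; exact mul_le_mul_of_nonneg_right (by nlinarith) st.le
    have e4 : 0 ≤ ε * s t := ♭
    refine le_trans (abs_le.2 ⟨?_, ?_⟩) (f3.trans f2) <;> linarith
  · obtain ⟨c, c0, hc⟩ := D
    refine tendsto_atTop.2 fun b => ?_
    obtain ⟨M, hM⟩ : ∃ M, M = (max b 1 / c) ^ (p - 1) := ◇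
    have M0 : 0 < M := by rw [hM]; positivity
    have Mp : M ^ (1 / (p - 1)) * c = max b 1 := by
      rw [hM, ← rpow_mul ♭, mul_one_div_cancel p1.ne', rpow_one, div_mul_cancel₀ _ c0.ne']
    filter_upwards [hc, (Asymptotics.isLittleO_iff.1 F) (show 0 < 1 / M by positivity), e0] with t h1 h2 ht
    have st := h.sp ht
    rw [norm_of_nonneg st.le, norm_of_nonneg ♭, one_div_mul_eq_div, le_div_iff₀ M0] at h2
    have h3 := rpow_le_rpow ♭ h2 ip.le
    rw [mul_rpow st.le M0.le, ← rpow_mul ht] at h3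
    have e : 1 / (2 * (p - 1)) = 1 / 2 * (1 / (p - 1)) := by field_simp
    rw [e]
    refine le_trans ?_ (mul_le_mul_of_nonneg_right h3 (h.SN ht).1)
    refine (le_max_left b 1).trans ?_
    rw [← Mp]
    have := mul_le_mul_of_nonneg_left h1 (rpow_nonneg M0.le (1 / (p - 1)))
    linarith
end

/-- Theorem 1.2: trichotomy for the family of solutions with initial data `(s₀, λφ)`. -/
theorem stmt_2 (p : ℝ) (hp : 1 < p) (s₀ : ℝ) (φ : ℝ → ℝ) (hW : memW s₀ φ)
    (S : ℝ → ℝ → ℝ) (U : ℝ → ℝ → ℝ → ℝ) (T : ℝ → ℝ≥0∞)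
    (hmax : ∀ lam : ℝ, 0 < lam →
      IsMaxSol p s₀ (fun x => lam * φ x) (T lam) (S lam) (U lam)) :
    ∃ lam₁ lam₂ : ℝ, 0 < lam₁ ∧ lam₁ ≤ lam₂ ∧
      -- (1) global existence with exponential decay
      (∀ lam : ℝ, 0 < lam → lam < lam₁ →
        T lam = ⊤ ∧ (∃ L : ℝ, Tendsto (S lam) atTop (𝓝 L)) ∧
        ∃ α : ℝ, 0 < α ∧
          (fun t => supNorm (S lam) (U lam) t) =O[atTop] fun t => Real.exp (-α * t)) ∧
      -- (2) global existence with non-exponential decay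
      (∀ lam : ℝ, lam₁ ≤ lam → lam ≤ lam₂ →
        T lam = ⊤ ∧ Tendsto (S lam) atTop atTop ∧
        Tendsto (fun t => supNorm (S lam) (U lam) t) atTop (𝓝 0) ∧
        (∃ c : ℝ, 0 < c ∧ ∀ᶠ t in atTop,
          c ≤ S lam t ^ (1 / (p - 1)) * supNorm (S lam) (U lam) t) ∧
        ((fun t => S lam t - ∫ τ in (0:ℝ)..t, U lam τ 0 ^ p) =o[atTop]
          fun t => ∫ τ in (0:ℝ)..t, U lam τ 0 ^ p) ∧
        ((fun t => S lam t) =o[atTop] fun t : ℝ => t ^ ((1:ℝ) / 2)) ∧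
        Tendsto (fun t => t ^ (1 / (2 * (p - 1))) * supNorm (S lam) (U lam) t)
          atTop atTop) ∧
      -- (3) blow-up
      (∀ lam : ℝ, lam₂ < lam → T lam < ⊤) := by
  obtain ⟨s0, ⟨k, hk⟩, ⟨x1, hx1, x1n⟩, hn, hz⟩ := hW
  have k0 : ⓪ ≤ k := k.2
  have hl : ∀ x ∈ Icc 0 s₀, ∀ y ∈ Icc 0 s₀, |φ x - φ y| ≤ k * |x - y| := fun x hx y hy => by
    simpa [Real.dist_eq] using hk.dist_le_mul x hx y hy
  have mx : ∀ lam Lam, 0 < lam → lam ≤ Lam → MX p s₀ (Lam * k) (fun x => lam * φ x) (T lam) (S lam) (U lam) := fun lam Lam h1 h2 =>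
    ⟨hp, s0, mul_nonneg (h1.le.trans h2) k0, fun x hx y hy => by
      rw [← mul_sub, abs_mul, abs_of_pos h1, mul_assoc]
      exact mul_le_mul h2 (hl x hx y hy) ◉ (h1.le.trans h2), fun x hx => mul_nonneg h1.le (hn x hx), by simp [hz], hmax lam h1⟩
  have mt : ∀ lam Lam, 0 < lam → lam ≤ Lam → T lam = ⊤ → MX p s₀ (Lam * k) (fun x => lam * φ x) ⊤ (S lam) (U lam) := fun lam Lam h1 h2 h3 =>
    h3 ▸ mx lam Lam h1 h2
  have M : ∀ x ∈ Icc 0 s₀, φ x ≤ k * s₀ := fun x hx => by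
    have := (le_abs_self _).trans (hl x hx s₀ ⟨s0.le, le_rfl⟩)
    rw [hz, sub_zero, abs_sub_comm, abs_of_nonneg (by linarith [hx.2])] at this
    exact this.trans (mul_le_mul_of_nonneg_left (by linarith [hx.1]) k0)
  have M0 : 0 ≤ k * s₀ := ♭
  obtain ⟨A, hA⟩ : ∃ A : Set ℝ, A = {l | 0 < l ∧ T l = ⊤ ∧ ∃ L, ∀ t, 0 ≤ t → S l t ≤ L} := ◇
  obtain ⟨G, hG⟩ : ∃ G : Set ℝ, G = {l | 0 < l ∧ T l = ⊤} := ◇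
  have AG : A ⊆ G := by rw [hA, hG]; exact fun l h => ⟨h.1, h.2.1⟩
  have dn : ∀ l l', 0 < l' → l' ≤ l → T l = ⊤ → T l' = ⊤ ∧ ∀ t, 0 ≤ t → S l' t ≤ S l t := fun l l' h0 h1 h2 =>
    DOWN (mt l l (h0.trans_le h1) le_rfl h2) (mx l' l h0 h1) fun x hx => mul_le_mul_of_nonneg_right h1 (hn x hx)
  have Ad : ∀ l ∈ A, ∀ l', 0 < l' → l' ≤ l → l' ∈ A := by
    rw [hA]; rintro l ⟨l0, lt, L, hL⟩ l' h0 h1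
    have := dn l l' h0 h1 lt
    exact ⟨h0, this.1, L, fun t ht => (this.2 t ht).trans (hL t ht)⟩
  have An : A.Nonempty := by
    obtain ⟨η, η0, η8, hη⟩ := etaE p s₀ hp s0
    obtain ⟨l, hl'⟩ : ∃ l, l = η / (2 * (k * s₀ + 1)) := ◇
    have l0 : 0 < l := by rw [hl']; positivity
    have ll : l * (k * s₀ + 1) = η / 2 := by rw [hl']; field_simp
    have m := mx l l l0 le_rfl
    have i := m.init
    have := STAY m le_rfl (by simpa using m.m.1) η0 η8 (by rw [i.1]; exact hη s₀ s0 le_rfl) (fun x hx => by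
      rw [i.1] at hx; rw [i.2 x hx]
      exact (mul_le_mul_of_nonneg_left (M x hx) l0.le).trans (by rw [mul_add] at ll; linarith))
    refine ⟨l, ?_⟩
    rw [hA]
    refine ⟨l0, this.1, 2 * s₀, fun t ht => ?_⟩
    rcases ht.eq_or_lt with rfl | ht
    · rw [i.1]; linarith
    · exact i.1 ▸ this.2.1 t ht
  have Gb : BddAbove G := by
    have a0 : 0 < φ x1 := lt_of_le_of_ne (hn x1 hx1) x1n.symm
    have x1s : x1 < s₀ := lt_of_le_of_ne hx1.2 (by rintro rfl; exact x1n hz)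
    obtain ⟨ρ, hρ⟩ : ∃ ρ, ρ = min ((s₀ - x1) / 2) (φ x1 / (4 * (k + 1))) := ◇
    have ρ0 : 0 < ρ := by rw [hρ]; exact lt_min ♮ ♭
    have ρ1 : ρ ≤ (s₀ - x1) / 2 := hρ ▸ min_le_left _ _
    have ρ2 : ρ ≤ φ x1 / (4 * (k + 1)) := hρ ▸ min_le_right _ _
    rw [le_div_iff₀ ♭] at ρ2
    obtain ⟨B, T0, B0, T00, hB⟩ := BIG (z0 := x1 + ρ) (ρ := ρ) (R := s₀) hp (by linarith [hx1.1]) ρ0 ♮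
    refine ⟨B / (φ x1 / 2), ?_⟩
    rw [hG]; rintro l ⟨l0, lt⟩
    by_contra hc
    push Not at hc
    rw [div_lt_iff₀ ♭] at hc
    have m := mt l l l0 le_rfl lt
    have i := m.init
    refine hB _ _ _ _ (m.gl T00) i.1.ge fun x hx hx' => ?_
    rw [i.2 x hx]
    refine hc.le.trans (mul_le_mul_of_nonneg_left ?_ l0.le)
    have e := (le_abs_self _).trans (hl x1 hx1 x hx)
    rw [abs_sub_comm, abs_of_nonneg (by linarith [hx'.1])] at e
    have := mul_le_mul_of_nonneg_left (show x - x1 ≤ 2 * ρ by linarith [hx'.2]) k0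
    nlinarith
  have Gn := An.mono AG
  have Ab := Gb.mono AG
  have A0 : 0 < sSup A := by
    obtain ⟨l, h⟩ := An
    exact lt_of_lt_of_le (by rw [hA] at h; exact h.1) (le_csSup Ab h)
  have AGs : sSup A ≤ sSup G := csSup_le_csSup Gb An AG
  have G0 := A0.trans_le AGs
  have GG : T (sSup G) = ⊤ := LIMG (mx _ _ G0 le_rfl) fun δ δ0 => by
    obtain ⟨l, lG, hl'⟩ := exists_lt_of_lt_csSup Gn (show sSup G - δ / (k * s₀ + 1) < sSup G from sub_lt_self _ ♭)
    have le := le_csSup Gb lG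
    rw [hG] at lG
    refine ⟨_, _, _, mt l _ lG.1 le lG.2, fun x hx => ⟨mul_le_mul_of_nonneg_right le (hn x hx), ?_⟩⟩
    have h1 : (sSup G - l) * (k * s₀ + 1) ≤ δ := by
      rw [← le_div_iff₀ ♭]; linarith
    have := mul_le_mul_of_nonneg_left ((M x hx).trans (by linarith : _ ≤ k * s₀ + 1)) (sub_nonneg.2 le)
    linarith
  have Ao : sSup A ∉ A := fun h => by
    have h' := (Set.ext_iff.1 hA _).1 h
    obtain ⟨_, ht, L, hL⟩ := h'
    obtain ⟨δ, δ0, hδ⟩ := OPEN (mt _ (sSup A + 1) A0 ♮ ht) hL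
    obtain ⟨ε, hε⟩ : ∃ ε, ε = min 1 (δ / (k * s₀ + 1)) := ◇
    have ε0 : 0 < ε := by rw [hε]; exact lt_min one_pos ♭
    have ε1 : ε ≤ 1 := hε ▸ min_le_left _ _
    have ε2 : ε ≤ δ / (k * s₀ + 1) := hε ▸ min_le_right _ _
    rw [le_div_iff₀ ♭] at ε2
    have := hδ _ _ _ _ (mx (sSup A + ε) (sSup A + 1) ♮ ♮) fun x hx => by
      have h1 := mul_nonneg ε0.le (hn x hx)
      have h2 := mul_le_mul_of_nonneg_left (M x hx) ε0.le
      constructor <;> linarith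
    have : sSup A + ε ∈ A := by
      have e : sSup A + ε ∈ {l | 0 < l ∧ T l = ⊤ ∧ ∃ L, ∀ t, 0 ≤ t → S l t ≤ L} := ⟨♮, this.1, this.2⟩
      rwa [← hA] at e
    linarith [le_csSup Ab this]
  refine ⟨sSup A, sSup G, A0, AGs, fun l l0 hl1 => ?_, fun l h1 h2 => ?_, fun l hl1 => ?_⟩
  · obtain ⟨l', h', hl'⟩ := exists_lt_of_lt_csSup An hl1
    have := Ad l' h' l l0 hl'.le
    rw [hA] at this
    obtain ⟨_, ht, L, hL⟩ := this
    exact ⟨ht, BDD1 (mt l l l0 le_rfl ht) hL⟩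
  · have l0 := A0.trans_le h1
    have ht := (dn _ l l0 h2 GG).1
    refine ⟨ht, F8 (mt l l l0 le_rfl ht) fun hL => ?_⟩
    have m : l ∈ A := by rw [hA]; exact ⟨l0, ht, hL⟩
    exact Ao (le_antisymm h1 (le_csSup Ab m) ▸ m)
  · rw [lt_top_iff_ne_top]
    intro ht
    have : l ∈ G := by rw [hG]; exact ⟨G0.trans hl1, ht⟩
    linarith [le_csSup Gb this]
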